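/- Let ℝ^n_+ = {x = (x',x_n) ∈ ℝ^n : x_n > 0}. Let u be a C^{2,1} function on ℝ^n_+ × [0,T] satisfying, for some constant M > 0, |Δu(x,t) + ∂_t u(x,t)| ≤ M(|u(x,t)| + |∇u(x,t)|) and |u(x,t)| ≤ M e^{M|x|^2} for all (x,t) ∈ ℝ^n_+ × [0,T]. If for every real k ≥ 1 there is a constant C_k > 0 such that |u(x,0)| ≤ C_k e^{-k|x|^2} for all x ∈ ℝ^n_+, then u vanishes identically on ℝ^n_+ × [0,T]. -/

import Mathlib

open MeasureTheory Real Set Metric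

/-- The spatial Laplacian of `f : ℝⁿ → ℝ`. -/
noncomputable def slap {n : ℕ} (f : EuclideanSpace ℝ (Fin n) → ℝ)
    (x : EuclideanSpace ℝ (Fin n)) : ℝ :=
  ∑ i : Fin n, fderiv ℝ (fun y => fderiv ℝ f y (EuclideanSpace.single i 1)) x
    (EuclideanSpace.single i 1)

open Filter Topology
open scoped ContDiff

/-- The directional derivative of `f` along `e`. -/
noncomputable def pd {V : Type*} [NormedAddCommGroup V] [NormedSpace ℝ V]
    (e : V) (f : V → ℝ) (x : V) : ℝ := fderiv ℝ f x e

section DirectionalDerivative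

variable {V : Type*} [NormedAddCommGroup V] [NormedSpace ℝ V] {e e' x : V} {f g : V → ℝ}

theorem pd_congr (h : f =ᶠ[𝓝 x] g) : pd e f x = pd e g x := by
  rw [pd, pd, h.fderiv_eq]

theorem pd_congr_nhds (h : f =ᶠ[𝓝 x] g) : pd e f =ᶠ[𝓝 x] pd e g :=
  h.eventuallyEq_nhds.mono fun _ hy => pd_congr hy

theorem pd_const (c : ℝ) : pd e (fun _ => c) x = 0 := by
  simp [pd]

theorem pd_add (hf : DifferentiableAt ℝ f x) (hg : DifferentiableAt ℝ g x) :
    pd e (fun y => f y + g y) x = pd e f x + pd e g x := by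
  simp [pd, fderiv_fun_add hf hg]

theorem pd_sub (hf : DifferentiableAt ℝ f x) (hg : DifferentiableAt ℝ g x) :
    pd e (fun y => f y - g y) x = pd e f x - pd e g x := by
  simp [pd, fderiv_fun_sub hf hg]

theorem pd_neg : pd e (fun y => -f y) x = -pd e f x := by
  simp [pd, fderiv_fun_neg]

theorem pd_mul (hf : DifferentiableAt ℝ f x) (hg : DifferentiableAt ℝ g x) :
    pd e (fun y => f y * g y) x = pd e f x * g x + f x * pd e g x := by
  simp [pd, fderiv_fun_mul hf hg]; ring

theorem pd_const_mul (c : ℝ) (hf : DifferentiableAt ℝ f x) :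
    pd e (fun y => c * f y) x = c * pd e f x := by
  simp [pd, fderiv_const_mul hf]

theorem pd_sum {ι : Type*} (s : Finset ι) {F : ι → V → ℝ}
    (h : ∀ i ∈ s, DifferentiableAt ℝ (F i) x) :
    pd e (fun y => ∑ i ∈ s, F i y) x = ∑ i ∈ s, pd e (F i) x := by
  simp [pd, fderiv_fun_sum h]

theorem pd_comp {h : ℝ → ℝ} {h' : ℝ} (hh : HasDerivAt h h' (f x)) (hf : DifferentiableAt ℝ f x) :
    pd e (fun y => h (f y)) x = h' * pd e f x := by
  have := hh.comp_hasFDerivAt x hf.hasFDerivAt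
  simp only [pd]
  rw [show (fun y => h (f y)) = h ∘ f from rfl, this.fderiv]
  simp

theorem ContDiffAt.pd {n m : WithTop ℕ∞} (hf : ContDiffAt ℝ n f x) (h : m + 1 ≤ n) :
    ContDiffAt ℝ m (pd e f) x :=
  (hf.fderiv_right h).clm_apply contDiffAt_const

theorem ContDiff.pd {n m : WithTop ℕ∞} (hf : ContDiff ℝ n f) (h : m + 1 ≤ n) :
    ContDiff ℝ m (pd e f) :=
  contDiff_iff_contDiffAt.2 fun x => (contDiff_iff_contDiffAt.1 hf x).pd h

theorem ContDiff.pd_infty (hf : ContDiff ℝ ∞ f) : ContDiff ℝ ∞ (_root_.pd e f) :=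
  hf.pd (by simp)

theorem pd_comm (hf : ContDiffAt ℝ 2 f x) : pd e (pd e' f) x = pd e' (pd e f) x := by
  have hd : DifferentiableAt ℝ (fderiv ℝ f) x :=
    (hf.fderiv_right (m := 1) (by norm_num)).differentiableAt (by norm_num)
  have key : ∀ a b : V, pd a (pd b f) x = fderiv ℝ (fderiv ℝ f) x a b := by
    intro a b
    have hb : pd b f = fun x => (fderiv ℝ f x) b := rfl
    rw [hb, pd, fderiv_clm_apply hd (differentiableAt_const b)]
    simp
  rw [key, key]
  exact (hf.isSymmSndFDerivAt (by simp)) e e'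

theorem pd_eq_zero_of_notMem_tsupport (hx : x ∉ tsupport f) : pd e f x = 0 := by
  rw [pd_congr (notMem_tsupport_iff_eventuallyEq.1 hx)]
  exact pd_const 0

theorem tsupport_pd_subset : tsupport (pd e f) ⊆ tsupport f := by
  refine closure_minimal (fun y hy => ?_) (isClosed_tsupport f)
  by_contra h
  exact hy (pd_eq_zero_of_notMem_tsupport h)

theorem HasCompactSupport.pd (hf : HasCompactSupport f) : HasCompactSupport (pd e f) :=
  hf.mono' ((subset_tsupport _).trans tsupport_pd_subset)

theorem contDiff_of_contDiffAt_tsupport {n : WithTop ℕ∞}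
    (h : ∀ x ∈ tsupport f, ContDiffAt ℝ n f x) : ContDiff ℝ n f := by
  refine contDiff_iff_contDiffAt.2 fun x => ?_
  by_cases hx : x ∈ tsupport f
  · exact h x hx
  · exact (contDiffAt_const (c := (0:ℝ))).congr_of_eventuallyEq
      (notMem_tsupport_iff_eventuallyEq.1 hx)

theorem integral_pd_eq_zero [FiniteDimensional ℝ V] [MeasurableSpace V] [BorelSpace V]
    {μ : Measure V} [μ.IsAddHaarMeasure] (hf : ContDiff ℝ 1 f) (hc : HasCompactSupport f) :
    ∫ x, pd e f x ∂μ = 0 := by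
  have h := integral_mul_fderiv_eq_neg_fderiv_mul_of_integrable (μ := μ) (f := fun _ : V => (1:ℝ))
    (g := f) (v := e) (by simp) ?_ ?_ (by intro x _; fun_prop)
    (fun x _ => hf.differentiable (by norm_num) x)
  · simpa [pd] using h
  · simp only [one_mul]
    exact (hf.pd (e := e) (m := 0) (by norm_num)).continuous.integrable_of_hasCompactSupport hc.pd
  · simpa using (hf.continuous.integrable_of_hasCompactSupport hc)

end DirectionalDerivative

/-- `d`-dimensional Euclidean space. -/
abbrev Spc (d : ℕ) := EuclideanSpace ℝ (Fin d)

/-- The `i`-th standard basis vector. -/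
noncomputable abbrev bv {d : ℕ} (i : Fin d) : Spc d := EuclideanSpace.single i 1

theorem slap_eq {d : ℕ} (f : Spc d → ℝ) (x : Spc d) :
    slap f x = ∑ i, pd (bv i) (pd (bv i) f) x := rfl

/-- The squared length of the gradient of `f`. -/
noncomputable def gsq {d : ℕ} (f : Spc d → ℝ) (x : Spc d) : ℝ := ∑ i, (pd (bv i) f x) ^ 2

theorem gsq_nonneg {d : ℕ} (f : Spc d → ℝ) (x : Spc d) : 0 ≤ gsq f x :=
  Finset.sum_nonneg fun _ _ => sq_nonneg _

theorem norm_sq_eq_sum {d : ℕ} (x : Spc d) : ‖x‖ ^ 2 = ∑ i, x i ^ 2 := by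
  rw [EuclideanSpace.norm_sq_eq]; simp

theorem norm_fderiv_sq {d : ℕ} (f : Spc d → ℝ) (x : Spc d) :
    ‖fderiv ℝ f x‖ ^ 2 = gsq f x := by
  have h : ‖gradient f x‖ = ‖fderiv ℝ f x‖ := by simp [gradient]
  rw [← h, norm_sq_eq_sum, gsq]
  refine Finset.sum_congr rfl fun i _ => ?_
  have : (gradient f x) i = inner ℝ (gradient f x) (bv i) := by
    rw [EuclideanSpace.inner_single_right]; simp
  rw [this]
  simp [gradient, pd]

theorem norm_fderiv_eq_sqrt {d : ℕ} (f : Spc d → ℝ) (x : Spc d) :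
    ‖fderiv ℝ f x‖ = √(gsq f x) := by
  rw [← norm_fderiv_sq, Real.sqrt_sq (norm_nonneg _)]

/-- `w` grows at most linearly in time after the instant `b`, uniformly on `K`. -/
def NiceAt {d : ℕ} (w : Spc d → ℝ → ℝ) (K : Set (Spc d)) (b : ℝ) : Prop :=
  ∃ C, 0 ≤ C ∧ ∃ δ > 0, ∀ x ∈ K, ∀ s ∈ Icc (0:ℝ) 1, b ≤ s → s < b + δ →
    |w x s - w x b| ≤ C * (s - b)

theorem NiceAt.mono {d : ℕ} {w : Spc d → ℝ → ℝ} {K L : Set (Spc d)} {b : ℝ}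
    (h : NiceAt w L b) (hKL : K ⊆ L) : NiceAt w K b := by
  obtain ⟨C, hC, δ, hδ, H⟩ := h
  exact ⟨C, hC, δ, hδ, fun x hx => H x (hKL hx)⟩

theorem continuous_mul_of_tsupport {X : Type*} [TopologicalSpace X] {O : Set X} (hO : IsOpen O)
    {η f : X → ℝ} (hη : Continuous η) (hs : tsupport η ⊆ O) (hf : ContinuousOn f O) :
    Continuous fun x => η x * f x :=
  (hη.continuousOn.mul hf).continuous_of_tsupport_subset hO
    ((tsupport_mul_subset_left (f := η) (g := f)).trans hs)

theorem integrable_mul_of_tsupport {X : Type*} [TopologicalSpace X] [MeasurableSpace X]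
    [OpensMeasurableSpace X] {μ : Measure X} [IsFiniteMeasureOnCompacts μ]
    {O : Set X} (hO : IsOpen O)
    {η f : X → ℝ} (hη : Continuous η) (hc : HasCompactSupport η) (hs : tsupport η ⊆ O)
    (hf : ContinuousOn f O) :
    Integrable (fun x => η x * f x) μ :=
  (continuous_mul_of_tsupport hO hη hs hf).integrable_of_hasCompactSupport hc.mul_right

section TimeIntegral

variable {d : ℕ} {O : Set (Spc d)} {η : Spc d → ℝ} {w : Spc d → ℝ → ℝ} {H H' : ℝ → ℝ} {m : ℝ}

theorem continuousOn_timeIntegral (hO : IsOpen O) (hη : Continuous η) (hc : HasCompactSupport η)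
    (hs : tsupport η ⊆ O) (hx : ∀ s ∈ Icc (0:ℝ) 1, ContinuousOn (fun x => w x s) O)
    (ht : ∀ x ∈ O, ContinuousOn (w x) (Icc 0 1))
    (hm : ∀ x ∈ tsupport η, ∀ s ∈ Icc (0:ℝ) 1, |w x s| ≤ m) (hH : Continuous H) :
    ContinuousOn (fun s => ∫ x, η x * H (w x s)) (Icc 0 1) := by
  obtain ⟨L, hL⟩ := (isCompact_Icc (a := -m) (b := m)).exists_bound_of_continuousOn hH.continuousOn
  refine continuousOn_of_dominated (bound := fun x => |η x| * L) ?_ ?_ ?_ ?_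
  · intro s hs'
    exact (continuous_mul_of_tsupport hO hη hs
      (hH.comp_continuousOn (hx s hs'))).aestronglyMeasurable
  · intro s hs'
    refine ae_of_all _ fun x => ?_
    rw [norm_mul, Real.norm_eq_abs (η x)]
    by_cases hxs : x ∈ tsupport η
    · exact mul_le_mul_of_nonneg_left (hL _ (abs_le.1 (hm x hxs s hs'))) (abs_nonneg _)
    · simp [image_eq_zero_of_notMem_tsupport hxs]
  · exact (hη.abs.integrable_of_hasCompactSupport hc.abs).mul_const L
  · refine ae_of_all _ fun x => ?_
    by_cases hxs : x ∈ tsupport η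
    · exact continuousOn_const.mul (hH.comp_continuousOn (ht x (hs hxs)))
    · simp only [image_eq_zero_of_notMem_tsupport hxs, zero_mul]
      exact continuousOn_const

theorem hasDerivWithinAt_timeIntegral {b : ℝ} (hb : b ∈ Ico (0:ℝ) 1) {w' : Spc d → ℝ}
    (hO : IsOpen O) (hη : Continuous η) (hc : HasCompactSupport η)
    (hs : tsupport η ⊆ O) (hx : ∀ s ∈ Icc (0:ℝ) 1, ContinuousOn (fun x => w x s) O)
    (ht : ∀ x ∈ O, HasDerivWithinAt (w x) (w' x) (Icc 0 1) b)
    (hm : ∀ x ∈ tsupport η, ∀ s ∈ Icc (0:ℝ) 1, |w x s| ≤ m)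
    (hn : NiceAt w (tsupport η) b)
    (hH : ∀ z, HasDerivAt H (H' z) z) (hH' : Continuous H') :
    HasDerivWithinAt (fun s => ∫ x, η x * H (w x s)) (∫ x, η x * (H' (w x b) * w' x)) (Ici b) b ∧
      Integrable (fun x => η x * (H' (w x b) * w' x)) := by
  obtain ⟨C, hC, δ, hδ, hn⟩ := hn
  have hbI : b ∈ Icc (0:ℝ) 1 := Ico_subset_Icc_self hb
  obtain ⟨L, hL⟩ := (isCompact_Icc (a := -m) (b := m)).exists_bound_of_continuousOn hH'.continuousOn
  have hHc : Continuous H := continuous_iff_continuousAt.2 fun z => (hH z).continuousAt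
  have hitg : ∀ s ∈ Icc (0:ℝ) 1, Integrable (fun x => η x * H (w x s)) := fun s hs' =>
    integrable_mul_of_tsupport hO hη hc hs (hHc.comp_continuousOn (hx s hs'))
  have hev : ∀ᶠ s in 𝓝[>] b, s ∈ Icc (0:ℝ) 1 ∧ b < s ∧ s < b + δ := by
    have h1 : ∀ᶠ s in 𝓝[>] b, s < min 1 (b + δ) :=
      nhdsWithin_le_nhds (Iio_mem_nhds (lt_min hb.2 (by linarith)))
    filter_upwards [h1, self_mem_nhdsWithin] with s h1 h2
    have h3 : b < s := h2
    have h4 := lt_min_iff.1 h1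
    exact ⟨⟨hb.1.trans h3.le, h4.1.le⟩, h3, h4.2⟩
  have hlip : ∀ x ∈ tsupport η, ∀ s ∈ Icc (0:ℝ) 1,
      |H (w x s) - H (w x b)| ≤ L * |w x s - w x b| := by
    intro x hxs s hs'
    have := (convex_Icc (-m) m).norm_image_sub_le_of_norm_hasDerivWithin_le
      (f := H) (f' := H') (C := L) (fun z _ => (hH z).hasDerivWithinAt) (fun z hz => hL z hz)
      (abs_le.1 (hm x hxs b hbI)) (abs_le.1 (hm x hxs s hs'))
    simpa using this
  have hlim : ∀ x, Tendsto (fun s => (s - b)⁻¹ * (η x * H (w x s) - η x * H (w x b))) (𝓝[>] b)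
      (𝓝 (η x * (H' (w x b) * w' x))) := by
    intro x
    by_cases hxs : x ∈ tsupport η
    · have h1 : HasDerivWithinAt (fun s => η x * H (w x s)) (η x * (H' (w x b) * w' x))
          (Icc 0 1) b := ((hH (w x b)).comp_hasDerivWithinAt b (ht x (hs hxs))).const_mul (η x)
      have h2 : HasDerivWithinAt (fun s => η x * H (w x s)) (η x * (H' (w x b) * w' x))
          (Ioi b) b := by
        refine h1.mono_of_mem_nhdsWithin ?_
        filter_upwards [hev] with s hs' using hs'.1
      have h3 := (hasDerivWithinAt_iff_tendsto_slope' (by simp)).1 h2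
      refine h3.congr fun s => ?_
      rw [slope_def_field]; ring
    · simp [image_eq_zero_of_notMem_tsupport hxs]
  have hbound : ∀ᶠ s in 𝓝[>] b, ∀ x,
      ‖(s - b)⁻¹ * (η x * H (w x s) - η x * H (w x b))‖ ≤ |η x| * (|L| * C) := by
    filter_upwards [hev] with s hs' x
    by_cases hxs : x ∈ tsupport η
    · have h1 := hlip x hxs s hs'.1
      have h2 := hn x hxs s hs'.1 hs'.2.1.le hs'.2.2
      have h3 : 0 < s - b := sub_pos.2 hs'.2.1
      rw [← mul_sub, norm_mul, norm_mul, norm_inv, Real.norm_eq_abs, Real.norm_eq_abs,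
        Real.norm_eq_abs, abs_of_pos h3]
      have h4 : |H (w x s) - H (w x b)| ≤ |L| * (C * (s - b)) :=
        h1.trans (mul_le_mul (le_abs_self L) h2 (abs_nonneg _) (abs_nonneg _))
      calc (s - b)⁻¹ * (|η x| * |H (w x s) - H (w x b)|)
          ≤ (s - b)⁻¹ * (|η x| * (|L| * (C * (s - b)))) := by gcongr
        _ = |η x| * (|L| * C) := by field_simp
    · simp [image_eq_zero_of_notMem_tsupport hxs]
  have hbint : Integrable (fun x => |η x| * (|L| * C)) :=
    (hη.abs.integrable_of_hasCompactSupport hc.abs).mul_const _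
  have hmeas : ∀ᶠ s in 𝓝[>] b, AEStronglyMeasurable
      (fun x => (s - b)⁻¹ * (η x * H (w x s) - η x * H (w x b))) volume := by
    filter_upwards [hev] with s hs'
    exact (((hitg s hs'.1).sub (hitg b hbI)).const_mul _).aestronglyMeasurable
  constructor
  · rw [← hasDerivWithinAt_Ioi_iff_Ici, hasDerivWithinAt_iff_tendsto_slope' (by simp)]
    have := tendsto_integral_filter_of_dominated_convergence _ hmeas
      (hbound.mono fun s hs' => ae_of_all _ hs') hbint (ae_of_all _ hlim)
    refine this.congr' ?_
    filter_upwards [hev] with s hs'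
    rw [integral_const_mul, integral_sub (hitg s hs'.1) (hitg b hbI), slope_def_field]
    ring
  · obtain ⟨s', hs'⟩ := exists_seq_tendsto (𝓝[>] b)
    have hm' : AEStronglyMeasurable (fun x => η x * (H' (w x b) * w' x)) volume := by
      obtain ⟨N, hN⟩ := eventually_atTop.1 (hs'.eventually hmeas)
      refine aestronglyMeasurable_of_tendsto_ae (u := atTop)
        (f := fun k x => (s' (k + N) - b)⁻¹ * (η x * H (w x (s' (k + N))) - η x * H (w x b)))
        (fun k => hN _ (by omega)) (ae_of_all _ fun x => ?_)
      exact ((hlim x).comp hs').comp (tendsto_add_atTop_nat N)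
    refine Integrable.mono' hbint hm' (ae_of_all _ fun x => ?_)
    exact le_of_tendsto (hlim x).norm (hbound.mono fun s h => h x)

end TimeIntegral

theorem ContDiffOn.continuousOn_pd {d : ℕ} {O : Set (Spc d)} (hO : IsOpen O) {g : Spc d → ℝ}
    (hg : ContDiffOn ℝ 1 g O) (e : Spc d) : ContinuousOn (pd e g) O := fun x hx =>
  (((hg.contDiffAt (hO.mem_nhds hx)).pd (m := 0) (by norm_num)).continuousAt).continuousWithinAt

theorem ContDiffOn.continuousOn_gsq {d : ℕ} {O : Set (Spc d)} (hO : IsOpen O) {g : Spc d → ℝ}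
    (hg : ContDiffOn ℝ 1 g O) : ContinuousOn (gsq g) O :=
  continuousOn_finsetSum _ fun _ _ => (hg.continuousOn_pd hO _).pow 2

theorem ContDiffOn.pd {d : ℕ} {O : Set (Spc d)} (hO : IsOpen O) {g : Spc d → ℝ}
    (hg : ContDiffOn ℝ 2 g O) (e : Spc d) : ContDiffOn ℝ 1 (_root_.pd e g) O := fun x hx =>
  (((hg.contDiffAt (hO.mem_nhds hx)).pd (m := 1) (by norm_num))).contDiffWithinAt

theorem ContDiffOn.continuousOn_slap {d : ℕ} {O : Set (Spc d)} (hO : IsOpen O) {g : Spc d → ℝ}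
    (hg : ContDiffOn ℝ 2 g O) : ContinuousOn (slap g) O :=
  continuousOn_finsetSum _ fun _ _ => (hg.pd hO _).continuousOn_pd hO _

theorem integral_green {d : ℕ} {O : Set (Spc d)} (hO : IsOpen O) {η g : Spc d → ℝ}
    (hη : ContDiff ℝ 1 η) (hc : HasCompactSupport η) (hs : tsupport η ⊆ O)
    (hg : ContDiffOn ℝ 2 g O) {p p' : ℝ → ℝ} (hp : ∀ z, HasDerivAt p (p' z) z)
    (hp' : Continuous p') :
    ∫ x, (η x * (p (g x) * slap g x) + η x * (p' (g x) * gsq g x) +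
      ∑ i, pd (bv i) η x * (p (g x) * pd (bv i) g x)) = 0 := by
  have hpc : ContDiff ℝ 1 p := by
    rw [contDiff_one_iff_deriv]
    exact ⟨fun z => (hp z).differentiableAt, by rwa [funext fun z => (hp z).deriv]⟩
  have hcF : ∀ i, HasCompactSupport fun x => η x * (p (g x) * pd (bv i) g x) :=
    fun i => hc.mul_right
  have hF : ∀ i, ContDiff ℝ 1 fun x => η x * (p (g x) * pd (bv i) g x) := by
    refine fun i => contDiff_of_contDiffAt_tsupport fun x hx => ?_
    have hxO : x ∈ O := hs (tsupport_mul_subset_left hx)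
    have hgx := hg.contDiffAt (hO.mem_nhds hxO)
    exact hη.contDiffAt.mul ((hpc.contDiffAt.comp x (hgx.of_le (by norm_num))).mul
      (hgx.pd (by norm_num)))
  have hz : ∀ i, ∫ x, pd (bv i) (fun x => η x * (p (g x) * pd (bv i) g x)) x = 0 :=
    fun i => integral_pd_eq_zero (hF i) (hcF i)
  have hsum : ∫ x, ∑ i, pd (bv i) (fun x => η x * (p (g x) * pd (bv i) g x)) x = 0 := by
    rw [integral_finsetSum]
    · exact Finset.sum_eq_zero fun i _ => hz i
    · exact fun i _ => ((hF i).pd (m := 0) (by norm_num)).continuous.integrable_of_hasCompactSupport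
        (hcF i).pd
  rw [← hsum]
  congr 1
  ext x
  by_cases hx : x ∈ tsupport η
  · have hgx := hg.contDiffAt (hO.mem_nhds (hs hx))
    have hgd : DifferentiableAt ℝ g x := hgx.differentiableAt (by norm_num)
    have hpg : DifferentiableAt ℝ (fun y => p (g y)) x :=
      (hp (g x)).differentiableAt.comp x hgd
    have key : ∀ i, pd (bv i) (fun x => η x * (p (g x) * pd (bv i) g x)) x =
        η x * (p (g x) * pd (bv i) (pd (bv i) g) x) + η x * (p' (g x) * (pd (bv i) g x) ^ 2) +
        pd (bv i) η x * (p (g x) * pd (bv i) g x) := by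
      intro i
      have hgi : DifferentiableAt ℝ (pd (bv i) g) x :=
        (hgx.pd (m := 1) (by norm_num)).differentiableAt (by norm_num)
      rw [pd_mul (hη.differentiable (by norm_num) x) (hpg.fun_mul hgi), pd_mul hpg hgi,
        pd_comp (hp (g x)) hgd]
      ring
    simp only [key, Finset.sum_add_distrib, slap_eq, gsq, Finset.mul_sum]
  · have h0 : η x = 0 := image_eq_zero_of_notMem_tsupport hx
    have h1 : ∀ i, pd (bv i) (fun x => η x * (p (g x) * pd (bv i) g x)) x = 0 := fun i =>
      pd_eq_zero_of_notMem_tsupport fun h => hx (tsupport_mul_subset_left h)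
    simp [h0, h1, pd_eq_zero_of_notMem_tsupport hx]

theorem timeIntegral_deriv_le {d : ℕ} {O : Set (Spc d)} {η : Spc d → ℝ} {w : Spc d → ℝ → ℝ}
    {H H' H'' : ℝ → ℝ} {m b : ℝ} (hb : b ∈ Ico (0:ℝ) 1) {w' B : Spc d → ℝ}
    (hO : IsOpen O) (hη : ContDiff ℝ 1 η) (hc : HasCompactSupport η)
    (hs : tsupport η ⊆ O) (hx : ∀ s ∈ Icc (0:ℝ) 1, ContDiffOn ℝ 2 (fun x => w x s) O)
    (ht : ∀ x ∈ O, HasDerivWithinAt (w x) (w' x) (Icc 0 1) b)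
    (hm : ∀ x ∈ tsupport η, ∀ s ∈ Icc (0:ℝ) 1, |w x s| ≤ m)
    (hn : NiceAt w (tsupport η) b)
    (hH : ∀ z, HasDerivAt H (H' z) z) (hH' : ∀ z, HasDerivAt H' (H'' z) z) (hH'' : Continuous H'')
    (hB : Integrable B)
    (hle : ∀ x, η x * (H' (w x b) * (w' x - slap (fun y => w y b) x)) -
      η x * (H'' (w x b) * gsq (fun y => w y b) x) -
      ∑ i, pd (bv i) η x * (H' (w x b) * pd (bv i) (fun y => w y b) x) ≤ B x) :
    ∃ E', HasDerivWithinAt (fun s => ∫ x, η x * H (w x s)) E' (Ici b) b ∧ E' ≤ ∫ x, B x := by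
  have hH'c : Continuous H' := continuous_iff_continuousAt.2 fun z => (hH' z).continuousAt
  have hbI : b ∈ Icc (0:ℝ) 1 := Ico_subset_Icc_self hb
  have hg := hx b hbI
  have hgc := hg.continuousOn
  obtain ⟨h1, h2⟩ := hasDerivWithinAt_timeIntegral hb hO hη.continuous hc hs
    (fun s hs => (hx s hs).continuousOn) ht hm hn hH hH'c
  refine ⟨_, h1, ?_⟩
  have hgreen := integral_green hO hη hc hs hg hH' hH''
  have i1 : Integrable fun x => η x * (H' (w x b) * slap (fun y => w y b) x) :=
    integrable_mul_of_tsupport hO hη.continuous hc hs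
      ((hH'c.comp_continuousOn hgc).mul (hg.continuousOn_slap hO))
  have i2 : Integrable fun x => η x * (H'' (w x b) * gsq (fun y => w y b) x) :=
    integrable_mul_of_tsupport hO hη.continuous hc hs
      ((hH''.comp_continuousOn hgc).mul ((hg.of_le (by norm_num)).continuousOn_gsq hO))
  have i3 : Integrable fun x => ∑ i, pd (bv i) η x * (H' (w x b) * pd (bv i) (fun y => w y b) x) :=
    integrable_finsetSum _ fun i _ => integrable_mul_of_tsupport hO
      (hη.pd (m := 0) (by norm_num)).continuous hc.pd (tsupport_pd_subset.trans hs)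
      ((hH'c.comp_continuousOn hgc).mul ((hg.of_le (by norm_num)).continuousOn_pd hO _))
  have i4 : Integrable fun x => η x * (H' (w x b) * slap (fun y => w y b) x) +
      η x * (H'' (w x b) * gsq (fun y => w y b) x) +
      ∑ i, pd (bv i) η x * (H' (w x b) * pd (bv i) (fun y => w y b) x) := (i1.add i2).add i3
  rw [← sub_zero (∫ x, η x * (H' (w x b) * w' x)), ← hgreen, ← integral_sub h2 i4]
  refine integral_mono (h2.sub i4) hB fun x => ?_
  refine le_trans (le_of_eq ?_) (hle x)
  ring

theorem hasDerivAt_max_zero_pow (k : ℕ) (z : ℝ) :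
    HasDerivAt (fun z : ℝ => max z 0 ^ (k + 2)) ((k + 2) * max z 0 ^ (k + 1)) z := by
  rcases lt_trichotomy z 0 with h | rfl | h
  · have : (fun z : ℝ => max z 0 ^ (k + 2)) =ᶠ[𝓝 z] fun _ => 0 := by
      filter_upwards [Iio_mem_nhds h] with y hy
      rw [max_eq_right (le_of_lt hy)]; simp
    rw [max_eq_right h.le]
    simpa using (hasDerivAt_const z (0:ℝ)).congr_of_eventuallyEq this
  · rw [hasDerivAt_iff_tendsto_slope]
    have h1 : Tendsto (fun z : ℝ => max z 0 ^ (k + 1)) (𝓝[≠] 0) (𝓝 (max 0 0 ^ (k + 1))) :=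
      (Continuous.tendsto (by fun_prop) 0).mono_left nhdsWithin_le_nhds
    simp only [max_self, ne_eq, Nat.add_eq_zero_iff, one_ne_zero, and_false, not_false_eq_true,
      zero_pow, mul_zero] at h1 ⊢
    refine h1.congr' ?_
    filter_upwards [self_mem_nhdsWithin] with y hy
    have hy' : y ≠ 0 := hy
    rw [slope_def_field]
    rcases lt_or_gt_of_ne hy' with h | h
    · rw [max_eq_right h.le]; simp
    · rw [max_eq_left h.le]; simp; field_simp; ring
  · have : (fun z : ℝ => max z 0 ^ (k + 2)) =ᶠ[𝓝 z] fun z => z ^ (k + 2) := by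
      filter_upwards [Ioi_mem_nhds h] with y hy
      rw [max_eq_left (le_of_lt hy)]
    rw [max_eq_left h.le]
    simpa using (hasDerivAt_pow (k + 2) z).congr_of_eventuallyEq this

/-- `v` is separately regular on `O × [0,1]`, locally bounded, and
`|∂ₛv - Δv| ≤ M (|v| + |∇v|)`. -/
structure HeatSol {d : ℕ} (O : Set (Spc d)) (M : ℝ) (v : Spc d → ℝ → ℝ) : Prop where
  isOpen : IsOpen O
  nonneg : 0 ≤ M
  contDiffOn : ∀ s ∈ Icc (0:ℝ) 1, ContDiffOn ℝ 2 (fun x => v x s) O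
  differentiableOn : ∀ x ∈ O, DifferentiableOn ℝ (v x) (Icc 0 1)
  pde : ∀ x ∈ O, ∀ s ∈ Icc (0:ℝ) 1,
    |derivWithin (v x) (Icc 0 1) s - slap (fun y => v y s) x| ≤
      M * (|v x s| + √(gsq (fun y => v y s) x))
  bdd : ∀ K ⊆ O, IsCompact K → ∃ m, ∀ x ∈ K, ∀ s ∈ Icc (0:ℝ) 1, |v x s| ≤ m

theorem slap_sub {d : ℕ} {f g : Spc d → ℝ} {x : Spc d} (hf : ContDiffAt ℝ 2 f x)
    (hg : ContDiffAt ℝ 2 g x) : slap (fun y => f y - g y) x = slap f x - slap g x := by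
  rw [slap_eq, slap_eq, slap_eq, ← Finset.sum_sub_distrib]
  refine Finset.sum_congr rfl fun i _ => ?_
  rw [← pd_sub ((hf.pd (m := 1) (by norm_num)).differentiableAt (by norm_num))
    ((hg.pd (m := 1) (by norm_num)).differentiableAt (by norm_num))]
  refine pd_congr ?_
  filter_upwards [hf.eventually (by simp), hg.eventually (by simp)] with y hy hy'
  exact pd_sub (hy.differentiableAt (by norm_num)) (hy'.differentiableAt (by norm_num))

theorem slap_neg {d : ℕ} {f : Spc d → ℝ} {x : Spc d} :
    slap (fun y => -f y) x = -slap f x := by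
  rw [slap_eq, slap_eq, ← Finset.sum_neg_distrib]
  refine Finset.sum_congr rfl fun i _ => ?_
  rw [← pd_neg]
  congr 1
  ext y
  exact pd_neg

theorem gsq_neg {d : ℕ} {f : Spc d → ℝ} {x : Spc d} : gsq (fun y => -f y) x = gsq f x := by
  simp [gsq, pd_neg]

theorem HeatSol.neg {d : ℕ} {O : Set (Spc d)} {M : ℝ} {v : Spc d → ℝ → ℝ} (hv : HeatSol O M v) :
    HeatSol O M (fun x s => -v x s) where
  isOpen := hv.isOpen
  nonneg := hv.nonneg
  contDiffOn s hs := (hv.contDiffOn s hs).neg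
  differentiableOn x hx := (hv.differentiableOn x hx).neg
  pde x hx s hs := by
    have : derivWithin (fun s => -v x s) (Icc 0 1) s = -derivWithin (v x) (Icc 0 1) s :=
      derivWithin.fun_neg
    rw [this, slap_neg, gsq_neg, abs_neg, ← neg_add', abs_neg]
    have := hv.pde x hx s hs
    rwa [sub_eq_add_neg] at this
  bdd K hK hKc := by simpa using hv.bdd K hK hKc

/-- A quadratic polynomial in space. -/
theorem contDiff_quadratic {d : ℕ} (a A : ℝ) (l : Spc d →L[ℝ] ℝ) (x0 : Spc d) :
    ContDiff ℝ ∞ fun x => a + l (x - x0) + A * ‖x - x0‖ ^ 2 := by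
  have : ContDiff ℝ ∞ fun x : Spc d => ‖x - x0‖ ^ 2 := (contDiff_id.sub contDiff_const).norm_sq ℝ
  fun_prop

theorem hasFDerivAt_quadratic {d : ℕ} (a A : ℝ) (l : Spc d →L[ℝ] ℝ) (x0 x : Spc d) :
    HasFDerivAt (fun x => a + l (x - x0) + A * ‖x - x0‖ ^ 2)
      (l + A • ((2:ℝ) • innerSL ℝ (x - x0))) x := by
  have h1 : HasFDerivAt (fun x : Spc d => x - x0) (ContinuousLinearMap.id ℝ _) x :=
    (hasFDerivAt_id x).sub_const x0
  have h2 := (l.hasFDerivAt (x := x - x0)).comp x h1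
  have h3 := (h1.norm_sq).const_mul A
  refine ((h2.const_add a).add h3).congr_fderiv ?_
  ext y
  simp

theorem slap_quadratic {d : ℕ} (a A : ℝ) (l : Spc d →L[ℝ] ℝ) (x0 x : Spc d) :
    slap (fun x => a + l (x - x0) + A * ‖x - x0‖ ^ 2) x = 2 * d * A := by
  have h1 : ∀ i, pd (bv i) (fun x => a + l (x - x0) + A * ‖x - x0‖ ^ 2) =
      fun x => (l (bv i) - 2 * A * x0 i) + (2 * A) * x i := by
    intro i
    ext y
    rw [pd, (hasFDerivAt_quadratic a A l x0 y).fderiv]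
    simp [EuclideanSpace.inner_single_right]
    ring
  have h2 : ∀ i, pd (bv i) (fun x : Spc d => (l (bv i) - 2 * A * x0 i) + (2 * A) * x i) x =
      2 * A := by
    intro i
    have hd : HasFDerivAt (fun x : Spc d => x i) (EuclideanSpace.proj i : Spc d →L[ℝ] ℝ) x :=
      (EuclideanSpace.proj i : Spc d →L[ℝ] ℝ).hasFDerivAt
    rw [pd, ((hd.const_mul (2 * A)).const_add _).fderiv]
    simp
  rw [slap_eq]
  simp only [h1, h2]
  simp; ring

/-- Curvature of the quadratic barrier used in `HeatSol.le_barrier`. -/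
noncomputable def barrierCurv (m N κ : ℝ) : ℝ := (2 * m + 1 + 2 * N * κ) / κ ^ 2 + N

/-- Growth rate of the barrier used in `HeatSol.le_barrier`. -/
noncomputable def barrierRate (d : ℕ) (M m N κ : ℝ) : ℝ :=
  2 * d * barrierCurv m N κ + M * (m + N + 4 * barrierCurv m N κ * κ)

theorem barrierRate_nonneg (d : ℕ) {M m N κ : ℝ} (hM : 0 ≤ M) (hm : 0 ≤ m) (hN : 0 ≤ N)
    (hκ : 0 < κ) : 0 ≤ barrierRate d M m N κ := by
  unfold barrierRate barrierCurv; positivity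

theorem two_le_infty : (2 : WithTop ℕ∞) ≤ ∞ :=
  WithTop.coe_le_coe.2 (le_top : (2 : ℕ∞) ≤ ⊤)

theorem cubic_absorb {z : ℝ} (hz : 0 ≤ z) (g M : ℝ) :
    3 * z ^ 2 * (M * g) - 6 * z * g ^ 2 ≤ 3 / 8 * M ^ 2 * z ^ 3 := by
  have : 0 ≤ z * (6 * (g - M * z / 4) ^ 2) := by positivity
  linarith [show z * (6 * (g - M * z / 4) ^ 2) =
    3 / 8 * M ^ 2 * z ^ 3 - (3 * z ^ 2 * (M * g) - 6 * z * g ^ 2) by ring]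

theorem HeatSol.hasDerivWithinAt {d : ℕ} {O : Set (Spc d)} {M : ℝ} {v : Spc d → ℝ → ℝ}
    (hv : HeatSol O M v) {x : Spc d} (hx : x ∈ O) {s : ℝ} (hs : s ∈ Icc (0:ℝ) 1) :
    HasDerivWithinAt (v x) (derivWithin (v x) (Icc 0 1) s) (Icc 0 1) s :=
  (hv.differentiableOn x hx s hs).hasDerivWithinAt

theorem eq_zero_of_right_deriv_le {E : ℝ → ℝ} {K b0 b1 : ℝ}
    (hE : ContinuousOn E (Icc b0 b1)) (h0 : E b0 = 0)
    (hd : ∀ b ∈ Ioo b0 b1, ∃ E', HasDerivWithinAt E E' (Ici b) b ∧ E' ≤ K * E b) :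
    ∀ s ∈ Icc b0 b1, E s ≤ 0 := by
  intro s hs
  rcases eq_or_lt_of_le hs.1 with h | h
  · rw [← h, h0]
  have hd' : ∀ b, ∃ E', b ∈ Ioo b0 b1 → HasDerivWithinAt E E' (Ici b) b ∧ E' ≤ K * E b := by
    intro b
    by_cases hb : b ∈ Ioo b0 b1
    · obtain ⟨E', h⟩ := hd b hb
      exact ⟨E', fun _ => h⟩
    · exact ⟨0, fun h => absurd h hb⟩
  choose E' hE' using hd'
  have key : ∀ b ∈ Ioo b0 s, E s ≤ E b * exp (K * (s - b)) := by
    intro b hb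
    have := le_gronwallBound_of_liminf_deriv_right_le (f := E) (f' := E') (δ := E b) (K := K)
      (ε := 0) (a := b) (b := b1) (hE.mono (Icc_subset_Icc_left hb.1.le)) ?_ le_rfl ?_ s
      ⟨hb.2.le, hs.2⟩
    · rwa [gronwallBound_ε0] at this
    · intro x hx r hr
      exact (hE' x ⟨hb.1.trans_le hx.1, hx.2⟩).1.liminf_right_slope_le hr
    · intro x hx
      simpa using (hE' x ⟨hb.1.trans_le hx.1, hx.2⟩).2
  have hlim : Tendsto (fun b => E b * exp (K * (s - b))) (𝓝[>] b0) (𝓝 (E b0 * exp (K * (s - b0)))) := by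
    have h1 : Tendsto E (𝓝[>] b0) (𝓝 (E b0)) := by
      refine (hE b0 ⟨le_rfl, h.le.trans hs.2⟩).mono_left ?_
      rw [← nhdsWithin_Ioo_eq_nhdsGT (h.trans_le hs.2)]
      exact nhdsWithin_mono _ Ioo_subset_Icc_self
    refine h1.mul (Tendsto.mono_left (Continuous.tendsto (by fun_prop) b0) nhdsWithin_le_nhds)
  rw [h0, zero_mul] at hlim
  refine ge_of_tendsto hlim ?_
  filter_upwards [Ioo_mem_nhdsGT h] with b hb using key b hb

set_option maxHeartbeats 1000000 in
theorem HeatSol.le_barrier {d : ℕ} {O : Set (Spc d)} {M : ℝ} {v : Spc d → ℝ → ℝ}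
    (hv : HeatSol O M v) {x0 : Spc d} {κ m N b0 b1 : ℝ} (hκ : 0 < κ)
    (hO : closedBall x0 (2 * κ) ⊆ O)
    (hm : ∀ x ∈ closedBall x0 (2 * κ), ∀ s ∈ Icc (0:ℝ) 1, |v x s| ≤ m)
    (h0 : 0 ≤ b0) (h01 : b0 ≤ b1) (h1 : b1 ≤ 1)
    (hn : ∀ b ∈ Ioo b0 b1, NiceAt v (closedBall x0 (2 * κ)) b) (hN : 0 ≤ N)
    {l : Spc d →L[ℝ] ℝ} (hl : ‖l‖ ≤ N)
    (hq : ∀ x ∈ closedBall x0 (2 * κ), v x b0 - v x0 b0 - l (x - x0) ≤ N * ‖x - x0‖ ^ 2) :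
    ∀ s ∈ Icc b0 b1, v x0 s - v x0 b0 ≤ barrierRate d M m N κ * (s - b0) := by
  have hsub : Icc b0 b1 ⊆ Icc 0 1 := Icc_subset_Icc h0 h1
  have hb0 : b0 ∈ Icc (0:ℝ) 1 := hsub ⟨le_rfl, h01⟩
  set A := barrierCurv m N κ with hA
  set Λ := barrierRate d M m N κ with hΛ
  have hx0 : x0 ∈ closedBall x0 (2 * κ) := mem_closedBall_self (by positivity)
  have hm0 : 0 ≤ m := (abs_nonneg _).trans (hm x0 hx0 b0 hb0)
  have hA0 : 0 ≤ A := by rw [hA]; unfold barrierCurv; positivity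
  have hAN : N ≤ A := by
    rw [hA]; unfold barrierCurv
    have : 0 ≤ (2 * m + 1 + 2 * N * κ) / κ ^ 2 := by positivity
    linarith
  have hAκ : 2 * m + 1 + 2 * N * κ ≤ A * κ ^ 2 := by
    rw [hA]; unfold barrierCurv
    rw [add_mul, div_mul_cancel₀ _ (by positivity)]
    have : 0 ≤ N * κ ^ 2 := by positivity
    linarith
  have hΛ0 : 0 ≤ Λ := barrierRate_nonneg d hv.nonneg hm0 hN hκ
  set Q : Spc d → ℝ := fun x => v x0 b0 + l (x - x0) + A * ‖x - x0‖ ^ 2 with hQ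
  set w : Spc d → ℝ → ℝ := fun x s => v x s - (Q x + Λ * (s - b0)) with hw
  have hQc : ContDiff ℝ ∞ Q := contDiff_quadratic _ _ _ _
  let f : ContDiffBump x0 := ⟨κ, 2 * κ, hκ, by linarith⟩
  have hts : tsupport f = closedBall x0 (2 * κ) := f.tsupport_eq
  have hfc : ContDiff ℝ 1 f := f.contDiff
  have hfs : HasCompactSupport f := f.hasCompactSupport
  have hlx : ∀ x, |l (x - x0)| ≤ N * ‖x - x0‖ := fun x =>
    (l.le_opNorm _).trans (mul_le_mul_of_nonneg_right hl (norm_nonneg _))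
  have hneg : ∀ x ∈ closedBall x0 (2 * κ), κ ≤ ‖x - x0‖ → ∀ s ∈ Icc b0 b1, w x s < 0 := by
    intro x hx hκx s hs
    have a1 := abs_le.1 (hm x hx s (hsub hs))
    have a2 := abs_le.1 (hm x0 hx0 b0 hb0)
    have a3 := abs_le.1 (hlx x)
    have a4 : ‖x - x0‖ ≤ 2 * κ := by simpa [dist_eq_norm] using hx
    have a5 : A * κ ^ 2 ≤ A * ‖x - x0‖ ^ 2 := by gcongr
    have a6 : N * ‖x - x0‖ ≤ N * (2 * κ) := by gcongr
    have a7 : 0 ≤ Λ * (s - b0) := mul_nonneg hΛ0 (by linarith [hs.1])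
    simp only [hw, hQ]
    linarith [a1.2, a2.1, a3.1]
  set H : ℝ → ℝ := fun z => max z 0 ^ 3 with hH
  have hHd : ∀ z, HasDerivAt H (3 * max z 0 ^ 2) z := fun z => by
    have := hasDerivAt_max_zero_pow 1 z
    norm_num at this
    exact this
  have hHd' : ∀ z, HasDerivAt (fun z : ℝ => 3 * max z 0 ^ 2) (6 * max z 0) z := fun z => by
    have := (hasDerivAt_max_zero_pow 0 z).const_mul 3
    norm_num at this
    rwa [← mul_assoc, show (3:ℝ) * 2 = 6 by norm_num] at this
  have hwx : ∀ s ∈ Icc (0:ℝ) 1, ContDiffOn ℝ 2 (fun x => w x s) O := fun s hs =>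
    (hv.contDiffOn s hs).sub ((hQc.of_le two_le_infty).add contDiff_const).contDiffOn
  obtain ⟨mQ, hmQ⟩ := (isCompact_closedBall x0 (2 * κ)).exists_bound_of_continuousOn
    hQc.continuous.continuousOn
  have hwm : ∀ x ∈ tsupport f, ∀ s ∈ Icc (0:ℝ) 1, |w x s| ≤ m + (mQ + Λ) := by
    intro x hx s hs
    rw [hts] at hx
    refine (abs_sub _ _).trans (add_le_add (hm x hx s hs) ((abs_add_le _ _).trans
      (add_le_add (hmQ x hx) ?_)))
    rw [abs_mul, abs_of_nonneg hΛ0]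
    refine mul_le_of_le_one_right hΛ0 (abs_le.2 ⟨?_, ?_⟩) <;> linarith [hs.1, hs.2, hb0.1, hb0.2]
  have hwt : ∀ b ∈ Icc (0:ℝ) 1, ∀ x ∈ O,
      HasDerivWithinAt (w x) (derivWithin (v x) (Icc 0 1) b - Λ) (Icc 0 1) b := by
    intro b hb x hx
    have e1 : HasDerivWithinAt (fun s => Q x + Λ * (s - b0)) Λ (Icc 0 1) b := by
      have := ((((hasDerivAt_id b).sub_const b0).const_mul Λ).const_add (Q x)).hasDerivWithinAt
        (s := Icc 0 1)
      simpa using this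
    exact (hv.hasDerivWithinAt hx hb).sub e1
  set E : ℝ → ℝ := fun s => ∫ x, f x * H (w x s) with hE
  have hHc : Continuous H := by rw [hH]; fun_prop
  have hEc : ContinuousOn E (Icc b0 b1) :=
    (continuousOn_timeIntegral hv.isOpen hfc.continuous hfs (by rw [hts]; exact hO)
      (fun s hs => (hwx s hs).continuousOn)
      (fun x hx s hs => (hwt s hs x hx).continuousWithinAt) hwm hHc).mono hsub
  have hE0 : E b0 = 0 := by
    rw [hE]
    refine integral_eq_zero_of_ae (ae_of_all _ fun x => ?_)
    by_cases hx : x ∈ closedBall x0 (2 * κ)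
    · have : w x b0 ≤ 0 := by
        have a1 := hq x hx
        have a2 : N * ‖x - x0‖ ^ 2 ≤ A * ‖x - x0‖ ^ 2 := by gcongr
        simp only [hw, hQ]
        linarith
      simp [hH, max_eq_right this]
    · rw [← hts] at hx
      simp [image_eq_zero_of_notMem_tsupport hx]
  have hEd : ∀ b ∈ Ioo b0 b1, ∃ E', HasDerivWithinAt E E' (Ici b) b ∧
      E' ≤ 3 / 8 * M ^ 2 * E b := by
    intro b hb
    have hbI : b ∈ Icc (0:ℝ) 1 := hsub (Ioo_subset_Icc_self hb)
    have hcont : ContinuousOn (fun x => w x b) O := (hwx b hbI).continuousOn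
    have hBint : Integrable fun x => f x * (3 / 8 * M ^ 2 * H (w x b)) :=
      integrable_mul_of_tsupport hv.isOpen hfc.continuous hfs (by rw [hts]; exact hO)
        (continuousOn_const.mul (hHc.comp_continuousOn hcont))
    have hnw : NiceAt w (tsupport f) b := by
      obtain ⟨C, hC, δ, hδ, hh⟩ := hn b hb
      refine ⟨C + Λ, by positivity, δ, hδ, fun x hx s hs hbs hsd => ?_⟩
      rw [hts] at hx
      have e1 := hh x hx s hs hbs hsd
      have e2 : w x s - w x b = (v x s - v x b) - Λ * (s - b) := by simp only [hw]; ring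
      rw [e2, add_mul]
      refine (abs_sub _ _).trans (add_le_add e1 ?_)
      rw [abs_of_nonneg (mul_nonneg hΛ0 (by linarith))]
    have := timeIntegral_deriv_le (H := H) (b := b) ⟨hbI.1, hb.2.trans_le h1⟩ hv.isOpen hfc hfs
      (by rw [hts]; exact hO) hwx (hwt b hbI) hwm hnw hHd hHd' (by fun_prop) hBint ?_
    · obtain ⟨E', e1, e2⟩ := this
      refine ⟨E', e1, e2.trans (le_of_eq ?_)⟩
      rw [hE, ← integral_const_mul]
      congr 1; ext x; ring
    · intro x
      by_cases hx : x ∈ closedBall x0 (2 * κ)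
      swap
      · rw [← hts] at hx
        simp [image_eq_zero_of_notMem_tsupport hx, pd_eq_zero_of_notMem_tsupport hx]
      have hf0 : 0 ≤ f x := f.nonneg
      have hgrad : ∀ i, pd (bv i) f x * (3 * max (w x b) 0 ^ 2 * pd (bv i) (fun y => w y b) x) = 0 := by
        intro i
        by_cases hxκ : ‖x - x0‖ < κ
        · have : (f : Spc d → ℝ) =ᶠ[𝓝 x] fun _ => 1 :=
            f.eventuallyEq_one_of_mem_ball (by simpa [dist_eq_norm] using hxκ)
          rw [pd_congr this, pd_const, zero_mul]
        · have := hneg x hx (not_lt.1 hxκ) b (Ioo_subset_Icc_self hb)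
          rw [max_eq_right this.le]; simp
      rw [Finset.sum_eq_zero fun i _ => hgrad i, sub_zero]
      rcases le_or_gt (w x b) 0 with hwn | hwp
      · simp [hH, max_eq_right hwn]
      simp only [hH, max_eq_left hwp.le]
      have hxO := hO hx
      have hvc := (hv.contDiffOn b hbI).contDiffAt (hv.isOpen.mem_nhds hxO)
      have hqc : ContDiffAt ℝ 2 (fun y => Q y + Λ * (b - b0)) x :=
        ((hQc.of_le two_le_infty).add contDiff_const).contDiffAt
      have hslap : slap (fun y => w y b) x = slap (fun y => v y b) x - 2 * d * A := by
        rw [show (fun y => w y b) = fun y => v y b - (Q y + Λ * (b - b0)) from rfl,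
          slap_sub hvc hqc]
        congr 1
        rw [← slap_quadratic (v x0 b0 + Λ * (b - b0)) A l x0 x]
        congr 1; ext y; simp only [hQ]; ring
      have hgq : √(gsq (fun y => v y b) x) ≤ √(gsq (fun y => w y b) x) + (N + 4 * A * κ) := by
        rw [← norm_fderiv_eq_sqrt, ← norm_fderiv_eq_sqrt]
        have e1 : fderiv ℝ (fun y => v y b) x = fderiv ℝ (fun y => w y b) x +
            (l + A • ((2:ℝ) • innerSL ℝ (x - x0))) := by
          have e3 := (hasFDerivAt_quadratic (v x0 b0) A l x0 x).add_const (Λ * (b - b0))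
          have e4 := (hvc.differentiableAt (by norm_num)).hasFDerivAt.sub e3
          rw [show (fun y => w y b) = (fun y => v y b) - (fun y => Q y + Λ * (b - b0)) from rfl,
            e4.fderiv]
          abel
        rw [e1]
        refine (norm_add_le _ _).trans (add_le_add_right ((norm_add_le _ _).trans
          (add_le_add hl ?_)) _)
        rw [norm_smul, norm_smul, innerSL_apply_norm, Real.norm_eq_abs, Real.norm_eq_abs,
          abs_of_nonneg hA0, abs_two]
        have a4 : ‖x - x0‖ ≤ 2 * κ := by simpa [dist_eq_norm] using hx
        nlinarith
      have hpde := (abs_le.1 (hv.pde x hxO b hbI)).2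
      have hmv := hm x hx b hbI
      have hM := hv.nonneg
      set g := √(gsq (fun y => w y b) x) with hg
      have hgg : gsq (fun y => w y b) x = g ^ 2 := (Real.sq_sqrt (gsq_nonneg _ _)).symm
      have hg0 : 0 ≤ g := Real.sqrt_nonneg _
      have hkey : derivWithin (v x) (Icc 0 1) b - Λ - slap (fun y => w y b) x ≤ M * g := by
        rw [hslap]
        have e5 : M * (|v x b| + √(gsq (fun y => v y b) x)) ≤ M * (m + (g + (N + 4 * A * κ))) := by
          gcongr
        have e6 : Λ = 2 * d * A + M * (m + N + 4 * A * κ) := rfl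
        rw [e6]; linarith
      rw [hgg, ← mul_sub]
      refine mul_le_mul_of_nonneg_left ?_ hf0
      set z := w x b
      have e7 : 3 * z ^ 2 * (derivWithin (v x) (Icc 0 1) b - Λ - slap (fun y => w y b) x) ≤
          3 * z ^ 2 * (M * g) := by gcongr
      have e8 := cubic_absorb hwp.le g M
      linarith
  intro s hs
  have hEs := eq_zero_of_right_deriv_le hEc hE0 hEd s hs
  have hcont : Continuous fun x => f x * H (w x s) :=
    continuous_mul_of_tsupport hv.isOpen hfc.continuous (by rw [hts]; exact hO)
      (hHc.comp_continuousOn (hwx s (hsub hs)).continuousOn)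
  have hnn : 0 ≤ fun x => f x * H (w x s) := fun x => mul_nonneg f.nonneg (by
    simp only [hH]; positivity)
  have hitg : Integrable fun x => f x * H (w x s) :=
    hcont.integrable_of_hasCompactSupport hfs.mul_right
  have hz := (integral_eq_zero_iff_of_nonneg hnn hitg).1
    (le_antisymm hEs (integral_nonneg hnn))
  have hz' := (hcont.ae_eq_iff_eq volume continuous_zero).1 hz
  have hz0 := congrFun hz' x0
  have hf1 : f x0 = 1 := f.one_of_mem_closedBall (mem_closedBall_self hκ.le)
  simp only [hf1, one_mul, Pi.zero_apply, hH] at hz0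
  have hle : w x0 s ≤ 0 := by
    have : max (w x0 s) 0 = 0 := pow_eq_zero_iff (three_ne_zero) |>.1 hz0
    exact (le_max_left _ _).trans this.le
  simp only [hw, hQ] at hle
  simp at hle
  linarith

/-- `f` has, at every point of `K`, a first order expansion with quadratic error,
all constants being at most `N`. -/
def QuadBd {d : ℕ} (f : Spc d → ℝ) (K : Set (Spc d)) (N : ℝ) : Prop :=
  ∀ x0 ∈ K, ∃ l : Spc d →L[ℝ] ℝ, ‖l‖ ≤ N ∧
    ∀ x ∈ K, |f x - f x0 - l (x - x0)| ≤ N * ‖x - x0‖ ^ 2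

theorem QuadBd.neg {d : ℕ} {f : Spc d → ℝ} {K : Set (Spc d)} {N : ℝ} (h : QuadBd f K N) :
    QuadBd (fun x => -f x) K N := by
  intro x0 hx0
  obtain ⟨l, hl, H⟩ := h x0 hx0
  refine ⟨-l, by simpa using hl, fun x hx => ?_⟩
  have := H x hx
  rw [← abs_neg] at this
  convert this using 2
  simp; ring

theorem exists_quadBd {d : ℕ} {O : Set (Spc d)} (hO : IsOpen O) {g : Spc d → ℝ}
    (hg : ContDiffOn ℝ 2 g O) {K : Set (Spc d)} (hK : IsCompact K) (hKc : Convex ℝ K)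
    (hKO : K ⊆ O) : ∃ N : ℕ, QuadBd g K N := by
  have hc : ∀ x ∈ K, ContDiffAt ℝ 2 g x := fun x hx => hg.contDiffAt (hO.mem_nhds (hKO hx))
  have hc1 : ∀ x ∈ K, ContDiffAt ℝ 1 (fderiv ℝ g) x := fun x hx =>
    (hc x hx).fderiv_right (by norm_num)
  have hc2 : ∀ x ∈ K, ContDiffAt ℝ 0 (fderiv ℝ (fderiv ℝ g)) x := fun x hx =>
    (hc1 x hx).fderiv_right (by norm_num)
  obtain ⟨N1, hN1⟩ := hK.exists_bound_of_continuousOn (f := fderiv ℝ g)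
    fun x hx => (hc1 x hx).continuousAt.continuousWithinAt
  obtain ⟨N2, hN2⟩ := hK.exists_bound_of_continuousOn (f := fderiv ℝ (fderiv ℝ g))
    fun x hx => (hc2 x hx).continuousAt.continuousWithinAt
  obtain ⟨N, hN⟩ := exists_nat_ge (max N1 N2)
  refine ⟨N, fun x0 hx0 => ⟨fderiv ℝ g x0, (hN1 x0 hx0).trans ((le_max_left _ _).trans hN), ?_⟩⟩
  intro x hx
  have h2 : ∀ y ∈ K ∩ closedBall x0 ‖x - x0‖, ‖fderiv ℝ g y - fderiv ℝ g x0‖ ≤ N * ‖x - x0‖ := by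
    intro y hy
    refine (hKc.norm_image_sub_le_of_norm_fderiv_le (C := N)
      (fun z hz => (hc1 z hz).differentiableAt (by norm_num))
      (fun z hz => (hN2 z hz).trans ((le_max_right _ _).trans hN)) hx0 hy.1).trans ?_
    have := mem_closedBall_iff_norm.1 hy.2
    gcongr
  have h3 := (hKc.inter (convex_closedBall x0 ‖x - x0‖)).norm_image_sub_le_of_norm_fderiv_le'
    (𝕜 := ℝ) (f := g) (φ := fderiv ℝ g x0)
    (fun z hz => (hc z hz.1).differentiableAt (by norm_num)) h2
    (x := x0) (y := x) ⟨hx0, mem_closedBall_self (norm_nonneg _)⟩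
    ⟨hx, mem_closedBall_iff_norm.2 le_rfl⟩
  rw [Real.norm_eq_abs] at h3
  linarith

theorem QuadBd.of_tendsto {d : ℕ} {f : ℕ → Spc d → ℝ} {g : Spc d → ℝ} {K : Set (Spc d)} {N : ℝ}
    (h : ∀ k, QuadBd (f k) K N) (ht : ∀ x ∈ K, Tendsto (fun k => f k x) atTop (𝓝 (g x))) :
    QuadBd g K N := by
  intro x0 hx0
  choose l hl H using fun k => h k x0 hx0
  have : ProperSpace (Spc d →L[ℝ] ℝ) := FiniteDimensional.proper ℝ _
  obtain ⟨L, hL, φ, hφ, hlim⟩ := (isCompact_closedBall (0 : Spc d →L[ℝ] ℝ) N).tendsto_subseq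
    (x := l) (fun k => by simpa using hl k)
  refine ⟨L, by simpa using hL, fun x hx => ?_⟩
  refine le_of_tendsto (x := atTop) (f := fun k => |f (φ k) x - f (φ k) x0 - l (φ k) (x - x0)|) ?_
    (Eventually.of_forall fun k => H (φ k) x hx)
  refine (((((ht x hx).comp hφ.tendsto_atTop)).sub ((ht x0 hx0).comp hφ.tendsto_atTop)).sub ?_).abs
  exact ((ContinuousLinearMap.apply ℝ ℝ (x - x0)).continuous.tendsto L).comp hlim

theorem QuadBd.norm_fderiv_le {d : ℕ} {f : Spc d → ℝ} {K : Set (Spc d)} {N : ℝ}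
    (h : QuadBd f K N) {x : Spc d} (hx : K ∈ 𝓝 x) :
    ‖fderiv ℝ f x‖ ≤ N ∧ ∀ y ∈ K, |f y - f x - fderiv ℝ f x (y - x)| ≤ N * ‖y - x‖ ^ 2 := by
  obtain ⟨l, hl, H⟩ := h x (mem_of_mem_nhds hx)
  have h1 : HasFDerivAt (fun y => f y - f x - l (y - x)) (0 : Spc d →L[ℝ] ℝ) x := by
    refine Asymptotics.IsBigO.hasFDerivAt (n := 2) ?_ (by norm_num)
    refine Asymptotics.IsBigO.of_bound N ?_
    filter_upwards [hx] with y hy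
    simpa using H y hy
  have h2 : HasFDerivAt (fun y => l (y - x)) l x :=
    l.hasFDerivAt.comp x ((hasFDerivAt_id x).sub_const x)
  have h3 : HasFDerivAt f l x := by
    have := (h1.add h2).add_const (f x)
    simpa using this
  rw [h3.fderiv]
  exact ⟨hl, H⟩

theorem QuadBd.pd_pd_le {d : ℕ} {f : Spc d → ℝ} {K : Set (Spc d)} {N : ℝ}
    (h : QuadBd f K N) {x : Spc d} (hx : K ∈ 𝓝 x) (hf : ContDiffAt ℝ 2 f x) {e : Spc d}
    (he : ‖e‖ = 1) : pd e (pd e f) x ≤ 2 * N := by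
  by_contra! hlt
  obtain ⟨-, H⟩ := h.norm_fderiv_le hx
  set a := fderiv ℝ f x e
  have hline : ∀ t : ℝ, HasDerivAt (fun t : ℝ => x + t • e) e t := fun t => by
    simpa using ((hasDerivAt_id t).smul_const e).const_add x
  have hcont : Tendsto (fun t : ℝ => x + t • e) (𝓝 0) (𝓝 x) := by
    simpa using (hline 0).continuousAt.tendsto
  have hder : ∀ g : Spc d → ℝ, ∀ t, DifferentiableAt ℝ g (x + t • e) →
      HasDerivAt (fun t : ℝ => g (x + t • e)) (pd e g (x + t • e)) t := fun g t hg =>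
    hg.hasFDerivAt.comp_hasDerivAt t (hline t)
  have hev : ∀ᶠ t : ℝ in 𝓝 0, DifferentiableAt ℝ f (x + t • e) :=
    hcont.eventually ((hf.eventually (by simp)).mono fun y hy => hy.differentiableAt (by norm_num))
  set q : ℝ → ℝ := fun t => f (x + t • e) - f x - t * a - N * t ^ 2 with hq
  have hq1 : ∀ᶠ t : ℝ in 𝓝 0, HasDerivAt q (pd e f (x + t • e) - a - N * (2 * t)) t := by
    filter_upwards [hev] with t ht
    have := (((hder f t ht).sub_const (f x)).sub ((hasDerivAt_id t).mul_const a)).sub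
      (((hasDerivAt_id t).pow 2).const_mul N)
    refine this.congr_deriv ?_
    simp
  have hq1' : deriv q =ᶠ[𝓝 0] fun t => pd e f (x + t • e) - a - N * (2 * t) :=
    hq1.mono fun t ht => ht.deriv
  have hq2 : deriv (deriv q) 0 = pd e (pd e f) x - N * 2 := by
    rw [hq1'.deriv_eq]
    have := ((hder (pd e f) 0 (by
      simpa using (hf.pd (m := 1) (by norm_num)).differentiableAt (by norm_num))).sub_const a).sub
      (((hasDerivAt_id (0:ℝ)).const_mul 2).const_mul N)
    rw [show (fun t : ℝ => pd e f (x + t • e) - a - N * (2 * t)) =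
      ((fun t => pd e f (x + t • e) - a) - fun y => N * (2 * id y)) from rfl, this.deriv]
    simp
  have hmin : IsLocalMin q 0 := by
    refine isLocalMin_of_deriv_deriv_pos (by rw [hq2]; linarith) ?_ ?_
    · rw [hq1'.self_of_nhds]; simp [a, pd]
    · exact hq1.self_of_nhds.continuousAt
  have hzero : q =ᶠ[𝓝 0] fun _ => 0 := by
    filter_upwards [hmin, hcont.eventually hx] with t ht htK
    have h1 := (abs_le.1 (H _ htK)).2
    simp only [add_sub_cancel_left, map_smul, norm_smul, he, smul_eq_mul, mul_one,
      Real.norm_eq_abs, sq_abs] at h1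
    simp only [hq] at ht ⊢
    simp only [zero_smul, add_zero, sub_self, zero_mul] at ht
    simp only [a] at ht ⊢
    norm_num at ht
    linarith
  have : deriv (deriv q) 0 = 0 := by
    have h1 : deriv q =ᶠ[𝓝 0] deriv fun _ => 0 := hzero.deriv
    rw [h1.deriv_eq]; simp
  linarith

theorem HeatSol.abs_derivWithin_le {d : ℕ} {O : Set (Spc d)} {M : ℝ} {v : Spc d → ℝ → ℝ}
    (hv : HeatSol O M v) {K : Set (Spc d)} (hKO : K ⊆ O) {N m s : ℝ} {x : Spc d}
    (hs : s ∈ Icc (0:ℝ) 1) (hm : |v x s| ≤ m) (hx : K ∈ 𝓝 x)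
    (hq : QuadBd (fun x => v x s) K N) :
    derivWithin (v x) (Icc 0 1) s ≤ d * (2 * N) + M * (m + N) := by
  have hxO : x ∈ O := hKO (mem_of_mem_nhds hx)
  have hc := (hv.contDiffOn s hs).contDiffAt (hv.isOpen.mem_nhds hxO)
  have h1 := (abs_le.1 (hv.pde x hxO s hs)).2
  have h2 : slap (fun y => v y s) x ≤ d * (2 * N) := by
    rw [slap_eq]
    refine (Finset.sum_le_sum (g := fun _ => 2 * N) fun i _ =>
      hq.pd_pd_le hx hc (e := bv i) (by simp)).trans ?_
    simp
  have h3 := (hq.norm_fderiv_le hx).1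
  rw [norm_fderiv_eq_sqrt] at h3
  have : M * (|v x s| + √(gsq (fun y => v y s) x)) ≤ M * (m + N) :=
    mul_le_mul_of_nonneg_left (add_le_add hm h3) hv.nonneg
  linarith

theorem HeatSol.jump_le {d : ℕ} {O : Set (Spc d)} {M : ℝ} {v : Spc d → ℝ → ℝ}
    (hv : HeatSol O M v) {c : Spc d} {r ρ m N α β : ℝ} (hρ : ρ < r)
    (hO : closedBall c r ⊆ O) (hm : ∀ x ∈ closedBall c r, ∀ s ∈ Icc (0:ℝ) 1, |v x s| ≤ m)
    (hm0 : 0 ≤ m) (hN : 0 ≤ N) {P : Set ℝ} (hP : IsClosed P) (hPI : P ⊆ Icc 0 1)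
    (hPN : ∀ b ∈ P, b ∈ Ioo α β → QuadBd (fun x => v x b) (closedBall c r) N)
    (hnice : ∀ b ∈ Icc (0:ℝ) 1, b ∉ P → ∀ ρ' < r, NiceAt v (closedBall c ρ') b)
    {x : Spc d} (hx : x ∈ closedBall c ρ) {b s : ℝ} (hb : b ∈ P) (hbJ : b ∈ Ioo α β)
    (hs : s ∈ Icc (0:ℝ) 1) (hsβ : s < β) (hbs : b ≤ s) :
    v x s - v x b ≤ (d * (2 * N) + M * (m + N) + barrierRate d M m N ((r - ρ) / 4) + 1) *
      (s - b) := by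
  set κ := (r - ρ) / 4 with hκ
  have hκ0 : 0 < κ := by rw [hκ]; linarith
  set C1 := d * (2 * N) + M * (m + N)
  set C2 := barrierRate d M m N κ with hC2
  have hC1 : 0 ≤ C1 := by have := hv.nonneg; positivity
  have hC20 : 0 ≤ C2 := barrierRate_nonneg d hv.nonneg hm0 hN hκ0
  have hb2 : closedBall x (2 * κ) ⊆ closedBall c ((ρ + r) / 2) :=
    closedBall_subset_closedBall' (by rw [mem_closedBall] at hx; rw [hκ]; linarith)
  have hb3 : closedBall c ((ρ + r) / 2) ⊆ closedBall c r := closedBall_subset_closedBall (by linarith)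
  have hxK : closedBall c r ∈ 𝓝 x := by
    refine mem_of_superset (ball_mem_nhds x (ε := 2 * κ) (by positivity)) ?_
    exact ball_subset_closedBall.trans (hb2.trans hb3)
  have hxr : x ∈ closedBall c r := mem_of_mem_nhds hxK
  have hxO := hO hxr
  have hbI := hPI hb
  by_contra! hcon
  set k : ℝ → ℝ := fun t => v x t - v x b - (C1 + C2 + 1) * (t - b) with hk
  have hks : 0 < k s := by simp only [hk]; linarith
  have hkb : k b = 0 := by simp [hk]
  have hsubI : Icc b s ⊆ Icc 0 1 := Icc_subset_Icc hbI.1 hs.2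
  have hkc : ContinuousOn k (Icc b s) := by
    refine ((((hv.differentiableOn x hxO).continuousOn.mono hsubI)).sub continuousOn_const).sub ?_
    fun_prop
  have hScl : IsCompact (Icc b s ∩ k ⁻¹' Ici (k s)) :=
    isCompact_Icc.of_isClosed_subset (hkc.preimage_isClosed_of_isClosed isClosed_Icc isClosed_Ici)
      inter_subset_left
  obtain ⟨σ, ⟨hσI, hσk⟩, hσmin⟩ := hScl.exists_isLeast
    ⟨s, ⟨hbs, le_rfl⟩, le_refl (k s)⟩
  have hσk : k s ≤ k σ := hσk
  have hbσ : b < σ := by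
    refine lt_of_le_of_ne hσI.1 fun h => ?_
    rw [← h, hkb] at hσk; linarith
  have hlt : ∀ t ∈ Ico b σ, k t < k σ := by
    intro t ht
    by_contra! hge
    exact absurd (hσmin ⟨⟨ht.1, ht.2.le.trans hσI.2⟩, hσk.trans hge⟩) (not_le.2 ht.2)
  have hσJ : ∀ t ∈ Icc b σ, t ∈ Ioo α β := fun t ht =>
    ⟨hbJ.1.trans_le ht.1, (ht.2.trans hσI.2).trans_lt hsβ⟩
  by_cases hσP : σ ∈ P
  · have hd := hv.hasDerivWithinAt hxO (hsubI hσI)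
    have hdle := hv.abs_derivWithin_le hO (hsubI hσI) (hm x hxr σ (hsubI hσI)) hxK
      (hPN σ hσP (hσJ σ ⟨hbσ.le, le_rfl⟩))
    have hk' : HasDerivWithinAt k (derivWithin (v x) (Icc 0 1) σ - (C1 + C2 + 1)) (Ioo b σ) σ := by
      have := ((hd.mono (s := Ioo b σ) fun t ht => hsubI ⟨ht.1.le, ht.2.le.trans hσI.2⟩).sub_const
        (v x b)).sub ((((hasDerivAt_id σ).sub_const b).const_mul (C1 + C2 + 1)).hasDerivWithinAt)
      refine this.congr_deriv ?_
      simp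
    rw [hasDerivWithinAt_iff_tendsto_slope' (by simp)] at hk'
    have hne : (𝓝[Ioo b σ] σ).NeBot := right_nhdsWithin_Ioo_neBot hbσ
    have hneg : derivWithin (v x) (Icc 0 1) σ - (C1 + C2 + 1) < 0 := by
      simp only [C1]; linarith
    obtain ⟨t, ht, htI⟩ := ((hk'.eventually_lt_const hneg).and self_mem_nhdsWithin).exists
    rw [slope_def_field] at ht
    have := hlt t ⟨htI.1.le, htI.2⟩
    have h2 : 0 < (k t - k σ) / (t - σ) := div_pos_of_neg_of_neg (by linarith) (by linarith [htI.2])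
    linarith
  · obtain ⟨a, ⟨haP, haI⟩, hamax⟩ := (isCompact_Icc.inter_left hP (s := P) (t := Icc b σ)).exists_isGreatest
      ⟨b, hb, le_rfl, hbσ.le⟩
    have haσ : a < σ := lt_of_le_of_ne haI.2 fun h => hσP (h ▸ haP)
    have hnP : ∀ t ∈ Ioo a σ, t ∉ P := fun t ht htP =>
      absurd (hamax ⟨htP, haI.1.trans ht.1.le, ht.2.le⟩) (not_le.2 ht.1)
    have haI1 := hPI haP
    have hq := hPN a haP (hσJ a haI)
    obtain ⟨hl, hq'⟩ := hq.norm_fderiv_le hxK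
    have := hv.le_barrier (x0 := x) hκ0 ((hb2.trans hb3).trans hO)
      (fun y hy => hm y (hb3 (hb2 hy))) haI1.1 haσ.le (hsubI hσI).2
      (fun t ht => (hnice t ⟨haI1.1.trans ht.1.le, ht.2.le.trans (hsubI hσI).2⟩ (hnP t ht) _
        (show (ρ + r) / 2 < r by linarith)).mono hb2) hN hl
      (fun y hy => (le_abs_self _).trans (hq' y (hb3 (hb2 hy)))) σ ⟨haσ.le, le_rfl⟩
    have h1 := hlt a ⟨haI.1, haσ⟩
    simp only [hk] at h1
    have h2 : 0 ≤ C1 * (σ - a) := mul_nonneg hC1 (by linarith)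
    rw [← hC2] at this
    linarith

theorem NiceAt.union {d : ℕ} {w : Spc d → ℝ → ℝ} {K L : Set (Spc d)} {b : ℝ}
    (h : NiceAt w K b) (h' : NiceAt w L b) : NiceAt w (K ∪ L) b := by
  obtain ⟨C, hC, δ, hδ, H⟩ := h
  obtain ⟨C', hC', δ', hδ', H'⟩ := h'
  refine ⟨max C C', hC.trans (le_max_left _ _), min δ δ', lt_min hδ hδ', ?_⟩
  rintro x (hx | hx) s hs hbs hlt
  · refine (H x hx s hs hbs (hlt.trans_le (by gcongr; exact min_le_left _ _))).trans ?_
    exact mul_le_mul_of_nonneg_right (le_max_left _ _) (by linarith)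
  · refine (H' x hx s hs hbs (hlt.trans_le (by gcongr; exact min_le_right _ _))).trans ?_
    exact mul_le_mul_of_nonneg_right (le_max_right _ _) (by linarith)

theorem HeatSol.niceAt_closedBall {d : ℕ} {O : Set (Spc d)} {M : ℝ} {v : Spc d → ℝ → ℝ}
    (hv : HeatSol O M v) {c : Spc d} {r : ℝ} (hO : closedBall c r ⊆ O) :
    ∀ b ∈ Icc (0:ℝ) 1, ∀ ρ < r, NiceAt v (closedBall c ρ) b := by
  obtain ⟨m', hm'⟩ := hv.bdd _ hO (isCompact_closedBall c r)
  set m := max m' 0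
  have hm : ∀ x ∈ closedBall c r, ∀ s ∈ Icc (0:ℝ) 1, |v x s| ≤ m := fun x hx s hs =>
    (hm' x hx s hs).trans (le_max_left _ _)
  have hm0 : 0 ≤ m := le_max_right _ _
  set B : Set ℝ := {b ∈ Icc (0:ℝ) 1 | ¬ ∀ ρ < r, NiceAt v (closedBall c ρ) b} with hB
  have hBI : B ⊆ Icc 0 1 := fun b hb => hb.1
  set P := closure B with hP
  have hPI : P ⊆ Icc 0 1 := closure_minimal hBI isClosed_Icc
  have hnice : ∀ b ∈ Icc (0:ℝ) 1, b ∉ P → ∀ ρ' < r, NiceAt v (closedBall c ρ') b := by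
    intro b hb hbP
    by_contra h
    exact hbP (subset_closure ⟨hb, h⟩)
  by_contra! hex
  obtain ⟨b0, hb0, ρ0, hρ0, hbad⟩ := hex
  have hb0B : b0 ∈ B := ⟨hb0, fun h => hbad (h ρ0 hρ0)⟩
  have : Nonempty P := ⟨⟨b0, subset_closure hb0B⟩⟩
  have : CompleteSpace P := isClosed_closure.completeSpace_coe
  have hcl : ∀ N : ℕ, IsClosed {p : P | QuadBd (fun x => v x p) (closedBall c r) N} := by
    intro N
    refine IsSeqClosed.isClosed fun p q hp hpq => ?_
    refine QuadBd.of_tendsto hp fun x hx => ?_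
    have h1 := (hv.differentiableOn x (hO hx)).continuousOn q (hPI q.2)
    refine h1.tendsto.comp (tendsto_nhdsWithin_iff.2 ⟨?_, Eventually.of_forall fun k => hPI (p k).2⟩)
    exact (continuous_subtype_val.tendsto q).comp hpq
  obtain ⟨N, hN⟩ := nonempty_interior_of_iUnion_of_closed hcl (by
    refine eq_univ_of_forall fun p => mem_iUnion.2 ?_
    exact exists_quadBd hv.isOpen (hv.contDiffOn p (hPI p.2)) (isCompact_closedBall c r)
      (convex_closedBall c r) hO)
  obtain ⟨p, hp⟩ := hN
  rw [mem_interior_iff_mem_nhds, nhds_subtype_eq_comap, mem_comap] at hp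
  obtain ⟨U, hU, hUP⟩ := hp
  obtain ⟨α, β, hpJ, hJU⟩ := mem_nhds_iff_exists_Ioo_subset.1 hU
  have hPN : ∀ b ∈ P, b ∈ Ioo α β → QuadBd (fun x => v x b) (closedBall c r) N :=
    fun b hb hbJ => hUP (show (⟨b, hb⟩ : P) ∈ Subtype.val ⁻¹' U from hJU hbJ)
  obtain ⟨b, hbJ, hbB⟩ := mem_closure_iff.1 p.2 (Ioo α β) isOpen_Ioo hpJ
  refine hbB.2 fun ρ hρ => ?_
  have hbP : b ∈ P := subset_closure hbB
  have hC : 0 ≤ d * (2 * (N:ℝ)) + M * (m + N) + barrierRate d M m N ((r - ρ) / 4) + 1 := by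
    have h1 := barrierRate_nonneg d hv.nonneg hm0 (Nat.cast_nonneg N)
      (show 0 < (r - ρ) / 4 by linarith)
    have h2 := hv.nonneg
    positivity
  refine ⟨_, hC, β - b, by linarith [hbJ.2], fun x hx s hs hbs hlt => abs_le.2 ⟨?_, ?_⟩⟩
  · have := hv.neg.jump_le hρ hO (by simpa using hm) hm0 (Nat.cast_nonneg N) isClosed_closure hPI
      (fun b hb hbJ => (hPN b hb hbJ).neg) ?_ hx hbP hbJ hs (by linarith) hbs
    · linarith
    · intro b' hb' hbP' ρ' hρ'
      obtain ⟨C, hC, δ, hδ, H⟩ := hnice b' hb' hbP' ρ' hρ'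
      refine ⟨C, hC, δ, hδ, fun x hx s hs h1 h2 => ?_⟩
      have := H x hx s hs h1 h2
      rw [← abs_neg] at this
      convert this using 2; ring
  · exact hv.jump_le hρ hO hm hm0 (Nat.cast_nonneg N) isClosed_closure hPI hPN hnice hx hbP hbJ hs
      (by linarith) hbs

theorem HeatSol.niceAt {d : ℕ} {O : Set (Spc d)} {M : ℝ} {v : Spc d → ℝ → ℝ}
    (hv : HeatSol O M v) {K : Set (Spc d)} (hK : IsCompact K) (hKO : K ⊆ O) {b : ℝ}
    (hb : b ∈ Icc (0:ℝ) 1) : NiceAt v K b := by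
  refine hK.induction_on (p := fun K => NiceAt v K b) ⟨0, le_rfl, 1, one_pos, by simp⟩
    (fun s t hst h => h.mono hst) (fun s t h h' => h.union h') fun x hx => ?_
  obtain ⟨r, hr, hrO⟩ := nhds_basis_closedBall.mem_iff.1 (hv.isOpen.mem_nhds (hKO hx))
  exact ⟨closedBall x (r / 2), mem_nhdsWithin_of_mem_nhds (closedBall_mem_nhds x (by positivity)),
    hv.niceAt_closedBall hrO b hb _ (by linarith)⟩

/-- The open space-time cylinder over `O`. -/
def cyl {d : ℕ} (O : Set (Spc d)) : Set (Spc d × ℝ) := O ×ˢ Ioo (0:ℝ) 1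

/-- Extension by zero of `v` off the cylinder over `O`. -/
noncomputable def uZ {d : ℕ} (O : Set (Spc d)) (v : Spc d → ℝ → ℝ) : Spc d × ℝ → ℝ :=
  (cyl O).indicator fun z => v z.1 z.2

/-- Extension by zero of the `i`-th spatial derivative of `v` off the cylinder over `O`. -/
noncomputable def gZ {d : ℕ} (O : Set (Spc d)) (v : Spc d → ℝ → ℝ) (i : Fin d) :
    Spc d × ℝ → ℝ :=
  (cyl O).indicator fun z => pd (bv i) (fun y => v y z.2) z.1

/-- Extension by zero of `∂ₛ v - Δ v` off the cylinder over `O`. -/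
noncomputable def fZ {d : ℕ} (O : Set (Spc d)) (v : Spc d → ℝ → ℝ) : Spc d × ℝ → ℝ :=
  (cyl O).indicator fun z =>
    derivWithin (v z.1) (Icc 0 1) z.2 - slap (fun y => v y z.2) z.1

/-- Squared length of the extended spatial gradient. -/
noncomputable def eG {d : ℕ} (O : Set (Spc d)) (v : Spc d → ℝ → ℝ) (z : Spc d × ℝ) : ℝ :=
  ∑ i, gZ O v i z ^ 2

theorem eG_nonneg {d : ℕ} (O : Set (Spc d)) (v : Spc d → ℝ → ℝ) (z : Spc d × ℝ) : 0 ≤ eG O v z :=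
  Finset.sum_nonneg fun _ _ => sq_nonneg _

theorem IsOpen.cyl {d : ℕ} {O : Set (Spc d)} (hO : IsOpen O) : IsOpen (cyl O) :=
  hO.prod isOpen_Ioo

theorem eG_eq {d : ℕ} {O : Set (Spc d)} {v : Spc d → ℝ → ℝ} {z : Spc d × ℝ} (hz : z ∈ cyl O) :
    eG O v z = gsq (fun y => v y z.2) z.1 := by
  simp [eG, gsq, gZ, hz]

theorem eG_eq_zero {d : ℕ} {O : Set (Spc d)} {v : Spc d → ℝ → ℝ} {z : Spc d × ℝ}
    (hz : z ∉ cyl O) : eG O v z = 0 := by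
  simp [eG, gZ, hz]

theorem HeatSol.fZ_sq_le {d : ℕ} {O : Set (Spc d)} {M : ℝ} {v : Spc d → ℝ → ℝ}
    (hv : HeatSol O M v) (z : Spc d × ℝ) :
    fZ O v z ^ 2 ≤ 2 * M ^ 2 * (uZ O v z ^ 2 + eG O v z) := by
  by_cases hz : z ∈ cyl O
  · have h := hv.pde z.1 hz.1 z.2 (Ioo_subset_Icc_self hz.2)
    rw [eG_eq hz]
    simp only [fZ, uZ, indicator_of_mem hz]
    have hg := gsq_nonneg (fun y => v y z.2) z.1
    have h2 := pow_le_pow_left₀ (abs_nonneg _) h 2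
    rw [sq_abs] at h2
    have h3 := Real.sq_sqrt hg
    have h4 := sq_abs (v z.1 z.2)
    nlinarith [mul_nonneg (sq_nonneg M) (sq_nonneg (|v z.1 z.2| - √(gsq (fun y => v y z.2) z.1)))]
  · have := hv.nonneg
    have h1 := eG_nonneg O v z
    simp only [fZ, indicator_of_notMem hz]
    have h2 := mul_nonneg (mul_nonneg zero_le_two (sq_nonneg M))
      (add_nonneg (sq_nonneg (uZ O v z)) h1)
    linarith

theorem Measurable.of_hasLineDerivAt {d : ℕ} {Ω : Set (Spc d × ℝ)} (hΩ : MeasurableSet Ω)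
    {F G : Spc d × ℝ → ℝ} (hF : Measurable F) (e : Spc d × ℝ)
    (h : ∀ z ∈ Ω, HasLineDerivAt ℝ F (G z) z e) : Measurable (Ω.indicator G) := by
  refine measurable_of_tendsto_metrizable (f := fun (k : ℕ) => Ω.indicator fun z =>
    (1 / ((k:ℝ) + 1))⁻¹ * (F (z + (1 / ((k:ℝ) + 1)) • e) - F z)) (fun k => ?_) ?_
  · refine Measurable.indicator ?_ hΩ
    exact ((hF.comp (measurable_id.add_const _)).sub hF).const_mul _
  · rw [tendsto_pi_nhds]
    intro z
    by_cases hz : z ∈ Ω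
    · simp only [indicator_of_mem hz]
      refine Tendsto.comp (h z hz).tendsto_slope_zero ?_
      exact tendsto_nhdsWithin_iff.2 ⟨tendsto_one_div_add_atTop_nhds_zero_nat,
        Eventually.of_forall fun k => by
          simp only [mem_compl_iff, mem_singleton_iff]; positivity⟩
    · simp [hz]

theorem eventually_line_mem {d : ℕ} {Ω : Set (Spc d × ℝ)} (hΩ : IsOpen Ω) {z : Spc d × ℝ}
    (hz : z ∈ Ω) (e : Spc d × ℝ) : ∀ᶠ t : ℝ in 𝓝 0, z + t • e ∈ Ω := by
  have : Continuous fun t : ℝ => z + t • e := by fun_prop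
  exact this.continuousAt.eventually_mem (by simpa using hΩ.mem_nhds hz)

section Meas

variable {d : ℕ} {O : Set (Spc d)} {M : ℝ} {v : Spc d → ℝ → ℝ}

theorem HeatSol.measurable_uZ (hv : HeatSol O M v) : Measurable (uZ O v) := by
  have hO := hv.isOpen
  set w : ℝ → Spc d → ℝ := fun s => O.indicator fun x => v x (projIcc 0 1 zero_le_one s) with hw
  have h1 : Measurable (Function.uncurry w) := by
    refine measurable_uncurry_of_continuous_of_measurable (fun x => ?_) fun s => ?_
    · by_cases hx : x ∈ O
      · simp only [hw, indicator_of_mem hx]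
        exact ((hv.differentiableOn x hx).continuousOn.comp_continuous
          (continuous_subtype_val.comp continuous_projIcc) fun s => (projIcc 0 1 zero_le_one s).2)
      · simp only [hw, indicator_of_notMem hx]; exact continuous_const
    · have := (hv.contDiffOn _ (projIcc 0 1 zero_le_one s).2).continuousOn
      refine measurable_of_restrict_of_restrict_compl hO.measurableSet ?_ ?_
      · have h2 : O.domRestrict (w s) = O.domRestrict fun x => v x (projIcc 0 1 zero_le_one s) := by
          ext x; simp [hw]
        rw [h2]
        exact (continuousOn_iff_continuous_domRestrict.1 this).measurable
      · have h2 : Oᶜ.domRestrict (w s) = fun _ => 0 := by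
          ext x
          have : (x : Spc d) ∉ O := x.2
          simp [hw, this]
        rw [h2]; exact measurable_const
  have h2 : uZ O v = (cyl O).indicator (Function.uncurry w ∘ Prod.swap) := by
    ext z
    by_cases hz : z ∈ cyl O
    · have h3 : z.1 ∈ O := hz.1
      have h4 := Ioo_subset_Icc_self hz.2
      simp [uZ, hz, hw, Function.uncurry, h3, projIcc_of_mem _ h4]
    · simp [uZ, hz]
  rw [h2]
  exact (h1.comp measurable_swap).indicator hO.cyl.measurableSet

theorem HeatSol.measurable_gZ (hv : HeatSol O M v) (i : Fin d) : Measurable (gZ O v i) := by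
  refine hv.measurable_uZ.of_hasLineDerivAt hv.isOpen.cyl.measurableSet (bv i, 0) fun z hz => ?_
  have h1 := ((hv.contDiffOn z.2 (Ioo_subset_Icc_self hz.2)).contDiffAt
    (hv.isOpen.mem_nhds hz.1)).differentiableAt (by norm_num)
  have h2 : HasLineDerivAt ℝ (fun y => v y z.2) (pd (bv i) (fun y => v y z.2) z.1) z.1 (bv i) :=
    h1.hasFDerivAt.hasLineDerivAt _
  refine HasDerivAt.congr_of_eventuallyEq h2 ?_
  filter_upwards [eventually_line_mem hv.isOpen.cyl hz (bv i, 0)] with t ht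
  simp only [uZ, indicator_of_mem ht]; simp

theorem HeatSol.measurable_fZ (hv : HeatSol O M v) : Measurable (fZ O v) := by
  have h1 : Measurable ((cyl O).indicator fun z => derivWithin (v z.1) (Icc 0 1) z.2) := by
    refine hv.measurable_uZ.of_hasLineDerivAt hv.isOpen.cyl.measurableSet (0, 1) fun z hz => ?_
    have h2 := (hv.hasDerivWithinAt hz.1 (Ioo_subset_Icc_self hz.2)).hasDerivAt
      (Icc_mem_nhds hz.2.1 hz.2.2)
    have h3 : HasDerivAt (fun t : ℝ => v z.1 (z.2 + t)) (derivWithin (v z.1) (Icc 0 1) z.2) 0 := by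
      refine HasDerivAt.comp_const_add (f := v z.1) z.2 0 ?_
      simpa using h2
    refine HasDerivAt.congr_of_eventuallyEq h3 ?_
    filter_upwards [eventually_line_mem hv.isOpen.cyl hz (0, 1)] with t ht
    simp only [uZ, indicator_of_mem ht]; simp
  have h2 : ∀ i, Measurable ((cyl O).indicator fun z =>
      pd (bv i) (pd (bv i) (fun y => v y z.2)) z.1) := by
    intro i
    refine (hv.measurable_gZ i).of_hasLineDerivAt hv.isOpen.cyl.measurableSet (bv i, 0)
      fun z hz => ?_
    have h1 := (((hv.contDiffOn z.2 (Ioo_subset_Icc_self hz.2)).contDiffAt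
      (hv.isOpen.mem_nhds hz.1)).pd (e := bv i) (m := 1) (by norm_num)).differentiableAt
        (by norm_num)
    have h2 : HasLineDerivAt ℝ (pd (bv i) (fun y => v y z.2))
      (pd (bv i) (pd (bv i) (fun y => v y z.2)) z.1) z.1 (bv i) :=
      h1.hasFDerivAt.hasLineDerivAt _
    refine HasDerivAt.congr_of_eventuallyEq h2 ?_
    filter_upwards [eventually_line_mem hv.isOpen.cyl hz (bv i, 0)] with t ht
    simp only [gZ, indicator_of_mem ht]; simp
  have h3 : fZ O v = fun z => ((cyl O).indicator fun z => derivWithin (v z.1) (Icc 0 1) z.2) z -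
      ∑ i, ((cyl O).indicator fun z => pd (bv i) (pd (bv i) (fun y => v y z.2)) z.1) z := by
    ext z
    by_cases hz : z ∈ cyl O
    · simp [fZ, hz, slap_eq]
    · simp [fZ, hz]
  rw [h3]
  exact h1.sub (Finset.measurable_fun_sum _ fun i _ => h2 i)

theorem HeatSol.measurable_eG (hv : HeatSol O M v) : Measurable (eG O v) :=
  Finset.measurable_fun_sum _ fun i _ => (hv.measurable_gZ i).pow_const 2

end Meas

theorem caccioppoli_pointwise {d : ℕ} {ξ w f M m : ℝ} {a b : Fin d → ℝ} (hM : 0 ≤ M)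
    (hf : |f| ≤ M * (|w| + √(∑ i, b i ^ 2))) (hm : |w| ≤ m) :
    ξ ^ 2 * (2 * w * f) - ξ ^ 2 * (2 * ∑ i, b i ^ 2) - ∑ i, 2 * ξ * a i * (2 * w * b i) ≤
      -(ξ ^ 2 * ∑ i, b i ^ 2) + m ^ 2 * (8 * ∑ i, a i ^ 2 + (2 * M + 2 * M ^ 2) * ξ ^ 2) := by
  set S := ∑ i, b i ^ 2 with hS
  have hS0 : 0 ≤ S := Finset.sum_nonneg fun _ _ => sq_nonneg _
  have hA0 : 0 ≤ ∑ i, a i ^ 2 := Finset.sum_nonneg fun _ _ => sq_nonneg _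
  have h1 : -∑ i, 2 * ξ * a i * (2 * w * b i) ≤ ξ ^ 2 / 2 * S + 8 * w ^ 2 * ∑ i, a i ^ 2 := by
    rw [hS, Finset.mul_sum, Finset.mul_sum, ← Finset.sum_add_distrib, ← Finset.sum_neg_distrib]
    refine Finset.sum_le_sum fun i _ => ?_
    nlinarith [sq_nonneg (ξ * b i + 4 * w * a i)]
  have h2 : 2 * w * f ≤ (2 * M + 2 * M ^ 2) * w ^ 2 + S / 2 := by
    have e1 : w * f ≤ |w| * (M * (|w| + √S)) := by
      calc w * f ≤ |w * f| := le_abs_self _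
        _ = |w| * |f| := abs_mul _ _
        _ ≤ _ := mul_le_mul_of_nonneg_left hf (abs_nonneg _)
    have e2 := Real.sq_sqrt hS0
    nlinarith [sq_nonneg (2 * M * |w| - √S), sq_abs w]
  have h3 : w ^ 2 ≤ m ^ 2 := by
    rw [← sq_abs w]; exact pow_le_pow_left₀ (abs_nonneg _) hm 2
  have h4 := mul_le_mul_of_nonneg_left h2 (sq_nonneg ξ)
  have h5 : w ^ 2 * (8 * ∑ i, a i ^ 2 + (2 * M + 2 * M ^ 2) * ξ ^ 2) ≤
      m ^ 2 * (8 * ∑ i, a i ^ 2 + (2 * M + 2 * M ^ 2) * ξ ^ 2) :=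
    mul_le_mul_of_nonneg_right h3 (by positivity)
  linarith

theorem HeatSol.caccioppoli {d : ℕ} {O : Set (Spc d)} {M : ℝ} {v : Spc d → ℝ → ℝ}
    (hv : HeatSol O M v) {ξ m : Spc d → ℝ} (hξ : ContDiff ℝ 1 ξ) (hc : HasCompactSupport ξ)
    (hs : tsupport ξ ⊆ O) (hmc : Continuous m)
    (hm : ∀ x ∈ tsupport ξ, ∀ s ∈ Icc (0:ℝ) 1, |v x s| ≤ m x) :
    ∫⁻ z, ENNReal.ofReal (ξ z.1 ^ 2 * eG O v z) ≤
      ENNReal.ofReal (∫ x, m x ^ 2 * (8 * gsq ξ x + (1 + 2 * M + 2 * M ^ 2) * ξ x ^ 2)) := by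
  have hO := hv.isOpen
  have hM := hv.nonneg
  set η : Spc d → ℝ := fun x => ξ x ^ 2 with hη
  have hηd : ContDiff ℝ 1 η := hξ.pow 2
  have hηs' : tsupport η ⊆ tsupport ξ := by
    refine closure_mono fun x hx h => hx (by simp [hη, h])
  have hηs : tsupport η ⊆ O := hηs'.trans hs
  have hηc : HasCompactSupport η := hc.mono' ((subset_tsupport _).trans hηs')
  have hgc : Continuous (gsq ξ) := by
    unfold gsq
    exact continuous_finsetSum _ fun i _ => ((hξ.pd (m := 0) (by norm_num)).continuous).pow 2
  have hgcs : HasCompactSupport (gsq ξ) := by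
    refine hc.mono' fun x hx => ?_
    by_contra h
    exact hx (by simp [gsq, pd_eq_zero_of_notMem_tsupport h])
  obtain ⟨m1, hm1⟩ := hv.bdd _ hs hc
  have hm1' : ∀ x ∈ tsupport η, ∀ s ∈ Icc (0:ℝ) 1, |v x s| ≤ m1 := fun x hx => hm1 x (hηs' hx)
  set D : ℝ → ℝ := fun s => ∫ x, ξ x ^ 2 * eG O v (x, s) with hD
  set S : ℝ := ∫ x, m x ^ 2 * (8 * gsq ξ x + (2 * M + 2 * M ^ 2) * ξ x ^ 2) with hS
  have hDmeas : StronglyMeasurable D := by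
    have : Measurable fun z : ℝ × Spc d => ξ z.2 ^ 2 * eG O v (z.2, z.1) :=
      ((hξ.continuous.measurable.comp measurable_snd).pow_const 2).mul
        (hv.measurable_eG.comp measurable_swap)
    exact this.stronglyMeasurable.integral_prod_right'
  have hitg : ∀ s, Integrable fun x => ξ x ^ 2 * eG O v (x, s) := by
    intro s
    by_cases hsI : s ∈ Ioo (0:ℝ) 1
    · have := integrable_mul_of_tsupport (μ := volume) hO hηd.continuous hηc hηs
        (((hv.contDiffOn s (Ioo_subset_Icc_self hsI)).of_le one_le_two).continuousOn_gsq hO)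
      refine this.congr (ae_of_all _ fun x => ?_)
      by_cases hx : x ∈ O
      · simp [hη, eG_eq (show (x, s) ∈ cyl O from ⟨hx, hsI⟩)]
      · have : ξ x = 0 := by
          by_contra h; exact hx (hs (subset_tsupport _ h))
        simp [hη, this]
    · have : (fun x => ξ x ^ 2 * eG O v (x, s)) = fun _ => 0 := by
        ext x; rw [eG_eq_zero (fun h => hsI h.2), mul_zero]
      rw [this]; exact integrable_zero _ _ _
  have hD0 : ∀ s, 0 ≤ D s := fun s => integral_nonneg fun x =>
    mul_nonneg (sq_nonneg _) (eG_nonneg _ _ _)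
  have hSint : Integrable fun x => m x ^ 2 * (8 * gsq ξ x + (2 * M + 2 * M ^ 2) * ξ x ^ 2) := by
    refine Continuous.integrable_of_hasCompactSupport (by fun_prop) ?_
    exact ((hgcs.mul_left).add (hηc.mul_left)).mul_left
  have hmint : Integrable fun x => m x ^ 2 * ξ x ^ 2 := by
    refine Continuous.integrable_of_hasCompactSupport (by fun_prop) ?_
    exact hηc.mul_left
  have key : ∀ n : ℕ, ∫ s in (0:ℝ)..1, min (D s) n ≤
      ∫ x, m x ^ 2 * (8 * gsq ξ x + (1 + 2 * M + 2 * M ^ 2) * ξ x ^ 2) := by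
    intro n
    have hder : ∀ b, ∃ E', b ∈ Ioo (0:ℝ) 1 →
        HasDerivWithinAt (fun s => ∫ x, η x * (v x s) ^ 2) E' (Ici b) b ∧ E' ≤ S - D b := by
      intro b
      by_cases hb : b ∈ Ioo (0:ℝ) 1
      swap
      · exact ⟨0, fun h => absurd h hb⟩
      have hbI := Ioo_subset_Icc_self hb
      have hle : ∀ x, η x * (2 * v x b * (derivWithin (v x) (Icc 0 1) b - slap (fun y => v y b) x)) -
          η x * (2 * gsq (fun y => v y b) x) -
          ∑ i, pd (bv i) η x * (2 * v x b * pd (bv i) (fun y => v y b) x) ≤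
          m x ^ 2 * (8 * gsq ξ x + (2 * M + 2 * M ^ 2) * ξ x ^ 2) - ξ x ^ 2 * eG O v (x, b) := by
        intro x
        by_cases hx : x ∈ tsupport ξ
        · have hpd : ∀ i, pd (bv i) η x = 2 * ξ x * pd (bv i) ξ x := by
            intro i
            simpa using pd_comp (e := bv i) (hasDerivAt_pow 2 (ξ x))
              (hξ.differentiable (by norm_num) x)
          have := caccioppoli_pointwise (ξ := ξ x) (a := fun i => pd (bv i) ξ x)
            (b := fun i => pd (bv i) (fun y => v y b) x) hM (hv.pde x (hs hx) b hbI) (hm x hx b hbI)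
          simp only [hpd]
          rw [show η x = ξ x ^ 2 from rfl]
          rw [eG_eq (show (x, b) ∈ cyl O from ⟨hs hx, hb⟩)]
          simp only [gsq] at this ⊢
          linarith
        · have h0 : ξ x = 0 := image_eq_zero_of_notMem_tsupport hx
          have h1 : ∀ i, pd (bv i) η x = 0 := fun i =>
            pd_eq_zero_of_notMem_tsupport fun h => hx (hηs' h)
          have h2 : gsq ξ x = 0 := by simp [gsq, pd_eq_zero_of_notMem_tsupport hx]
          simp only [h1, h2, show η x = 0 by simp [hη, h0], h0]; simp
      obtain ⟨E', h1, h2⟩ := timeIntegral_deriv_le (H := fun z => z ^ 2) (H' := fun z => 2 * z)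
        (H'' := fun _ => 2) (m := m1) ⟨hb.1.le, hb.2⟩ hO hηd hηc hηs hv.contDiffOn
        (fun x hx => hv.hasDerivWithinAt hx hbI) hm1'
        (hv.niceAt hηc hηs hbI) (fun z => by simpa using hasDerivAt_pow 2 z)
        (fun z => by simpa using (hasDerivAt_id z).const_mul 2) continuous_const
        (hSint.sub (hitg b)) hle
      exact ⟨E', fun _ => ⟨h1, h2.trans (integral_sub hSint (hitg b)).le⟩⟩
    choose E' hE' using hder
    have hcont := continuousOn_timeIntegral hO hηd.continuous hηc hηs
      (fun s hs => (hv.contDiffOn s hs).continuousOn)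
      (fun x hx => (hv.differentiableOn x hx).continuousOn) hm1' (continuous_pow 2)
    have hmin : IntegrableOn (fun s => min (D s) n) (Icc 0 1) := by
      refine Measure.integrableOn_of_bounded (M := n) (by simp)
        (hDmeas.measurable.min measurable_const).aestronglyMeasurable (ae_of_all _ fun s => ?_)
      rw [Real.norm_of_nonneg (le_min (hD0 s) n.cast_nonneg)]
      exact min_le_right _ _
    have h1 := intervalIntegral.sub_le_integral_of_hasDeriv_right_of_le zero_le_one hcont
      (g' := E') (φ := fun s => S - min (D s) n)
      (fun b hb => (hE' b hb).1.mono Ioi_subset_Ici_self)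
      ((integrableOn_const (by simp)).sub hmin)
      (fun b hb => (hE' b hb).2.trans (by linarith [min_le_left (D b) (n:ℝ)]))
    rw [intervalIntegral.integral_sub (by simp)
      (by rw [intervalIntegrable_iff_integrableOn_Icc_of_le zero_le_one]; exact hmin)] at h1
    simp only [intervalIntegral.integral_const, sub_zero, one_smul] at h1
    have h2 : 0 ≤ ∫ x, η x * (v x 1) ^ 2 := integral_nonneg fun x => by
      simp only [hη]; positivity
    have h3 : ∫ x, η x * (v x 0) ^ 2 ≤ ∫ x, m x ^ 2 * ξ x ^ 2 := by
      refine integral_mono_of_nonneg (ae_of_all _ fun x => by simp only [hη]; positivity) hmint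
        (ae_of_all _ fun x => ?_)
      by_cases hx : x ∈ tsupport ξ
      · have := pow_le_pow_left₀ (abs_nonneg _) (hm x hx 0 (by simp)) 2
        rw [sq_abs] at this
        simp only [hη]
        rw [mul_comm]
        exact mul_le_mul_of_nonneg_right this (sq_nonneg _)
      · simp [hη, image_eq_zero_of_notMem_tsupport hx]
    have h4 : ∫ x, m x ^ 2 * (8 * gsq ξ x + (1 + 2 * M + 2 * M ^ 2) * ξ x ^ 2) =
        S + ∫ x, m x ^ 2 * ξ x ^ 2 := by
      rw [hS, ← integral_add hSint hmint]
      congr 1; ext x; ring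
    linarith
  have hmeas : Measurable fun z : Spc d × ℝ => ENNReal.ofReal (ξ z.1 ^ 2 * eG O v z) :=
    ENNReal.measurable_ofReal.comp
      (((hξ.continuous.measurable.comp measurable_fst).pow_const 2).mul hv.measurable_eG)
  have hD' : ∀ s, ∫⁻ x, ENNReal.ofReal (ξ x ^ 2 * eG O v (x, s)) = ENNReal.ofReal (D s) :=
    fun s => (ofReal_integral_eq_lintegral_ofReal (hitg s) (ae_of_all _ fun x =>
      mul_nonneg (sq_nonneg _) (eG_nonneg _ _ _))).symm
  rw [Measure.volume_eq_prod, lintegral_prod_symm _ hmeas.aemeasurable]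
  simp only [hD']
  have hsup : ∀ s, ENNReal.ofReal (D s) = ⨆ n : ℕ, ENNReal.ofReal (min (D s) n) := by
    intro s
    refine le_antisymm ?_ (iSup_le fun n => ENNReal.ofReal_le_ofReal (min_le_left _ _))
    obtain ⟨n, hn⟩ := exists_nat_ge (D s)
    refine le_iSup_of_le n ?_
    rw [min_eq_left hn]
  simp only [hsup]
  rw [lintegral_iSup (f := fun (n : ℕ) s => ENNReal.ofReal (min (D s) n))
    (fun n => ENNReal.measurable_ofReal.comp (hDmeas.measurable.min measurable_const))
    (fun n k hnk s => ENNReal.ofReal_le_ofReal (min_le_min_left _ (by exact_mod_cast hnk)))]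
  refine iSup_le fun n => ?_
  refine le_trans ?_ (ENNReal.ofReal_le_ofReal (key n))
  rw [intervalIntegral.integral_of_le zero_le_one, ofReal_integral_eq_lintegral_ofReal]
  · rw [← lintegral_indicator measurableSet_Ioc]
    refine lintegral_mono fun s => ?_
    by_cases hsI : s ∈ Ioc (0:ℝ) 1
    · simp [hsI]
    · have : D s = 0 := by
        simp only [hD]
        rw [show (fun x => ξ x ^ 2 * eG O v (x, s)) = fun _ => 0 from ?_]
        · simp
        · ext x; rw [eG_eq_zero (fun h => hsI ⟨h.2.1, h.2.2.le⟩), mul_zero]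
      simp [this, hsI]
  · refine Measure.integrableOn_of_bounded (M := n) (by simp)
      (hDmeas.measurable.min measurable_const).aestronglyMeasurable (ae_of_all _ fun s => ?_)
    rw [Real.norm_of_nonneg (le_min (hD0 s) n.cast_nonneg)]
    exact min_le_right _ _
  · exact ae_of_all _ fun s => le_min (hD0 s) n.cast_nonneg

theorem exists_bound_deriv_smoothTransition : ∃ L : ℝ, 1 ≤ L ∧ (∀ t, |deriv smoothTransition t| ≤ L) ∧
    ∀ t, |deriv (deriv smoothTransition) t| ≤ L := by
  have hc : HasCompactSupport (deriv smoothTransition) := by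
    refine HasCompactSupport.intro (isCompact_Icc (a := (0:ℝ)) (b := 1)) fun t ht => ?_
    by_cases h0 : t < 0
    · have : smoothTransition =ᶠ[𝓝 t] fun _ => 0 := by
        filter_upwards [Iio_mem_nhds h0] with s hs
        exact smoothTransition.zero_of_nonpos (le_of_lt hs)
      rw [this.deriv_eq, deriv_const]
    · have h1 : 1 < t := by
        by_contra h
        exact ht ⟨not_lt.1 h0, not_lt.1 h⟩
      have : smoothTransition =ᶠ[𝓝 t] fun _ => 1 := by
        filter_upwards [Ioi_mem_nhds h1] with s hs
        exact smoothTransition.one_of_one_le (le_of_lt hs)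
      rw [this.deriv_eq, deriv_const]
  have hs : ContDiff ℝ 2 smoothTransition := smoothTransition.contDiff (n := 2)
  have hs1 : ContDiff ℝ 1 (deriv smoothTransition) := hs.deriv' (n := 1)
  obtain ⟨a, ha⟩ := hc.exists_bound_of_continuous hs1.continuous
  obtain ⟨b, hb⟩ := hc.deriv.exists_bound_of_continuous (hs1.continuous_deriv le_rfl)
  exact ⟨max 1 (max a b), le_max_left _ _,
    fun t => (ha t).trans ((le_max_left _ _).trans (le_max_right _ _)),
    fun t => (hb t).trans ((le_max_right _ _).trans (le_max_right _ _))⟩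

theorem integrable_exp_neg_mul_norm_sq (d : ℕ) {c : ℝ} (hc : 0 < c) :
    Integrable fun x : Spc d => rexp (-c * ‖x‖ ^ 2) := by
  have h := GaussianFourier.integrable_cexp_neg_mul_sq_norm_add (V := Spc d) (b := (c:ℂ))
    (by simpa using hc) 0 0
  have h2 := h.norm
  refine h2.congr (ae_of_all _ fun x => ?_)
  simp only [Complex.norm_exp]
  congr 1
  simp [← Complex.ofReal_pow, ← Complex.ofReal_neg, ← Complex.ofReal_mul]

theorem norm_fderiv_coord_le {d : ℕ} (i : Fin d) (x : Spc d) :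
    ‖fderiv ℝ (fun y : Spc d => y i) x‖ ≤ 1 := by
  have : (fun y : Spc d => y i) = EuclideanSpace.proj (𝕜 := ℝ) i := rfl
  rw [this, ContinuousLinearMap.fderiv]
  refine ContinuousLinearMap.opNorm_le_bound _ zero_le_one fun y => ?_
  simpa using PiLp.norm_apply_le y i

theorem norm_fderiv_norm_sq {d : ℕ} (x : Spc d) :
    ‖fderiv ℝ (fun y : Spc d => ‖y‖ ^ 2) x‖ ≤ 2 * ‖x‖ := by
  rw [fderiv_norm_sq_apply, two_nsmul, two_mul]
  exact (norm_add_le _ _).trans (by simp)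

theorem norm_fderiv_comp_le {d : ℕ} {f : Spc d → ℝ} {h : ℝ → ℝ} {h' B : ℝ} {x : Spc d}
    (hh : HasDerivAt h h' (f x)) (hf : DifferentiableAt ℝ f x) (hB : ‖fderiv ℝ f x‖ ≤ B) :
    ‖fderiv ℝ (fun y => h (f y)) x‖ ≤ |h'| * B := by
  have := hh.comp_hasFDerivAt x hf.hasFDerivAt
  rw [show (fun y => h (f y)) = h ∘ f from rfl, this.fderiv, norm_smul]
  exact mul_le_mul_of_nonneg_left hB (norm_nonneg _)

theorem norm_fderiv_mul_le {d : ℕ} {f g : Spc d → ℝ} {x : Spc d}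
    (hf : DifferentiableAt ℝ f x) (hg : DifferentiableAt ℝ g x) :
    ‖fderiv ℝ (fun y => f y * g y) x‖ ≤ |f x| * ‖fderiv ℝ g x‖ + |g x| * ‖fderiv ℝ f x‖ := by
  rw [fderiv_fun_mul hf hg]
  refine (norm_add_le _ _).trans ?_
  rw [norm_smul, norm_smul]; rfl

/-- A cutoff to `δ ≤ x i`, `‖x‖ ^ 2 ≤ k - 1`, multiplied by a Gaussian. -/
noncomputable def gaussCut {d : ℕ} (i : Fin d) (δ k : ℝ) (x : Spc d) : ℝ :=
  smoothTransition (2 * x i / δ - 1) * smoothTransition (k - ‖x‖ ^ 2) * rexp (-(‖x‖ ^ 2 / 20))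

section

variable {d : ℕ} {i : Fin d} {δ k : ℝ}

theorem contDiff_coord : ContDiff ℝ ∞ fun y : Spc d => y i :=
  (EuclideanSpace.proj (𝕜 := ℝ) i).contDiff

theorem contDiff_gaussCut : ContDiff ℝ ∞ (gaussCut i δ k) := by
  have h1 : ContDiff ℝ ∞ fun y : Spc d => ‖y‖ ^ 2 := contDiff_norm_sq ℝ
  have h2 := contDiff_coord (i := i)
  refine ContDiff.mul (ContDiff.mul ?_ ?_) ?_
  · exact smoothTransition.contDiff.comp (((contDiff_const.mul h2).div_const _).sub contDiff_const)
  · exact smoothTransition.contDiff.comp (contDiff_const.sub h1)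
  · exact ((h1.div_const _).neg).exp

theorem tsupport_gaussCut (hδ : 0 < δ) :
    tsupport (gaussCut i δ k) ⊆ {x | δ / 2 ≤ x i} ∩ {x | ‖x‖ ^ 2 ≤ k} := by
  have hc : Continuous fun x : Spc d => x i := contDiff_coord.continuous
  refine closure_minimal (fun x hx => ⟨?_, ?_⟩) (IsClosed.inter
    (isClosed_le continuous_const hc) (isClosed_le (by fun_prop) continuous_const))
  · by_contra h
    simp only [mem_ofPred_eq, not_le] at h
    refine hx ?_
    have : 2 * x i / δ - 1 ≤ 0 := by
      rw [sub_nonpos, div_le_one hδ]; linarith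
    simp [gaussCut, smoothTransition.zero_of_nonpos this]
  · by_contra h
    simp only [mem_ofPred_eq, not_le] at h
    refine hx ?_
    simp [gaussCut, smoothTransition.zero_of_nonpos (show k - ‖x‖ ^ 2 ≤ 0 by linarith)]

theorem isCompact_tsupport_gaussCut (hδ : 0 < δ) : HasCompactSupport (gaussCut i δ k) := by
  refine IsCompact.of_isClosed_subset (isCompact_closedBall (0 : Spc d) √k) (isClosed_tsupport _)
    fun x hx => ?_
  have := (tsupport_gaussCut hδ hx).2
  rw [mem_closedBall_zero_iff]
  exact Real.le_sqrt_of_sq_le this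

theorem gaussCut_eq (hδ : 0 < δ) {x : Spc d} (h1 : δ ≤ x i) (h2 : ‖x‖ ^ 2 ≤ k - 1) :
    gaussCut i δ k x = rexp (-(‖x‖ ^ 2 / 20)) := by
  have : 1 ≤ 2 * x i / δ - 1 := by
    rw [le_sub_iff_add_le, le_div_iff₀ hδ]; linarith
  simp [gaussCut, smoothTransition.one_of_one_le this,
    smoothTransition.one_of_one_le (show 1 ≤ k - ‖x‖ ^ 2 by linarith)]

theorem gaussCut_sq_le (x : Spc d) : gaussCut i δ k x ^ 2 ≤ rexp (-(‖x‖ ^ 2 / 10)) := by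
  have h1 := smoothTransition.le_one (2 * x i / δ - 1)
  have h2 := smoothTransition.le_one (k - ‖x‖ ^ 2)
  have h3 := smoothTransition.nonneg (2 * x i / δ - 1)
  have h4 := smoothTransition.nonneg (k - ‖x‖ ^ 2)
  have h5 : gaussCut i δ k x ≤ rexp (-(‖x‖ ^ 2 / 20)) := by
    have := mul_le_one₀ h1 h4 h2
    exact mul_le_of_le_one_left (exp_pos _).le this
  have h6 : 0 ≤ gaussCut i δ k x := by unfold gaussCut; positivity
  calc _ ≤ rexp (-(‖x‖ ^ 2 / 20)) ^ 2 := pow_le_pow_left₀ h6 h5 2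
    _ = _ := by rw [← Real.exp_nat_mul]; congr 1; push_cast; ring

theorem exists_gsq_gaussCut_le (d : ℕ) (i : Fin d) {δ : ℝ} (hδ : 0 < δ) : ∃ C : ℝ, 0 ≤ C ∧ ∀ k x,
    gsq (gaussCut i δ k) x ≤ C * (1 + ‖x‖ ^ 2) * rexp (-(‖x‖ ^ 2 / 10)) := by
  obtain ⟨L, hL1, hL, -⟩ := exists_bound_deriv_smoothTransition
  refine ⟨2 * (2 * L / δ + 2 * L + 1) ^ 2, by positivity, fun k x => ?_⟩
  have hst : ∀ t, HasDerivAt smoothTransition (deriv smoothTransition t) t := fun t =>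
    ((smoothTransition.contDiff (n := 1)).differentiable (by norm_num) t).hasDerivAt
  have hn : DifferentiableAt ℝ (fun y : Spc d => ‖y‖ ^ 2) x :=
    (contDiff_norm_sq ℝ (n := 1)).differentiable (by norm_num) x
  have hi : DifferentiableAt ℝ (fun y : Spc d => y i) x :=
    (contDiff_coord (i := i)).differentiable (by simp) x
  have da : HasDerivAt (fun t => smoothTransition (2 * t / δ - 1))
      (deriv smoothTransition (2 * x i / δ - 1) * (2 / δ)) (x i) := by
    refine HasDerivAt.comp (h := fun t => 2 * t / δ - 1) (x i) (hst _) ?_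
    simpa using ((((hasDerivAt_id (x i)).const_mul 2).div_const δ).sub_const 1)
  have db : HasDerivAt (fun t => smoothTransition (k - t))
      (deriv smoothTransition (k - ‖x‖ ^ 2) * (-1)) (‖x‖ ^ 2) := by
    refine HasDerivAt.comp (h := fun t => k - t) (‖x‖ ^ 2) (hst _) ?_
    simpa using (hasDerivAt_id (‖x‖ ^ 2)).const_sub k
  have dc : HasDerivAt (fun t => rexp (-(t / 20))) (rexp (-(‖x‖ ^ 2 / 20)) * (-(1 / 20))) (‖x‖ ^ 2) :=
    (((hasDerivAt_id (‖x‖ ^ 2)).div_const 20).neg).exp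
  have ha := norm_fderiv_comp_le da hi (norm_fderiv_coord_le i x)
  have hb := norm_fderiv_comp_le db hn (norm_fderiv_norm_sq x)
  have hc := norm_fderiv_comp_le dc hn (norm_fderiv_norm_sq x)
  have ha' := hi.hasFDerivAt
  have dfa : DifferentiableAt ℝ (fun y : Spc d => smoothTransition (2 * y i / δ - 1)) x :=
    DifferentiableAt.comp (g := fun t => smoothTransition (2 * t / δ - 1)) x da.differentiableAt hi
  have dfb : DifferentiableAt ℝ (fun y : Spc d => smoothTransition (k - ‖y‖ ^ 2)) x :=
    DifferentiableAt.comp (g := fun t => smoothTransition (k - t)) x db.differentiableAt hn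
  have dfc : DifferentiableAt ℝ (fun y : Spc d => rexp (-(‖y‖ ^ 2 / 20))) x :=
    DifferentiableAt.comp (g := fun t => rexp (-(t / 20))) x dc.differentiableAt hn
  have hab := norm_fderiv_mul_le dfa dfb
  have habc := norm_fderiv_mul_le (dfa.fun_mul dfb) dfc
  have h1 := smoothTransition.le_one (2 * x i / δ - 1)
  have h2 := smoothTransition.le_one (k - ‖x‖ ^ 2)
  have h3 := smoothTransition.nonneg (2 * x i / δ - 1)
  have h4 := smoothTransition.nonneg (k - ‖x‖ ^ 2)
  have hx := norm_nonneg x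
  rw [abs_of_nonneg h3, abs_of_nonneg h4] at hab
  rw [abs_of_nonneg (mul_nonneg h3 h4), abs_of_pos (exp_pos _)] at habc
  have hA : ‖fderiv ℝ (fun y : Spc d => smoothTransition (2 * y i / δ - 1)) x‖ ≤ 2 * L / δ := by
    refine ha.trans ?_
    rw [abs_mul, mul_one, abs_of_pos (show 0 < 2 / δ by positivity)]
    calc _ ≤ L * (2 / δ) := mul_le_mul_of_nonneg_right (hL _) (by positivity)
      _ = _ := by ring
  have hB : ‖fderiv ℝ (fun y : Spc d => smoothTransition (k - ‖y‖ ^ 2)) x‖ ≤ 2 * L * ‖x‖ := by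
    refine hb.trans ?_
    rw [abs_mul, abs_neg, abs_one, mul_one]
    calc _ ≤ L * (2 * ‖x‖) := mul_le_mul_of_nonneg_right (hL _) (by positivity)
      _ = _ := by ring
  have hC : ‖fderiv ℝ (fun y : Spc d => rexp (-(‖y‖ ^ 2 / 20))) x‖ ≤
      rexp (-(‖x‖ ^ 2 / 20)) * ‖x‖ := by
    refine hc.trans ?_
    rw [abs_mul, abs_neg, abs_of_pos (exp_pos _), abs_of_pos (by norm_num : (0:ℝ) < 1 / 20)]
    nlinarith [mul_nonneg (exp_pos (-(‖x‖ ^ 2 / 20))).le hx]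
  have hAB : ‖fderiv ℝ (fun y : Spc d => smoothTransition (2 * y i / δ - 1) *
      smoothTransition (k - ‖y‖ ^ 2)) x‖ ≤ 2 * L * ‖x‖ + 2 * L / δ := by
    refine hab.trans (add_le_add ?_ ?_)
    · exact (mul_le_of_le_one_left (norm_nonneg _) h1).trans hB
    · exact (mul_le_of_le_one_left (norm_nonneg _) h2).trans hA
  have hfin : ‖fderiv ℝ (gaussCut i δ k) x‖ ≤
      rexp (-(‖x‖ ^ 2 / 20)) * ((2 * L / δ + 2 * L + 1) * (1 + ‖x‖)) := by
    refine habc.trans ?_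
    have e1 := mul_le_of_le_one_left (norm_nonneg (fderiv ℝ (fun y : Spc d => rexp (-(‖y‖ ^ 2 / 20))) x))
      (mul_le_one₀ h1 h4 h2)
    have e2 := mul_le_mul_of_nonneg_left hAB (exp_pos (-(‖x‖ ^ 2 / 20))).le
    refine (add_le_add (e1.trans hC) e2).trans ?_
    rw [← mul_add]
    refine mul_le_mul_of_nonneg_left ?_ (exp_pos _).le
    have : 0 ≤ 2 * L / δ := by positivity
    nlinarith [mul_nonneg this hx]
  rw [← norm_fderiv_sq]
  have hE : rexp (-(‖x‖ ^ 2 / 20)) ^ 2 = rexp (-(‖x‖ ^ 2 / 10)) := by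
    rw [← Real.exp_nat_mul]; congr 1; push_cast; ring
  calc _ ≤ (rexp (-(‖x‖ ^ 2 / 20)) * ((2 * L / δ + 2 * L + 1) * (1 + ‖x‖))) ^ 2 :=
        pow_le_pow_left₀ (norm_nonneg _) hfin 2
    _ = rexp (-(‖x‖ ^ 2 / 10)) * ((2 * L / δ + 2 * L + 1) ^ 2 * (1 + ‖x‖) ^ 2) := by
        rw [mul_pow, hE, mul_pow]
    _ ≤ rexp (-(‖x‖ ^ 2 / 10)) * ((2 * L / δ + 2 * L + 1) ^ 2 * (2 * (1 + ‖x‖ ^ 2))) := by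
        refine mul_le_mul_of_nonneg_left (mul_le_mul_of_nonneg_left ?_ (sq_nonneg _)) (exp_pos _).le
        nlinarith [sq_nonneg (1 - ‖x‖)]
    _ = _ := by ring

end

theorem measurableSet_le_coord {d : ℕ} (i : Fin d) (δ : ℝ) :
    MeasurableSet {z : Spc d × ℝ | δ ≤ z.1 i} :=
  (isClosed_le continuous_const
    (contDiff_coord (i := i).continuous.comp continuous_fst)).measurableSet

theorem HeatSol.lintegral_weighted_lt_top {d : ℕ} {i : Fin d} {M M0 ε δ : ℝ} {v : Spc d → ℝ → ℝ}
    (hv : HeatSol {x : Spc d | 0 < x i} M v) (hε : ε ≤ 1 / 100)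
    (hg : ∀ x ∈ {x : Spc d | 0 < x i}, ∀ s ∈ Icc (0:ℝ) 1, |v x s| ≤ M0 * rexp (ε * ‖x‖ ^ 2))
    (hδ : 0 < δ) :
    ∫⁻ z in {z : Spc d × ℝ | δ ≤ z.1 i}, ENNReal.ofReal (rexp (-(‖z.1‖ ^ 2 / 10)) *
      eG {x : Spc d | 0 < x i} v z) < ⊤ := by
  set O := {x : Spc d | 0 < x i} with hO
  have hM := hv.nonneg
  obtain ⟨C, hC0, hC⟩ := exists_gsq_gaussCut_le d i hδ
  set K := 1 + 2 * M + 2 * M ^ 2 with hK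
  have hK0 : 0 ≤ K := by positivity
  set J : ℝ := ∫ x : Spc d, M0 ^ 2 * (40 * (8 * C + K)) * rexp (-(1 / 20) * ‖x‖ ^ 2) with hJ
  have hJi : Integrable fun x : Spc d => M0 ^ 2 * (40 * (8 * C + K)) * rexp (-(1 / 20) * ‖x‖ ^ 2) :=
    (integrable_exp_neg_mul_norm_sq d (by norm_num)).const_mul _
  have key : ∀ k : ℕ, ∫⁻ z in {z : Spc d × ℝ | δ ≤ z.1 i},
      ({z : Spc d × ℝ | ‖z.1‖ ^ 2 ≤ k}).indicator (fun z => ENNReal.ofReal (rexp (-(‖z.1‖ ^ 2 / 10)) *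
        eG O v z)) z ≤ ENNReal.ofReal J := by
    intro k
    have hcut : ContDiff ℝ ∞ (gaussCut i δ (k + 1)) := contDiff_gaussCut
    have hsup : tsupport (gaussCut i δ (k + 1)) ⊆ O := fun x hx =>
      lt_of_lt_of_le (half_pos hδ) (tsupport_gaussCut hδ hx).1
    have h := hv.caccioppoli (ξ := gaussCut i δ (k + 1)) (m := fun x => M0 * rexp (ε * ‖x‖ ^ 2))
      (hcut.of_le (by norm_cast)) (isCompact_tsupport_gaussCut hδ) hsup
      (by fun_prop) (fun x hx => hg x (hsup hx))
    refine le_trans ?_ (h.trans (ENNReal.ofReal_le_ofReal ?_))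
    · rw [← lintegral_indicator (measurableSet_le_coord i δ)]
      refine lintegral_mono fun z => ?_
      by_cases h1 : δ ≤ z.1 i
      · by_cases h2 : ‖z.1‖ ^ 2 ≤ k
        · have e1 : z ∈ {z : Spc d × ℝ | δ ≤ z.1 i} := h1
          have e2 : z ∈ {z : Spc d × ℝ | ‖z.1‖ ^ 2 ≤ k} := h2
          rw [indicator_of_mem e1, indicator_of_mem e2, gaussCut_eq hδ h1 (by simpa using h2)]
          rw [← Real.exp_nat_mul]
          refine le_of_eq ?_
          congr 3; push_cast; ring
        · have e1 : z ∈ {z : Spc d × ℝ | δ ≤ z.1 i} := h1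
          have e2 : z ∉ {z : Spc d × ℝ | ‖z.1‖ ^ 2 ≤ k} := h2
          rw [indicator_of_mem e1, indicator_of_notMem e2]
          exact zero_le
      · have e1 : z ∉ {z : Spc d × ℝ | δ ≤ z.1 i} := h1
        rw [indicator_of_notMem e1]
        exact zero_le
    · have hle : ∀ x : Spc d, (M0 * rexp (ε * ‖x‖ ^ 2)) ^ 2 *
          (8 * gsq (gaussCut i δ (k + 1)) x + K * gaussCut i δ (k + 1) x ^ 2) ≤
          M0 ^ 2 * (40 * (8 * C + K)) * rexp (-(1 / 20) * ‖x‖ ^ 2) := by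
        intro x
        set r := ‖x‖ ^ 2 with hr
        have hr0 : 0 ≤ r := sq_nonneg _
        have h1 : 8 * gsq (gaussCut i δ (k + 1)) x + K * gaussCut i δ (k + 1) x ^ 2 ≤
            (8 * C + K) * (1 + r) * rexp (-(r / 10)) := by
          have e1 := hC (k + 1) x
          have e2 := mul_le_mul_of_nonneg_left (gaussCut_sq_le (i := i) (δ := δ) (k := k + 1) x) hK0
          have e3 := mul_nonneg (mul_nonneg hK0 hr0) (exp_pos (-(r / 10))).le
          rw [← hr] at e1 e2
          linarith
        have h2 : 1 + r ≤ 40 * rexp (3 / 100 * r) := by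
          linarith [Real.add_one_le_exp (3 / 100 * r)]
        have h3 : (rexp (ε * r)) ^ 2 ≤ rexp (r / 50) := by
          rw [← Real.exp_nat_mul]
          refine Real.exp_le_exp.2 ?_
          push_cast; nlinarith
        calc _ ≤ (M0 * rexp (ε * r)) ^ 2 * ((8 * C + K) * (1 + r) * rexp (-(r / 10))) :=
              mul_le_mul_of_nonneg_left h1 (sq_nonneg _)
          _ = M0 ^ 2 * (8 * C + K) * ((rexp (ε * r)) ^ 2 * ((1 + r) * rexp (-(r / 10)))) := by ring
          _ ≤ M0 ^ 2 * (8 * C + K) * (rexp (r / 50) *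
                ((40 * rexp (3 / 100 * r)) * rexp (-(r / 10)))) := by gcongr
          _ = M0 ^ 2 * (40 * (8 * C + K)) * (rexp (r / 50) *
                (rexp (3 / 100 * r) * rexp (-(r / 10)))) := by ring
          _ = _ := by
              rw [← Real.exp_add, ← Real.exp_add]
              congr 2; ring
      exact integral_mono_of_nonneg (ae_of_all _ fun x => by
        have := gsq_nonneg (gaussCut i δ (k + 1)) x
        positivity) hJi (ae_of_all _ hle)
  have hmeas : Measurable fun z : Spc d × ℝ => ENNReal.ofReal (rexp (-(‖z.1‖ ^ 2 / 10)) *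
      eG O v z) := by
    refine ENNReal.measurable_ofReal.comp (Measurable.mul ?_ hv.measurable_eG)
    exact Continuous.measurable (by fun_prop)
  have hsup : ∀ z : Spc d × ℝ, ENNReal.ofReal (rexp (-(‖z.1‖ ^ 2 / 10)) * eG O v z) =
      ⨆ k : ℕ, ({z : Spc d × ℝ | ‖z.1‖ ^ 2 ≤ k}).indicator
        (fun z => ENNReal.ofReal (rexp (-(‖z.1‖ ^ 2 / 10)) * eG O v z)) z := by
    intro z
    refine le_antisymm ?_ (iSup_le fun k => indicator_le_self _ _ _)
    obtain ⟨k, hk⟩ := exists_nat_ge (‖z.1‖ ^ 2)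
    refine le_iSup_of_le k ?_
    rw [indicator_of_mem (show z ∈ {z : Spc d × ℝ | ‖z.1‖ ^ 2 ≤ k} from hk)]
  rw [lintegral_congr hsup]
  rw [lintegral_iSup]
  · exact lt_of_le_of_lt (iSup_le key) ENNReal.ofReal_lt_top
  · exact fun k => hmeas.indicator (isClosed_le (by fun_prop) continuous_const).measurableSet
  · intro k l hkl z
    refine indicator_le_indicator_of_subset (fun z hz => ?_) (fun _ => zero_le) z
    exact le_trans (show ‖z.1‖ ^ 2 ≤ k from hz) (by exact_mod_cast hkl)

theorem HeatSol.integrableOn_weighted {d : ℕ} {i : Fin d} {M M0 ε δ : ℝ} {v : Spc d → ℝ → ℝ}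
    (hv : HeatSol {x : Spc d | 0 < x i} M v) (hε : ε ≤ 1 / 100)
    (hg : ∀ x ∈ {x : Spc d | 0 < x i}, ∀ s ∈ Icc (0:ℝ) 1, |v x s| ≤ M0 * rexp (ε * ‖x‖ ^ 2))
    (hδ : 0 < δ) :
    IntegrableOn (fun z => rexp (-(‖z.1‖ ^ 2 / 10)) *
      (uZ {x : Spc d | 0 < x i} v z ^ 2 + eG {x : Spc d | 0 < x i} v z))
      {z : Spc d × ℝ | δ ≤ z.1 i} := by
  have hexp : Measurable fun z : Spc d × ℝ => rexp (-(‖z.1‖ ^ 2 / 10)) :=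
    Continuous.measurable (by fun_prop)
  have h1 : IntegrableOn (fun z => rexp (-(‖z.1‖ ^ 2 / 10)) *
      eG {x : Spc d | 0 < x i} v z) {z : Spc d × ℝ | δ ≤ z.1 i} := by
    refine ⟨(hexp.mul hv.measurable_eG).aestronglyMeasurable, ?_⟩
    rw [hasFiniteIntegral_iff_ofReal (ae_of_all _ fun z =>
      mul_nonneg (exp_pos _).le (eG_nonneg _ _ _))]
    exact hv.lintegral_weighted_lt_top hε hg hδ
  have h2 : Integrable fun z => rexp (-(‖z.1‖ ^ 2 / 10)) * uZ {x : Spc d | 0 < x i} v z ^ 2 := by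
    have hb : Integrable fun z : Spc d × ℝ => M0 ^ 2 * rexp (-(1 / 20) * ‖z.1‖ ^ 2) *
        (Ioo (0:ℝ) 1).indicator (fun _ => 1) z.2 := by
      rw [Measure.volume_eq_prod]
      exact ((integrable_exp_neg_mul_norm_sq d (by norm_num)).const_mul _).mul_prod
        ((integrable_indicator_iff measurableSet_Ioo).2 (integrableOn_const (by simp)))
    refine hb.mono' (hexp.mul (hv.measurable_uZ.pow_const 2)).aestronglyMeasurable
      (ae_of_all _ fun z => ?_)
    rw [Real.norm_of_nonneg (mul_nonneg (exp_pos _).le (sq_nonneg _))]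
    by_cases hz : z ∈ cyl {x : Spc d | 0 < x i}
    · have h3 : z.2 ∈ Ioo (0:ℝ) 1 := hz.2
      rw [uZ, indicator_of_mem hz, indicator_of_mem h3, mul_one]
      have h4 := pow_le_pow_left₀ (abs_nonneg _) (hg z.1 hz.1 z.2 (Ioo_subset_Icc_self h3)) 2
      rw [sq_abs] at h4
      calc _ ≤ rexp (-(‖z.1‖ ^ 2 / 10)) * (M0 * rexp (ε * ‖z.1‖ ^ 2)) ^ 2 :=
            mul_le_mul_of_nonneg_left h4 (exp_pos _).le
        _ = M0 ^ 2 * (rexp (-(‖z.1‖ ^ 2 / 10)) * rexp (2 * (ε * ‖z.1‖ ^ 2))) := by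
            rw [mul_pow, ← Real.exp_nat_mul]; push_cast; ring
        _ ≤ _ := by
            rw [← Real.exp_add]
            refine mul_le_mul_of_nonneg_left (Real.exp_le_exp.2 ?_) (sq_nonneg _)
            nlinarith [sq_nonneg ‖z.1‖]
    · rw [uZ, indicator_of_notMem hz]
      have : 0 ≤ (Ioo (0:ℝ) 1).indicator (fun _ => (1:ℝ)) z.2 :=
        indicator_nonneg (fun _ _ => zero_le_one) _
      rw [zero_pow two_ne_zero, mul_zero]
      positivity
  refine (h2.integrableOn.add h1).congr_fun (fun z _ => ?_) (measurableSet_le_coord i δ)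
  simp only [Pi.add_apply]; ring

theorem integrable_mul_of_integrableOn {d : ℕ} {F ψ : Spc d × ℝ → ℝ} (hF : IntegrableOn F (tsupport ψ))
    (hψ : Continuous ψ) (hc : HasCompactSupport ψ) : Integrable fun z => F z * ψ z := by
  have h := hF.mul_continuousOn (g' := ψ) hψ.continuousOn hc
  refine (integrableOn_iff_integrable_of_support_subset fun z hz => ?_).1 h
  exact subset_tsupport _ fun h0 => hz (by simp [h0])

theorem integral_mul_pd_eq_neg {d : ℕ} {O : Set (Spc d)} (hO : IsOpen O) {ψ g : Spc d → ℝ}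
    (hψ : ContDiff ℝ 1 ψ) (hc : HasCompactSupport ψ) (hs : tsupport ψ ⊆ O)
    (hg : ContDiffOn ℝ 1 g O) (e : Spc d) :
    ∫ x, ψ x * pd e g x = -∫ x, pd e ψ x * g x := by
  have hgx : ∀ x ∈ O, ContDiffAt ℝ 1 g x := fun x hx => hg.contDiffAt (hO.mem_nhds hx)
  have hprod : ContDiff ℝ 1 fun x => ψ x * g x := by
    refine contDiff_of_contDiffAt_tsupport fun x hx => ?_
    exact hψ.contDiffAt.mul (hgx x (hs (tsupport_mul_subset_left hx)))
  have h0 := integral_pd_eq_zero (μ := volume) (e := e) hprod hc.mul_right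
  have i1 := integrable_mul_of_tsupport (μ := volume) hO hψ.continuous hc hs
    (hg.continuousOn_pd hO e)
  have i2 := integrable_mul_of_tsupport (μ := volume) hO
    ((hψ.pd (e := e) (m := 0) (by norm_num)).continuous) hc.pd (tsupport_pd_subset.trans hs)
    hg.continuousOn
  have h1 : ∀ x, pd e (fun y => ψ y * g y) x = pd e ψ x * g x + ψ x * pd e g x := by
    intro x
    by_cases hx : x ∈ tsupport ψ
    · exact pd_mul (hψ.differentiable (by norm_num) x)
        ((hgx x (hs hx)).differentiableAt (by norm_num))
    · rw [pd_eq_zero_of_notMem_tsupport hx, image_eq_zero_of_notMem_tsupport hx,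
        pd_eq_zero_of_notMem_tsupport fun h => hx (tsupport_mul_subset_left h)]
      simp
  simp only [h1] at h0
  rw [integral_add i2 i1] at h0
  linarith

/-- The `i`-th spatial direction in space-time. -/
noncomputable abbrev sv {d : ℕ} (i : Fin d) : Spc d × ℝ := (bv i, 0)

/-- The time direction in space-time. -/
abbrev tv {d : ℕ} : Spc d × ℝ := (0, 1)

section Slice

variable {d : ℕ} {ψ : Spc d × ℝ → ℝ}

theorem hasFDerivAt_slice {x : Spc d} {s : ℝ} (hψ : DifferentiableAt ℝ ψ (x, s)) :
    HasFDerivAt (fun y => ψ (y, s)) ((fderiv ℝ ψ (x, s)).comp (ContinuousLinearMap.inl ℝ _ _)) x :=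
  hψ.hasFDerivAt.comp x (hasFDerivAt_prodMk_left x s)

theorem pd_slice {x e : Spc d} {s : ℝ} (hψ : DifferentiableAt ℝ ψ (x, s)) :
    pd e (fun y => ψ (y, s)) x = pd (e, 0) ψ (x, s) := by
  rw [pd, (hasFDerivAt_slice hψ).fderiv]
  simp [pd]

theorem hasDerivAt_slice {x : Spc d} {s : ℝ} (hψ : DifferentiableAt ℝ ψ (x, s)) :
    HasDerivAt (fun t => ψ (x, t)) (pd tv ψ (x, s)) s := by
  have := hψ.hasFDerivAt.comp_hasDerivAt s ((hasDerivAt_const s x).prodMk (hasDerivAt_id s))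
  exact this

theorem tsupport_slice (s : ℝ) :
    tsupport (fun y => ψ (y, s)) ⊆ {x | (x, s) ∈ tsupport ψ} :=
  closure_minimal (fun x hx => subset_tsupport ψ hx)
    ((isClosed_tsupport ψ).preimage (by fun_prop))

theorem hasCompactSupport_slice (hc : HasCompactSupport ψ) (s : ℝ) :
    HasCompactSupport fun y => ψ (y, s) := by
  refine IsCompact.of_isClosed_subset (hc.isCompact.image continuous_fst) (isClosed_tsupport _)
    fun x hx => ?_
  exact ⟨(x, s), tsupport_slice s hx, rfl⟩

end Slice

section Weak

variable {d : ℕ} {O : Set (Spc d)} {M : ℝ} {v : Spc d → ℝ → ℝ}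

theorem HeatSol.sq_integrableOn_uZ (hv : HeatSol O M v) {K : Set (Spc d × ℝ)} (hK : IsCompact K)
    (hKO : K ⊆ cyl O) : IntegrableOn (fun z => uZ O v z ^ 2) K := by
  obtain ⟨m, hm⟩ := hv.bdd (Prod.fst '' K) (by rintro _ ⟨z, hz, rfl⟩; exact (hKO hz).1)
    (hK.image continuous_fst)
  refine Measure.integrableOn_of_bounded (M := m ^ 2) hK.measure_lt_top.ne
    (hv.measurable_uZ.pow_const 2).aestronglyMeasurable ?_
  refine (ae_restrict_iff' hK.measurableSet).2 (ae_of_all _ fun z hz => ?_)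
  rw [Real.norm_of_nonneg (sq_nonneg _), uZ, indicator_of_mem (hKO hz), ← sq_abs]
  exact pow_le_pow_left₀ (abs_nonneg _)
    (hm z.1 ⟨z, hz, rfl⟩ z.2 (Ioo_subset_Icc_self (hKO hz).2)) 2

theorem integrableOn_of_sq_le {f g : Spc d × ℝ → ℝ} {K : Set (Spc d × ℝ)} (hK : IsCompact K)
    (hf : Measurable f) (hg : IntegrableOn g K) (h : ∀ z, f z ^ 2 ≤ g z) :
    IntegrableOn f K := by
  have h1 : IntegrableOn (fun z => 1 + g z) K :=
    (integrableOn_const hK.measure_lt_top.ne).add hg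
  refine h1.mono' hf.aestronglyMeasurable (ae_of_all _ fun z => ?_)
  rw [Real.norm_eq_abs]
  nlinarith [h z, sq_abs (f z), sq_nonneg (|f z| - 1)]

theorem HeatSol.integrableOn_uZ (hv : HeatSol O M v) {K : Set (Spc d × ℝ)} (hK : IsCompact K)
    (hKO : K ⊆ cyl O) : IntegrableOn (uZ O v) K :=
  integrableOn_of_sq_le hK hv.measurable_uZ (hv.sq_integrableOn_uZ hK hKO) fun _ => le_rfl

theorem HeatSol.integrableOn_gZ (hv : HeatSol O M v) {K : Set (Spc d × ℝ)} (hK : IsCompact K)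
    (hE : IntegrableOn (eG O v) K) (i : Fin d) : IntegrableOn (gZ O v i) K :=
  integrableOn_of_sq_le hK (hv.measurable_gZ i) hE fun z =>
    Finset.single_le_sum (f := fun i => gZ O v i z ^ 2) (fun _ _ => sq_nonneg _) (Finset.mem_univ i)

theorem HeatSol.integrableOn_fZ (hv : HeatSol O M v) {K : Set (Spc d × ℝ)} (hK : IsCompact K)
    (hKO : K ⊆ cyl O) (hE : IntegrableOn (eG O v) K) : IntegrableOn (fZ O v) K :=
  integrableOn_of_sq_le hK hv.measurable_fZ
    (((hv.sq_integrableOn_uZ hK hKO).add hE).const_mul (2 * M ^ 2)) fun z => hv.fZ_sq_le z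

theorem HeatSol.weak_grad (hv : HeatSol O M v)
    (hE : ∀ K ⊆ cyl O, IsCompact K → IntegrableOn (eG O v) K) {ψ : Spc d × ℝ → ℝ}
    (hψ : ContDiff ℝ ∞ ψ) (hc : HasCompactSupport ψ) (hs : tsupport ψ ⊆ cyl O) (i : Fin d) :
    ∫ z, uZ O v z * pd (sv i) ψ z = -∫ z, gZ O v i z * ψ z := by
  have h1 : Integrable fun z => uZ O v z * pd (sv i) ψ z :=
    integrable_mul_of_integrableOn (hv.integrableOn_uZ hc.pd (tsupport_pd_subset.trans hs))
      hψ.pd_infty.continuous hc.pd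
  have h2 : Integrable fun z => gZ O v i z * ψ z :=
    integrable_mul_of_integrableOn (hv.integrableOn_gZ hc (hE _ hs hc) i) hψ.continuous hc
  rw [Measure.volume_eq_prod, integral_prod_symm _ h1, integral_prod_symm _ h2, ← integral_neg]
  congr 1
  ext s
  by_cases hsI : s ∈ Ioo (0:ℝ) 1
  · have hd : ∀ x, DifferentiableAt ℝ ψ (x, s) := fun x => hψ.differentiable (by simp) _
    have hsl : ContDiff ℝ 1 fun y => ψ (y, s) :=
      (hψ.of_le (by norm_cast)).comp (contDiff_id.prodMk contDiff_const)
    have hts : tsupport (fun y => ψ (y, s)) ⊆ O := (tsupport_slice s).trans fun x hx => (hs hx).1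
    have := integral_mul_pd_eq_neg hv.isOpen hsl (hasCompactSupport_slice hc s) hts
      ((hv.contDiffOn s (Ioo_subset_Icc_self hsI)).of_le one_le_two) (bv i)
    rw [eq_neg_iff_add_eq_zero, add_comm, ← eq_neg_iff_add_eq_zero]
    have e1 : ∫ x, gZ O v i (x, s) * ψ (x, s) =
        ∫ x, ψ (x, s) * pd (bv i) (fun y => v y s) x := by
      refine integral_congr_ae (ae_of_all _ fun x => ?_)
      by_cases hx : x ∈ O
      · have hz : (x, s) ∈ cyl O := ⟨hx, hsI⟩
        simp only [gZ, indicator_of_mem hz]; ring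
      · have : ψ (x, s) = 0 := image_eq_zero_of_notMem_tsupport fun h => hx (hs h).1
        simp [this]
    have e2 : ∫ x, uZ O v (x, s) * pd (sv i) ψ (x, s) =
        ∫ x, pd (bv i) (fun y => ψ (y, s)) x * v x s := by
      refine integral_congr_ae (ae_of_all _ fun x => ?_)
      simp only [pd_slice (hd x)]
      by_cases hx : x ∈ O
      · have hz : (x, s) ∈ cyl O := ⟨hx, hsI⟩
        simp only [uZ, indicator_of_mem hz]; ring
      · rw [pd_eq_zero_of_notMem_tsupport fun h => hx (hs h).1]; simp
    rw [e1, e2]; exact this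
  · have hz : ∀ x, (x, s) ∉ cyl O := fun x h => hsI h.2
    simp [uZ, gZ, hz]

theorem HeatSol.slice_hasDerivWithinAt (hv : HeatSol O M v) {ψ : Spc d × ℝ → ℝ}
    (hψ : ContDiff ℝ ∞ ψ) (hc : HasCompactSupport ψ) (hs : tsupport ψ ⊆ cyl O) :
    ContinuousOn (fun s => ∫ x, ψ (x, s) * v x s) (Icc 0 1) ∧ ∀ s ∈ Ioo (0:ℝ) 1,
    HasDerivWithinAt (fun s => ∫ x, ψ (x, s) * v x s)
      (∫ x, (pd tv ψ (x, s) * v x s + ψ (x, s) * derivWithin (v x) (Icc 0 1) s)) (Ici s) s := by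
  have hO := hv.isOpen
  set K := Prod.fst '' tsupport ψ with hK
  have hKc : IsCompact K := hc.isCompact.image continuous_fst
  have hKO : K ⊆ O := by rintro _ ⟨z, hz, rfl⟩; exact (hs hz).1
  obtain ⟨k, hkc, hKk, hkO⟩ := exists_compact_between hKc hO hKO
  obtain ⟨η, h1, h0, hηc, -⟩ := exists_continuous_one_zero_of_isCompact hKc
    isOpen_interior.isClosed_compl (disjoint_compl_right_iff_subset.2 hKk)
  have hηs : tsupport η ⊆ k := closure_minimal (fun x hx => by
    by_contra h
    exact hx (h0 fun h' => h (interior_subset h'))) hkc.isClosed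
  have hψ0 : ∀ x ∉ K, ∀ s, (x, s) ∉ tsupport ψ := fun x hx s h => hx ⟨_, h, rfl⟩
  obtain ⟨m, hm⟩ := hv.bdd k hkO hkc
  obtain ⟨a, ha⟩ := hc.exists_bound_of_continuous hψ.continuous
  obtain ⟨L, hL⟩ := hc.pd.exists_bound_of_continuous (hψ.pd_infty (e := tv)).continuous
  have hd : ∀ z, DifferentiableAt ℝ ψ z := fun z => hψ.differentiable (by simp) _
  set w : Spc d → ℝ → ℝ := fun x s => ψ (x, s) * v x s with hw
  have hwx : ∀ s ∈ Icc (0:ℝ) 1, ContinuousOn (fun x => w x s) O := fun s hs =>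
    (hψ.continuous.comp (by fun_prop : Continuous fun x : Spc d => (x, s))).continuousOn.mul
      (hv.contDiffOn s hs).continuousOn
  have hwm : ∀ x ∈ tsupport η, ∀ s ∈ Icc (0:ℝ) 1, |w x s| ≤ a * m := fun x hx s hs => by
    rw [hw]; dsimp only
    rw [abs_mul]
    exact mul_le_mul (ha _) (hm x (hηs hx) s hs) (abs_nonneg _) ((norm_nonneg _).trans (ha (x, s)))
  have hηw : ∀ F : Spc d → ℝ, (∀ x ∉ K, F x = 0) → ∀ x, η x * F x = F x := fun F hF x => by
    by_cases hx : x ∈ K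
    · rw [h1 hx]; simp
    · simp [hF x hx]
  have e1 : ∀ s, ∫ x, ψ (x, s) * v x s = ∫ x, η x * id (w x s) := fun s => by
    refine integral_congr_ae (ae_of_all _ fun x => (hηw (fun x => w x s) (fun x hx => ?_) x).symm)
    simp [hw, image_eq_zero_of_notMem_tsupport (hψ0 x hx s)]
  simp only [e1]
  refine ⟨continuousOn_timeIntegral hO η.continuous hηc (hηs.trans hkO) hwx (fun x hx =>
    (hψ.continuous.comp (by fun_prop : Continuous fun s : ℝ => (x, s))).continuousOn.mul
      (hv.differentiableOn x hx).continuousOn) hwm continuous_id, fun s hsI => ?_⟩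
  have hsI' := Ioo_subset_Icc_self hsI
  have hn : NiceAt w (tsupport η) s := by
    obtain ⟨C, hC, δ, hδ, H⟩ := hv.niceAt hkc hkO hsI'
    have hm0 : ∀ x ∈ tsupport η, 0 ≤ m := fun x hx => (abs_nonneg _).trans (hm x (hηs hx) s hsI')
    have ha0 : 0 ≤ a := (norm_nonneg _).trans (ha 0)
    have hL0 : 0 ≤ L := (norm_nonneg _).trans (hL 0)
    refine ⟨a * C + L * |m|, by positivity, δ, hδ, fun x hx t ht hst htδ => ?_⟩
    have q1 := H x (hηs hx) t ht hst htδ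
    have q2 : |ψ (x, t) - ψ (x, s)| ≤ L * (t - s) := by
      have := Convex.norm_image_sub_le_of_norm_hasDerivWithin_le (f := fun t => ψ (x, t))
        (f' := fun t => pd tv ψ (x, t)) (s := univ) (C := L) (x := s) (y := t)
        (fun r _ => (hasDerivAt_slice (hd _)).hasDerivWithinAt) (fun r _ => hL _) convex_univ
        (mem_univ _) (mem_univ _)
      rw [Real.norm_eq_abs, Real.norm_eq_abs, abs_of_nonneg (sub_nonneg.2 hst)] at this
      exact this
    have q3 := hm x (hηs hx) s hsI'
    have e : w x t - w x s = ψ (x, t) * (v x t - v x s) + (ψ (x, t) - ψ (x, s)) * v x s := by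
      simp only [hw]; ring
    rw [e]
    refine (abs_add_le _ _).trans ?_
    rw [abs_mul, abs_mul]
    have r1 : |ψ (x, t)| * |v x t - v x s| ≤ a * (C * (t - s)) :=
      mul_le_mul (ha _) q1 (abs_nonneg _) ha0
    have r2 : |ψ (x, t) - ψ (x, s)| * |v x s| ≤ L * (t - s) * |m| :=
      mul_le_mul q2 (q3.trans (le_abs_self m)) (abs_nonneg _)
        (mul_nonneg hL0 (sub_nonneg.2 hst))
    linarith
  have h := (hasDerivWithinAt_timeIntegral (w' := fun x => pd tv ψ (x, s) * v x s +
      ψ (x, s) * derivWithin (v x) (Icc 0 1) s) ⟨hsI.1.le, hsI.2⟩ hO η.continuous hηc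
    (hηs.trans hkO) hwx (fun x hx => (hasDerivAt_slice (hd _)).hasDerivWithinAt.mul
      (hv.hasDerivWithinAt hx hsI')) hwm hn (fun z => hasDerivAt_id z) continuous_const).1
  convert h using 1
  refine integral_congr_ae (ae_of_all _ fun x => ?_)
  dsimp only
  rw [one_mul, hηw (fun x => pd tv ψ (x, s) * v x s +
      ψ (x, s) * derivWithin (v x) (Icc 0 1) s)]
  intro x hx
  have q := hψ0 x hx s
  simp [image_eq_zero_of_notMem_tsupport q, pd_eq_zero_of_notMem_tsupport q]

theorem HeatSol.weak_heat (hv : HeatSol O M v)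
    (hE : ∀ K ⊆ cyl O, IsCompact K → IntegrableOn (eG O v) K) {ψ : Spc d × ℝ → ℝ}
    (hψ : ContDiff ℝ ∞ ψ) (hc : HasCompactSupport ψ) (hs : tsupport ψ ⊆ cyl O) :
    ∫ z, uZ O v z * (pd tv ψ z + ∑ i, pd (sv i) (pd (sv i) ψ) z) = -∫ z, fZ O v z * ψ z := by
  have hO := hv.isOpen
  have hψ1 : ∀ e, ContDiff ℝ ∞ (pd e ψ) := fun e => hψ.pd_infty
  have hψ2 : ∀ e e', ContDiff ℝ ∞ (pd e (pd e' ψ)) := fun e e' => (hψ1 e').pd_infty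
  have h1 : Integrable fun z => uZ O v z * (pd tv ψ z + ∑ i, pd (sv i) (pd (sv i) ψ) z) := by
    simp only [mul_add, Finset.mul_sum]
    refine Integrable.add ?_ (integrable_finsetSum _ fun i _ => ?_)
    · exact integrable_mul_of_integrableOn (hv.integrableOn_uZ hc.pd (tsupport_pd_subset.trans hs))
        (hψ1 _).continuous hc.pd
    · exact integrable_mul_of_integrableOn (hv.integrableOn_uZ hc.pd.pd
        ((tsupport_pd_subset.trans tsupport_pd_subset).trans hs)) (hψ2 _ _).continuous hc.pd.pd
  have h2 : Integrable fun z => fZ O v z * ψ z :=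
    integrable_mul_of_integrableOn (hv.integrableOn_fZ hc hs (hE _ hs hc)) hψ.continuous hc
  have h12 : Integrable fun z => uZ O v z * (pd tv ψ z + ∑ i, pd (sv i) (pd (sv i) ψ) z) +
    fZ O v z * ψ z := h1.add h2
  rw [eq_neg_iff_add_eq_zero, ← integral_add h1 h2, Measure.volume_eq_prod,
    integral_prod_symm _ h12]
  obtain ⟨hI, hI'⟩ := hv.slice_hasDerivWithinAt hψ hc hs
  have hd : ∀ z, DifferentiableAt ℝ ψ z := fun z => hψ.differentiable (by simp) _
  set D : ℝ → ℝ := fun s => ∫ x, (uZ O v (x, s) * (pd tv ψ (x, s) +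
    ∑ i, pd (sv i) (pd (sv i) ψ) (x, s)) + fZ O v (x, s) * ψ (x, s)) with hD
  have hDi : Integrable D := by
    have := h1.add h2
    rw [Measure.volume_eq_prod] at this
    exact this.integral_prod_right
  have hout : ∀ s ∉ Ioo (0:ℝ) 1, D s = 0 := fun s hsI => by
    have hz : ∀ x, (x, s) ∉ cyl O := fun x h => hsI h.2
    simp [hD, uZ, fZ, hz]
  have hends : ∀ s ∉ Ioo (0:ℝ) 1, ∫ x, ψ (x, s) * v x s = 0 := fun s hsI => by
    have hz : ∀ x, ψ (x, s) = 0 := fun x =>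
      image_eq_zero_of_notMem_tsupport fun h => hsI (hs h).2
    simp [hz]
  have hder : ∀ s ∈ Ioo (0:ℝ) 1, HasDerivWithinAt (fun s => ∫ x, ψ (x, s) * v x s) (D s)
      (Ioi s) s := by
    intro s hsI
    have hsI' := Ioo_subset_Icc_self hsI
    have hcl : ∀ x ∈ O, (x, s) ∈ cyl O := fun x hx => ⟨hx, hsI⟩
    have hsl : ∀ {φ : Spc d × ℝ → ℝ}, ContDiff ℝ ∞ φ → ContDiff ℝ 1 fun y => φ (y, s) :=
      fun h => (h.of_le (by norm_cast)).comp (contDiff_id.prodMk contDiff_const)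
    have hts : tsupport (fun y => ψ (y, s)) ⊆ O := (tsupport_slice s).trans fun x hx => (hs hx).1
    have hts1 : ∀ e, tsupport (fun y => pd e ψ (y, s)) ⊆ O := fun e =>
      (tsupport_slice s).trans fun x hx => (hs (tsupport_pd_subset hx)).1
    have hvs := hv.contDiffOn s hsI'
    have hg1 : ∀ i, ∫ x, ψ (x, s) * pd (bv i) (pd (bv i) (fun y => v y s)) x =
        ∫ x, pd (sv i) (pd (sv i) ψ) (x, s) * v x s := by
      intro i
      rw [integral_mul_pd_eq_neg hO (hsl hψ) (hasCompactSupport_slice hc s) hts (hvs.pd hO (bv i))]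
      simp only [pd_slice (hd _)]
      rw [integral_mul_pd_eq_neg hO (hsl (hψ1 (sv i))) (hasCompactSupport_slice hc.pd s) (hts1 _)
        (hvs.of_le one_le_two), neg_neg]
      simp only [pd_slice ((hψ1 (sv i)).differentiable (by simp) _)]
    have hcont : ∀ e, Continuous fun x => pd e ψ (x, s) := fun e =>
      (hψ1 e).continuous.comp (by fun_prop)
    have j1 : ∀ i, Integrable fun x => ψ (x, s) * pd (bv i) (pd (bv i) (fun y => v y s)) x :=
      fun i => integrable_mul_of_tsupport hO (hsl hψ).continuous (hasCompactSupport_slice hc s) hts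
        ((hvs.pd hO _).continuousOn_pd hO _)
    have j2 : ∀ i, Integrable fun x => pd (sv i) (pd (sv i) ψ) (x, s) * v x s := fun i =>
      integrable_mul_of_tsupport hO (hsl (hψ2 _ _)).continuous (hasCompactSupport_slice hc.pd.pd s)
        ((tsupport_slice s).trans fun x hx =>
          (hs (tsupport_pd_subset (tsupport_pd_subset hx))).1) hvs.continuousOn
    have hL : ∫ x, (ψ (x, s) * slap (fun y => v y s) x -
        ∑ i, pd (sv i) (pd (sv i) ψ) (x, s) * v x s) = 0 := by
      simp only [slap_eq, Finset.mul_sum]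
      rw [integral_sub (integrable_finsetSum _ fun i _ => j1 i)
        (integrable_finsetSum _ fun i _ => j2 i), integral_finsetSum _ fun i _ => j1 i,
        integral_finsetSum _ fun i _ => j2 i, sub_eq_zero]
      exact Finset.sum_congr rfl fun i _ => hg1 i
    have j3 : Integrable fun x => ψ (x, s) * slap (fun y => v y s) x -
        ∑ i, pd (sv i) (pd (sv i) ψ) (x, s) * v x s := by
      simp only [slap_eq, Finset.mul_sum]
      exact (integrable_finsetSum _ fun i _ => j1 i).sub (integrable_finsetSum _ fun i _ => j2 i)
    have hEq : ∀ x, (pd tv ψ (x, s) * v x s + ψ (x, s) * derivWithin (v x) (Icc 0 1) s) -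
        (ψ (x, s) * slap (fun y => v y s) x - ∑ i, pd (sv i) (pd (sv i) ψ) (x, s) * v x s) =
        uZ O v (x, s) * (pd tv ψ (x, s) + ∑ i, pd (sv i) (pd (sv i) ψ) (x, s)) +
          fZ O v (x, s) * ψ (x, s) := by
      intro x
      by_cases hx : x ∈ O
      · simp only [uZ, fZ, indicator_of_mem (hcl x hx), ← Finset.sum_mul]
        ring
      · have q : (x, s) ∉ tsupport ψ := fun h => hx (hs h).1
        have q1 : ∀ i, pd (sv i) (pd (sv i) ψ) (x, s) = 0 := fun i =>
          pd_eq_zero_of_notMem_tsupport fun h => q (tsupport_pd_subset h)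
        simp [image_eq_zero_of_notMem_tsupport q, pd_eq_zero_of_notMem_tsupport q, q1]
    have hDs : D s = ∫ x, (pd tv ψ (x, s) * v x s + ψ (x, s) * derivWithin (v x) (Icc 0 1) s) := by
      by_cases hitg : Integrable fun x =>
        pd tv ψ (x, s) * v x s + ψ (x, s) * derivWithin (v x) (Icc 0 1) s
      · rw [hD]; dsimp only
        simp only [← hEq]
        rw [integral_sub hitg j3, hL, sub_zero]
      · rw [integral_undef hitg, hD]; dsimp only
        rw [integral_undef]
        intro h
        simp only [← hEq] at h
        refine hitg ((h.add j3).congr (ae_of_all _ fun x => ?_))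
        simp
    rw [hDs]
    exact (hI' s hsI).mono Ioi_subset_Ici_self
  have h3 := intervalIntegral.integral_eq_sub_of_hasDeriv_right_of_le zero_le_one hI hder
    hDi.intervalIntegrable
  rw [hends 0 (by simp), hends 1 (by simp), sub_zero,
    intervalIntegral.integral_of_le zero_le_one, setIntegral_eq_integral_of_forall_compl_eq_zero] at h3
  · exact h3
  · exact fun s hsI => hout s fun h => hsI (Ioo_subset_Ioc_self h)

end Weak

section Mollification

variable {E : Type*} [NormedAddCommGroup E] [NormedSpace ℝ E] [FiniteDimensional ℝ E]
  [MeasurableSpace E] [BorelSpace E] {μ : Measure E} [μ.IsAddHaarMeasure] {F ρ b : E → ℝ}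

/-- The mollification of `F` with kernel `ρ`. -/
noncomputable def moll (μ : Measure E) (F ρ : E → ℝ) (z : E) : ℝ := ∫ y, F y * ρ (z - y) ∂μ

theorem moll_eq_convolution :
    moll μ F ρ = convolution F ρ (ContinuousLinearMap.mul ℝ ℝ) μ := rfl

theorem contDiff_moll (hF : LocallyIntegrable F μ) (hρ : ContDiff ℝ ∞ ρ)
    (hc : HasCompactSupport ρ) : ContDiff ℝ ∞ (moll μ F ρ) := by
  rw [moll_eq_convolution]
  exact hc.contDiff_convolution_right (ContinuousLinearMap.mul ℝ ℝ) hF hρ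

theorem integrable_moll (hF : LocallyIntegrable F μ) (hρ : Continuous ρ)
    (hc : HasCompactSupport ρ) (z : E) : Integrable (fun y => F y * ρ (z - y)) μ :=
  hc.convolutionExists_right (ContinuousLinearMap.mul ℝ ℝ) hF hρ z

theorem pd_moll (hF : LocallyIntegrable F μ) (hρ : ContDiff ℝ ∞ ρ)
    (hc : HasCompactSupport ρ) (e : E) : pd e (moll μ F ρ) = moll μ F (pd e ρ) := by
  ext z
  have hρ1 : ContDiff ℝ 1 ρ := hρ.of_le (by norm_cast)
  have h := hc.hasFDerivAt_convolution_right (ContinuousLinearMap.mul ℝ ℝ) hF hρ1 z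
  rw [← moll_eq_convolution] at h
  unfold pd
  rw [h.fderiv]
  have hitg := (hc.fderiv ℝ).convolutionExists_right
    ((ContinuousLinearMap.mul ℝ ℝ).precompR E) hF (hρ1.continuous_fderiv (by norm_num)) z
  rw [convolution, ContinuousLinearMap.integral_apply hitg]
  rfl

theorem pd_reflect (hρ : Differentiable ℝ ρ) (e z : E) :
    pd e (fun y => ρ (z - y)) = fun y => -pd e ρ (z - y) := by
  ext y
  unfold pd
  have := (HasFDerivAt.comp (g := ρ) y (hρ (z - y)).hasFDerivAt
    ((hasFDerivAt_id y).const_sub z)).fderiv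
  rw [show (fun y => ρ (z - y)) = ρ ∘ HSub.hSub z from rfl]
  refine (congrArg (fun T => T e) this).trans ?_
  simp

theorem hasCompactSupport_reflect (hc : HasCompactSupport ρ) (z : E) :
    HasCompactSupport fun y => ρ (z - y) :=
  hc.comp_homeomorph (Homeomorph.subLeft z)

theorem contDiff_reflect (hρ : ContDiff ℝ ∞ ρ) (z : E) : ContDiff ℝ ∞ fun y => ρ (z - y) :=
  hρ.comp (by fun_prop)

theorem pd_moll_of_weak {G : E → ℝ} (hF : LocallyIntegrable F μ) (hρ : ContDiff ℝ ∞ ρ)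
    (hc : HasCompactSupport ρ) (e : E)
    (h : ∀ ψ : E → ℝ, ContDiff ℝ ∞ ψ → HasCompactSupport ψ →
      ∫ y, F y * pd e ψ y ∂μ = -∫ y, G y * ψ y ∂μ) : pd e (moll μ F ρ) = moll μ G ρ := by
  rw [pd_moll hF hρ hc]
  ext z
  have := h _ (contDiff_reflect hρ z) (hasCompactSupport_reflect hc z)
  rw [pd_reflect (hρ.differentiable (by simp))] at this
  simp only [mul_neg, integral_neg, neg_inj] at this
  exact this

theorem moll_eq_zero {r : ℝ} {K : Set E} (hF : ∀ y ∉ K, F y = 0) (hρ : ∀ y, r < ‖y‖ → ρ y = 0)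
    {z : E} (hz : z ∉ cthickening r K) : moll μ F ρ z = 0 := by
  refine integral_eq_zero_of_ae (ae_of_all _ fun y => ?_)
  by_cases hy : y ∈ K
  · have : r < ‖z - y‖ := by
      by_contra! hle
      exact hz (mem_cthickening_of_dist_le z y r K hy (by rwa [dist_eq_norm]))
    simp [hρ _ this]
  · simp [hF y hy]

theorem sq_moll_le (hF : LocallyIntegrable F μ) (hF2 : LocallyIntegrable (fun z => F z ^ 2) μ)
    (hρ : Continuous ρ) (hc : HasCompactSupport ρ) (h0 : ∀ y, 0 ≤ ρ y) (h1 : ∫ y, ρ y ∂μ = 1)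
    (z : E) : moll μ F ρ z ^ 2 ≤ moll μ (fun z => F z ^ 2) ρ z := by
  have i1 := integrable_moll hF hρ hc z
  have i2 := integrable_moll hF2 hρ hc z
  have i3 : Integrable (fun y => ρ (z - y)) μ :=
    (hρ.comp (by fun_prop)).integrable_of_hasCompactSupport (hasCompactSupport_reflect hc z)
  have e3 : ∫ y, ρ (z - y) ∂μ = 1 := by rw [integral_sub_left_eq_self ρ μ z, h1]
  set m := moll μ F ρ z with hm
  have h : 0 ≤ ∫ y, (F y ^ 2 * ρ (z - y) - 2 * m * (F y * ρ (z - y))) + m ^ 2 * ρ (z - y) ∂μ := by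
    refine integral_nonneg fun y => ?_
    have := mul_nonneg (sq_nonneg (F y - m)) (h0 (z - y))
    simp only [Pi.zero_apply]
    nlinarith
  have i4 : Integrable (fun y => F y ^ 2 * ρ (z - y) - 2 * m * (F y * ρ (z - y))) μ :=
    i2.sub (i1.const_mul _)
  rw [integral_add i4 (i3.const_mul _), integral_sub i2 (i1.const_mul _),
    integral_const_mul, integral_const_mul, e3] at h
  change 0 ≤ moll μ (fun z => F z ^ 2) ρ z - 2 * m * m + m ^ 2 * 1 at h
  nlinarith

/-- An upper bound for weighted norms of mollifications. -/
theorem integral_mul_sq_moll_le {r ε : ℝ} (hF : Integrable F μ)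
    (hF2 : Integrable (fun z => F z ^ 2) μ)
    (hρ : Continuous ρ) (hc : HasCompactSupport ρ) (h0 : ∀ y, 0 ≤ ρ y) (h1 : ∫ y, ρ y ∂μ = 1)
    (hr : ∀ y, r < ‖y‖ → ρ y = 0) (hb : Continuous b) (hb0 : ∀ z, 0 ≤ b z)
    (hbF : Integrable (fun z => b z * F z ^ 2) μ)
    (hu : ∀ z y, ‖z - y‖ ≤ r → b z ≤ b y + ε) :
    Integrable (fun z => b z * moll μ F ρ z ^ 2) μ ∧
    ∫ z, b z * moll μ F ρ z ^ 2 ∂μ ≤ ∫ z, b z * F z ^ 2 ∂μ + ε * ∫ z, F z ^ 2 ∂μ := by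
  set h : E → E → ℝ := fun z y => b y * F y ^ 2 * ρ (z - y) + ε * (F y ^ 2 * ρ (z - y)) with hh
  have hpr : Integrable (fun p : E × E => F p.2 ^ 2 * ρ (p.1 - p.2)) (μ.prod μ) :=
    hF2.convolution_integrand (ContinuousLinearMap.mul ℝ ℝ)
      (hρ.integrable_of_hasCompactSupport hc)
  have hpr2 : Integrable (fun p : E × E => b p.2 * F p.2 ^ 2 * ρ (p.1 - p.2)) (μ.prod μ) :=
    hbF.convolution_integrand (ContinuousLinearMap.mul ℝ ℝ)
      (hρ.integrable_of_hasCompactSupport hc)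
  have hI1 : Integrable (moll μ (fun z => F z ^ 2) ρ) μ := hpr.integral_prod_left
  have hI2 : Integrable (moll μ (fun z => b z * F z ^ 2) ρ) μ := hpr2.integral_prod_left
  have hitg : ∀ {G : E → ℝ}, Integrable G μ → ∫ z, moll μ G ρ z ∂μ = ∫ z, G z ∂μ := by
    intro G hG
    have := integral_convolution (μ := μ) (ν := μ) (L := ContinuousLinearMap.mul ℝ ℝ) hG
      (hρ.integrable_of_hasCompactSupport hc)
    rw [← moll_eq_convolution] at this
    rw [this, h1]
    simp
  have hle : ∀ z, b z * moll μ F ρ z ^ 2 ≤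
      moll μ (fun z => b z * F z ^ 2) ρ z + ε * moll μ (fun z => F z ^ 2) ρ z := by
    intro z
    refine (mul_le_mul_of_nonneg_left (sq_moll_le hF.locallyIntegrable hF2.locallyIntegrable
      hρ hc h0 h1 z) (hb0 z)).trans ?_
    have i1 := integrable_moll hF2.locallyIntegrable hρ hc z
    have i2 := integrable_moll hbF.locallyIntegrable hρ hc z
    unfold moll
    rw [← integral_const_mul, ← integral_const_mul, ← integral_add i2 (i1.const_mul _)]
    refine integral_mono (i1.const_mul _) (i2.add (i1.const_mul _)) fun y => ?_
    by_cases hy : ‖z - y‖ ≤ r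
    · have := mul_le_mul_of_nonneg_right (hu z y hy) (mul_nonneg (sq_nonneg (F y)) (h0 (z - y)))
      simp only
      linarith
    · simp [hr _ (not_le.1 hy)]
  have hI : Integrable (fun z => moll μ (fun z => b z * F z ^ 2) ρ z +
      ε * moll μ (fun z => F z ^ 2) ρ z) μ := hI2.add (hI1.const_mul ε)
  have hmI : Integrable (fun z => b z * moll μ F ρ z ^ 2) μ := by
    have hmc : Continuous (moll μ F ρ) := by
      rw [moll_eq_convolution]
      exact hc.continuous_convolution_right _ hF.locallyIntegrable hρ
    refine hI.mono' (hb.mul (hmc.pow 2)).aestronglyMeasurable (ae_of_all _ fun z => ?_)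
    rw [Real.norm_of_nonneg (mul_nonneg (hb0 z) (sq_nonneg _))]
    exact hle z
  refine ⟨hmI, (integral_mono hmI hI hle).trans (le_of_eq ?_)⟩
  rw [integral_add hI2 (hI1.const_mul ε), integral_const_mul, hitg hbF, hitg hF2]

end Mollification

theorem integral_le_of_ae_tendsto {α : Type*} [MeasurableSpace α] {μ : Measure α} {h : ℕ → α → ℝ}
    {g : α → ℝ} {A : ℝ} (h0 : ∀ k x, 0 ≤ h k x) (hi : ∀ k, Integrable (h k) μ)
    (hlim : ∀ᵐ x ∂μ, Tendsto (fun k => h k x) atTop (𝓝 (g x)))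
    (hA : ∀ᶠ k in atTop, ∫ x, h k x ∂μ ≤ A) : ∫ x, g x ∂μ ≤ A := by
  have hA0 : 0 ≤ A := by
    obtain ⟨k, hk⟩ := hA.exists
    exact (integral_nonneg (h0 k)).trans hk
  have hg0 : 0 ≤ᵐ[μ] g := hlim.mono fun x hx => ge_of_tendsto' hx fun k => h0 k x
  have hgm : AEStronglyMeasurable g μ :=
    aestronglyMeasurable_of_tendsto_ae atTop (fun k => (hi k).aestronglyMeasurable) hlim
  rw [integral_eq_lintegral_of_nonneg_ae hg0 hgm]
  refine ENNReal.toReal_le_of_le_ofReal hA0 ?_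
  calc ∫⁻ x, ENNReal.ofReal (g x) ∂μ
      = ∫⁻ x, liminf (fun k => ENNReal.ofReal (h k x)) atTop ∂μ := by
        refine lintegral_congr_ae (hlim.mono fun x hx => ?_)
        exact ((ENNReal.continuous_ofReal.tendsto _).comp hx).liminf_eq.symm
    _ ≤ liminf (fun k => ∫⁻ x, ENNReal.ofReal (h k x) ∂μ) atTop :=
        lintegral_liminf_le' fun k => (hi k).aemeasurable.ennreal_ofReal
    _ ≤ ENNReal.ofReal A := by
        refine liminf_le_of_frequently_le' (Eventually.frequently ?_)
        filter_upwards [hA] with k hk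
        rw [← ofReal_integral_eq_lintegral_ofReal (hi k) (ae_of_all _ (h0 k))]
        exact ENNReal.ofReal_le_ofReal hk

section Kernel

variable (E : Type*) [NormedAddCommGroup E] [NormedSpace ℝ E] [FiniteDimensional ℝ E]
  [HasContDiffBump E]

/-- A sequence of bump functions shrinking to the origin. -/
noncomputable def shrinkBump (k : ℕ) : ContDiffBump (0 : E) where
  rIn := 1 / (k + 1) / 2
  rOut := 1 / (k + 1)
  rIn_pos := by positivity
  rIn_lt_rOut := half_lt_self (by positivity)

variable {E} [MeasurableSpace E] [BorelSpace E] {μ : Measure E} [μ.IsAddHaarMeasure]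

/-- The mollification kernels given by `shrinkBump`. -/
noncomputable def moller (μ : Measure E) (k : ℕ) : E → ℝ := (shrinkBump E k).normed μ

theorem moller_contDiff (k : ℕ) : ContDiff ℝ ∞ (moller μ k) :=
  (shrinkBump E k).contDiff_normed

theorem moller_hasCompactSupport (k : ℕ) : HasCompactSupport (moller μ k) :=
  (shrinkBump E k).hasCompactSupport_normed

theorem moller_nonneg (k : ℕ) (y : E) : 0 ≤ moller μ k y := (shrinkBump E k).nonneg_normed y

theorem integral_moller (k : ℕ) : ∫ y, moller μ k y ∂μ = 1 := (shrinkBump E k).integral_normed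

theorem moller_eq_zero (k : ℕ) {y : E} (h : 1 / ((k:ℝ) + 1) < ‖y‖) : moller μ k y = 0 := by
  by_contra hne
  have : y ∈ Function.support ((shrinkBump E k).normed μ) := hne
  rw [ContDiffBump.support_normed_eq, mem_ball_zero_iff] at this
  exact absurd this (not_lt.2 h.le)

theorem ae_tendsto_moll {F : E → ℝ} (hF : LocallyIntegrable F μ) :
    ∀ᵐ z ∂μ, Tendsto (fun k => moll μ F (moller μ k) z) atTop (𝓝 (F z)) := by
  have h := ContDiffBump.ae_convolution_tendsto_right_of_locallyIntegrable
    (φ := shrinkBump E) (K := 2) (l := atTop) (μ := μ) (g := F)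
    tendsto_one_div_add_atTop_nhds_zero_nat
    (Eventually.of_forall fun k => by simp [shrinkBump]; ring_nf; rfl) hF
  refine h.mono fun z hz => ?_
  refine hz.congr fun k => ?_
  rw [convolution_eq_swap]
  refine integral_congr_ae (ae_of_all _ fun y => ?_)
  simp [moller, mul_comm]

end Kernel

/-- Smooth compactly supported cutoff functions equal to one near a compact set. -/
theorem exists_smooth_cutoff {E : Type*} [NormedAddCommGroup E] [NormedSpace ℝ E]
    [FiniteDimensional ℝ E] {K Ω : Set E} (hK : IsCompact K) (hΩ : IsOpen Ω) (hKΩ : K ⊆ Ω) :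
    ∃ χ : E → ℝ, ContDiff ℝ ∞ χ ∧ HasCompactSupport χ ∧ tsupport χ ⊆ Ω ∧
      (∀ z ∈ K, χ =ᶠ[𝓝 z] fun _ => 1) ∧ ∀ z, 0 ≤ χ z := by
  obtain ⟨r, hr, hrΩ⟩ := hK.exists_cthickening_subset_open hΩ hKΩ
  obtain ⟨f, hf, hr01, hsupp, h1⟩ := exists_contMDiff_support_eq_eq_one_iff (n := ⊤)
    (modelWithCornersSelf ℝ E)
    (s := thickening r K) (t := cthickening (r / 2) K) isOpen_thickening isClosed_cthickening
    (cthickening_subset_thickening' hr (by linarith) K)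
  have hts : tsupport f ⊆ cthickening r K := by
    rw [tsupport, hsupp]
    exact closure_thickening_subset_cthickening r K
  refine ⟨f, hf.contDiff, hK.cthickening.of_isClosed_subset (isClosed_tsupport f) hts,
    hts.trans hrΩ, fun z hz => ?_, fun z => (hr01 (mem_range_self z)).1⟩
  filter_upwards [isOpen_thickening.mem_nhds (self_subset_thickening (half_pos hr) K hz)] with y hy
  exact (h1 y).1 (thickening_subset_cthickening _ _ hy)

instance instIsAddHaarMeasureSpaceTime (d : ℕ) :
    (volume : Measure (Spc d × ℝ)).IsAddHaarMeasure := by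
  rw [Measure.volume_eq_prod]
  infer_instance

theorem integrable_weight_mul {d : ℕ} {Ω K : Set (Spc d × ℝ)} {b F : Spc d × ℝ → ℝ}
    (hK : IsCompact K) (hKΩ : K ⊆ Ω) (hb : ContinuousOn b Ω) (hF : Integrable F)
    (h0 : ∀ z ∉ K, F z = 0) : Integrable fun z => b z * F z := by
  have h := hF.integrableOn (s := K) |>.continuousOn_mul (hb.mono hKΩ) hK
  refine (integrableOn_iff_integrable_of_support_subset fun z hz => ?_).1 h
  by_contra hzK
  exact hz (by simp [h0 z hzK])

/-- A weighted inequality for test functions extends to `L²` functions with weak derivatives. -/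
theorem weighted_le_of_smooth {d : ℕ} {Ω K : Set (Spc d × ℝ)} (hΩ : IsOpen Ω) (hK : IsCompact K)
    (hKΩ : K ⊆ Ω) {w F : Spc d × ℝ → ℝ} {G : Fin d → Spc d × ℝ → ℝ} {b₁ b₂ b₃ : Spc d × ℝ → ℝ}
    (hb₁ : ContinuousOn b₁ Ω) (hb₂ : ContinuousOn b₂ Ω) (hb₃ : ContinuousOn b₃ Ω)
    (hb₁0 : ∀ z ∈ Ω, 0 ≤ b₁ z) (hb₂0 : ∀ z ∈ Ω, 0 ≤ b₂ z) (hb₃0 : ∀ z ∈ Ω, 0 ≤ b₃ z)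
    (hsm : ∀ f : Spc d × ℝ → ℝ, ContDiff ℝ ∞ f → HasCompactSupport f → tsupport f ⊆ Ω →
      ∫ z, b₁ z * (f z ^ 2 + ∑ i, pd (sv i) f z ^ 2) ≤
        (∫ z, b₂ z * (pd tv f z - ∑ i, pd (sv i) (pd (sv i) f) z) ^ 2) + ∫ z, b₃ z * f z ^ 2)
    (hw : Integrable w) (hw2 : Integrable fun z => w z ^ 2) (hw0 : ∀ z ∉ K, w z = 0)
    (hG : ∀ i, Integrable (G i)) (hG0 : ∀ i, ∀ z ∉ K, G i z = 0)
    (hF : Integrable F) (hF2 : Integrable fun z => F z ^ 2) (hF0 : ∀ z ∉ K, F z = 0)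
    (hwG : ∀ i, ∀ ψ : Spc d × ℝ → ℝ, ContDiff ℝ ∞ ψ → HasCompactSupport ψ →
      ∫ z, w z * pd (sv i) ψ z = -∫ z, G i z * ψ z)
    (hwF : ∀ ψ : Spc d × ℝ → ℝ, ContDiff ℝ ∞ ψ → HasCompactSupport ψ →
      ∫ z, w z * (pd tv ψ z + ∑ i, pd (sv i) (pd (sv i) ψ) z) = -∫ z, F z * ψ z) :
    ∫ z, b₁ z * (w z ^ 2 + ∑ i, G i z ^ 2) ≤ (∫ z, b₂ z * F z ^ 2) + ∫ z, b₃ z * w z ^ 2 := by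
  obtain ⟨r, hr, hrΩ⟩ := hK.exists_cthickening_subset_open hΩ hKΩ
  set K' := cthickening r K with hK'
  have hK'c : IsCompact K' := hK.cthickening
  have hKK' : K ⊆ K' := self_subset_cthickening K
  obtain ⟨χ, hχd, hχc, hχs, hχe, hχ0⟩ := exists_smooth_cutoff hK'c hΩ hrΩ
  have hχ1 : Continuous χ := hχd.continuous
  have hχ1' : ∀ z ∈ K', χ z = 1 := fun z hz => (hχe z hz).self_of_nhds
  set m : ℕ → (Spc d × ℝ → ℝ) → Spc d × ℝ → ℝ := fun k H => moll volume H (moller volume k) with hm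
  have hmz : ∀ {H : Spc d × ℝ → ℝ} {k : ℕ}, 1 / ((k:ℝ) + 1) ≤ r → (∀ z ∉ K, H z = 0) →
      ∀ z ∉ K', m k H z = 0 := by
    intro H k hk hH z hz
    refine moll_eq_zero (r := r) hH (fun y hy => moller_eq_zero k (hk.trans_lt hy)) hz
  have hkr : ∀ η : ℝ, 0 < η → ∀ᶠ k : ℕ in atTop, 1 / ((k:ℝ) + 1) ≤ η := fun η hη =>
    (tendsto_one_div_add_atTop_nhds_zero_nat.eventually (gt_mem_nhds hη)).mono fun _ h => h.le
  have hcont : ∀ {b : Spc d × ℝ → ℝ}, ContinuousOn b Ω → Continuous fun z => χ z * b z :=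
    fun hb => continuous_mul_of_tsupport hΩ hχ1 hχs hb
  have hχb : ∀ {b H : Spc d × ℝ → ℝ}, (∀ z ∉ K', H z = 0) → ∀ z, χ z * b z * H z = b z * H z := by
    intro b H hH z
    by_cases hz : z ∈ K'
    · rw [hχ1' z hz, one_mul]
    · simp [hH z hz]
  have hχn : ∀ {b : Spc d × ℝ → ℝ}, (∀ z ∈ Ω, 0 ≤ b z) → ∀ z, 0 ≤ χ z * b z := by
    intro b hb z
    by_cases hz : z ∈ Ω
    · exact mul_nonneg (hχ0 z) (hb z hz)
    · simp [image_eq_zero_of_notMem_tsupport fun h => hz (hχs h)]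
  have hup : ∀ {b H : Spc d × ℝ → ℝ}, ContinuousOn b Ω → (∀ z ∈ Ω, 0 ≤ b z) → Integrable H →
      Integrable (fun z => H z ^ 2) → (∀ z ∉ K, H z = 0) → ∀ ε > 0,
      ∀ᶠ k in atTop, ∫ z, b z * m k H z ^ 2 ≤ (∫ z, b z * H z ^ 2) + ε * ∫ z, H z ^ 2 := by
    intro b H hb hb0 hH hH2 hH0 ε hε
    have huc := hχc.mul_right.uniformContinuous_of_continuous (hcont hb)
    obtain ⟨η, hη, hηb⟩ := Metric.uniformContinuous_iff.1 huc ε hε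
    have hbH := integrable_weight_mul hK hKΩ hb hH2 (fun z hz => by simp [hH0 z hz])
    filter_upwards [hkr (η / 2) (by positivity), hkr r hr] with k hk hk'
    have key := (integral_mul_sq_moll_le (μ := volume) (ρ := moller volume k) (r := η / 2) (ε := ε)
      (b := fun z => χ z * b z) hH hH2
      (moller_contDiff k).continuous (moller_hasCompactSupport k) (moller_nonneg k)
      (integral_moller k) (fun y hy => moller_eq_zero k (hk.trans_lt hy)) (hcont hb) (hχn hb0)
      (by
        refine hbH.congr (ae_of_all _ fun z => ?_)
        exact (hχb (H := fun z => H z ^ 2) (fun z hz => by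
          simp [hH0 z fun h => hz (hKK' h)]) z).symm)
      (fun z y hzy => by
        have := hηb (a := z) (b := y) (by rw [dist_eq_norm]; exact hzy.trans_lt (half_lt_self hη))
        simp only [Real.dist_eq, Pi.mul_apply] at this
        have h2 := (abs_lt.1 this).2
        linarith)).2
    rw [integral_congr_ae (ae_of_all _ (hχb (b := b) (H := fun z => m k H z ^ 2)
      fun z hz => by simp [hmz hk' hH0 z hz])),
      integral_congr_ae (ae_of_all _ (hχb (b := b) (H := fun z => H z ^ 2)
      fun z hz => by simp [hH0 z fun h => hz (hKK' h)]))] at key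
    exact key
  have hint1 : ∀ {b H : Spc d × ℝ → ℝ} {k : ℕ}, ContinuousOn b Ω → 1 / ((k:ℝ) + 1) ≤ r →
      Integrable H → (∀ z ∉ K, H z = 0) → Integrable fun z => b z * m k H z ^ 2 := by
    intro b H k hb hk hH hH0
    have hc : Continuous (m k H) := (contDiff_moll hH.locallyIntegrable (moller_contDiff k)
      (moller_hasCompactSupport k)).continuous
    have hcs : HasCompactSupport (m k H) :=
      HasCompactSupport.intro hK'c fun z hz => hmz hk hH0 z hz
    refine integrable_weight_mul hK'c hrΩ hb
      ((hc.pow 2).integrable_of_hasCompactSupport ?_) fun z hz => by simp [hmz hk hH0 z hz]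
    exact HasCompactSupport.intro hK'c fun z hz => by simp [hmz hk hH0 z hz]
  have hmG : ∀ k i, pd (sv i) (m k w) = m k (G i) := fun k i =>
    pd_moll_of_weak hw.locallyIntegrable (moller_contDiff k) (moller_hasCompactSupport k) (sv i)
      (hwG i)
  have hmF : ∀ k z, pd tv (m k w) z - ∑ i, pd (sv i) (pd (sv i) (m k w)) z = m k F z := by
    intro k z
    have hl := hw.locallyIntegrable (μ := volume)
    have hρ := moller_contDiff (E := Spc d × ℝ) (μ := volume) k
    have hρc := moller_hasCompactSupport (E := Spc d × ℝ) (μ := volume) k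
    have hd : ∀ {ρ : Spc d × ℝ → ℝ}, ContDiff ℝ ∞ ρ → Differentiable ℝ ρ := fun h =>
      h.differentiable (by simp)
    have h := hwF _ (contDiff_reflect hρ z) (hasCompactSupport_reflect hρc z)
    have e2 : ∀ i y, pd (sv i) (pd (sv i) fun y => moller volume k (z - y)) y =
        pd (sv i) (pd (sv i) (moller volume k)) (z - y) := by
      intro i y
      rw [pd_reflect (hd hρ), pd_neg, pd_reflect (hd hρ.pd_infty), neg_neg]
    simp only [e2] at h
    rw [pd_reflect (hd hρ)] at h
    simp only [hm]
    have e3 : ∀ i, pd (sv i) (pd (sv i) (moll volume w (moller volume k))) =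
        moll volume w (pd (sv i) (pd (sv i) (moller volume k))) := fun i => by
      rw [pd_moll hl hρ hρc, pd_moll hl hρ.pd_infty hρc.pd]
    simp only [e3]
    rw [pd_moll hl hρ hρc]
    unfold moll
    rw [← integral_finsetSum _ fun i _ =>
        integrable_moll hl (hρ.pd_infty.pd_infty.continuous) hρc.pd.pd z,
      ← integral_sub (integrable_moll hl hρ.pd_infty.continuous hρc.pd z)
        (integrable_finsetSum _ fun i _ =>
        integrable_moll hl (hρ.pd_infty.pd_infty.continuous) hρc.pd.pd z),
      eq_comm, ← neg_eq_iff_eq_neg.2 h, ← integral_neg]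
    refine integral_congr_ae (ae_of_all _ fun y => ?_)
    simp only [Finset.mul_sum, mul_add]
    ring
  refine le_of_forall_pos_le_add fun ε hε => ?_
  set S := (∫ z, F z ^ 2) + ∫ z, w z ^ 2 with hS
  have hF20 : 0 ≤ ∫ z, F z ^ 2 := integral_nonneg fun z => sq_nonneg _
  have hw20 : 0 ≤ ∫ z, w z ^ 2 := integral_nonneg fun z => sq_nonneg _
  have hS0 : 0 ≤ S := by positivity
  obtain ⟨k₀, hk₀⟩ := (hkr r hr).exists_forall_of_atTop
  have hlim : ∀ᵐ z, Tendsto (fun k => b₁ z * (m (k + k₀) w z ^ 2 + ∑ i, m (k + k₀) (G i) z ^ 2))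
      atTop (𝓝 (b₁ z * (w z ^ 2 + ∑ i, G i z ^ 2))) := by
    have h1 := ae_tendsto_moll (hw.locallyIntegrable (μ := volume))
    have h2 := ae_all_iff.2 fun i => ae_tendsto_moll ((hG i).locallyIntegrable (μ := volume))
    filter_upwards [h1, h2] with z hz1 hz2
    have sh : ∀ {f : ℕ → ℝ} {a : ℝ}, Tendsto f atTop (𝓝 a) →
        Tendsto (fun k => f (k + k₀)) atTop (𝓝 a) := fun h => h.comp (tendsto_add_atTop_nat k₀)
    exact ((sh hz1).pow 2 |>.add (tendsto_finsetSum _ fun i _ => (sh (hz2 i)).pow 2)).const_mul _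
  have hmi : ∀ k, Integrable fun z =>
      b₁ z * (m (k + k₀) w z ^ 2 + ∑ i, m (k + k₀) (G i) z ^ 2) := by
    intro k
    have h1 := hint1 hb₁ (hk₀ (k + k₀) (by omega)) hw hw0
    have h2 := integrable_finsetSum Finset.univ fun i _ =>
      hint1 hb₁ (hk₀ (k + k₀) (by omega)) (hG i) (hG0 i)
    refine (h1.add h2).congr (ae_of_all _ fun z => ?_)
    simp only [Pi.add_apply, mul_add, Finset.mul_sum]
  refine integral_le_of_ae_tendsto (h := fun k z =>
    b₁ z * (m (k + k₀) w z ^ 2 + ∑ i, m (k + k₀) (G i) z ^ 2)) (fun k z => ?_) hmi hlim ?_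
  · by_cases hz : z ∈ K'
    · exact mul_nonneg (hb₁0 z (hrΩ hz))
        (add_nonneg (sq_nonneg _) (Finset.sum_nonneg fun i _ => sq_nonneg _))
    · have e : ∀ {H : Spc d × ℝ → ℝ}, (∀ z ∉ K, H z = 0) → m (k + k₀) H z = 0 :=
        fun hH => hmz (hk₀ _ (by omega)) hH z hz
      simp [e hw0, fun i => e (hG0 i)]
  · have hε' : 0 < ε / (S + 1) := by positivity
    have t1 := (tendsto_add_atTop_nat k₀).eventually (hup hb₂ hb₂0 hF hF2 hF0 _ hε')
    have t2 := (tendsto_add_atTop_nat k₀).eventually (hup hb₃ hb₃0 hw hw2 hw0 _ hε')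
    filter_upwards [t1, t2] with k h1 h2
    have hts : HasCompactSupport (m (k + k₀) w) :=
      HasCompactSupport.intro hK'c fun z hz => hmz (hk₀ _ (by omega)) hw0 z hz
    have hts' : tsupport (m (k + k₀) w) ⊆ Ω := by
      refine (closure_minimal (fun z hz => ?_) isClosed_cthickening).trans hrΩ
      by_contra h
      exact hz (hmz (hk₀ _ (by omega)) hw0 z h)
    have h3 := hsm (m (k + k₀) w) (contDiff_moll hw.locallyIntegrable (moller_contDiff _)
      (moller_hasCompactSupport _)) hts hts'
    simp only [hmF] at h3
    simp only [hmG] at h3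
    have h4 : ε / (S + 1) * S ≤ ε := by
      rw [div_mul_eq_mul_div, div_le_iff₀ (by positivity)]
      nlinarith
    have h5 : ε / (S + 1) * S = ε / (S + 1) * (∫ z, F z ^ 2) + ε / (S + 1) * ∫ z, w z ^ 2 := by
      rw [← mul_add]
    linarith

/-- The spatial Laplacian of a function of space and time. -/
noncomputable def lap {d : ℕ} (f : Spc d × ℝ → ℝ) (z : Spc d × ℝ) : ℝ :=
  ∑ i, pd (sv i) (pd (sv i) f) z

/-- The inner product of the spatial gradients of two functions of space and time. -/
noncomputable def gip {d : ℕ} (f g : Spc d × ℝ → ℝ) (z : Spc d × ℝ) : ℝ :=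
  ∑ i, pd (sv i) f z * pd (sv i) g z

/-- The spatial Hessian of `φ` evaluated on the spatial gradient of `v`. -/
noncomputable def hessGrad {d : ℕ} (φ v : Spc d × ℝ → ℝ) (z : Spc d × ℝ) : ℝ :=
  ∑ i, ∑ j, pd (sv i) (pd (sv j) φ) z * pd (sv i) v z * pd (sv j) v z

section Smooth

variable {d : ℕ} {f g : Spc d × ℝ → ℝ}

theorem contDiff_lap (hf : ContDiff ℝ ∞ f) : ContDiff ℝ ∞ (lap f) :=
  ContDiff.sum fun _ _ => hf.pd_infty.pd_infty

theorem contDiff_gip (hf : ContDiff ℝ ∞ f) (hg : ContDiff ℝ ∞ g) : ContDiff ℝ ∞ (gip f g) :=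
  ContDiff.sum fun _ _ => hf.pd_infty.mul hg.pd_infty

theorem hasCompactSupport_gip (hg : HasCompactSupport g) : HasCompactSupport (gip f g) := by
  refine HasCompactSupport.intro hg fun z hz => ?_
  exact Finset.sum_eq_zero fun i _ => by rw [pd_eq_zero_of_notMem_tsupport hz, mul_zero]

theorem pd_mul_smooth {u v : Spc d × ℝ → ℝ} (hu : ContDiff ℝ ∞ u) (hv : ContDiff ℝ ∞ v)
    (e z : Spc d × ℝ) : pd e (fun y => u y * v y) z = pd e u z * v z + u z * pd e v z :=
  pd_mul (hu.differentiable (by simp) z) (hv.differentiable (by simp) z)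

theorem pd_sq_smooth {u : Spc d × ℝ → ℝ} (hu : ContDiff ℝ ∞ u)
    (e z : Spc d × ℝ) : pd e (fun y => u y ^ 2) z = 2 * u z * pd e u z := by
  rw [show (fun y => u y ^ 2) = fun y => u y * u y by ext; ring, pd_mul_smooth hu hu]
  ring

/-- A function whose integral exists and vanishes. -/
def IsNull (e : Spc d × ℝ → ℝ) : Prop := Integrable e ∧ ∫ z, e z = 0

theorem IsNull.add {e e' : Spc d × ℝ → ℝ} (h : IsNull e) (h' : IsNull e') :
    IsNull fun z => e z + e' z :=
  ⟨h.1.add h'.1, by rw [integral_add h.1 h'.1, h.2, h'.2, add_zero]⟩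

theorem IsNull.const_mul {e : Spc d × ℝ → ℝ} (h : IsNull e) (c : ℝ) : IsNull fun z => c * e z :=
  ⟨h.1.const_mul c, by rw [integral_const_mul, h.2, mul_zero]⟩

theorem isNull_pd (hf : ContDiff ℝ ∞ f) (hc : HasCompactSupport f) (e : Spc d × ℝ) :
    IsNull (pd e f) :=
  ⟨hf.pd_infty.continuous.integrable_of_hasCompactSupport hc.pd,
    integral_pd_eq_zero (hf.of_le (by norm_cast)) hc⟩

theorem isNull_div {g : Fin d → Spc d × ℝ → ℝ} (hg : ∀ i, ContDiff ℝ ∞ (g i))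
    (hc : ∀ i, HasCompactSupport (g i)) : IsNull fun z => ∑ i, pd (sv i) (g i) z :=
  ⟨integrable_finsetSum _ fun i _ => (isNull_pd (hg i) (hc i) _).1, by
    rw [integral_finsetSum _ fun i _ => (isNull_pd (hg i) (hc i) _).1]
    exact Finset.sum_eq_zero fun i _ => (isNull_pd (hg i) (hc i) _).2⟩

theorem integral_le_of_isNull {e : Spc d × ℝ → ℝ} (hf : Integrable f) (hg : Integrable g)
    (he : IsNull e) (h : ∀ z, f z + e z ≤ g z) : ∫ z, f z ≤ ∫ z, g z := by
  have := integral_mono (hf.add he.1) hg h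
  rwa [integral_add' hf he.1, he.2, add_zero] at this

theorem sum_pd_gip (hf : ContDiff ℝ ∞ f) (hg : ContDiff ℝ ∞ g) (z : Spc d × ℝ) :
    gip g (gip f g) z = hessGrad f g z + gip f (gip g g) z / 2 := by
  have e1 : ∀ i, pd (sv i) (gip f g) z = ∑ j, (pd (sv i) (pd (sv j) f) z * pd (sv j) g z +
      pd (sv j) f z * pd (sv i) (pd (sv j) g) z) := by
    intro i
    unfold gip
    rw [pd_sum _ fun j _ => (hf.pd_infty.mul hg.pd_infty).differentiable (by simp) z]
    exact Finset.sum_congr rfl fun j _ => pd_mul_smooth hf.pd_infty hg.pd_infty _ _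
  have e2 : ∀ i, pd (sv i) (gip g g) z =
      ∑ j, 2 * (pd (sv j) g z * pd (sv i) (pd (sv j) g) z) := by
    intro i
    unfold gip
    rw [pd_sum _ fun j _ => (hg.pd_infty.mul hg.pd_infty).differentiable (by simp) z]
    refine Finset.sum_congr rfl fun j _ => ?_
    rw [pd_mul_smooth hg.pd_infty hg.pd_infty]
    ring
  rw [show gip g (gip f g) z = ∑ i, pd (sv i) g z * pd (sv i) (gip f g) z from rfl,
    show gip f (gip g g) z = ∑ i, pd (sv i) f z * pd (sv i) (gip g g) z from rfl]
  simp only [e1, e2, hessGrad, Finset.mul_sum, mul_add, Finset.sum_add_distrib, Finset.sum_div]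
  congr 1
  · exact Finset.sum_congr rfl fun i _ => Finset.sum_congr rfl fun j _ => by ring
  · rw [Finset.sum_comm]
    refine Finset.sum_congr rfl fun i _ => Finset.sum_congr rfl fun j _ => ?_
    rw [pd_comm (e := sv j) (e' := sv i) ((hg.of_le (by norm_cast)).contDiffAt)]
    ring

theorem pd_tv_gip (hg : ContDiff ℝ ∞ g) (z : Spc d × ℝ) :
    pd tv (gip g g) z = 2 * gip g (pd tv g) z := by
  unfold gip
  rw [pd_sum _ fun j _ => (hg.pd_infty.mul hg.pd_infty).differentiable (by simp) z,
    Finset.mul_sum]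
  refine Finset.sum_congr rfl fun j _ => ?_
  rw [pd_mul_smooth hg.pd_infty hg.pd_infty,
    pd_comm (e := tv) (e' := sv j) ((hg.of_le (by norm_cast)).contDiffAt)]
  ring

/-- The divergence of `a b ∇f` for `a` depending on time only. -/
theorem div_mul_grad {a b : Spc d × ℝ → ℝ} (ha : ContDiff ℝ ∞ a) (ha0 : ∀ i z, pd (sv i) a z = 0)
    (hb : ContDiff ℝ ∞ b) (hf : ContDiff ℝ ∞ f) (z : Spc d × ℝ) :
    ∑ i, pd (sv i) (fun y => a y * (b y * pd (sv i) f y)) z =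
      a z * (gip b f z + b z * lap f z) := by
  rw [gip, lap, Finset.mul_sum, ← Finset.sum_add_distrib, Finset.mul_sum]
  refine Finset.sum_congr rfl fun i _ => ?_
  rw [pd_mul_smooth ha (hb.mul hf.pd_infty), pd_mul_smooth hb hf.pd_infty, ha0]
  ring

theorem isNull_div_mul_grad {a b : Spc d × ℝ → ℝ} (ha : ContDiff ℝ ∞ a)
    (ha0 : ∀ i z, pd (sv i) a z = 0) (hb : ContDiff ℝ ∞ b) (hf : ContDiff ℝ ∞ f)
    (hc : HasCompactSupport b ∨ HasCompactSupport f) :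
    IsNull fun z => a z * (gip b f z + b z * lap f z) := by
  have := isNull_div (g := fun i y => a y * (b y * pd (sv i) f y))
    (fun i => ha.mul (hb.mul hf.pd_infty)) (fun i => by
      rcases hc with hc | hc
      · exact hc.mul_right.mul_left
      · exact hc.pd.mul_left.mul_left)
  simpa only [div_mul_grad ha ha0 hb hf] using this

theorem gip_comm (z : Spc d × ℝ) : gip f g z = gip g f z :=
  Finset.sum_congr rfl fun _ _ => mul_comm _ _

theorem gip_mul_left {h : Spc d × ℝ → ℝ} (hf : ContDiff ℝ ∞ f) (hg : ContDiff ℝ ∞ g)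
    (z : Spc d × ℝ) :
    gip (fun y => f y * g y) h z = f z * gip g h z + g z * gip f h z := by
  simp only [gip, Finset.mul_sum, ← Finset.sum_add_distrib]
  refine Finset.sum_congr rfl fun i _ => ?_
  rw [pd_mul_smooth hf hg]
  ring

/-- The Carleman inequality for the conjugated heat operator. -/
theorem carleman_conj {v φ θ N : Spc d × ℝ → ℝ} (hv : ContDiff ℝ ∞ v) (hc : HasCompactSupport v)
    (hφ : ContDiff ℝ ∞ φ) (hθ : ContDiff ℝ ∞ θ) (hN : ContDiff ℝ ∞ N)
    (hθ0 : ∀ i z, pd (sv i) θ z = 0) (hN0 : ∀ i z, pd (sv i) N z = 0)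
    (hθn : ∀ z, 0 ≤ θ z) (hθt : ∀ z, pd tv θ z ≤ 0) {V : Spc d × ℝ → ℝ}
    (hV : V = fun z => gip φ φ z + pd tv φ z) :
    ∫ z, (pd tv θ z * V z * v z ^ 2 + θ z * ((pd tv V z + 2 * gip V φ z - lap (lap φ) z
        - 2 * N z * V z - N z ^ 2) * v z ^ 2 + 4 * hessGrad φ v z + 2 * N z * gip v v z)) ≤
      ∫ z, θ z * (pd tv v z + 2 * gip φ v z + lap φ z * v z - lap v z - V z * v z) ^ 2 := by
  have hVs : ContDiff ℝ ∞ V := by rw [hV]; exact (contDiff_gip hφ hφ).add hφ.pd_infty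
  have hΛ := contDiff_lap hφ
  have hv2 : ContDiff ℝ ∞ fun z => v z * v z := hv.mul hv
  have hP := contDiff_gip hv hv
  have hY := contDiff_gip hφ hv
  have hPc : HasCompactSupport (gip v v) := hasCompactSupport_gip hc
  have hv2c : HasCompactSupport fun z => v z * v z := hc.mul_right
  have n1 := isNull_div_mul_grad hθ hθ0 (hv.pd_infty (e := tv)) hv (Or.inr hc)
  have n2 := isNull_pd (hθ.mul hP) hPc.mul_left tv
  have n3 := isNull_pd (hθ.mul (hVs.mul hv2)) hv2c.mul_left.mul_left tv
  have n4 := isNull_div_mul_grad hθ hθ0 hY hv (Or.inr hc)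
  have n5 := isNull_div_mul_grad hθ hθ0 hP hφ (Or.inl hPc)
  have n6 := isNull_div_mul_grad hθ hθ0 (hΛ.mul hv) hv (Or.inr hc)
  have n7 := isNull_div_mul_grad hθ hθ0 hv2 hΛ (Or.inl hv2c)
  have n8 := isNull_div_mul_grad hθ hθ0 (hVs.mul hv2) hφ (Or.inl hv2c.mul_left)
  have n9 := isNull_div_mul_grad hθ hθ0 (hN.mul hv) hv (Or.inr hc)
  have n := ((((((((n1.const_mul (-2)).add n2).add (n3.const_mul (-1))).add
    (n4.const_mul (-4))).add (n5.const_mul 2)).add (n6.const_mul (-2))).add n7).add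
    (n8.const_mul (-2))).add (n9.const_mul (-2))
  have hlv := contDiff_lap hv
  have hcl : Continuous fun z => θ z * (pd tv v z + 2 * gip φ v z + lap φ z * v z - lap v z
      - V z * v z) ^ 2 := by
    refine hθ.continuous.mul (Continuous.pow ?_ 2)
    have := (hv.pd_infty (e := tv)).continuous
    have := hY.continuous
    have := hΛ.continuous
    have := hv.continuous
    have := hlv.continuous
    have := hVs.continuous
    fun_prop
  have z0 : ∀ z ∉ tsupport v, v z = 0 ∧ (∀ e, pd e v z = 0) ∧ lap v z = 0 ∧ gip φ v z = 0 ∧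
      gip v v z = 0 ∧ hessGrad φ v z = 0 := by
    intro z hz
    have h1 : ∀ e, pd e v z = 0 := fun e => pd_eq_zero_of_notMem_tsupport hz
    refine ⟨image_eq_zero_of_notMem_tsupport hz, h1, ?_, ?_, ?_, ?_⟩
    · exact Finset.sum_eq_zero fun i _ =>
        pd_eq_zero_of_notMem_tsupport fun h => hz (tsupport_pd_subset h)
    · exact Finset.sum_eq_zero fun i _ => by rw [h1, mul_zero]
    · exact Finset.sum_eq_zero fun i _ => by rw [h1, mul_zero]
    · exact Finset.sum_eq_zero fun i _ => Finset.sum_eq_zero fun j _ => by rw [h1, h1, mul_zero]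
  have hil : Integrable fun z => θ z * (pd tv v z + 2 * gip φ v z + lap φ z * v z - lap v z
      - V z * v z) ^ 2 := by
    refine hcl.integrable_of_hasCompactSupport (HasCompactSupport.intro hc fun z hz => ?_)
    obtain ⟨h1, h2, h3, h4, -, -⟩ := z0 z hz
    simp [h1, h2, h3, h4]
  have hH : Continuous (hessGrad φ v) := continuous_finsetSum _ fun i _ =>
    continuous_finsetSum _ fun j _ => (hφ.pd_infty.pd_infty.continuous.mul
      hv.pd_infty.continuous).mul hv.pd_infty.continuous
  have hir : Integrable fun z => pd tv θ z * V z * v z ^ 2 + θ z * ((pd tv V z + 2 * gip V φ z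
      - lap (lap φ) z - 2 * N z * V z - N z ^ 2) * v z ^ 2 + 4 * hessGrad φ v z
      + 2 * N z * gip v v z) := by
    refine Continuous.integrable_of_hasCompactSupport ?_ (HasCompactSupport.intro hc fun z hz => ?_)
    · have := (hθ.pd_infty (e := tv)).continuous
      have := (hVs.pd_infty (e := tv)).continuous
      have := hVs.continuous
      have := hv.continuous
      have := hθ.continuous
      have := hN.continuous
      have := hP.continuous
      have := (contDiff_gip hVs hφ).continuous
      have := (contDiff_lap hΛ).continuous
      fun_prop
    · obtain ⟨h1, -, -, -, h5, h6⟩ := z0 z hz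
      simp [h1, h5, h6]
  refine integral_le_of_isNull hir hil n fun z => ?_
  have e2 : pd tv (fun x => θ x * gip v v x) z =
      pd tv θ z * gip v v z + θ z * (2 * gip v (pd tv v) z) := by
    rw [pd_mul_smooth hθ hP, pd_tv_gip hv]
  have e3 : pd tv (fun x => θ x * (V x * (v x * v x))) z = pd tv θ z * (V z * (v z * v z)) +
      θ z * (pd tv V z * (v z * v z) + V z * (2 * v z * pd tv v z)) := by
    rw [pd_mul_smooth hθ (hVs.mul hv2), pd_mul_smooth hVs hv2, pd_mul_smooth hv hv]
    ring
  have e9 : gip N v z = 0 := Finset.sum_eq_zero fun i _ => by rw [hN0, zero_mul]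
  have p1 : 0 ≤ θ z * ((pd tv v z + 2 * gip φ v z + lap φ z * v z) ^ 2 +
      (lap v z + V z * v z + N z * v z) ^ 2) := mul_nonneg (hθn z) (by positivity)
  have p2 : 0 ≤ -pd tv θ z * gip v v z :=
    mul_nonneg (neg_nonneg.2 (hθt z)) (Finset.sum_nonneg fun i _ => mul_self_nonneg _)
  rw [e2, e3, gip_comm (f := pd tv v), gip_comm (f := gip φ v), sum_pd_gip hφ hv,
    gip_comm (f := gip v v), gip_mul_left hΛ hv, gip_mul_left hv hv, gip_mul_left hVs hv2,
    gip_mul_left hv hv, gip_mul_left hN hv, e9, gip_comm (f := v) (g := lap φ),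
    gip_comm (f := v) (g := φ)]
  linarith

end Smooth

section Weighted

variable {d : ℕ} {w φ : Spc d × ℝ → ℝ}

theorem pd_exp_mul (hφ : ContDiff ℝ ∞ φ) (hw : ContDiff ℝ ∞ w) (e z : Spc d × ℝ) :
    pd e (fun y => rexp (φ y) * w y) z = rexp (φ z) * (pd e φ z * w z + pd e w z) := by
  rw [pd_mul_smooth hφ.exp hw, pd_comp (Real.hasDerivAt_exp _) (hφ.differentiable (by simp) z)]
  ring

theorem lap_exp_mul (hφ : ContDiff ℝ ∞ φ) (hw : ContDiff ℝ ∞ w) (z : Spc d × ℝ) :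
    lap (fun y => rexp (φ y) * w y) z =
      rexp (φ z) * (gip φ φ z * w z + 2 * gip φ w z + lap φ z * w z + lap w z) := by
  have h : ∀ i, pd (sv i) (pd (sv i) fun y => rexp (φ y) * w y) z =
      rexp (φ z) * (pd (sv i) φ z * pd (sv i) φ z * w z + 2 * (pd (sv i) φ z * pd (sv i) w z) +
        pd (sv i) (pd (sv i) φ) z * w z + pd (sv i) (pd (sv i) w) z) := by
    intro i
    rw [show pd (sv i) (fun y => rexp (φ y) * w y) = fun y => rexp (φ y) *
      (pd (sv i) φ y * w y + pd (sv i) w y) from funext fun y => pd_exp_mul hφ hw _ _,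
      pd_exp_mul hφ ((hφ.pd_infty.mul hw).add hw.pd_infty),
      pd_add ((hφ.pd_infty.mul hw).differentiable (by simp) z)
        (hw.pd_infty.differentiable (by simp) z), pd_mul_smooth hφ.pd_infty hw]
    ring
  simp only [lap, gip, h, ← Finset.mul_sum, Finset.sum_add_distrib, Finset.sum_mul]

theorem gip_exp_mul (f : Spc d × ℝ → ℝ) (hφ : ContDiff ℝ ∞ φ) (hw : ContDiff ℝ ∞ w)
    (z : Spc d × ℝ) :
    gip f (fun y => rexp (φ y) * w y) z = rexp (φ z) * (gip f φ z * w z + gip f w z) := by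
  simp only [gip, pd_exp_mul hφ hw, Finset.sum_mul, Finset.mul_sum, ← Finset.sum_add_distrib]
  exact Finset.sum_congr rfl fun i _ => by ring

theorem heat_exp_mul (hφ : ContDiff ℝ ∞ φ) (hw : ContDiff ℝ ∞ w) (z : Spc d × ℝ) :
    pd tv (fun y => rexp (φ y) * w y) z + 2 * gip φ (fun y => rexp (φ y) * w y) z
      + lap φ z * (rexp (φ z) * w z) - lap (fun y => rexp (φ y) * w y) z
      - (gip φ φ z + pd tv φ z) * (rexp (φ z) * w z) = rexp (φ z) * (pd tv w z - lap w z) := by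
  rw [pd_exp_mul hφ hw, gip_exp_mul φ hφ hw, lap_exp_mul hφ hw]
  ring

theorem gip_self_exp_mul_ge (hφ : ContDiff ℝ ∞ φ) (hw : ContDiff ℝ ∞ w) (z : Spc d × ℝ) :
    rexp (φ z) ^ 2 * (gip w w z / 2 - gip φ φ z * w z ^ 2) ≤
      gip (fun y => rexp (φ y) * w y) (fun y => rexp (φ y) * w y) z := by
  have h : 0 ≤ ∑ i, (2 * pd (sv i) φ z * w z + pd (sv i) w z) ^ 2 :=
    Finset.sum_nonneg fun _ _ => sq_nonneg _
  have e : ∑ i, (2 * pd (sv i) φ z * w z + pd (sv i) w z) ^ 2 =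
      4 * (gip φ φ z * w z ^ 2) + 4 * (gip φ w z * w z) + gip w w z := by
    simp only [gip, Finset.sum_mul, Finset.mul_sum, ← Finset.sum_add_distrib]
    exact Finset.sum_congr rfl fun i _ => by ring
  rw [e] at h
  have e1 : gip (fun y => rexp (φ y) * w y) φ z =
      rexp (φ z) * (gip φ φ z * w z + gip φ w z) := by
    rw [gip_comm, gip_exp_mul φ hφ hw]
  have e2 : gip (fun y => rexp (φ y) * w y) w z =
      rexp (φ z) * (gip φ w z * w z + gip w w z) := by
    rw [gip_comm, gip_exp_mul w hφ hw, gip_comm (f := w) (g := φ)]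
  rw [gip_exp_mul _ hφ hw, e1, e2]
  nlinarith [mul_nonneg (sq_nonneg (rexp (φ z))) h]

/-- The zeroth-order coefficient produced by the Carleman commutator computation. -/
noncomputable def carlemanQ (φ N V : Spc d × ℝ → ℝ) (z : Spc d × ℝ) : ℝ :=
  pd tv V z + 2 * gip V φ z - lap (lap φ) z - 2 * N z * V z - N z ^ 2

/-- The weighted Carleman inequality for smooth functions and smooth weights. -/
theorem carleman_weighted {θ N V : Spc d × ℝ → ℝ} (hw : ContDiff ℝ ∞ w)
    (hc : HasCompactSupport w)
    (hφ : ContDiff ℝ ∞ φ) (hθ : ContDiff ℝ ∞ θ) (hN : ContDiff ℝ ∞ N)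
    (hθ0 : ∀ i z, pd (sv i) θ z = 0) (hN0 : ∀ i z, pd (sv i) N z = 0)
    (hθn : ∀ z, 0 ≤ θ z) (hθt : ∀ z, pd tv θ z ≤ 0)
    (hV : V = fun z => gip φ φ z + pd tv φ z)
    (hH : ∀ z ∈ tsupport w, ∀ f, gip f f z / 2 ≤ 4 * hessGrad φ f z + 2 * N z * gip f f z)
    (hQ : ∀ z ∈ tsupport w, 1 / 16 + gip φ φ z / 8 ≤ carlemanQ φ N V z) :
    ∫ z, θ z * rexp (φ z) ^ 2 / 16 * (w z ^ 2 + gip w w z) ≤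
      (∫ z, θ z * rexp (φ z) ^ 2 * (pd tv w z - lap w z) ^ 2) +
      ∫ z, -pd tv θ z * max (V z) 0 * rexp (φ z) ^ 2 * w z ^ 2 := by
  set v : Spc d × ℝ → ℝ := fun y => rexp (φ y) * w y with hv
  have hvs : ContDiff ℝ ∞ v := hφ.exp.mul hw
  have hVs : ContDiff ℝ ∞ V := by rw [hV]; exact (contDiff_gip hφ hφ).add hφ.pd_infty
  have key := carleman_conj hvs hc.mul_left hφ hθ hN hθ0 hN0 hθn hθt hV
  have e1 : ∀ z, θ z * (pd tv v z + 2 * gip φ v z + lap φ z * v z - lap v z - V z * v z) ^ 2 =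
      θ z * rexp (φ z) ^ 2 * (pd tv w z - lap w z) ^ 2 := by
    intro z
    have := heat_exp_mul hφ hw z
    simp only [hV, hv] at this ⊢
    rw [this]
    ring
  simp only [e1] at key
  have z0 : ∀ z ∉ tsupport w, w z = 0 ∧ gip w w z = 0 ∧ v z = 0 ∧ gip v v z = 0 ∧
      hessGrad φ v z = 0 := by
    intro z hz
    have h1 : ∀ e, pd e w z = 0 := fun e => pd_eq_zero_of_notMem_tsupport hz
    have h0 : w z = 0 := image_eq_zero_of_notMem_tsupport hz
    have h2 : ∀ e, pd e v z = 0 := fun e => by rw [pd_exp_mul hφ hw, h1, h0]; ring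
    refine ⟨h0, ?_, by simp [hv, h0], ?_, ?_⟩
    · exact Finset.sum_eq_zero fun i _ => by rw [h1, mul_zero]
    · exact Finset.sum_eq_zero fun i _ => by rw [h2, mul_zero]
    · exact Finset.sum_eq_zero fun i _ => Finset.sum_eq_zero fun j _ => by rw [h2 (sv i), mul_zero, zero_mul]
  have c1 := hw.continuous
  have c2 := hvs.continuous
  have c3 := hθ.continuous
  have c4 := (hθ.pd_infty (e := tv)).continuous
  have c5 := hφ.continuous
  have c6 := hVs.continuous
  have c7 := (contDiff_gip hw hw).continuous
  have c8 := (contDiff_gip hvs hvs).continuous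
  have c9 := hN.continuous
  have c10 := (hVs.pd_infty (e := tv)).continuous
  have c11 := (contDiff_gip hVs hφ).continuous
  have c12 := (contDiff_lap (contDiff_lap hφ)).continuous
  have c13 : Continuous (hessGrad φ v) := continuous_finsetSum _ fun i _ =>
    continuous_finsetSum _ fun j _ => (hφ.pd_infty.pd_infty.continuous.mul
      hvs.pd_infty.continuous).mul hvs.pd_infty.continuous
  have i1 : Integrable fun z => θ z * rexp (φ z) ^ 2 / 16 * (w z ^ 2 + gip w w z) := by
    refine Continuous.integrable_of_hasCompactSupport (by fun_prop)
      (HasCompactSupport.intro hc fun z hz => ?_)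
    obtain ⟨h1, h2, -⟩ := z0 z hz
    simp [h1, h2]
  have i2 : Integrable fun z => -pd tv θ z * max (V z) 0 * rexp (φ z) ^ 2 * w z ^ 2 := by
    refine Continuous.integrable_of_hasCompactSupport (by fun_prop)
      (HasCompactSupport.intro hc fun z hz => ?_)
    simp [(z0 z hz).1]
  have i3 : Integrable fun z => (pd tv θ z * V z * v z ^ 2 + θ z * ((pd tv V z + 2 * gip V φ z
      - lap (lap φ) z - 2 * N z * V z - N z ^ 2) * v z ^ 2 + 4 * hessGrad φ v z
      + 2 * N z * gip v v z)) := by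
    refine Continuous.integrable_of_hasCompactSupport (by fun_prop)
      (HasCompactSupport.intro hc fun z hz => ?_)
    obtain ⟨-, -, h3, h4, h5⟩ := z0 z hz
    simp [h3, h4, h5]
  have hle := integral_mono i1 (i3.add i2) fun z => ?_
  · rw [integral_add' i3 i2] at hle
    linarith
  · by_cases hz : z ∈ tsupport w
    · have h1 := hH z hz v
      have h2 := hQ z hz
      have h3 := gip_self_exp_mul_ge hφ hw z
      have h4 : 0 ≤ gip v v z := Finset.sum_nonneg fun i _ => mul_self_nonneg _
      have h5 : 0 ≤ -pd tv θ z * (max (V z) 0 - V z) * v z ^ 2 :=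
        mul_nonneg (mul_nonneg (neg_nonneg.2 (hθt z)) (sub_nonneg.2 (le_max_left _ _)))
          (sq_nonneg _)
      have h6 : v z ^ 2 = rexp (φ z) ^ 2 * w z ^ 2 := by simp only [hv]; ring
      have h7 := mul_le_mul_of_nonneg_right h2 (sq_nonneg (v z))
      have h8 : rexp (φ z) ^ 2 / 16 * (w z ^ 2 + gip w w z) ≤ carlemanQ φ N V z * v z ^ 2
          + 4 * hessGrad φ v z + 2 * N z * gip v v z := by
        rw [h6] at h7 ⊢
        nlinarith
      have h9 := mul_le_mul_of_nonneg_left h8 (hθn z)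
      simp only [Pi.add_apply]
      unfold carlemanQ at h9
      rw [h6] at h5 h9 ⊢
      linarith
    · obtain ⟨h1, h2, h3, h4, h5⟩ := z0 z hz
      simp [h1, h2, h3, h4, h5]

end Weighted

section Local

variable {d : ℕ} {f f' g g' φ φ' : Spc d × ℝ → ℝ} {z : Spc d × ℝ}

theorem gip_congr_nhds (hf : f =ᶠ[𝓝 z] f') (hg : g =ᶠ[𝓝 z] g') : gip f g =ᶠ[𝓝 z] gip f' g' := by
  have h1 : ∀ᶠ y in 𝓝 z, ∀ i, pd (sv i) f y = pd (sv i) f' y :=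
    eventually_all.2 fun i => pd_congr_nhds hf
  have h2 : ∀ᶠ y in 𝓝 z, ∀ i, pd (sv i) g y = pd (sv i) g' y :=
    eventually_all.2 fun i => pd_congr_nhds hg
  filter_upwards [h1, h2] with y hy hy'
  exact Finset.sum_congr rfl fun i _ => by rw [hy i, hy' i]

theorem lap_congr_nhds (hf : f =ᶠ[𝓝 z] f') : lap f =ᶠ[𝓝 z] lap f' := by
  have h1 : ∀ᶠ y in 𝓝 z, ∀ i, pd (sv i) (pd (sv i) f) y = pd (sv i) (pd (sv i) f') y :=
    eventually_all.2 fun i => pd_congr_nhds (pd_congr_nhds hf)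
  filter_upwards [h1] with y hy
  exact Finset.sum_congr rfl fun i _ => hy i

theorem hessGrad_congr (hφ : φ =ᶠ[𝓝 z] φ') : hessGrad φ f z = hessGrad φ' f z := by
  refine Finset.sum_congr rfl fun i _ => Finset.sum_congr rfl fun j _ => ?_
  rw [pd_congr (pd_congr_nhds hφ)]

/-- The potential `|∇φ|² + ∂ₛφ`. -/
noncomputable def potential (φ : Spc d × ℝ → ℝ) (z : Spc d × ℝ) : ℝ := gip φ φ z + pd tv φ z

theorem potential_congr_nhds (hφ : φ =ᶠ[𝓝 z] φ') : potential φ =ᶠ[𝓝 z] potential φ' := by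
  filter_upwards [gip_congr_nhds hφ hφ, pd_congr_nhds hφ] with y hy hy'
  rw [potential, potential, hy, hy']

theorem carlemanQ_congr {N : Spc d × ℝ → ℝ} {V V' : Spc d × ℝ → ℝ} (hφ : φ =ᶠ[𝓝 z] φ')
    (hV : V =ᶠ[𝓝 z] V') : carlemanQ φ N V z = carlemanQ φ' N V' z := by
  rw [carlemanQ, carlemanQ, pd_congr hV, (gip_congr_nhds hV hφ).self_of_nhds,
    (lap_congr_nhds (lap_congr_nhds hφ)).self_of_nhds, hV.self_of_nhds]

/-- The weighted Carleman inequality for smooth functions supported in an open set on which the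
weight is smooth. -/
theorem carleman_weighted_local {w θ N : Spc d × ℝ → ℝ} {Ω : Set (Spc d × ℝ)} (hΩ : IsOpen Ω)
    (hw : ContDiff ℝ ∞ w) (hc : HasCompactSupport w) (hs : tsupport w ⊆ Ω)
    (hφ : ContDiffOn ℝ ∞ φ Ω) (hθ : ContDiff ℝ ∞ θ) (hN : ContDiff ℝ ∞ N)
    (hθ0 : ∀ i z, pd (sv i) θ z = 0) (hN0 : ∀ i z, pd (sv i) N z = 0)
    (hθn : ∀ z, 0 ≤ θ z) (hθt : ∀ z, pd tv θ z ≤ 0)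
    (hH : ∀ z ∈ Ω, ∀ f, gip f f z / 2 ≤ 4 * hessGrad φ f z + 2 * N z * gip f f z)
    (hQ : ∀ z ∈ Ω, 1 / 16 + gip φ φ z / 8 ≤ carlemanQ φ N (potential φ) z) :
    ∫ z, θ z * rexp (φ z) ^ 2 / 16 * (w z ^ 2 + gip w w z) ≤
      (∫ z, θ z * rexp (φ z) ^ 2 * (pd tv w z - lap w z) ^ 2) +
      ∫ z, -pd tv θ z * max (potential φ z) 0 * rexp (φ z) ^ 2 * w z ^ 2 := by
  obtain ⟨χ, hχ, hχc, hχs, hχ1, -⟩ := exists_smooth_cutoff hc hΩ hs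
  set φ' : Spc d × ℝ → ℝ := fun z => χ z * φ z with hφ'
  have hφs : ContDiff ℝ ∞ φ' := contDiff_of_contDiffAt_tsupport fun z hz =>
    hχ.contDiffAt.mul (hφ.contDiffAt (hΩ.mem_nhds (hχs (tsupport_mul_subset_left hz))))
  have he : ∀ z ∈ tsupport w, φ' =ᶠ[𝓝 z] φ := fun z hz =>
    (hχ1 z hz).mono fun y hy => by simp only [hφ', hy, one_mul]
  have key := carleman_weighted (V := potential φ') hw hc hφs hθ hN hθ0 hN0 hθn hθt rfl
    (fun z hz f => by rw [hessGrad_congr (he z hz)]; exact hH z (hs hz) f)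
    (fun z hz => by
      rw [(gip_congr_nhds (he z hz) (he z hz)).self_of_nhds,
        carlemanQ_congr (he z hz) (potential_congr_nhds (he z hz))]
      exact hQ z (hs hz))
  have e : ∀ z, z ∈ tsupport w ∨ (w z = 0 ∧ gip w w z = 0 ∧ pd tv w z = 0 ∧ lap w z = 0) := by
    intro z
    by_cases hz : z ∈ tsupport w
    · exact Or.inl hz
    · have h1 : w =ᶠ[𝓝 z] fun _ => 0 := notMem_tsupport_iff_eventuallyEq.1 hz
      refine Or.inr ⟨h1.self_of_nhds, ?_, ?_, ?_⟩
      · exact Finset.sum_eq_zero fun i _ => by rw [pd_congr h1, pd_const, mul_zero]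
      · rw [pd_congr h1, pd_const]
      · refine Finset.sum_eq_zero fun i _ => pd_eq_zero_of_notMem_tsupport fun h => hz ?_
        exact tsupport_pd_subset h
  convert key using 2
  · refine funext fun z => ?_
    rcases e z with hz | ⟨h1, h2, -, -⟩
    · rw [(he z hz).self_of_nhds]
    · rw [h1, h2]; simp
  · refine integral_congr_ae (Eventually.of_forall fun z => ?_)
    rcases e z with hz | ⟨-, -, h1, h2⟩
    · simp only [(he z hz).self_of_nhds]
    · simp only [h1, h2]; simp
  · refine integral_congr_ae (Eventually.of_forall fun z => ?_)
    rcases e z with hz | ⟨h1, -⟩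
    · simp only [(he z hz).self_of_nhds, (potential_congr_nhds (he z hz)).self_of_nhds]
    · simp only [h1]; simp

end Local

section Profile

variable {d : ℕ} {F : Spc d × ℝ → ℝ} {z : Spc d × ℝ} {c : ℝ} {i : Fin d}

theorem pd_eq_of_hasDerivAt {e : Spc d × ℝ} (hF : DifferentiableAt ℝ F z)
    (h : HasDerivAt (fun t : ℝ => F (z + t • e)) c 0) : pd e F z = c := by
  have h1 : HasDerivAt (fun t : ℝ => z + t • e) e 0 := by
    simpa using ((hasDerivAt_id (0:ℝ)).smul_const e).const_add z
  have h2 : HasFDerivAt F (fderiv ℝ F z) (z + (0:ℝ) • e) := by simpa using hF.hasFDerivAt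
  exact (h2.comp_hasDerivAt (0:ℝ) h1).unique h

/-- Spatial derivative of a function of the form `a(xᵢ, s) + b(s)|x|²`. -/
theorem pd_sv_profile {a : ℝ → ℝ → ℝ} {b : ℝ → ℝ} (j : Fin d)
    (hF : DifferentiableAt ℝ (fun z : Spc d × ℝ => a (z.1 i) z.2 + b z.2 * ‖z.1‖ ^ 2) z)
    (ha : HasDerivAt (fun y => a y z.2) c (z.1 i)) :
    pd (sv j) (fun z : Spc d × ℝ => a (z.1 i) z.2 + b z.2 * ‖z.1‖ ^ 2) z =
      (if j = i then c else 0) + 2 * b z.2 * z.1 j := by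
  refine pd_eq_of_hasDerivAt hF ?_
  have e1 : ∀ t : ℝ, ‖z.1 + t • bv j‖ ^ 2 = ‖z.1‖ ^ 2 + 2 * t * z.1 j + t ^ 2 := by
    intro t
    rw [norm_add_sq_real, norm_smul, inner_smul_right]
    simp [bv, EuclideanSpace.inner_single_right]
    ring
  have h2 : HasDerivAt (fun t : ℝ => b z.2 * (‖z.1‖ ^ 2 + 2 * t * z.1 j + t ^ 2))
      (2 * b z.2 * z.1 j) 0 := by
    have := ((((((hasDerivAt_id (0:ℝ)).const_mul 2).mul_const (z.1 j)).const_add (‖z.1‖ ^ 2)).add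
      ((hasDerivAt_id (0:ℝ)).pow 2)).const_mul (b z.2))
    refine this.congr_deriv ?_
    simp; ring
  have h3 : HasDerivAt (fun t : ℝ => a ((z.1 + t • bv j) i) z.2) (if j = i then c else 0) 0 := by
    have h4 : HasDerivAt (fun t : ℝ => (z.1 + t • bv j) i) (if j = i then 1 else 0) 0 := by
      have := ((hasDerivAt_id (0:ℝ)).mul_const (bv j i)).const_add (z.1 i)
      refine this.congr_deriv ?_
      simp [bv, eq_comm]
    have h5 : HasDerivAt (fun y => a y z.2) c ((z.1 + (0:ℝ) • bv j) i) := by simpa using ha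
    refine (h5.comp (0:ℝ) h4).congr_deriv ?_
    split_ifs <;> simp
  refine (h3.add h2).congr_of_eventuallyEq (Eventually.of_forall fun t => ?_)
  simp only [sv, Prod.fst_add, Prod.smul_fst, Prod.snd_add, Prod.smul_snd, smul_zero, add_zero,
    Pi.add_apply]
  rw [e1]

/-- Time derivative of a function of the form `a(xᵢ, s) + b(s)|x|²`. -/
theorem pd_tv_profile {a : ℝ → ℝ → ℝ} {b : ℝ → ℝ} {b' : ℝ}
    (hF : DifferentiableAt ℝ (fun z : Spc d × ℝ => a (z.1 i) z.2 + b z.2 * ‖z.1‖ ^ 2) z)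
    (ha : HasDerivAt (fun s => a (z.1 i) s) c z.2) (hb : HasDerivAt b b' z.2) :
    pd tv (fun z : Spc d × ℝ => a (z.1 i) z.2 + b z.2 * ‖z.1‖ ^ 2) z = c + b' * ‖z.1‖ ^ 2 := by
  have h := hasDerivAt_slice (x := z.1) (s := z.2) hF
  have h' := ha.add (hb.mul_const (‖z.1‖ ^ 2))
  exact h.unique h'

theorem gip_profile {F G : Spc d × ℝ → ℝ} {c b c' b' : ℝ}
    (hF : ∀ j, pd (sv j) F z = (if j = i then c else 0) + 2 * b * z.1 j)
    (hG : ∀ j, pd (sv j) G z = (if j = i then c' else 0) + 2 * b' * z.1 j) :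
    gip F G z = c * c' + 2 * (b' * c + b * c') * z.1 i + 4 * b * b' * ‖z.1‖ ^ 2 := by
  have h : ∀ j, pd (sv j) F z * pd (sv j) G z = (if j = i then c * c' + 2 * b' * c * z.1 j
      + 2 * b * c' * z.1 j else 0) + 4 * b * b' * z.1 j ^ 2 := by
    intro j
    rw [hF, hG]
    split_ifs <;> ring
  simp only [gip, h, Finset.sum_add_distrib, Finset.sum_ite_eq', Finset.mem_univ, if_true,
    ← Finset.mul_sum, ← norm_sq_eq_sum]
  ring

end Profile

section Weight

variable {d : ℕ} {i : Fin d} {κ C S : ℝ} {z : Spc d × ℝ}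

/-- The weight exponent of the Carleman inequality. -/
noncomputable def wt (κ C S : ℝ) (i : Fin d) (z : Spc d × ℝ) : ℝ :=
  (S ^ 3 * rexp (κ * z.2) * z.1 i ^ (5 / 4 : ℝ) - C * S ^ 8 * (z.2 - 1 / 2) ^ 2) +
    (-(1 + z.2) / 16) * ‖z.1‖ ^ 2

theorem contDiffAt_coord_rpow (p : ℝ) (hz : 0 < z.1 i) :
    ContDiffAt ℝ ∞ (fun z : Spc d × ℝ => z.1 i ^ p) z :=
  ((contDiff_coord (i := i)).contDiffAt.comp z contDiffAt_fst).rpow_const_of_ne hz.ne'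

theorem eventually_coord_pos (hz : 0 < z.1 i) : ∀ᶠ y : Spc d × ℝ in 𝓝 z, 0 < y.1 i := by
  have : Continuous fun y : Spc d × ℝ => y.1 i := by fun_prop
  exact this.continuousAt.eventually (lt_mem_nhds hz)

theorem contDiffAt_wt (hz : 0 < z.1 i) : ContDiffAt ℝ ∞ (wt κ C S i) z := by
  have := contDiffAt_coord_rpow (5 / 4) hz
  unfold wt
  exact ((((contDiff_const.mul (contDiff_const.mul contDiff_snd).exp).contDiffAt.mul this).sub
    (contDiff_const.mul ((contDiff_snd.sub contDiff_const).pow 2)).contDiffAt).add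
    (((contDiff_const.add contDiff_snd).neg.div_const 16).mul
      (contDiff_fst.norm_sq ℝ)).contDiffAt)

theorem pd_sv_wt (hz : 0 < z.1 i) (j : Fin d) :
    pd (sv j) (wt κ C S i) z =
      (if j = i then S ^ 3 * rexp (κ * z.2) * (5 / 4 * z.1 i ^ (1 / 4 : ℝ)) else 0) +
        2 * (-(1 + z.2) / 16) * z.1 j := by
  refine pd_sv_profile (a := fun y s => S ^ 3 * rexp (κ * s) * y ^ (5 / 4 : ℝ)
    - C * S ^ 8 * (s - 1 / 2) ^ 2) (b := fun s => -(1 + s) / 16) j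
    ((contDiffAt_wt hz).differentiableAt (by simp)) ?_
  refine (((Real.hasDerivAt_rpow_const (p := 5 / 4) (Or.inl hz.ne')).const_mul _).sub_const
    _).congr_deriv ?_
  norm_num

theorem pd_tv_wt (hz : 0 < z.1 i) :
    pd tv (wt κ C S i) z = κ * (S ^ 3 * rexp (κ * z.2) * z.1 i ^ (5 / 4 : ℝ))
      - 2 * C * S ^ 8 * (z.2 - 1 / 2) + -1 / 16 * ‖z.1‖ ^ 2 := by
  refine pd_tv_profile (a := fun y s => S ^ 3 * rexp (κ * s) * y ^ (5 / 4 : ℝ)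
    - C * S ^ 8 * (s - 1 / 2) ^ 2) (b := fun s => -(1 + s) / 16)
    ((contDiffAt_wt hz).differentiableAt (by simp)) ?_ ?_
  · have := ((((((hasDerivAt_id z.2).const_mul κ).exp.const_mul (S ^ 3)).mul_const
      (z.1 i ^ (5 / 4 : ℝ)))).sub ((((hasDerivAt_id z.2).sub_const (1 / 2)).pow 2).const_mul
      (C * S ^ 8)))
    refine this.congr_deriv ?_
    simp; ring
  · refine (((hasDerivAt_id z.2).const_add 1).neg.div_const 16).congr_deriv ?_
    norm_num

theorem rpow_quarter {y : ℝ} (hy : 0 < y) :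
    (y ^ (1 / 4 : ℝ)) ^ 4 = y ∧ y ^ (5 / 4 : ℝ) = (y ^ (1 / 4 : ℝ)) ^ 5 ∧
      y ^ (1 / 2 : ℝ) = (y ^ (1 / 4 : ℝ)) ^ 2 ∧ y ^ (-1 / 2 : ℝ) = ((y ^ (1 / 4 : ℝ)) ^ 2)⁻¹ ∧
      y ^ (-11 / 4 : ℝ) = ((y ^ (1 / 4 : ℝ)) ^ 11)⁻¹ := by
  refine ⟨?_, ?_, ?_, ?_, ?_⟩
  all_goals
    rw [← Real.rpow_natCast, ← Real.rpow_mul hy.le]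
    try rw [← Real.rpow_neg hy.le]
    norm_num

theorem potential_wt (hz : 0 < z.1 i) :
    potential (wt κ C S i) z =
      (25 / 16 * S ^ 6 * rexp (2 * κ * z.2) * z.1 i ^ (1 / 2 : ℝ) + (κ - 5 / 16 * (1 + z.2)) *
        (S ^ 3 * rexp (κ * z.2) * z.1 i ^ (5 / 4 : ℝ)) - 2 * C * S ^ 8 * (z.2 - 1 / 2)) +
        ((1 + z.2) ^ 2 / 64 - 1 / 16) * ‖z.1‖ ^ 2 := by
  obtain ⟨h1, h2, h3, -, -⟩ := rpow_quarter hz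
  rw [potential, pd_tv_wt hz, gip_profile (pd_sv_wt hz) (pd_sv_wt hz), h2, h3,
    show 2 * κ * z.2 = κ * z.2 + κ * z.2 by ring, Real.exp_add]
  have e : z.1 i ^ (1 / 4 : ℝ) * z.1 i = (z.1 i ^ (1 / 4 : ℝ)) ^ 5 := by
    rw [pow_succ' _ 4, h1]
  linear_combination (-5 / 16 * (1 + z.2) * S ^ 3 * rexp (κ * z.2)) * e

theorem pd_sv_linear (j k : Fin d) (b : ℝ → ℝ) (hb : DifferentiableAt ℝ b z.2) :
    pd (sv k) (fun z : Spc d × ℝ => b z.2 * z.1 j) z = if k = j then b z.2 else 0 := by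
  have hd : DifferentiableAt ℝ (fun z : Spc d × ℝ => b z.2 * z.1 j) z := by
    have h1 : DifferentiableAt ℝ (fun z : Spc d × ℝ => b z.2) z :=
      DifferentiableAt.comp (g := b) z hb differentiableAt_snd
    have h2 : DifferentiableAt ℝ (fun z : Spc d × ℝ => z.1 j) z := by fun_prop
    exact h1.mul h2
  refine pd_eq_of_hasDerivAt hd ?_
  have := (((hasDerivAt_id (0:ℝ)).mul_const (bv k j)).const_add (z.1 j)).const_mul (b z.2)
  refine (this.congr_of_eventuallyEq (Eventually.of_forall fun t => ?_)).congr_deriv ?_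
  · simp
  · simp [bv, eq_comm]

theorem pd_sv_single {a : ℝ → ℝ → ℝ} {c : ℝ} (j k : Fin d)
    (hF : DifferentiableAt ℝ (fun z : Spc d × ℝ => a (z.1 i) z.2) z)
    (ha : HasDerivAt (fun y => a y z.2) c (z.1 i)) :
    pd (sv k) (fun z : Spc d × ℝ => if j = i then a (z.1 i) z.2 else 0) z =
      if j = i then (if k = i then c else 0) else 0 := by
  by_cases hj : j = i
  · have := pd_sv_profile (b := fun _ => 0) k (by simpa using hF) ha
    simpa [hj] using this
  · simp only [hj, if_false, pd_const]

theorem pd_pd_wt (hz : 0 < z.1 i) (j k : Fin d) :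
    pd (sv k) (pd (sv j) (wt κ C S i)) z =
      (if j = i then (if k = i then S ^ 3 * rexp (κ * z.2) * (5 / 16 * z.1 i ^ (-3 / 4 : ℝ))
        else 0) else 0) + if k = j then 2 * (-(1 + z.2) / 16) else 0 := by
  have e := (eventually_coord_pos hz).mono fun y hy => pd_sv_wt (κ := κ) (C := C) (S := S) hy j
  have hd : DifferentiableAt ℝ (fun z : Spc d × ℝ =>
      S ^ 3 * rexp (κ * z.2) * (5 / 4 * z.1 i ^ (1 / 4 : ℝ))) z := by
    have := (contDiffAt_coord_rpow (1 / 4) hz).differentiableAt (by simp)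
    exact (by fun_prop : DifferentiableAt ℝ (fun z : Spc d × ℝ => S ^ 3 * rexp (κ * z.2)) z).mul
      (this.const_mul _)
  have hd' : DifferentiableAt ℝ (fun z : Spc d × ℝ =>
      if j = i then S ^ 3 * rexp (κ * z.2) * (5 / 4 * z.1 i ^ (1 / 4 : ℝ)) else 0) z := by
    split_ifs
    · exact hd
    · exact differentiableAt_const _
  rw [pd_congr e, pd_add hd' (by fun_prop),
    pd_sv_single (a := fun y s => S ^ 3 * rexp (κ * s) * (5 / 4 * y ^ (1 / 4 : ℝ))) j k hd
      (((Real.hasDerivAt_rpow_const (p := 1 / 4) (Or.inl hz.ne')).const_mul _).const_mul _),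
    pd_sv_linear j k (fun s => 2 * (-(1 + s) / 16)) (by fun_prop)]
  norm_num
  ring_nf

theorem hessGrad_wt (hz : 0 < z.1 i) (f : Spc d × ℝ → ℝ) :
    hessGrad (wt κ C S i) f z =
      S ^ 3 * rexp (κ * z.2) * (5 / 16 * z.1 i ^ (-3 / 4 : ℝ)) * pd (sv i) f z ^ 2
        + 2 * (-(1 + z.2) / 16) * gip f f z := by
  simp only [hessGrad, pd_pd_wt hz, gip, add_mul, Finset.sum_add_distrib, ite_mul, zero_mul,
    Finset.sum_ite_eq', Finset.sum_ite_eq, Finset.mem_univ, if_true, Finset.mul_sum]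
  congr 1
  · ring
  · exact Finset.sum_congr rfl fun _ _ => by ring

theorem lap_wt (hz : 0 < z.1 i) :
    lap (wt κ C S i) z = S ^ 3 * rexp (κ * z.2) * (5 / 16 * z.1 i ^ (-3 / 4 : ℝ)) +
      d * (2 * (-(1 + z.2) / 16)) := by
  simp [lap, pd_pd_wt hz, Finset.sum_add_distrib]

theorem lap_lap_wt (hz : 0 < z.1 i) :
    lap (lap (wt κ C S i)) z =
      S ^ 3 * rexp (κ * z.2) * (105 / 256 * z.1 i ^ (-11 / 4 : ℝ)) := by
  have hd : ∀ (c p : ℝ) (y : Spc d × ℝ), 0 < y.1 i → DifferentiableAt ℝ (fun z : Spc d × ℝ =>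
      S ^ 3 * rexp (κ * z.2) * (c * z.1 i ^ p)) y := by
    intro c p y hy
    have := (contDiffAt_coord_rpow p hy).differentiableAt (by simp)
    exact (by fun_prop : DifferentiableAt ℝ (fun z : Spc d × ℝ => S ^ 3 * rexp (κ * z.2)) y).mul
      (this.const_mul _)
  have e1 : ∀ (j : Fin d) (y : Spc d × ℝ), 0 < y.1 i → pd (sv j) (lap (wt κ C S i)) y =
      if j = i then S ^ 3 * rexp (κ * y.2) * (-15 / 64 * y.1 i ^ (-7 / 4 : ℝ)) else 0 := by
    intro j y hy
    rw [pd_congr ((eventually_coord_pos hy).mono fun x hx => lap_wt hx),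
      pd_add (hd _ _ _ hy) (by fun_prop)]
    have h1 := pd_sv_single (z := y) (a := fun y s => S ^ 3 * rexp (κ * s) *
      (5 / 16 * y ^ (-3 / 4 : ℝ))) i j (hd _ _ _ hy)
      (((Real.hasDerivAt_rpow_const (p := -3 / 4) (Or.inl hy.ne')).const_mul _).const_mul _)
    have h2 := pd_sv_profile (i := j) (z := y) (c := 0) (a := fun _ s => d * (2 * (-(1 + s) / 16)))
      (b := fun _ => 0) j (by simp only [zero_mul, add_zero]; fun_prop)
      (hasDerivAt_const _ _)
    simp only [if_true, zero_mul, add_zero, mul_zero, ite_self] at h1 h2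
    rw [h1, h2, add_zero]
    norm_num
    refine if_congr Iff.rfl ?_ rfl
    ring
  have e2 : ∀ j : Fin d, pd (sv j) (pd (sv j) (lap (wt κ C S i))) z =
      if j = i then S ^ 3 * rexp (κ * z.2) * (105 / 256 * z.1 i ^ (-11 / 4 : ℝ)) else 0 := by
    intro j
    rw [pd_congr ((eventually_coord_pos hz).mono fun x hx => e1 j x hx),
      pd_sv_single (a := fun y s => S ^ 3 * rexp (κ * s) * (-15 / 64 * y ^ (-7 / 4 : ℝ))) j j
      (hd _ _ _ hz)
      (((Real.hasDerivAt_rpow_const (p := -7 / 4) (Or.inl hz.ne')).const_mul _).const_mul _)]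
    norm_num
    split_ifs
    · ring
    · rfl
  simp only [lap] at e2 ⊢
  simp [e2]

end Weight

section WeightBound

variable {d : ℕ} {i : Fin d} {κ C S : ℝ} {z : Spc d × ℝ}

theorem contDiffAt_potential_wt (hz : 0 < z.1 i) : ContDiffAt ℝ ∞ (potential (wt κ C S i)) z := by
  have h : ContDiffAt ℝ ∞ (wt κ C S i) z := contDiffAt_wt hz
  exact (ContDiffAt.sum fun j _ => (h.pd (by simp)).mul (h.pd (by simp))).add (h.pd (by simp))

theorem pd_sv_potential_wt (hz : 0 < z.1 i) (j : Fin d) :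
    pd (sv j) (potential (wt κ C S i)) z =
      (if j = i then 25 / 16 * S ^ 6 * rexp (2 * κ * z.2) * (1 / 2 * z.1 i ^ (-1 / 2 : ℝ)) +
        (κ - 5 / 16 * (1 + z.2)) * (S ^ 3 * rexp (κ * z.2) * (5 / 4 * z.1 i ^ (1 / 4 : ℝ)))
        else 0) + 2 * ((1 + z.2) ^ 2 / 64 - 1 / 16) * z.1 j := by
  have e := (eventually_coord_pos hz).mono fun y hy => potential_wt (κ := κ) (C := C) (S := S) hy
  have hd := ((contDiffAt_potential_wt (κ := κ) (C := C) (S := S) hz).differentiableAt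
    (by simp)).congr_of_eventuallyEq (EventuallyEq.symm e)
  rw [pd_congr e]
  refine pd_sv_profile (a := fun y s => 25 / 16 * S ^ 6 * rexp (2 * κ * s) * y ^ (1 / 2 : ℝ) +
    (κ - 5 / 16 * (1 + s)) * (S ^ 3 * rexp (κ * s) * y ^ (5 / 4 : ℝ))
      - 2 * C * S ^ 8 * (s - 1 / 2)) (b := fun s => (1 + s) ^ 2 / 64 - 1 / 16) j hd ?_
  have h1 := (Real.hasDerivAt_rpow_const (p := 1 / 2) (Or.inl hz.ne')).const_mul
    (25 / 16 * S ^ 6 * rexp (2 * κ * z.2))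
  have h2 := ((Real.hasDerivAt_rpow_const (p := 5 / 4) (Or.inl hz.ne')).const_mul
    (S ^ 3 * rexp (κ * z.2))).const_mul (κ - 5 / 16 * (1 + z.2))
  refine ((h1.add h2).sub_const _).congr_deriv ?_
  norm_num

theorem pd_tv_potential_wt (hz : 0 < z.1 i) :
    pd tv (potential (wt κ C S i)) z =
      (2 * κ * (25 / 16 * S ^ 6 * rexp (2 * κ * z.2) * z.1 i ^ (1 / 2 : ℝ)) +
        (κ * (κ - 5 / 16 * (1 + z.2)) - 5 / 16) * (S ^ 3 * rexp (κ * z.2) * z.1 i ^ (5 / 4 : ℝ))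
        - 2 * C * S ^ 8) + (1 + z.2) / 32 * ‖z.1‖ ^ 2 := by
  have e := (eventually_coord_pos hz).mono fun y hy => potential_wt (κ := κ) (C := C) (S := S) hy
  have hd := ((contDiffAt_potential_wt (κ := κ) (C := C) (S := S) hz).differentiableAt
    (by simp)).congr_of_eventuallyEq (EventuallyEq.symm e)
  rw [pd_congr e]
  have hi := hasDerivAt_id z.2
  refine pd_tv_profile (a := fun y s => 25 / 16 * S ^ 6 * rexp (2 * κ * s) * y ^ (1 / 2 : ℝ) +
    (κ - 5 / 16 * (1 + s)) * (S ^ 3 * rexp (κ * s) * y ^ (5 / 4 : ℝ))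
      - 2 * C * S ^ 8 * (s - 1 / 2)) (b := fun s => (1 + s) ^ 2 / 64 - 1 / 16) hd ?_ ?_
  · have h1 := ((hi.const_mul (2 * κ)).exp.const_mul (25 / 16 * S ^ 6)).mul_const
      (z.1 i ^ (1 / 2 : ℝ))
    have h2 := (((hi.const_add 1).const_mul (5 / 16)).const_sub κ).mul
      (((hi.const_mul κ).exp.const_mul (S ^ 3)).mul_const (z.1 i ^ (5 / 4 : ℝ)))
    have h3 := (hi.sub_const (1 / 2)).const_mul (2 * C * S ^ 8)
    refine ((h1.add h2).sub h3).congr_deriv ?_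
    simp only [id]
    ring
  · refine ((((hi.const_add 1).pow 2).div_const 64).sub_const _).congr_deriv ?_
    simp only [id]
    norm_num
    ring

theorem carlemanQ_wt (hz : 0 < z.1 i) {r : ℝ} (hr : r = z.1 i ^ (1 / 4 : ℝ)) :
    carlemanQ (wt κ C S i) (fun z => (1 + z.2) / 2) (potential (wt κ C S i)) z =
      (4 * κ - 7 / 4 * (1 + z.2)) * (25 / 16 * S ^ 6 * rexp (κ * z.2) ^ 2 * r ^ 2) +
      125 / 64 * S ^ 9 * rexp (κ * z.2) ^ 3 * r⁻¹ +
      (κ ^ 2 - 13 / 8 * (1 + z.2) * κ + 125 / 256 * (1 + z.2) ^ 2 - 5 / 8) *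
        (S ^ 3 * rexp (κ * z.2) * r ^ 5) +
      ((1 + z.2) / 8 - 3 / 128 * (1 + z.2) ^ 3) * ‖z.1‖ ^ 2 -
      2 * C * S ^ 8 + 2 * (1 + z.2) * C * S ^ 8 * (z.2 - 1 / 2) -
      S ^ 3 * rexp (κ * z.2) * (105 / 256) * (r ^ 11)⁻¹ - (1 + z.2) ^ 2 / 4 := by
  obtain ⟨h1, h2, h3, h4, h5⟩ := rpow_quarter hz
  have hr0 : 0 < r := hr ▸ Real.rpow_pos_of_pos hz _
  rw [carlemanQ, pd_tv_potential_wt hz, gip_profile (pd_sv_potential_wt hz) (pd_sv_wt hz),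
    lap_lap_wt hz, potential_wt hz, h2, h3, h4, h5,
    show 2 * κ * z.2 = κ * z.2 + κ * z.2 by ring, Real.exp_add]
  rw [← hr] at h1 ⊢
  rw [← h1]
  field_simp
  ring

theorem gip_wt (hz : 0 < z.1 i) {r : ℝ} (hr : r = z.1 i ^ (1 / 4 : ℝ)) :
    gip (wt κ C S i) (wt κ C S i) z ≤
      2 * (25 / 16 * S ^ 6 * rexp (κ * z.2) ^ 2 * r ^ 2) + (1 + z.2) ^ 2 / 32 * ‖z.1‖ ^ 2 := by
  rw [gip_profile (pd_sv_wt hz) (pd_sv_wt hz), ← hr]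
  have h : z.1 i ^ 2 ≤ ‖z.1‖ ^ 2 := by
    rw [norm_sq_eq_sum]
    exact Finset.single_le_sum (f := fun j => z.1 j ^ 2) (fun _ _ => sq_nonneg _)
      (Finset.mem_univ i)
  have h' := mul_le_mul_of_nonneg_left h (sq_nonneg ((1 + z.2) / 8))
  nlinarith [sq_nonneg (S ^ 3 * rexp (κ * z.2) * (5 / 4 * r) + (1 + z.2) / 8 * z.1 i)]

/-- Positivity of the Carleman coefficient for large parameters. -/
theorem carlemanQ_wt_ge (hz : 0 < z.1 i) {r : ℝ} (hr : r = z.1 i ^ (1 / 4 : ℝ))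
    (hs : z.2 ∈ Icc (0:ℝ) 1) (hC : 2 ≤ C) (hκ : 8 ≤ κ) (hκC : 10 * C * (3 * C) ^ 5 ≤ κ ^ 2)
    (hS : 1 ≤ S) (hSr : 1 ≤ S ^ 3 * r ^ 13) :
    1 / 16 + gip (wt κ C S i) (wt κ C S i) z / 8 ≤
      carlemanQ (wt κ C S i) (fun z => (1 + z.2) / 2) (potential (wt κ C S i)) z := by
  have hg := gip_wt (κ := κ) (C := C) (S := S) hz hr
  rw [carlemanQ_wt hz hr]
  have hr0 : 0 < r := hr ▸ Real.rpow_pos_of_pos hz _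
  obtain ⟨hs0, hs1⟩ := hs
  set s := z.2
  set G := rexp (κ * s)
  have hG : 1 ≤ G := Real.one_le_exp (by positivity)
  have hS8 : 1 ≤ S ^ 8 := one_le_pow₀ hS
  have hCS : 2 ≤ C * S ^ 8 := by nlinarith
  have key : 5 * (C * S ^ 8) ≤ 125 / 64 * S ^ 9 * G ^ 3 * r⁻¹ +
      κ ^ 2 / 2 * (S ^ 3 * G * r ^ 5) := by
    have hS0 : 0 < S := by linarith
    have t1 : 0 ≤ 125 / 64 * S ^ 9 * G ^ 3 * r⁻¹ := by positivity
    have t2 : 0 ≤ κ ^ 2 / 2 * (S ^ 3 * G * r ^ 5) := by positivity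
    rcases le_total (3 * C * r) S with h | h
    · have hG3 : 1 ≤ G ^ 3 := one_le_pow₀ hG
      have h1 : 3 * C ≤ S * r⁻¹ := by
        rw [← div_eq_mul_inv, le_div_iff₀ hr0]; exact h
      have h2 : 3 * C * S ^ 8 ≤ S ^ 9 * G ^ 3 * r⁻¹ := by
        calc 3 * C * S ^ 8 ≤ S * r⁻¹ * S ^ 8 := by gcongr
          _ = S ^ 9 * 1 * r⁻¹ := by ring
          _ ≤ S ^ 9 * G ^ 3 * r⁻¹ := by gcongr
      linarith
    · have h1 : S ^ 5 ≤ (3 * C) ^ 5 * r ^ 5 := by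
        rw [← mul_pow]; gcongr
      have h2 : 10 * C * S ^ 5 ≤ κ ^ 2 * r ^ 5 := by
        calc 10 * C * S ^ 5 ≤ 10 * C * ((3 * C) ^ 5 * r ^ 5) := by gcongr
          _ = 10 * C * (3 * C) ^ 5 * r ^ 5 := by ring
          _ ≤ κ ^ 2 * r ^ 5 := by gcongr
      have h3 : 10 * C * S ^ 8 ≤ κ ^ 2 * (S ^ 3 * G * r ^ 5) := by
        calc 10 * C * S ^ 8 = 10 * C * S ^ 5 * S ^ 3 * 1 := by ring
          _ ≤ κ ^ 2 * r ^ 5 * S ^ 3 * G := by gcongr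
          _ = _ := by ring
      linarith
  have hL : S ^ 3 * G * (105 / 256) * (r ^ 11)⁻¹ ≤ 25 / 16 * S ^ 6 * G ^ 2 * r ^ 2 := by
    have h1 : (r ^ 11)⁻¹ ≤ S ^ 3 * r ^ 2 := by
      rw [inv_eq_one_div, div_le_iff₀ (by positivity)]
      calc (1:ℝ) ≤ S ^ 3 * r ^ 13 := hSr
        _ = _ := by ring
    have h2 : S ^ 6 * G * 1 * r ^ 2 ≤ S ^ 6 * G * G * r ^ 2 := by gcongr
    have h3 : 0 ≤ S ^ 6 * G * 1 * r ^ 2 := by positivity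
    calc S ^ 3 * G * (105 / 256) * (r ^ 11)⁻¹ ≤ S ^ 3 * G * (105 / 256) * (S ^ 3 * r ^ 2) := by
          gcongr
      _ = 105 / 256 * (S ^ 6 * G * 1 * r ^ 2) := by ring
      _ ≤ 25 / 16 * (S ^ 6 * G * G * r ^ 2) := by linarith
      _ = _ := by ring
  set P := 25 / 16 * S ^ 6 * G ^ 2 * r ^ 2
  have hP : 0 ≤ P := by positivity
  set g := S ^ 3 * G * r ^ 5
  have hg0 : 0 ≤ g := by positivity
  have e1 : 2 * P ≤ (4 * κ - 7 / 4 * (1 + s)) * P := by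
    refine mul_le_mul_of_nonneg_right ?_ hP
    linarith
  have e2 : κ ^ 2 / 2 * g ≤
      (κ ^ 2 - 13 / 8 * (1 + s) * κ + 125 / 256 * (1 + s) ^ 2 - 5 / 8) * g := by
    refine mul_le_mul_of_nonneg_right ?_ hg0
    nlinarith [sq_nonneg (1 + s), mul_nonneg (sub_nonneg.2 hs1) (by linarith : 0 ≤ κ)]
  have e3 : (1 + s) ^ 2 / 32 / 8 * ‖z.1‖ ^ 2 ≤
      ((1 + s) / 8 - 3 / 128 * (1 + s) ^ 3) * ‖z.1‖ ^ 2 := by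
    refine mul_le_mul_of_nonneg_right ?_ (sq_nonneg _)
    have h1 : (1 + s) ^ 2 ≤ 4 := by nlinarith
    have h2 : (1 + s) * (1 + s) ^ 2 ≤ (1 + s) * 4 :=
      mul_le_mul_of_nonneg_left h1 (by linarith)
    nlinarith
  have e4 : -(3 / 2) * (C * S ^ 8) ≤ 2 * (1 + s) * C * S ^ 8 * (s - 1 / 2) := by
    have : -(3 / 2) ≤ 2 * (1 + s) * (s - 1 / 2) := by nlinarith
    nlinarith
  have e5 : (1 + s) ^ 2 / 4 ≤ 1 := by nlinarith
  linarith

end WeightBound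

/-- `u` is a weak solution of `∂ₛu - Δu = f` in `Ω` with weak spatial gradient `g`, all being
locally square integrable. -/
structure WeakHeat {d : ℕ} (Ω : Set (Spc d × ℝ)) (u f : Spc d × ℝ → ℝ)
    (g : Fin d → Spc d × ℝ → ℝ) : Prop where
  measurable_u : Measurable u
  measurable_f : Measurable f
  measurable_g : ∀ i, Measurable (g i)
  sq_u : ∀ K ⊆ Ω, IsCompact K → IntegrableOn (fun z => u z ^ 2) K
  sq_f : ∀ K ⊆ Ω, IsCompact K → IntegrableOn (fun z => f z ^ 2) K
  sq_g : ∀ i, ∀ K ⊆ Ω, IsCompact K → IntegrableOn (fun z => g i z ^ 2) K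
  grad : ∀ i, ∀ ψ : Spc d × ℝ → ℝ, ContDiff ℝ ∞ ψ → HasCompactSupport ψ → tsupport ψ ⊆ Ω →
    ∫ z, u z * pd (sv i) ψ z = -∫ z, g i z * ψ z
  heat : ∀ ψ : Spc d × ℝ → ℝ, ContDiff ℝ ∞ ψ → HasCompactSupport ψ → tsupport ψ ⊆ Ω →
    ∫ z, u z * (pd tv ψ z + lap ψ z) = -∫ z, f z * ψ z

theorem HeatSol.weakHeat {d : ℕ} {O : Set (Spc d)} {M : ℝ} {v : Spc d → ℝ → ℝ}
    (hv : HeatSol O M v) (hE : ∀ K ⊆ cyl O, IsCompact K → IntegrableOn (eG O v) K) :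
    WeakHeat (cyl O) (uZ O v) (fZ O v) (gZ O v) where
  measurable_u := hv.measurable_uZ
  measurable_f := hv.measurable_fZ
  measurable_g := hv.measurable_gZ
  sq_u := fun _ hK hc => hv.sq_integrableOn_uZ hc hK
  sq_f := fun K hK hc => by
    refine (((hv.sq_integrableOn_uZ hc hK).add (hE K hK hc)).const_mul (2 * M ^ 2)).mono'
      (hv.measurable_fZ.pow_const 2).aestronglyMeasurable (ae_of_all _ fun z => ?_)
    rw [Real.norm_of_nonneg (sq_nonneg _)]
    exact hv.fZ_sq_le z
  sq_g := fun i K hK hc => by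
    refine (hE K hK hc).mono' ((hv.measurable_gZ i).pow_const 2).aestronglyMeasurable
      (ae_of_all _ fun z => ?_)
    rw [Real.norm_of_nonneg (sq_nonneg _)]
    exact Finset.single_le_sum (f := fun i => gZ O v i z ^ 2) (fun _ _ => sq_nonneg _)
      (Finset.mem_univ i)
  grad := fun i _ h1 h2 h3 => hv.weak_grad hE h1 h2 h3 i
  heat := fun _ h1 h2 h3 => hv.weak_heat hE h1 h2 h3

section Cutoff

variable {d : ℕ} {Ω : Set (Spc d × ℝ)} {u f : Spc d × ℝ → ℝ} {g : Fin d → Spc d × ℝ → ℝ}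
  {χ : Spc d × ℝ → ℝ}

/-- The weak gradient of `χ u`. -/
noncomputable def cutGrad (χ u : Spc d × ℝ → ℝ) (g : Fin d → Spc d × ℝ → ℝ) (i : Fin d)
    (z : Spc d × ℝ) : ℝ := g i z * χ z + u z * pd (sv i) χ z

/-- The weak heat operator applied to `χ u`. -/
noncomputable def cutHeat (χ u f : Spc d × ℝ → ℝ) (g : Fin d → Spc d × ℝ → ℝ)
    (z : Spc d × ℝ) : ℝ :=
  f z * χ z + u z * (pd tv χ z - lap χ z) - 2 * ∑ i, g i z * pd (sv i) χ z

theorem integrable_mul_of_eq_zero {K : Set (Spc d × ℝ)} (hK : IsCompact K) {F ρ : Spc d × ℝ → ℝ}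
    (hF : IntegrableOn F K) (hρ : Continuous ρ) (h0 : ∀ z ∉ K, ρ z = 0) :
    Integrable fun z => F z * ρ z := by
  have hs : tsupport ρ ⊆ K :=
    closure_minimal (fun z hz => by_contra fun h => hz (h0 z h)) hK.isClosed
  exact integrable_mul_of_integrableOn (hF.mono_set hs) hρ (HasCompactSupport.intro hK h0)

theorem memLp_mul_of_eq_zero {K : Set (Spc d × ℝ)} (hK : IsCompact K) {F ρ : Spc d × ℝ → ℝ}
    (hm : Measurable F) (hF : IntegrableOn (fun z => F z ^ 2) K) (hρ : Continuous ρ)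
    (h0 : ∀ z ∉ K, ρ z = 0) :
    Integrable (fun z => F z * ρ z) ∧ MemLp (fun z => F z * ρ z) 2 := by
  refine ⟨integrable_mul_of_eq_zero hK (integrableOn_of_sq_le hK hm hF fun _ => le_rfl) hρ h0,
    (memLp_two_iff_integrable_sq (hm.mul hρ.measurable).aestronglyMeasurable).2 ?_⟩
  have := integrable_mul_of_eq_zero hK hF (hρ.pow 2) fun z hz => by simp [h0 z hz]
  exact this.congr (ae_of_all _ fun z => (mul_pow _ _ 2).symm)

theorem lap_eq_zero_of_notMem {z : Spc d × ℝ} (hz : z ∉ tsupport χ) : lap χ z = 0 :=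
  Finset.sum_eq_zero fun _ _ =>
    pd_eq_zero_of_notMem_tsupport fun h => hz (tsupport_pd_subset h)

theorem cutGrad_eq_zero {z : Spc d × ℝ} (hz : z ∉ tsupport χ) (i : Fin d) :
    cutGrad χ u g i z = 0 := by
  rw [cutGrad, image_eq_zero_of_notMem_tsupport hz, pd_eq_zero_of_notMem_tsupport hz]
  ring

theorem cutHeat_eq_zero {z : Spc d × ℝ} (hz : z ∉ tsupport χ) : cutHeat χ u f g z = 0 := by
  rw [cutHeat, image_eq_zero_of_notMem_tsupport hz, pd_eq_zero_of_notMem_tsupport hz,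
    lap_eq_zero_of_notMem hz, Finset.sum_eq_zero fun i _ => by
      rw [pd_eq_zero_of_notMem_tsupport hz, mul_zero]]
  ring

theorem WeakHeat.memLp_cut (h : WeakHeat Ω u f g) (hχ : ContDiff ℝ ∞ χ)
    (hc : HasCompactSupport χ) (hs : tsupport χ ⊆ Ω) :
    Integrable (fun z => u z * χ z) ∧ MemLp (fun z => u z * χ z) 2 :=
  memLp_mul_of_eq_zero hc h.measurable_u (h.sq_u _ hs hc) hχ.continuous
    fun _ => image_eq_zero_of_notMem_tsupport

theorem WeakHeat.memLp_cutGrad (h : WeakHeat Ω u f g) (hχ : ContDiff ℝ ∞ χ)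
    (hc : HasCompactSupport χ) (hs : tsupport χ ⊆ Ω) (i : Fin d) :
    Integrable (cutGrad χ u g i) ∧ MemLp (cutGrad χ u g i) 2 := by
  have h1 := memLp_mul_of_eq_zero hc (h.measurable_g i) (h.sq_g i _ hs hc) hχ.continuous
    fun _ => image_eq_zero_of_notMem_tsupport
  have h2 := memLp_mul_of_eq_zero hc h.measurable_u (h.sq_u _ hs hc)
    (hχ.pd_infty (e := sv i)).continuous fun _ => pd_eq_zero_of_notMem_tsupport
  exact ⟨h1.1.add h2.1, h1.2.add h2.2⟩

theorem WeakHeat.memLp_cutHeat (h : WeakHeat Ω u f g) (hχ : ContDiff ℝ ∞ χ)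
    (hc : HasCompactSupport χ) (hs : tsupport χ ⊆ Ω) :
    Integrable (cutHeat χ u f g) ∧ MemLp (cutHeat χ u f g) 2 := by
  have h1 := memLp_mul_of_eq_zero hc h.measurable_f (h.sq_f _ hs hc) hχ.continuous
    fun _ => image_eq_zero_of_notMem_tsupport
  have h2 := memLp_mul_of_eq_zero hc h.measurable_u (h.sq_u _ hs hc)
    ((hχ.pd_infty (e := tv)).continuous.sub (contDiff_lap hχ).continuous) fun z hz => by
      rw [Pi.sub_apply, pd_eq_zero_of_notMem_tsupport hz, lap_eq_zero_of_notMem hz, sub_zero]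
  have h3 := fun i => memLp_mul_of_eq_zero hc (h.measurable_g i) (h.sq_g i _ hs hc)
    (hχ.pd_infty (e := sv i)).continuous fun _ => pd_eq_zero_of_notMem_tsupport
  exact ⟨(h1.1.add h2.1).sub ((integrable_finsetSum _ fun i _ => (h3 i).1).const_mul 2),
    (h1.2.add h2.2).sub ((memLp_finsetSum _ fun i _ => (h3 i).2).const_mul 2)⟩

theorem WeakHeat.cut_grad (h : WeakHeat Ω u f g) (hχ : ContDiff ℝ ∞ χ)
    (hc : HasCompactSupport χ) (hs : tsupport χ ⊆ Ω) (i : Fin d) {ψ : Spc d × ℝ → ℝ} (hψ : ContDiff ℝ ∞ ψ) :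
    ∫ z, u z * χ z * pd (sv i) ψ z = -∫ z, cutGrad χ u g i z * ψ z := by
  have hK := h.sq_u _ hs hc
  have i1 : Integrable fun z => u z * pd (sv i) (fun y => χ y * ψ y) z :=
    (memLp_mul_of_eq_zero hc h.measurable_u hK (hχ.mul hψ).pd_infty.continuous fun z hz =>
      pd_eq_zero_of_notMem_tsupport fun h => hz (tsupport_mul_subset_left h)).1
  have i2 : Integrable fun z => u z * (pd (sv i) χ z * ψ z) :=
    (memLp_mul_of_eq_zero hc h.measurable_u hK (hχ.pd_infty.continuous.mul hψ.continuous)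
      fun z hz => by rw [Pi.mul_apply, pd_eq_zero_of_notMem_tsupport hz, zero_mul]).1
  have i3 : Integrable fun z => g i z * (χ z * ψ z) :=
    (memLp_mul_of_eq_zero hc (h.measurable_g i) (h.sq_g i _ hs hc)
      (hχ.continuous.mul hψ.continuous)
      fun z hz => by rw [Pi.mul_apply, image_eq_zero_of_notMem_tsupport hz, zero_mul]).1
  have key := h.grad i _ (hχ.mul hψ) hc.mul_right (tsupport_mul_subset_left.trans hs)
  have e1 : ∫ z, u z * χ z * pd (sv i) ψ z =
      (∫ z, u z * pd (sv i) (fun y => χ y * ψ y) z) - ∫ z, u z * (pd (sv i) χ z * ψ z) := by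
    rw [← integral_sub i1 i2]
    exact integral_congr_ae (ae_of_all _ fun z => by
      simp only [pd_mul_smooth hχ hψ]; ring)
  have e2 : ∫ z, cutGrad χ u g i z * ψ z =
      (∫ z, g i z * (χ z * ψ z)) + ∫ z, u z * (pd (sv i) χ z * ψ z) := by
    rw [← integral_add i3 i2]
    exact integral_congr_ae (ae_of_all _ fun z => by simp only [cutGrad]; ring)
  rw [e1, e2, key]
  ring

theorem lap_mul_smooth {ψ : Spc d × ℝ → ℝ} (hχ : ContDiff ℝ ∞ χ) (hψ : ContDiff ℝ ∞ ψ)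
    (z : Spc d × ℝ) : lap (fun y => χ y * ψ y) z =
      lap χ z * ψ z + 2 * gip χ ψ z + χ z * lap ψ z := by
  have e : ∀ i, pd (sv i) (pd (sv i) fun y => χ y * ψ y) z = pd (sv i) (pd (sv i) χ) z * ψ z +
      2 * (pd (sv i) χ z * pd (sv i) ψ z) + χ z * pd (sv i) (pd (sv i) ψ) z := by
    intro i
    rw [show pd (sv i) (fun y => χ y * ψ y) = fun y => pd (sv i) χ y * ψ y + χ y * pd (sv i) ψ y
      from funext fun y => pd_mul_smooth hχ hψ _ _,
      pd_add ((hχ.pd_infty.mul hψ).differentiable (by simp) z)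
        ((hχ.mul hψ.pd_infty).differentiable (by simp) z), pd_mul_smooth hχ.pd_infty hψ,
      pd_mul_smooth hχ hψ.pd_infty]
    ring
  simp only [lap, gip, e, Finset.sum_add_distrib, Finset.sum_mul, Finset.mul_sum]

theorem WeakHeat.cut_heat (h : WeakHeat Ω u f g) (hχ : ContDiff ℝ ∞ χ)
    (hc : HasCompactSupport χ) (hs : tsupport χ ⊆ Ω) {ψ : Spc d × ℝ → ℝ} (hψ : ContDiff ℝ ∞ ψ) :
    ∫ z, u z * χ z * (pd tv ψ z + lap ψ z) = -∫ z, cutHeat χ u f g z * ψ z := by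
  have hK := h.sq_u _ hs hc
  have hu : ∀ {ρ : Spc d × ℝ → ℝ}, Continuous ρ → (∀ z ∉ tsupport χ, ρ z = 0) →
      Integrable fun z => u z * ρ z := fun hρ h0 =>
    (memLp_mul_of_eq_zero hc h.measurable_u hK hρ h0).1
  have hχψ := hχ.mul hψ
  have i1 : Integrable fun z => u z * (pd tv (fun y => χ y * ψ y) z + lap (fun y => χ y * ψ y) z) :=
    hu (hχψ.pd_infty.continuous.add (contDiff_lap hχψ).continuous) fun z hz => by
      have hz' : z ∉ tsupport fun y => χ y * ψ y := fun h => hz (tsupport_mul_subset_left h)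
      rw [pd_eq_zero_of_notMem_tsupport hz', lap_eq_zero_of_notMem hz', add_zero]
  have i2 : Integrable fun z => u z * ((pd tv χ z - lap χ z) * ψ z) :=
    hu ((hχ.pd_infty.continuous.sub (contDiff_lap hχ).continuous).mul hψ.continuous)
      fun z hz => by
        rw [pd_eq_zero_of_notMem_tsupport hz, lap_eq_zero_of_notMem hz]; ring
  have i3 : ∀ i, Integrable fun z => u z * pd (sv i) (fun y => pd (sv i) χ y * ψ y) z := fun i =>
    hu (hχ.pd_infty.mul hψ).pd_infty.continuous fun z hz =>
      pd_eq_zero_of_notMem_tsupport fun h => hz (tsupport_pd_subset (tsupport_mul_subset_left h))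
  have i4 : Integrable fun z => f z * (χ z * ψ z) :=
    (memLp_mul_of_eq_zero hc h.measurable_f (h.sq_f _ hs hc) (hχ.continuous.mul hψ.continuous)
      fun z hz => by rw [Pi.mul_apply, image_eq_zero_of_notMem_tsupport hz, zero_mul]).1
  have i5 : ∀ i, Integrable fun z => g i z * (pd (sv i) χ z * ψ z) := fun i =>
    (memLp_mul_of_eq_zero hc (h.measurable_g i) (h.sq_g i _ hs hc)
      (hχ.pd_infty.continuous.mul hψ.continuous)
      fun z hz => by rw [Pi.mul_apply, pd_eq_zero_of_notMem_tsupport hz, zero_mul]).1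
  have key := h.heat _ hχψ hc.mul_right (tsupport_mul_subset_left.trans hs)
  have key2 : ∀ i, _ := fun i => h.grad i _ (hχ.pd_infty (e := sv i) |>.mul hψ)
    (hc.pd.mul_right) ((tsupport_mul_subset_left.trans tsupport_pd_subset).trans hs)
  have e1 : ∫ z, u z * χ z * (pd tv ψ z + lap ψ z) =
      (∫ z, u z * (pd tv (fun y => χ y * ψ y) z + lap (fun y => χ y * ψ y) z)) -
      (∫ z, u z * ((pd tv χ z - lap χ z) * ψ z)) -
      2 * ∑ i, ∫ z, u z * pd (sv i) (fun y => pd (sv i) χ y * ψ y) z := by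
    rw [← integral_sub' i1 i2, ← integral_finsetSum _ fun i _ => i3 i, ← integral_const_mul,
      ← integral_sub' (i1.sub i2) ((integrable_finsetSum _ fun i _ => i3 i).const_mul 2)]
    refine integral_congr_ae (ae_of_all _ fun z => ?_)
    have : ∑ i, u z * pd (sv i) (fun y => pd (sv i) χ y * ψ y) z =
        u z * (lap χ z * ψ z + gip χ ψ z) := by
      simp only [pd_mul_smooth hχ.pd_infty hψ, ← Finset.mul_sum, Finset.sum_add_distrib, lap, gip,
        Finset.sum_mul]
    simp only [Pi.sub_apply, this, pd_mul_smooth hχ hψ, lap_mul_smooth hχ hψ]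
    ring
  have e2 : ∫ z, cutHeat χ u f g z * ψ z =
      (∫ z, f z * (χ z * ψ z)) + (∫ z, u z * ((pd tv χ z - lap χ z) * ψ z)) -
      2 * ∑ i, ∫ z, g i z * (pd (sv i) χ z * ψ z) := by
    rw [← integral_add' i4 i2, ← integral_finsetSum _ fun i _ => i5 i, ← integral_const_mul,
      ← integral_sub' (i4.add i2) ((integrable_finsetSum _ fun i _ => i5 i).const_mul 2)]
    refine integral_congr_ae (ae_of_all _ fun z => ?_)
    simp only [cutHeat, Pi.sub_apply, Pi.add_apply, ← mul_assoc, ← Finset.sum_mul]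
    ring
  rw [e1, e2, key, Finset.sum_congr rfl fun i _ => key2 i, Finset.sum_neg_distrib]
  ring

end Cutoff

section CarlemanCutoff

variable {d : ℕ} {i : Fin d} {u f : Spc d × ℝ → ℝ} {g : Fin d → Spc d × ℝ → ℝ}
  {χ θ : Spc d × ℝ → ℝ} {κ C S δ : ℝ}

/-- The part of the half-space cylinder at distance more than `δ` from the boundary. -/
def innerCyl {d : ℕ} (i : Fin d) (δ : ℝ) : Set (Spc d × ℝ) := {z | δ < z.1 i} ∩ {z | z.2 ∈ Ioo 0 1}

theorem isOpen_innerCyl : IsOpen (innerCyl i δ) := by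
  refine IsOpen.inter ?_ (isOpen_Ioo.preimage continuous_snd)
  exact isOpen_lt continuous_const ((contDiff_coord (i := i)).continuous.comp continuous_fst)

theorem innerCyl_subset (hδ : 0 ≤ δ) : innerCyl i δ ⊆ cyl {x : Spc d | 0 < x i} :=
  fun _ hz => ⟨hδ.trans_lt hz.1, hz.2⟩

theorem gip_self (f : Spc d × ℝ → ℝ) (z : Spc d × ℝ) : gip f f z = ∑ i, pd (sv i) f z ^ 2 :=
  Finset.sum_congr rfl fun _ _ => (sq _).symm

theorem gip_self_nonneg (f : Spc d × ℝ → ℝ) (z : Spc d × ℝ) : 0 ≤ gip f f z := by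
  rw [gip_self]
  exact Finset.sum_nonneg fun _ _ => sq_nonneg _

theorem carleman_wt {w : Spc d × ℝ → ℝ} (hδ : 0 < δ) (hC : 2 ≤ C) (hκ : 8 ≤ κ)
    (hκC : 10 * C * (3 * C) ^ 5 ≤ κ ^ 2) (hS : 1 ≤ S) (hSδ : 1 ≤ S ^ 3 * (δ ^ (1 / 4 : ℝ)) ^ 13)
    (hθ : ContDiff ℝ ∞ θ) (hθ0 : ∀ i z, pd (sv i) θ z = 0) (hθn : ∀ z, 0 ≤ θ z)
    (hθt : ∀ z, pd tv θ z ≤ 0) (hw : ContDiff ℝ ∞ w) (hc : HasCompactSupport w)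
    (hs : tsupport w ⊆ innerCyl i δ) :
    ∫ z, θ z * rexp (wt κ C S i z) ^ 2 / 16 * (w z ^ 2 + gip w w z) ≤
      (∫ z, θ z * rexp (wt κ C S i z) ^ 2 * (pd tv w z - lap w z) ^ 2) +
      ∫ z, -pd tv θ z * max (potential (wt κ C S i) z) 0 * rexp (wt κ C S i z) ^ 2 * w z ^ 2 := by
  have hz0 : ∀ z ∈ innerCyl i δ, 0 < z.1 i := fun z hz => hδ.trans hz.1
  have hN : ContDiff ℝ ∞ fun z : Spc d × ℝ => (1 + z.2) / 2 := by fun_prop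
  refine carleman_weighted_local (N := fun z => (1 + z.2) / 2) isOpen_innerCyl hw hc hs
    (fun z hz => (contDiffAt_wt (hz0 z hz)).contDiffWithinAt) hθ hN hθ0 ?_ hθn hθt ?_ ?_
  · intro j z
    refine pd_eq_of_hasDerivAt (hN.differentiable (by simp) z) ?_
    simpa using hasDerivAt_const (0:ℝ) ((1 + z.2) / 2)
  · intro z hz f
    rw [hessGrad_wt (hz0 z hz)]
    have h1 := gip_self_nonneg f z
    have h2 : 0 ≤ S ^ 3 * rexp (κ * z.2) * (5 / 16 * z.1 i ^ (-3 / 4 : ℝ)) * pd (sv i) f z ^ 2 := by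
      have := hz0 z hz
      positivity
    have h3 := mul_nonneg hz.2.1.le h1
    linarith
  · intro z hz
    refine carlemanQ_wt_ge (hz0 z hz) rfl ⟨hz.2.1.le, hz.2.2.le⟩ hC hκ hκC hS (hSδ.trans ?_)
    have : δ ^ (1 / 4 : ℝ) ≤ z.1 i ^ (1 / 4 : ℝ) :=
      Real.rpow_le_rpow hδ.le hz.1.le (by norm_num)
    gcongr

theorem continuousOn_wt (hδ : 0 < δ) : ContinuousOn (wt κ C S i) (innerCyl i δ) := fun _ hz =>
  (contDiffAt_wt (hδ.trans hz.1)).continuousAt.continuousWithinAt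

theorem continuousOn_potential_wt (hδ : 0 < δ) :
    ContinuousOn (potential (wt κ C S i)) (innerCyl i δ) := fun _ hz =>
  (contDiffAt_potential_wt (hδ.trans hz.1)).continuousAt.continuousWithinAt

/-- The Carleman inequality for a localized weak solution. -/
theorem WeakHeat.carleman (h : WeakHeat (cyl {x : Spc d | 0 < x i}) u f g) (hδ : 0 < δ)
    (hC : 2 ≤ C) (hκ : 8 ≤ κ) (hκC : 10 * C * (3 * C) ^ 5 ≤ κ ^ 2) (hS : 1 ≤ S)
    (hSδ : 1 ≤ S ^ 3 * (δ ^ (1 / 4 : ℝ)) ^ 13) (hθ : ContDiff ℝ ∞ θ)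
    (hθ0 : ∀ i z, pd (sv i) θ z = 0) (hθn : ∀ z, 0 ≤ θ z) (hθt : ∀ z, pd tv θ z ≤ 0)
    (hχ : ContDiff ℝ ∞ χ) (hc : HasCompactSupport χ) (hs : tsupport χ ⊆ innerCyl i δ) :
    ∫ z, θ z * rexp (wt κ C S i z) ^ 2 / 16 * ((u z * χ z) ^ 2 + ∑ j, cutGrad χ u g j z ^ 2) ≤
      (∫ z, θ z * rexp (wt κ C S i z) ^ 2 * cutHeat χ u f g z ^ 2) +
      ∫ z, -pd tv θ z * max (potential (wt κ C S i) z) 0 * rexp (wt κ C S i z) ^ 2 *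
        (u z * χ z) ^ 2 := by
  have hs' := hs.trans (innerCyl_subset hδ.le)
  have hW : ContinuousOn (fun z => rexp (wt κ C S i z) ^ 2) (innerCyl i δ) :=
    (continuous_exp.comp_continuousOn (continuousOn_wt hδ)).pow 2
  have hθW := hθ.continuous.continuousOn.mul hW
  obtain ⟨hw, hw2⟩ := h.memLp_cut hχ hc hs'
  have hG := fun j => h.memLp_cutGrad hχ hc hs' j
  obtain ⟨hF, hF2⟩ := h.memLp_cutHeat hχ hc hs'
  refine weighted_le_of_smooth isOpen_innerCyl hc hs (hθW.div_const 16) hθW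
    (((hθ.pd_infty.continuous.neg.continuousOn).mul
      ((continuousOn_potential_wt hδ).sup continuousOn_const)).mul hW)
    (fun z _ => ?_) (fun z _ => ?_) (fun z _ => ?_) (fun w hw hwc hws => ?_) hw hw2.integrable_sq
    (fun z hz => ?_) (fun j => (hG j).1)
    (fun j z hz => cutGrad_eq_zero hz j) hF hF2.integrable_sq (fun z hz => cutHeat_eq_zero hz)
    (fun j ψ hψ _ => h.cut_grad hχ hc hs' j hψ) (fun ψ hψ _ => h.cut_heat hχ hc hs' hψ)
  · exact div_nonneg (mul_nonneg (hθn z) (sq_nonneg _)) (by norm_num)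
  · exact mul_nonneg (hθn z) (sq_nonneg _)
  · exact mul_nonneg (mul_nonneg (neg_nonneg.2 (hθt z)) (le_max_right _ _)) (sq_nonneg _)
  · have := carleman_wt hδ hC hκ hκC hS hSδ hθ hθ0 hθn hθt hw hwc hws
    simp only [gip_self] at this
    exact this
  · rw [image_eq_zero_of_notMem_tsupport hz, mul_zero]

/-- The coefficient of the error terms produced by the cutoff `χ`. -/
noncomputable def cutErr (χ : Spc d × ℝ → ℝ) (z : Spc d × ℝ) : ℝ :=
  3 * (pd tv χ z - lap χ z) ^ 2 + 13 * gip χ χ z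

theorem cutErr_nonneg (z : Spc d × ℝ) : 0 ≤ cutErr χ z := by
  have := gip_self_nonneg χ z
  unfold cutErr
  positivity

theorem cut_pointwise {ε : ℝ} (hε : ε ^ 2 ≤ 1 / 384) (z : Spc d × ℝ)
    (hf : f z ^ 2 ≤ 2 * ε ^ 2 * (u z ^ 2 + ∑ j, g j z ^ 2)) :
    χ z ^ 2 * (u z ^ 2 + ∑ j, g j z ^ 2) / 64 ≤
      ((u z * χ z) ^ 2 + ∑ j, cutGrad χ u g j z ^ 2) / 16 - cutHeat χ u f g z ^ 2 +
        cutErr χ z * (u z ^ 2 + ∑ j, g j z ^ 2) := by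
  have hg := gip_self χ z
  set e := ∑ j, g j z ^ 2 with he
  set p := gip χ χ z with hp
  have hp0 : 0 ≤ p := gip_self_nonneg χ z
  have he0 : 0 ≤ e := Finset.sum_nonneg fun _ _ => sq_nonneg _
  have h1 : χ z ^ 2 * e / 2 - u z ^ 2 * p ≤ ∑ j, cutGrad χ u g j z ^ 2 := by
    rw [he, hg, Finset.mul_sum, Finset.mul_sum, Finset.sum_div, ← Finset.sum_sub_distrib]
    refine Finset.sum_le_sum fun j _ => ?_
    rw [cutGrad]
    nlinarith [sq_nonneg (g j z * χ z + 2 * (u z * pd (sv j) χ z))]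
  have h2 : (∑ j, g j z * pd (sv j) χ z) ^ 2 ≤ e * p := by
    rw [hg]; exact Finset.sum_mul_sq_le_sq_mul_sq _ _ _
  have h3 : cutHeat χ u f g z ^ 2 ≤ 3 * (f z ^ 2 * χ z ^ 2) +
      3 * (u z ^ 2 * (pd tv χ z - lap χ z) ^ 2) + 12 * (e * p) := by
    rw [cutHeat]
    set a := f z * χ z
    set b := u z * (pd tv χ z - lap χ z) with hb
    set c := ∑ j, g j z * pd (sv j) χ z
    rw [← mul_pow, ← mul_pow]
    nlinarith [sq_nonneg (a - b), sq_nonneg (a + 2 * c), sq_nonneg (b + 2 * c)]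
  have h4 : f z ^ 2 * χ z ^ 2 ≤ 1 / 192 * (χ z ^ 2 * (u z ^ 2 + e)) := by
    have : f z ^ 2 ≤ 1 / 192 * (u z ^ 2 + e) := hf.trans (by
      have : 2 * ε ^ 2 ≤ 1 / 192 := by linarith
      gcongr)
    calc _ ≤ 1 / 192 * (u z ^ 2 + e) * χ z ^ 2 := by gcongr
      _ = _ := by ring
  rw [cutErr, mul_pow]
  have h5 : 0 ≤ u z ^ 2 * p := by positivity
  have h6 : 0 ≤ e * p := by positivity
  have h7 : 0 ≤ e * (pd tv χ z - lap χ z) ^ 2 := by positivity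
  have h8 : 0 ≤ χ z ^ 2 * e := by positivity
  have h9 : 0 ≤ χ z ^ 2 * u z ^ 2 := by positivity
  rw [← hp]
  nlinarith

theorem continuous_cutErr (hχ : ContDiff ℝ ∞ χ) : Continuous (cutErr χ) :=
  ((((hχ.pd_infty.continuous.sub (contDiff_lap hχ).continuous).pow 2).const_mul 3)).add
    ((contDiff_gip hχ hχ).continuous.const_mul 13)

theorem cutErr_eq_zero {z : Spc d × ℝ} (hz : z ∉ tsupport χ) : cutErr χ z = 0 := by
  have : gip χ χ z = 0 := Finset.sum_eq_zero fun i _ => by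
    rw [pd_eq_zero_of_notMem_tsupport hz, mul_zero]
  rw [cutErr, pd_eq_zero_of_notMem_tsupport hz, lap_eq_zero_of_notMem hz, this]
  ring

theorem integrable_weight_cut {K Ω : Set (Spc d × ℝ)} {E b ρ : Spc d × ℝ → ℝ}
    (hK : IsCompact K) (hKΩ : K ⊆ Ω) (hE : IntegrableOn E K)
    (hb : ContinuousOn b Ω) (hρ : Continuous ρ) (h0 : ∀ z ∉ K, ρ z = 0) :
    Integrable fun z => b z * (E z * ρ z) :=
  integrable_weight_mul hK hKΩ hb (integrable_mul_of_eq_zero hK hE hρ h0)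
    fun z hz => by rw [h0 z hz, mul_zero]

/-- The Carleman inequality for a localized weak solution, lower order terms being absorbed. -/
theorem WeakHeat.carleman_absorbed (h : WeakHeat (cyl {x : Spc d | 0 < x i}) u f g) {ε : ℝ}
    (hε : ε ^ 2 ≤ 1 / 384) (hf : ∀ z, f z ^ 2 ≤ 2 * ε ^ 2 * (u z ^ 2 + ∑ j, g j z ^ 2))
    (hδ : 0 < δ) (hC : 2 ≤ C) (hκ : 8 ≤ κ) (hκC : 10 * C * (3 * C) ^ 5 ≤ κ ^ 2) (hS : 1 ≤ S)
    (hSδ : 1 ≤ S ^ 3 * (δ ^ (1 / 4 : ℝ)) ^ 13) (hθ : ContDiff ℝ ∞ θ)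
    (hθ0 : ∀ i z, pd (sv i) θ z = 0) (hθn : ∀ z, 0 ≤ θ z) (hθt : ∀ z, pd tv θ z ≤ 0)
    (hχ : ContDiff ℝ ∞ χ) (hc : HasCompactSupport χ) (hs : tsupport χ ⊆ innerCyl i δ) :
    ∫ z, θ z * rexp (wt κ C S i z) ^ 2 * (χ z ^ 2 * (u z ^ 2 + ∑ j, g j z ^ 2) / 64) ≤
      (∫ z, θ z * rexp (wt κ C S i z) ^ 2 * (cutErr χ z * (u z ^ 2 + ∑ j, g j z ^ 2))) +
      ∫ z, -pd tv θ z * max (potential (wt κ C S i) z) 0 * rexp (wt κ C S i z) ^ 2 *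
        (u z * χ z) ^ 2 := by
  have key := h.carleman hδ hC hκ hκC hS hSδ hθ hθ0 hθn hθt hχ hc hs
  have hs' := hs.trans (innerCyl_subset hδ.le)
  have hθW : ContinuousOn (fun z => θ z * rexp (wt κ C S i z) ^ 2) (innerCyl i δ) :=
    hθ.continuous.continuousOn.mul
      ((continuous_exp.comp_continuousOn (continuousOn_wt hδ)).pow 2)
  set b := fun z => θ z * rexp (wt κ C S i z) ^ 2 with hb
  have hb0 : ∀ z, 0 ≤ b z := fun z => mul_nonneg (hθn z) (sq_nonneg _)
  set E := fun z => u z ^ 2 + ∑ j, g j z ^ 2 with hE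
  have hEK : IntegrableOn E (tsupport χ) := (h.sq_u _ hs' hc).add
    (integrable_finsetSum _ fun j _ => h.sq_g j _ hs' hc)
  have i1 : Integrable fun z => b z * (cutErr χ z * E z) := by
    have := integrable_weight_cut hc hs hEK hθW (continuous_cutErr hχ)
      fun z hz => cutErr_eq_zero hz
    simpa only [mul_comm (E _)] using this
  have i2 : Integrable fun z => b z * (χ z ^ 2 * E z / 64) := by
    have := integrable_weight_cut hc hs hEK hθW
      ((hχ.continuous.pow 2).div_const 64) fun z hz => by
        rw [Pi.pow_apply, image_eq_zero_of_notMem_tsupport hz]; norm_num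
    refine this.congr (ae_of_all _ fun z => ?_)
    simp only [Pi.pow_apply]
    ring
  have i3 : Integrable fun z => b z * cutHeat χ u f g z ^ 2 :=
    integrable_weight_mul hc hs hθW (h.memLp_cutHeat hχ hc hs').2.integrable_sq
      fun z hz => by rw [cutHeat_eq_zero hz]; ring
  have i4 : Integrable fun z =>
      b z / 16 * ((u z * χ z) ^ 2 + ∑ j, cutGrad χ u g j z ^ 2) := by
    refine integrable_weight_mul hc hs (hθW.div_const 16)
      ((h.memLp_cut hχ hc hs').2.integrable_sq.add
        (integrable_finsetSum _ fun j _ => (h.memLp_cutGrad hχ hc hs' j).2.integrable_sq))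
      fun z hz => ?_
    simp only [cutGrad_eq_zero hz, image_eq_zero_of_notMem_tsupport hz]
    simp
  have hle : ∫ z, b z * (χ z ^ 2 * E z / 64) ≤
      (∫ z, b z / 16 * ((u z * χ z) ^ 2 + ∑ j, cutGrad χ u g j z ^ 2)) -
      (∫ z, b z * cutHeat χ u f g z ^ 2) + ∫ z, b z * (cutErr χ z * E z) := by
    rw [← integral_sub' i4 i3, ← integral_add' (i4.sub i3) i1]
    refine integral_mono i2 ((i4.sub i3).add i1) fun z => ?_
    have := mul_le_mul_of_nonneg_left (cut_pointwise (χ := χ) hε z (hf z)) (hb0 z)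
    simp only [Pi.add_apply, Pi.sub_apply]
    refine this.trans (le_of_eq ?_)
    simp only [hE]
    ring
  linarith

end CarlemanCutoff

section Tame

variable {d : ℕ} {f g : Spc d × ℝ → ℝ} {A B : ℝ}

/-- Smooth functions bounded by one, with derivatives bounded by `A`. -/
structure Tame (A : ℝ) (f : Spc d × ℝ → ℝ) : Prop where
  contDiff : ContDiff ℝ ∞ f
  abs_le_one : ∀ z, |f z| ≤ 1
  pd_le : ∀ i z, |pd (sv i) f z| ≤ A
  pd_tv_le : ∀ z, |pd tv f z| ≤ A
  pd_pd_le : ∀ i z, |pd (sv i) (pd (sv i) f) z| ≤ A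

theorem Tame.nonneg (hf : Tame A f) : 0 ≤ A := (abs_nonneg _).trans (hf.pd_tv_le 0)

theorem Tame.mul (hf : Tame A f) (hg : Tame B g) :
    Tame (A + B + 2 * (A * B)) fun z => f z * g z := by
  have hA := hf.nonneg
  have hB := hg.nonneg
  have hAB := mul_nonneg hA hB
  have first : ∀ e z, |pd e f z| ≤ A → |pd e g z| ≤ B →
      |pd e (fun y => f y * g y) z| ≤ A + B + 2 * (A * B) := by
    intro e z h1 h2
    rw [pd_mul_smooth hf.contDiff hg.contDiff]
    refine (abs_add_le _ _).trans ?_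
    rw [abs_mul, abs_mul]
    have h3 := mul_le_mul h1 (hg.abs_le_one z) (abs_nonneg _) hA
    have h4 := mul_le_mul (hf.abs_le_one z) h2 (abs_nonneg _) zero_le_one
    linarith
  refine ⟨hf.contDiff.mul hg.contDiff, fun z => ?_, fun i z => first _ z (hf.pd_le i z)
    (hg.pd_le i z), fun z => first _ z (hf.pd_tv_le z) (hg.pd_tv_le z), fun i z => ?_⟩
  · rw [abs_mul]
    exact mul_le_one₀ (hf.abs_le_one z) (abs_nonneg _) (hg.abs_le_one z)
  · rw [show pd (sv i) (fun y => f y * g y) = fun y => pd (sv i) f y * g y + f y * pd (sv i) g y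
      from funext fun y => pd_mul_smooth hf.contDiff hg.contDiff _ _,
      pd_add ((hf.contDiff.pd_infty.mul hg.contDiff).differentiable (by simp) z)
        ((hf.contDiff.mul hg.contDiff.pd_infty).differentiable (by simp) z),
      pd_mul_smooth hf.contDiff.pd_infty hg.contDiff,
      pd_mul_smooth hf.contDiff hg.contDiff.pd_infty]
    have h1 := mul_le_mul (hf.pd_pd_le i z) (hg.abs_le_one z) (abs_nonneg _) hA
    have h2 := mul_le_mul (hf.pd_le i z) (hg.pd_le i z) (abs_nonneg _) hA
    have h3 := mul_le_mul (hf.abs_le_one z) (hg.pd_pd_le i z) (abs_nonneg _) zero_le_one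
    rw [← abs_mul] at h1 h2 h3
    have h1' := abs_le.1 h1
    have h2' := abs_le.1 h2
    have h3' := abs_le.1 h3
    rw [abs_le]
    constructor <;> linarith

theorem Tame.cutErr_le (hf : Tame A f) (z : Spc d × ℝ) :
    cutErr f z ≤ 3 * (A + d * A) ^ 2 + 13 * (d * A ^ 2) := by
  have hA := hf.nonneg
  have h1 : |lap f z| ≤ d * A := by
    refine (Finset.abs_sum_le_sum_abs _ _).trans ((Finset.sum_le_sum fun i _ =>
      hf.pd_pd_le i z).trans (le_of_eq (by simp)))
  have h2 : gip f f z ≤ d * A ^ 2 := by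
    rw [gip_self]
    refine (Finset.sum_le_sum fun i _ => sq_le_sq' (abs_le.1 (hf.pd_le i z)).1
      (abs_le.1 (hf.pd_le i z)).2).trans (le_of_eq (by simp))
  have h3 : (pd tv f z - lap f z) ^ 2 ≤ (A + d * A) ^ 2 := by
    have := abs_le.1 (hf.pd_tv_le z)
    have := abs_le.1 h1
    exact sq_le_sq' (by linarith) (by linarith)
  rw [cutErr]
  linarith

theorem tame_smoothTransition {a : ℝ} (ha : 0 ≤ a) (hf : ContDiff ℝ ∞ f)
    (h1 : ∀ i z, |pd (sv i) f z| ≤ a) (h2 : ∀ z, |pd tv f z| ≤ a)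
    (h3 : ∀ i z, |pd (sv i) (pd (sv i) f) z| ≤ a) {L : ℝ}
    (hL1 : ∀ t, |deriv smoothTransition t| ≤ L) (hL2 : ∀ t, |deriv (deriv smoothTransition) t| ≤ L) :
    Tame (L * a + L * a ^ 2) fun z => smoothTransition (f z) := by
  have hst : ContDiff ℝ ∞ smoothTransition := smoothTransition.contDiff
  have hst' : ContDiff ℝ ∞ (deriv smoothTransition) :=
    (contDiff_infty_iff_deriv.1 hst).2
  have hL : 0 ≤ L := (abs_nonneg _).trans (hL1 0)
  have e1 : ∀ e z, pd e (fun y => smoothTransition (f y)) z =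
      deriv smoothTransition (f z) * pd e f z := fun e z =>
    pd_comp (hst.differentiable (by simp) _).hasDerivAt (hf.differentiable (by simp) z)
  have first : ∀ e z, |pd e f z| ≤ a →
      |pd e (fun y => smoothTransition (f y)) z| ≤ L * a + L * a ^ 2 := by
    intro e z h
    rw [e1, abs_mul]
    have := mul_le_mul (hL1 (f z)) h (abs_nonneg _) hL
    have : 0 ≤ L * a ^ 2 := by positivity
    linarith
  refine ⟨hst.comp hf, fun z => ?_, fun i z => first _ z (h1 i z), fun z => first _ z (h2 z),
    fun i z => ?_⟩
  · rw [abs_of_nonneg (smoothTransition.nonneg _)]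
    exact smoothTransition.le_one _
  · rw [show pd (sv i) (fun y => smoothTransition (f y)) = fun y =>
      deriv smoothTransition (f y) * pd (sv i) f y from funext fun y => e1 _ y,
      pd_mul_smooth (u := fun y => deriv smoothTransition (f y)) (hst'.comp hf) hf.pd_infty,
      pd_comp (hst'.differentiable (by simp) _).hasDerivAt (hf.differentiable (by simp) z)]
    refine (abs_add_le _ _).trans ?_
    rw [abs_mul, abs_mul, abs_mul]
    have h4 := mul_le_mul (hL1 (f z)) (h3 i z) (abs_nonneg _) hL
    have h5 := mul_le_mul (h1 i z) (h1 i z) (abs_nonneg _) ha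
    have h6 := mul_le_mul (hL2 (f z)) h5 (by positivity) hL
    linarith

end Tame

section Cutoffs

variable {d : ℕ} {i : Fin d} {κ δ R : ℝ}

theorem pd_comp_snd {h : ℝ → ℝ} {h' : ℝ} {z : Spc d × ℝ} (hh : HasDerivAt h h' z.2) :
    (∀ j, pd (sv j) (fun z : Spc d × ℝ => h z.2) z = 0) ∧
      pd tv (fun z : Spc d × ℝ => h z.2) z = h' := by
  have hd : DifferentiableAt ℝ (fun z : Spc d × ℝ => h z.2) z :=
    DifferentiableAt.comp (g := h) z hh.differentiableAt differentiableAt_snd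
  refine ⟨fun j => pd_eq_of_hasDerivAt hd ?_, ?_⟩
  · simpa using hasDerivAt_const (0:ℝ) (h z.2)
  · exact (hasDerivAt_slice (x := z.1) (s := z.2) hd).unique hh

/-- The smooth function `√(1 + |x|²)`. -/
noncomputable def jap {d : ℕ} (z : Spc d × ℝ) : ℝ := √(1 + ‖z.1‖ ^ 2)

theorem jap_sq (z : Spc d × ℝ) : jap z ^ 2 = 1 + ‖z.1‖ ^ 2 := Real.sq_sqrt (by positivity)

theorem one_le_jap (z : Spc d × ℝ) : 1 ≤ jap z := Real.one_le_sqrt.2 (by nlinarith [norm_nonneg z.1])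

theorem contDiff_jap : ContDiff ℝ ∞ (jap (d := d)) :=
  (contDiff_const.add (contDiff_fst.norm_sq ℝ)).sqrt fun z => by positivity

theorem pd_sv_jap (j : Fin d) (z : Spc d × ℝ) : pd (sv j) jap z = z.1 j * (jap z)⁻¹ := by
  have h := pd_sq_smooth (contDiff_jap (d := d)) (sv j) z
  have hd : DifferentiableAt ℝ (fun z : Spc d × ℝ =>
      (fun _ _ => (1:ℝ)) (z.1 j) z.2 + (fun _ => (1:ℝ)) z.2 * ‖z.1‖ ^ 2) z :=
    ((contDiff_const.add (contDiff_const.mul (contDiff_fst.norm_sq ℝ))).differentiable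
      (n := ∞) (by simp) z)
  have h2 := pd_sv_profile (i := j) (a := fun _ _ => (1:ℝ)) (b := fun _ => (1:ℝ)) j hd
    (hasDerivAt_const _ (1:ℝ))
  rw [show (fun y : Spc d × ℝ => jap y ^ 2) = fun z : Spc d × ℝ =>
      (fun _ _ => (1:ℝ)) (z.1 j) z.2 + (fun _ => (1:ℝ)) z.2 * ‖z.1‖ ^ 2 from
    funext fun y => by simp [jap_sq], h2] at h
  have := one_le_jap z
  simp only [ite_self] at h
  field_simp
  linarith

theorem pd_tv_jap (z : Spc d × ℝ) : pd tv jap z = 0 := by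
  refine pd_eq_of_hasDerivAt (contDiff_jap.differentiable (by simp) z) ?_
  simpa [jap] using hasDerivAt_const (0:ℝ) √(1 + ‖z.1‖ ^ 2)

theorem abs_coord_le_jap (j : Fin d) (z : Spc d × ℝ) : |z.1 j| ≤ jap z := by
  refine Real.abs_le_sqrt ?_
  have : z.1 j ^ 2 ≤ ‖z.1‖ ^ 2 := by
    rw [norm_sq_eq_sum]
    exact Finset.single_le_sum (f := fun j => z.1 j ^ 2) (fun _ _ => sq_nonneg _)
      (Finset.mem_univ j)
  linarith

theorem pd_coord (e : Spc d × ℝ) (j : Fin d) (z : Spc d × ℝ) :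
    pd e (fun z : Spc d × ℝ => z.1 j) z = e.1 j := by
  refine pd_eq_of_hasDerivAt
    (((contDiff_coord (i := j)).comp contDiff_fst).differentiable (by simp) z) ?_
  simpa using ((hasDerivAt_id (0:ℝ)).mul_const (e.1 j)).const_add (z.1 j)

theorem contDiff_coord_fst (j : Fin d) : ContDiff ℝ ∞ fun z : Spc d × ℝ => z.1 j :=
  (contDiff_coord (i := j)).comp contDiff_fst

theorem contDiff_inv_jap : ContDiff ℝ ∞ fun z : Spc d × ℝ => (jap z)⁻¹ :=
  contDiff_jap.inv fun z => (zero_lt_one.trans_le (one_le_jap z)).ne'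

theorem pd_pd_jap (j : Fin d) (z : Spc d × ℝ) :
    pd (sv j) (pd (sv j) jap) z = (jap z)⁻¹ - z.1 j ^ 2 * ((jap z)⁻¹) ^ 3 := by
  have h0 : jap z ≠ 0 := (zero_lt_one.trans_le (one_le_jap z)).ne'
  rw [show pd (sv j) (jap (d := d)) = fun z => z.1 j * (jap z)⁻¹ from funext (pd_sv_jap j),
    pd_mul_smooth (contDiff_coord_fst j) contDiff_inv_jap, pd_coord,
    pd_comp (hasDerivAt_inv h0) (contDiff_jap.differentiable (by simp) z), pd_sv_jap]
  simp
  field_simp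
  ring

theorem tame_time {L : ℝ} (hL1 : ∀ t, |deriv smoothTransition t| ≤ L)
    (hL2 : ∀ t, |deriv (deriv smoothTransition) t| ≤ L) (κ : ℝ) :
    Tame (L * |2 * κ| + L * |2 * κ| ^ 2)
      fun z : Spc d × ℝ => smoothTransition (2 * κ * z.2 - 1) := by
  have hκ : ∀ z : Spc d × ℝ, HasDerivAt (fun s : ℝ => 2 * κ * s - 1) (2 * κ) z.2 :=
    fun z => by simpa using ((hasDerivAt_id z.2).const_mul (2 * κ)).sub_const 1
  refine tame_smoothTransition (abs_nonneg _) (by fun_prop) (fun j z => ?_) (fun z => ?_)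
    (fun j z => ?_) hL1 hL2
  · rw [(pd_comp_snd (hκ z)).1 j, abs_zero]; positivity
  · rw [(pd_comp_snd (hκ z)).2]
  · rw [show pd (sv j) (fun z : Spc d × ℝ => 2 * κ * z.2 - 1) = fun _ => 0 from
      funext fun y => (pd_comp_snd (hκ y)).1 j, pd_const, abs_zero]
    positivity

theorem tame_coord {L : ℝ} (hL1 : ∀ t, |deriv smoothTransition t| ≤ L)
    (hL2 : ∀ t, |deriv (deriv smoothTransition) t| ≤ L) (hδ : 0 < δ) :
    Tame (L * δ⁻¹ + L * δ⁻¹ ^ 2)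
      fun z : Spc d × ℝ => smoothTransition ((z.1 i - δ) / δ) := by
  have hη : ∀ e z, pd e (fun z : Spc d × ℝ => (z.1 i - δ) / δ) z = δ⁻¹ * e.1 i := by
    intro e z
    rw [show (fun z : Spc d × ℝ => (z.1 i - δ) / δ) = fun z => δ⁻¹ * (z.1 i - δ) by
      ext; ring]
    rw [pd_const_mul _ (((contDiff_coord_fst i).sub contDiff_const).differentiable (n := ∞)
      (by simp) z), pd_sub ((contDiff_coord_fst i).differentiable (by simp) z)
      (differentiableAt_const _), pd_const, pd_coord, sub_zero]
  refine tame_smoothTransition (by positivity)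
    (((contDiff_coord_fst i).sub contDiff_const).div_const δ) (fun j z => ?_) (fun z => ?_)
    (fun j z => ?_) hL1 hL2
  · rw [hη, abs_mul, abs_of_pos (inv_pos.2 hδ)]
    refine mul_le_of_le_one_right (by positivity) ?_
    by_cases h : i = j
    · simp [h]
    · simp [h]
  · rw [hη]; simp; positivity
  · rw [show pd (sv j) (fun z : Spc d × ℝ => (z.1 i - δ) / δ) = fun _ => δ⁻¹ * (sv j).1 i from
      funext fun y => hη _ y, pd_const, abs_zero]
    positivity

theorem tame_jap {L : ℝ} (hL1 : ∀ t, |deriv smoothTransition t| ≤ L)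
    (hL2 : ∀ t, |deriv (deriv smoothTransition) t| ≤ L) (R : ℝ) :
    Tame (L * 1 + L * 1 ^ 2) fun z : Spc d × ℝ => smoothTransition (R + 1 - jap z) := by
  have hρ : ∀ e z, pd e (fun z : Spc d × ℝ => R + 1 - jap z) z = - pd e jap z := by
    intro e z
    rw [pd_sub (differentiableAt_const _) (contDiff_jap.differentiable (by simp) z), pd_const,
      zero_sub]
  have hj : ∀ z : Spc d × ℝ, (jap z)⁻¹ ≤ 1 := fun z => inv_le_one_of_one_le₀ (one_le_jap z)
  have hj0 : ∀ z : Spc d × ℝ, 0 < jap z := fun z => zero_lt_one.trans_le (one_le_jap z)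
  refine tame_smoothTransition zero_le_one (contDiff_const.sub contDiff_jap)
    (fun j z => ?_) (fun z => ?_) (fun j z => ?_) hL1 hL2
  · rw [hρ, abs_neg, pd_sv_jap, abs_mul, abs_of_pos (inv_pos.2 (hj0 z)), ← div_eq_mul_inv,
      div_le_one (hj0 z)]
    exact abs_coord_le_jap j z
  · rw [hρ, pd_tv_jap]; simp
  · rw [show pd (sv j) (fun z : Spc d × ℝ => R + 1 - jap z) = fun z => - pd (sv j) jap z from
      funext fun y => hρ _ y, pd_neg, pd_pd_jap, abs_neg]
    have h1 := hj z
    have h2 : z.1 j ^ 2 * ((jap z)⁻¹) ^ 2 ≤ 1 := by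
      rw [← mul_pow, ← div_eq_mul_inv, sq_le_one_iff_abs_le_one, abs_div, abs_of_pos (hj0 z),
        div_le_one (hj0 z)]
      exact abs_coord_le_jap j z
    have h3 : 0 < (jap z)⁻¹ := inv_pos.2 (hj0 z)
    have h4 : 0 ≤ z.1 j ^ 2 * ((jap z)⁻¹) ^ 2 := by positivity
    have h5 := mul_nonneg h3.le h4
    have h6 := mul_le_mul_of_nonneg_left h2 h3.le
    rw [abs_le]
    constructor <;> linarith

/-- The cutoff to `s > 1/(2κ)`, `xᵢ > δ` and `√(1 + |x|²) < R + 1`. -/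
noncomputable def cutoff {d : ℕ} (κ δ R : ℝ) (i : Fin d) (z : Spc d × ℝ) : ℝ :=
  smoothTransition (2 * κ * z.2 - 1) *
    (smoothTransition ((z.1 i - δ) / δ) * smoothTransition (R + 1 - jap z))

theorem exists_tame_cutoff (d : ℕ) (κ : ℝ) (hδ : 0 < δ) :
    ∃ A : ℝ, ∀ (i : Fin d) (R : ℝ), Tame A (cutoff κ δ R i) := by
  obtain ⟨L, -, hL1, hL2⟩ := exists_bound_deriv_smoothTransition
  exact ⟨_, fun i R => (tame_time hL1 hL2 κ).mul ((tame_coord hL1 hL2 hδ).mul (tame_jap hL1 hL2 R))⟩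

theorem of_cutoff_ne_zero (hκ : 0 < κ) (hδ : 0 < δ) {z : Spc d × ℝ} (h : cutoff κ δ R i z ≠ 0) :
    1 / (2 * κ) < z.2 ∧ δ < z.1 i ∧ jap z < R + 1 := by
  rw [cutoff, mul_ne_zero_iff, mul_ne_zero_iff] at h
  obtain ⟨h1, h2, h3⟩ := h
  refine ⟨?_, ?_, ?_⟩
  · by_contra hh
    refine h1 (smoothTransition.zero_of_nonpos ?_)
    have := (le_div_iff₀ (by positivity)).1 (not_lt.1 hh)
    linarith
  · by_contra hh
    exact h2 (smoothTransition.zero_of_nonpos (div_nonpos_of_nonpos_of_nonneg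
      (by linarith) hδ.le))
  · by_contra hh
    exact h3 (smoothTransition.zero_of_nonpos (by linarith))

theorem cutoff_eq_one (hκ : 0 < κ) (hδ : 0 < δ) {z : Spc d × ℝ} (h1 : 1 / κ ≤ z.2)
    (h2 : 2 * δ ≤ z.1 i) (h3 : jap z ≤ R) : cutoff κ δ R i z = 1 := by
  have h1' := (div_le_iff₀ hκ).1 h1
  rw [cutoff, smoothTransition.one_of_one_le (by linarith), smoothTransition.one_of_one_le
    ((one_le_div hδ).2 (by linarith)), smoothTransition.one_of_one_le (by linarith)]
  ring

theorem cutErr_congr {f g : Spc d × ℝ → ℝ} {z : Spc d × ℝ} (h : f =ᶠ[𝓝 z] g) :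
    cutErr f z = cutErr g z := by
  rw [cutErr, cutErr, pd_congr h, (gip_congr_nhds h h).self_of_nhds,
    (lap_congr_nhds h).self_of_nhds]

theorem cutErr_cutoff_eq_zero (hκ : 0 < κ) (hδ : 0 < δ) {z : Spc d × ℝ} (h1 : 1 / κ < z.2)
    (h2 : 2 * δ < z.1 i) (h3 : jap z < R) : cutErr (cutoff κ δ R i) z = 0 := by
  have : cutoff κ δ R i =ᶠ[𝓝 z] fun _ => 1 := by
    filter_upwards [continuous_snd.continuousAt.eventually (lt_mem_nhds h1),
      (contDiff_coord_fst i).continuous.continuousAt.eventually (lt_mem_nhds h2),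
      contDiff_jap.continuous.continuousAt.eventually (gt_mem_nhds h3)] with y hy1 hy2 hy3
    exact cutoff_eq_one hκ hδ hy1.le hy2.le hy3.le
  have e : ∀ e : Spc d × ℝ, pd e (fun _ : Spc d × ℝ => (1:ℝ)) = fun _ => 0 :=
    fun e => funext fun _ => pd_const 1
  rw [cutErr_congr this, cutErr, pd_const]
  simp [lap, gip, e, pd_const]

end Cutoffs

section TimeCutoff

variable {d : ℕ} {a b : ℝ}

/-- A function of time decreasing from one to zero on `[a, a + b]`. -/
noncomputable def timeCut {d : ℕ} (a b : ℝ) (z : Spc d × ℝ) : ℝ :=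
  1 - smoothTransition ((z.2 - a) / b)

theorem contDiff_timeCut : ContDiff ℝ ∞ (timeCut a b : Spc d × ℝ → ℝ) :=
  contDiff_const.sub (smoothTransition.contDiff.comp
    ((contDiff_snd.sub contDiff_const).div_const b))

theorem timeCut_nonneg (z : Spc d × ℝ) : 0 ≤ timeCut a b z :=
  sub_nonneg.2 (smoothTransition.le_one _)

theorem timeCut_le_one (z : Spc d × ℝ) : timeCut a b z ≤ 1 :=
  sub_le_self _ (smoothTransition.nonneg _)

theorem timeCut_eq_one (hb : 0 < b) {z : Spc d × ℝ} (h : z.2 ≤ a) : timeCut a b z = 1 := by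
  rw [timeCut, smoothTransition.zero_of_nonpos (div_nonpos_of_nonpos_of_nonneg
    (by linarith) hb.le), sub_zero]

theorem timeCut_eq_zero (hb : 0 < b) {z : Spc d × ℝ} (h : a + b ≤ z.2) : timeCut a b z = 0 := by
  rw [timeCut, smoothTransition.one_of_one_le ((one_le_div hb).2 (by linarith)), sub_self]

theorem pd_timeCut (a b : ℝ) (z : Spc d × ℝ) : (∀ j, pd (sv j) (timeCut a b) z = 0) ∧
    pd tv (timeCut a b) z = -(deriv smoothTransition ((z.2 - a) / b) * (1 / b)) := by
  refine pd_comp_snd (h := fun s => 1 - smoothTransition ((s - a) / b)) ?_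
  have h1 : HasDerivAt smoothTransition (deriv smoothTransition ((z.2 - a) / b)) ((z.2 - a) / b) :=
    ((smoothTransition.contDiff (n := 1)).differentiable (by norm_num) _).hasDerivAt
  have h2 : HasDerivAt (fun s => (s - a) / b) (1 / b) z.2 :=
    ((hasDerivAt_id z.2).sub_const a).div_const b
  simpa using (h1.comp z.2 h2).const_sub 1

theorem pd_tv_timeCut_nonpos (hb : 0 < b) (z : Spc d × ℝ) : pd tv (timeCut a b) z ≤ 0 := by
  rw [(pd_timeCut a b z).2]
  have : 0 ≤ deriv smoothTransition ((z.2 - a) / b) := smoothTransition.monotone.deriv_nonneg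
  have : 0 ≤ deriv smoothTransition ((z.2 - a) / b) * (1 / b) := by positivity
  linarith

theorem neg_pd_tv_timeCut_le {L : ℝ} (hL : ∀ t, |deriv smoothTransition t| ≤ L) (hb : 0 < b)
    (z : Spc d × ℝ) : -pd tv (timeCut a b) z ≤ L / b := by
  rw [(pd_timeCut a b z).2, neg_neg, mul_one_div]
  exact div_le_div_of_nonneg_right ((le_abs_self _).trans (hL _)) hb.le

theorem pd_tv_timeCut_eq_zero (hb : 0 < b) {z : Spc d × ℝ} (h : z.2 < a ∨ a + b < z.2) :
    pd tv (timeCut a b) z = 0 := by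
  rcases h with h | h
  · have : timeCut a b =ᶠ[𝓝 z] fun _ => 1 := by
      filter_upwards [continuous_snd.continuousAt.eventually (gt_mem_nhds h)] with y hy
      exact timeCut_eq_one hb hy.le
    rw [pd_congr this, pd_const]
  · have : timeCut a b =ᶠ[𝓝 z] fun _ => 0 := by
      filter_upwards [continuous_snd.continuousAt.eventually (lt_mem_nhds h)] with y hy
      exact timeCut_eq_zero hb hy.le
    rw [pd_congr this, pd_const]

end TimeCutoff

section

variable {d : ℕ} {i : Fin d} {κ C S δ ε R τ : ℝ} {v : Spc d → ℝ → ℝ}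

/-- The closed region containing the support of the cutoff. -/
def cutRegion {d : ℕ} (i : Fin d) (κ δ R t : ℝ) : Set (Spc d × ℝ) :=
  {z | 1 / (2 * κ) ≤ z.2 ∧ z.2 ≤ t ∧ δ ≤ z.1 i ∧ jap z ≤ R + 1}

theorem norm_le_jap (z : Spc d × ℝ) : ‖z.1‖ ≤ jap z :=
  Real.le_sqrt_of_sq_le (by linarith)

theorem isClosed_cutRegion {t : ℝ} : IsClosed (cutRegion i κ δ R t) :=
  (isClosed_le continuous_const continuous_snd).inter
    ((isClosed_le continuous_snd continuous_const).inter
    ((isClosed_le continuous_const (contDiff_coord_fst i).continuous).inter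
    (isClosed_le contDiff_jap.continuous continuous_const)))

theorem isCompact_cutRegion {t : ℝ} : IsCompact (cutRegion i κ δ R t) := by
  refine IsCompact.of_isClosed_subset ((isCompact_closedBall (0 : Spc d) (R + 1)).prod
    (isCompact_Icc (a := 1 / (2 * κ)) (b := t))) isClosed_cutRegion fun z hz => ?_
  exact ⟨mem_closedBall_zero_iff.2 ((norm_le_jap z).trans hz.2.2.2), hz.1, hz.2.1⟩

theorem tsupport_cutoff_mul_timeCut (hκ : 0 < κ) (hδ : 0 < δ) {a b : ℝ} (hb : 0 < b) :
    tsupport (fun z => cutoff κ δ R i z * timeCut a b z) ⊆ cutRegion i κ δ R (a + b) := by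
  refine closure_minimal (fun z hz => ?_) isClosed_cutRegion
  obtain ⟨h1, h2⟩ := mul_ne_zero_iff.1 hz
  obtain ⟨h3, h4, h5⟩ := of_cutoff_ne_zero hκ hδ h1
  exact ⟨h3.le, by_contra fun h => h2 (timeCut_eq_zero hb (not_le.1 h).le), h4.le, h5.le⟩

theorem contDiff_cutoff (hδ : 0 < δ) : ContDiff ℝ ∞ (cutoff κ δ R i) :=
  ((exists_tame_cutoff d κ hδ).choose_spec i R).contDiff

theorem HeatSol.carleman_cutoff (hv : HeatSol {x : Spc d | 0 < x i} ε v)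
    (hE : ∀ K ⊆ cyl {x : Spc d | 0 < x i}, IsCompact K →
      IntegrableOn (eG {x : Spc d | 0 < x i} v) K)
    (hε : ε ^ 2 ≤ 1 / 384) (hδ : 0 < δ) (hC : 2 ≤ C) (hκ : 8 ≤ κ)
    (hκC : 10 * C * (3 * C) ^ 5 ≤ κ ^ 2) (hS : 1 ≤ S)
    (hSδ : 1 ≤ S ^ 3 * ((δ / 2) ^ (1 / 4 : ℝ)) ^ 13) (hτ : 0 < τ) :
    ∫ z, timeCut (1 - 2 * τ) τ z * rexp (wt κ C S i z) ^ 2 * (cutoff κ δ R i z ^ 2 *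
        (uZ {x : Spc d | 0 < x i} v z ^ 2 + eG {x : Spc d | 0 < x i} v z) / 64) ≤
      (∫ z, timeCut (1 - 2 * τ) τ z * rexp (wt κ C S i z) ^ 2 * (cutErr (cutoff κ δ R i) z *
        (uZ {x : Spc d | 0 < x i} v z ^ 2 + eG {x : Spc d | 0 < x i} v z))) +
      ∫ z, -pd tv (timeCut (1 - 2 * τ) τ) z * max (potential (wt κ C S i) z) 0 *
        rexp (wt κ C S i z) ^ 2 * (uZ {x : Spc d | 0 < x i} v z * cutoff κ δ R i z) ^ 2 := by
  set χ : Spc d × ℝ → ℝ := fun z => cutoff κ δ R i z * timeCut (1 - τ) (τ / 2) z with hχ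
  have hτ2 : 0 < τ / 2 := by linarith
  have hκ0 : 0 < κ := by linarith
  have hts := tsupport_cutoff_mul_timeCut (R := R) (i := i) hκ0 hδ (a := 1 - τ) hτ2
  have hts' : tsupport χ ⊆ innerCyl i (δ / 2) := hts.trans fun z hz =>
    ⟨lt_of_lt_of_le (half_lt_self hδ) hz.2.2.1, lt_of_lt_of_le (by positivity) hz.1,
      lt_of_le_of_lt hz.2.1 (by linarith)⟩
  have key := (hv.weakHeat hE).carleman_absorbed (χ := χ) hε hv.fZ_sq_le (half_pos hδ) hC hκ hκC
    hS hSδ (contDiff_timeCut (a := 1 - 2 * τ) (b := τ)) (fun j z => (pd_timeCut _ _ z).1 j)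
    timeCut_nonneg (pd_tv_timeCut_nonpos hτ) ((contDiff_cutoff (i := i) (κ := κ) (R := R) hδ).mul
      (contDiff_timeCut (a := 1 - τ) (b := τ / 2)))
    (isCompact_cutRegion.of_isClosed_subset (isClosed_tsupport _) hts) hts'
  have e1 : ∀ z : Spc d × ℝ, z.2 ≤ 1 - τ → χ z = cutoff κ δ R i z := fun z hz => by
    simp only [hχ]
    rw [timeCut_eq_one hτ2 hz, mul_one]
  have e2 : ∀ z : Spc d × ℝ, z.2 < 1 - τ → cutErr χ z = cutErr (cutoff κ δ R i) z := fun z hz => by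
    refine cutErr_congr ?_
    filter_upwards [continuous_snd.continuousAt.eventually (gt_mem_nhds hz)] with y hy
    exact e1 y hy.le
  have e3 : ∀ z : Spc d × ℝ, 1 - τ ≤ z.2 → timeCut (1 - 2 * τ) τ z = 0 := fun z hz =>
    timeCut_eq_zero hτ (by linarith)
  refine (le_of_eq_of_le ?_ key).trans_eq (congr_arg₂ (· + ·) ?_ ?_)
  · refine integral_congr_ae (ae_of_all _ fun z => ?_)
    rcases le_or_gt (1 - τ) z.2 with h | h
    · simp only [e3 z h]; ring
    · simp only [e1 z h.le, eG]
  · refine integral_congr_ae (ae_of_all _ fun z => ?_)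
    rcases le_or_gt (1 - τ) z.2 with h | h
    · simp only [e3 z h]; ring
    · simp only [e2 z h, eG]
  · refine integral_congr_ae (ae_of_all _ fun z => ?_)
    rcases lt_or_ge (1 - τ) z.2 with h | h
    · simp only [pd_tv_timeCut_eq_zero hτ (Or.inr (show 1 - 2 * τ + τ < z.2 by linarith))]; ring
    · simp only [e1 z h]

end

section Young

theorem rpow_five_quarter_scale {S y : ℝ} (hS : 0 < S) (hy : 0 < y) :
    ∃ t, 0 ≤ t ∧ S ^ 3 * y ^ (5 / 4 : ℝ) = S ^ 8 * t ^ 5 ∧ y ^ 2 = S ^ 8 * t ^ 8 := by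
  obtain ⟨h1, h2, -⟩ := rpow_quarter hy
  refine ⟨y ^ (1 / 4 : ℝ) / S, by positivity, ?_, ?_⟩
  · rw [h2, div_pow]
    field_simp
  · nth_rewrite 1 [← h1]
    rw [div_pow]
    field_simp

theorem exists_young_small {ε : ℝ} (hε : 0 < ε) : ∃ c, 0 ≤ c ∧ ∀ S y : ℝ, 0 < S → 0 < y →
    S ^ 3 * y ^ (5 / 4 : ℝ) ≤ ε * y ^ 2 + c * S ^ 8 := by
  set m := max 1 (1 / ε) with hm
  have hm1 : 1 ≤ m := le_max_left _ _
  have hm2 : 1 ≤ ε * m := by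
    have := mul_le_mul_of_nonneg_left (le_max_right 1 (1 / ε)) hε.le
    rwa [mul_one_div_cancel hε.ne'] at this
  refine ⟨m ^ 5, by positivity, fun S y hS hy => ?_⟩
  obtain ⟨t, ht, h1, h2⟩ := rpow_five_quarter_scale hS hy
  rw [h1, h2]
  have key : t ^ 5 ≤ ε * t ^ 8 + m ^ 5 := by
    rcases le_total t m with h | h
    · have : t ^ 5 ≤ m ^ 5 := by gcongr
      have : 0 ≤ ε * t ^ 8 := by positivity
      linarith
    · have h3 : 1 ≤ ε * t ^ 3 := by
        have : m ≤ t ^ 3 := h.trans (le_self_pow₀ (hm1.trans h) (by norm_num))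
        exact hm2.trans (by gcongr)
      have h4 : 0 ≤ t ^ 5 := by positivity
      have : 0 ≤ m ^ 5 := by positivity
      nlinarith
  have := mul_le_mul_of_nonneg_left key (by positivity : 0 ≤ S ^ 8)
  linarith

theorem exists_young_large {ε : ℝ} (hε : 0 < ε) : ∃ A, 0 ≤ A ∧ ∀ S y : ℝ, 0 < S → 0 < y →
    S ^ 3 * y ^ (5 / 4 : ℝ) ≤ A * y ^ 2 + ε * S ^ 8 := by
  set m := min 1 ε with hm
  have hm1 : m ≤ 1 := min_le_left _ _
  have hm2 : m ≤ ε := min_le_right _ _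
  have hm0 : 0 < m := lt_min one_pos hε
  refine ⟨1 / m ^ 3, by positivity, fun S y hS hy => ?_⟩
  obtain ⟨t, ht, h1, h2⟩ := rpow_five_quarter_scale hS hy
  rw [h1, h2]
  have key : t ^ 5 ≤ 1 / m ^ 3 * t ^ 8 + ε := by
    rcases le_total t m with h | h
    · have h3 : t ^ 5 ≤ m ^ 5 := by gcongr
      have h4 : m ^ 5 ≤ m := pow_le_of_le_one hm0.le hm1 (by norm_num)
      have : 0 ≤ 1 / m ^ 3 * t ^ 8 := by positivity
      linarith
    · have h3 : 1 ≤ 1 / m ^ 3 * t ^ 3 := by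
        rw [one_div_mul_eq_div, one_le_div (by positivity)]
        gcongr
      have h4 : 0 ≤ t ^ 5 := by positivity
      nlinarith
  have := mul_le_mul_of_nonneg_left key (by positivity : 0 ≤ S ^ 8)
  linarith

end Young

section WeightBounds

variable {d : ℕ} {i : Fin d} {κ C S δ : ℝ} {z : Spc d × ℝ}

theorem coord_sq_le (x : Spc d) (i : Fin d) : x i ^ 2 ≤ ‖x‖ ^ 2 := by
  rw [norm_sq_eq_sum]
  exact Finset.single_le_sum (f := fun j => x j ^ 2) (fun _ _ => sq_nonneg _)
    (Finset.mem_univ i)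

/-- For `C` large the weight is small near the initial time. -/
theorem exists_wt_le_of_early : ∃ C : ℝ, 2 ≤ C ∧ ∀ (d : ℕ) (i : Fin d) (κ S : ℝ) (z : Spc d × ℝ),
    8 ≤ κ → 0 < S → 0 < z.1 i → 0 ≤ z.2 → z.2 ≤ 1 / κ → 2 * wt κ C S i z ≤ -(‖z.1‖ ^ 2 / 10) := by
  have he : 0 < rexp 1 := exp_pos 1
  obtain ⟨c, hc, h⟩ := exists_young_small (ε := 1 / (200 * rexp 1)) (by positivity)
  refine ⟨max 2 (8 * (rexp 1 * c)), le_max_left _ _, fun d i κ S z hκ hS hz hs0 hs => ?_⟩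
  set C := max 2 (8 * (rexp 1 * c)) with hC
  have hCc : 8 * (rexp 1 * c) ≤ C := le_max_right _ _
  have hκs : κ * z.2 ≤ 1 := by
    rw [mul_comm]; exact (le_div_iff₀ (by linarith)).1 hs
  have h8 : z.2 ≤ 1 / 8 := by nlinarith
  have h1 := h S (z.1 i) hS hz
  have h2 := mul_le_mul_of_nonneg_left h1 he.le
  have e2 : rexp 1 * (1 / (200 * rexp 1) * z.1 i ^ 2 + c * S ^ 8) =
      z.1 i ^ 2 / 200 + rexp 1 * c * S ^ 8 := by field_simp
  rw [e2] at h2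
  have h3 : S ^ 3 * rexp (κ * z.2) * z.1 i ^ (5 / 4 : ℝ) ≤
      rexp 1 * (S ^ 3 * z.1 i ^ (5 / 4 : ℝ)) := by
    have : rexp (κ * z.2) ≤ rexp 1 := exp_le_exp.2 hκs
    calc _ = rexp (κ * z.2) * (S ^ 3 * z.1 i ^ (5 / 4 : ℝ)) := by ring
      _ ≤ _ := by gcongr
  have h4 := coord_sq_le z.1 i
  have h5 : 1 / 8 ≤ (z.2 - 1 / 2) ^ 2 := by nlinarith
  have h6 : 8 * (rexp 1 * c) * S ^ 8 * (1 / 8) ≤ C * S ^ 8 * (z.2 - 1 / 2) ^ 2 := by gcongr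
  have h7 := mul_nonneg hs0 (sq_nonneg ‖z.1‖)
  have h9 := sq_nonneg ‖z.1‖
  rw [wt]
  linarith

/-- The weight is small far away. -/
theorem exists_wt_le_of_far (hC : 0 ≤ C) (hκ : 0 ≤ κ) : ∃ S₀ : ℝ, ∀ S, S₀ ≤ S → 1 ≤ S →
    ∀ (i : Fin d) (z : Spc d × ℝ), 0 < z.1 i → z.2 ∈ Icc (0:ℝ) 1 → S ^ 8 ≤ jap z →
      2 * wt κ C S i z ≤ -(‖z.1‖ ^ 2 / 10) := by
  have he : 0 < rexp κ := exp_pos κ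
  obtain ⟨c, hc, h⟩ := exists_young_small (ε := 1 / (160 * rexp κ)) (by positivity)
  refine ⟨160 * (rexp κ * c) + 1, fun S hS0 hS i z hz hs hj => ?_⟩
  have hSp : 0 < S := by linarith
  have h1 := mul_le_mul_of_nonneg_left (h S (z.1 i) hSp hz) he.le
  have e2 : rexp κ * (1 / (160 * rexp κ) * z.1 i ^ 2 + c * S ^ 8) =
      z.1 i ^ 2 / 160 + rexp κ * c * S ^ 8 := by field_simp
  rw [e2] at h1
  have h3 : S ^ 3 * rexp (κ * z.2) * z.1 i ^ (5 / 4 : ℝ) ≤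
      rexp κ * (S ^ 3 * z.1 i ^ (5 / 4 : ℝ)) := by
    have : rexp (κ * z.2) ≤ rexp κ := exp_le_exp.2 (mul_le_of_le_one_right hκ hs.2)
    calc _ = rexp (κ * z.2) * (S ^ 3 * z.1 i ^ (5 / 4 : ℝ)) := by ring
      _ ≤ _ := by gcongr
  have h4 := coord_sq_le z.1 i
  have h5 : 0 ≤ C * S ^ 8 * (z.2 - 1 / 2) ^ 2 := by positivity
  have h7 := mul_nonneg hs.1 (sq_nonneg ‖z.1‖)
  have h8 : S ≤ S ^ 8 := le_self_pow₀ hS (by norm_num)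
  have h9 : S ^ 8 * S ^ 8 ≤ 1 + ‖z.1‖ ^ 2 := by
    rw [← jap_sq, ← sq]; gcongr
  have h10 : S ^ 8 * (160 * (rexp κ * c) + 1) ≤ S ^ 8 * S ^ 8 := by gcongr; linarith
  have h11 : 1 ≤ S ^ 8 := one_le_pow₀ hS
  rw [wt]
  linarith

/-- The weight is controlled near the flat boundary. -/
theorem exists_wt_le_of_boundary (hC : 0 < C) (hκ : 0 < κ) (hδ : 0 < δ) : ∃ S₀ : ℝ, ∀ S, S₀ ≤ S →
    1 ≤ S → ∀ (i : Fin d) (z : Spc d × ℝ), δ ≤ z.1 i → z.1 i ≤ 2 * δ → z.2 ∈ Icc (0:ℝ) 1 →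
      2 * wt κ C S i z ≤ 2 * (S ^ 3 * (rexp (κ / 2) * (3 * δ) ^ (5 / 4 : ℝ))) - ‖z.1‖ ^ 2 / 10 := by
  set a := Real.log ((3 / 2 : ℝ) ^ (5 / 4 : ℝ)) / κ with ha
  have ha0 : 0 < a := div_pos (Real.log_pos (Real.one_lt_rpow (by norm_num) (by norm_num))) hκ
  refine ⟨rexp κ * (2 * δ) ^ (5 / 4 : ℝ) / (C * a ^ 2), fun S hS0 hS i z h1 h2 hs => ?_⟩
  have hSp : 0 < S := by linarith
  have hz : 0 < z.1 i := by linarith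
  have h3 : z.1 i ^ (5 / 4 : ℝ) ≤ (2 * δ) ^ (5 / 4 : ℝ) :=
    Real.rpow_le_rpow hz.le h2 (by norm_num)
  have h7 := mul_nonneg hs.1 (sq_nonneg ‖z.1‖)
  have h8 := sq_nonneg ‖z.1‖
  have main : S ^ 3 * rexp (κ * z.2) * z.1 i ^ (5 / 4 : ℝ) - C * S ^ 8 * (z.2 - 1 / 2) ^ 2 ≤
      S ^ 3 * (rexp (κ / 2) * (3 * δ) ^ (5 / 4 : ℝ)) := by
    rcases le_or_gt (z.2 - 1 / 2) a with h | h
    · have h4 : rexp (κ * z.2) ≤ rexp (κ / 2) * (3 / 2 : ℝ) ^ (5 / 4 : ℝ) := by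
        have h5 := (le_div_iff₀ hκ).1 h
        rw [← Real.le_log_iff_exp_le (by positivity), Real.log_mul (by positivity)
          (by positivity), Real.log_exp]
        linarith
      have h5 : 0 ≤ C * S ^ 8 * (z.2 - 1 / 2) ^ 2 := by positivity
      have h6 : (3 * δ) ^ (5 / 4 : ℝ) = (3 / 2 : ℝ) ^ (5 / 4 : ℝ) * (2 * δ) ^ (5 / 4 : ℝ) := by
        rw [← Real.mul_rpow (by norm_num) (by positivity)]
        congr 1
        ring
      have h9 : S ^ 3 * rexp (κ * z.2) * z.1 i ^ (5 / 4 : ℝ) ≤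
          S ^ 3 * (rexp (κ / 2) * (3 / 2 : ℝ) ^ (5 / 4 : ℝ)) * (2 * δ) ^ (5 / 4 : ℝ) := by gcongr
      rw [h6]
      linarith
    · have h4 : rexp (κ * z.2) ≤ rexp κ := exp_le_exp.2 (mul_le_of_le_one_right hκ.le hs.2)
      have h5 : S ^ 3 * rexp (κ * z.2) * z.1 i ^ (5 / 4 : ℝ) ≤
          S ^ 3 * rexp κ * (2 * δ) ^ (5 / 4 : ℝ) := by gcongr
      have h6 := (div_le_iff₀ (by positivity)).1 hS0
      have h9 : a ^ 2 ≤ (z.2 - 1 / 2) ^ 2 := by gcongr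
      have h10 : S ^ 4 ≤ S ^ 8 := pow_le_pow_right₀ hS (by norm_num)
      have h11 : C * S ^ 4 * a ^ 2 ≤ C * S ^ 8 * (z.2 - 1 / 2) ^ 2 := by gcongr
      have h12 := mul_le_mul_of_nonneg_left h6 (by positivity : 0 ≤ S ^ 3)
      have : 0 ≤ S ^ 3 * (rexp (κ / 2) * (3 * δ) ^ (5 / 4 : ℝ)) := by positivity
      linarith
  rw [wt]
  linarith

theorem rpow_le_one_add_sq {y p : ℝ} (hy : 0 < y) (hp0 : 0 ≤ p) (hp : p ≤ 2) :
    y ^ p ≤ 1 + y ^ 2 := by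
  rcases le_total y 1 with h | h
  · have := Real.rpow_le_one hy.le h hp0
    nlinarith
  · have := Real.rpow_le_rpow_of_exponent_le h hp
    rw [Real.rpow_two] at this
    linarith

/-- The weight at the final time grows at most like a Gaussian, uniformly in `S`. -/
theorem exists_potential_mul_le (hC : 2 ≤ C) (hκ : 0 ≤ κ) : ∃ A : ℝ, 0 ≤ A ∧ ∀ S, 1 ≤ S →
    ∀ (i : Fin d) (x : Spc d), 0 < x i → max (potential (wt κ C S i) (x, 1)) 0 *
      rexp (wt κ C S i (x, 1)) ^ 2 ≤ A * rexp (A * ‖x‖ ^ 2) := by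
  have he : 0 < rexp κ := exp_pos κ
  obtain ⟨A, hA, h⟩ := exists_young_large (ε := 1 / (4 * rexp κ)) (by positivity)
  set c := 25 / 16 * rexp (2 * κ) + κ * rexp κ with hc
  have hc0 : 0 ≤ c := by positivity
  refine ⟨max (2 * c) (2 * (rexp κ * A) + 1), by positivity, fun S hS i x hx => ?_⟩
  set q := ‖x‖ ^ 2 with hq
  have hq0 : 0 ≤ q := sq_nonneg _
  have hxq : x i ^ 2 ≤ q := coord_sq_le x i
  have hSp : 0 < S := by linarith
  have h1 : potential (wt κ C S i) (x, 1) ≤ c * S ^ 6 * (1 + q) := by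
    rw [potential_wt (show 0 < ((x, (1:ℝ)) : Spc d × ℝ).1 i from hx)]
    simp only
    have h2 : x i ^ (1 / 2 : ℝ) ≤ 1 + q := (rpow_le_one_add_sq hx (by norm_num)
      (by norm_num)).trans (by linarith)
    have h3 : x i ^ (5 / 4 : ℝ) ≤ 1 + q := (rpow_le_one_add_sq hx (by norm_num)
      (by norm_num)).trans (by linarith)
    have h4 : S ^ 3 ≤ S ^ 6 := pow_le_pow_right₀ hS (by norm_num)
    have h5 : 25 / 16 * S ^ 6 * rexp (2 * κ * 1) * x i ^ (1 / 2 : ℝ) ≤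
        25 / 16 * S ^ 6 * rexp (2 * κ * 1) * (1 + q) := by gcongr
    have h6 : (κ - 5 / 16 * (1 + 1)) * (S ^ 3 * rexp (κ * 1) * x i ^ (5 / 4 : ℝ)) ≤
        κ * (S ^ 6 * rexp (κ * 1) * (1 + q)) := by
      have : 0 ≤ S ^ 3 * rexp (κ * 1) * x i ^ (5 / 4 : ℝ) := by positivity
      calc _ ≤ κ * (S ^ 3 * rexp (κ * 1) * x i ^ (5 / 4 : ℝ)) := by gcongr; linarith
        _ ≤ _ := by gcongr
    have h7 : 0 ≤ C * S ^ 8 := by positivity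
    simp only [mul_one] at h5 h6 ⊢
    rw [show c * S ^ 6 * (1 + q) = 25 / 16 * S ^ 6 * rexp (2 * κ) * (1 + q) +
      κ * (S ^ 6 * rexp κ * (1 + q)) by rw [hc]; ring]
    linarith
  have h2 : rexp (wt κ C S i (x, 1)) ^ 2 ≤ rexp (2 * (rexp κ * A) * q - S ^ 8 / 2) := by
    rw [← Real.exp_nat_mul]
    refine exp_le_exp.2 ?_
    have h3 := mul_le_mul_of_nonneg_left (h S (x i) hSp hx) he.le
    have e3 : rexp κ * (A * x i ^ 2 + 1 / (4 * rexp κ) * S ^ 8) =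
      rexp κ * A * x i ^ 2 + S ^ 8 / 4 := by field_simp
    rw [e3] at h3
    have h4 : rexp κ * A * x i ^ 2 ≤ rexp κ * A * q := by gcongr
    have h5 : 2 * S ^ 8 ≤ C * S ^ 8 := by gcongr
    rw [wt]
    simp only [mul_one, Nat.cast_ofNat]
    have : ‖x‖ ^ 2 = q := rfl
    rw [this]
    linarith
  have h3 : S ^ 6 ≤ 2 * rexp (S ^ 8 / 2) := by
    have h4 : S ^ 6 ≤ S ^ 8 := pow_le_pow_right₀ hS (by norm_num)
    have := Real.add_one_le_exp (S ^ 8 / 2)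
    linarith
  calc max (potential (wt κ C S i) (x, 1)) 0 * rexp (wt κ C S i (x, 1)) ^ 2
      ≤ (c * (2 * rexp (S ^ 8 / 2)) * rexp q) * rexp (2 * (rexp κ * A) * q - S ^ 8 / 2) := by
        refine mul_le_mul (max_le (h1.trans ?_) (by positivity)) h2 (by positivity) (by positivity)
        have : 1 + q ≤ rexp q := by linarith [Real.add_one_le_exp q]
        gcongr
    _ = 2 * c * rexp ((2 * (rexp κ * A) + 1) * q) := by
        rw [show (2 * (rexp κ * A) + 1) * q = S ^ 8 / 2 + (q + (2 * (rexp κ * A) * q - S ^ 8 / 2))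
          by ring, Real.exp_add, Real.exp_add]
        ring
    _ ≤ _ := by gcongr <;> simp

/-- The weight is large near the middle time, away from the flat boundary. -/
theorem exists_le_wt (hC : 0 ≤ C) (hκ : 0 < κ) (hδ : 0 < δ) : ∃ S₀ : ℝ, ∀ S, S₀ ≤ S → 1 ≤ S →
    ∀ (i : Fin d) (z : Spc d × ℝ), 4 * δ ≤ z.1 i → |z.2 - 1 / 2| ≤ 1 / S ^ 4 → z.2 ≤ 1 →
      S ^ 3 * (rexp (κ / 2) * (7 / 2 * δ) ^ (5 / 4 : ℝ)) - C - ‖z.1‖ ^ 2 / 8 ≤ wt κ C S i z := by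
  set a := Real.log ((8 / 7 : ℝ) ^ (5 / 4 : ℝ)) with ha
  have ha0 : 0 < a := Real.log_pos (Real.one_lt_rpow (by norm_num) (by norm_num))
  refine ⟨κ / a, fun S hS0 hS i z hz hs hs1 => ?_⟩
  have hSp : 0 < S := by linarith
  have hz0 : 0 < z.1 i := by linarith
  have h1 : (4 * δ) ^ (5 / 4 : ℝ) ≤ z.1 i ^ (5 / 4 : ℝ) :=
    Real.rpow_le_rpow (by positivity) hz (by norm_num)
  have h2 : (4 * δ) ^ (5 / 4 : ℝ) = rexp a * (7 / 2 * δ) ^ (5 / 4 : ℝ) := by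
    rw [ha, Real.exp_log (by positivity), ← Real.mul_rpow (by norm_num) (by positivity)]
    congr 1
    ring
  have h3 : κ / 2 ≤ κ * z.2 + a := by
    have h4 := (div_le_iff₀ ha0).1 hS0
    have h5 : S ≤ S ^ 4 := le_self_pow₀ hS (by norm_num)
    have h6 : κ * (1 / S ^ 4) ≤ a := by
      rw [mul_one_div, div_le_iff₀ (by positivity)]
      nlinarith
    have h7 := (abs_le.1 hs).1
    nlinarith
  have h4 : rexp (κ / 2) * (7 / 2 * δ) ^ (5 / 4 : ℝ) ≤ rexp (κ * z.2) * z.1 i ^ (5 / 4 : ℝ) := by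
    calc _ ≤ rexp (κ * z.2 + a) * (7 / 2 * δ) ^ (5 / 4 : ℝ) := by gcongr
      _ = rexp (κ * z.2) * (4 * δ) ^ (5 / 4 : ℝ) := by rw [h2, Real.exp_add]; ring
      _ ≤ _ := by gcongr
  have h5 := mul_le_mul_of_nonneg_left h4 (by positivity : 0 ≤ S ^ 3)
  have h6 : C * S ^ 8 * (z.2 - 1 / 2) ^ 2 ≤ C := by
    have : (z.2 - 1 / 2) ^ 2 ≤ (1 / S ^ 4) ^ 2 := sq_le_sq' (by linarith [(abs_le.1 hs).1])
      (abs_le.1 hs).2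
    calc _ ≤ C * S ^ 8 * (1 / S ^ 4) ^ 2 := by gcongr
      _ = C := by field_simp
  have h7 := mul_le_mul_of_nonneg_right hs1 (sq_nonneg ‖z.1‖)
  rw [wt]
  linarith

end WeightBounds

section CutTerm

variable {d : ℕ} {i : Fin d} {κ C S δ R ε M M0 τ : ℝ} {v : Spc d → ℝ → ℝ}

/-- The growth rate (in `S ^ 3`) of the weight at the middle time and height `y`. -/
noncomputable def rate (κ y : ℝ) : ℝ := rexp (κ / 2) * y ^ (5 / 4 : ℝ)

theorem rate_nonneg {y : ℝ} (hy : 0 ≤ y) : 0 ≤ rate κ y := by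
  rw [rate]; positivity

theorem le_of_cutErr_cutoff_ne_zero (hκ : 0 < κ) (hδ : 0 < δ) {z : Spc d × ℝ}
    (hz : cutErr (cutoff κ δ R i) z ≠ 0) : δ ≤ z.1 i := by
  have h1 : z ∈ tsupport (cutoff κ δ R i) := by
    by_contra h; exact hz (cutErr_eq_zero h)
  have h2 : IsClosed {z : Spc d × ℝ | δ ≤ z.1 i} :=
    isClosed_le continuous_const (contDiff_coord_fst i).continuous
  exact closure_minimal (fun y hy => (of_cutoff_ne_zero hκ hδ hy).2.1.le) h2 h1

/-- The error due to the spatial cutoff is controlled by the weight at height `3δ`. -/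
theorem HeatSol.exists_cut_term_le (hv : HeatSol {x : Spc d | 0 < x i} M v) (hε : ε ≤ 1 / 100)
    (hg : ∀ x ∈ {x : Spc d | 0 < x i}, ∀ s ∈ Icc (0:ℝ) 1, |v x s| ≤ M0 * rexp (ε * ‖x‖ ^ 2))
    (hδ : 0 < δ) (hC : 2 ≤ C) (hκ : 8 ≤ κ)
    (he : ∀ (S : ℝ) (z : Spc d × ℝ), 0 < S → 0 < z.1 i → 0 ≤ z.2 → z.2 ≤ 1 / κ →
      2 * wt κ C S i z ≤ -(‖z.1‖ ^ 2 / 10)) :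
    ∃ P S₀ : ℝ, 0 ≤ P ∧ ∀ S, S₀ ≤ S → 1 ≤ S → ∀ τ, 0 < τ →
      ∫ z, timeCut (1 - 2 * τ) τ z * rexp (wt κ C S i z) ^ 2 * (cutErr (cutoff κ δ (S ^ 8) i) z *
        (uZ {x : Spc d | 0 < x i} v z ^ 2 + eG {x : Spc d | 0 < x i} v z)) ≤
      P * rexp (2 * (S ^ 3 * rate κ (3 * δ))) := by
  have hκ0 : 0 < κ := by linarith
  obtain ⟨A, hA⟩ := exists_tame_cutoff d κ hδ
  obtain ⟨S₁, h₁⟩ := exists_wt_le_of_far (d := d) (C := C) (κ := κ) (by linarith) hκ0.le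
  obtain ⟨S₂, h₂⟩ := exists_wt_le_of_boundary (d := d) (C := C) (κ := κ) (δ := δ)
    (by linarith) hκ0 hδ
  have hJ := hv.integrableOn_weighted hε hg hδ
  have hmeas : MeasurableSet {z : Spc d × ℝ | δ ≤ z.1 i} :=
    (isClosed_le continuous_const (contDiff_coord_fst i).continuous).measurableSet
  set E : Spc d × ℝ → ℝ := fun z => uZ {x : Spc d | 0 < x i} v z ^ 2 +
    eG {x : Spc d | 0 < x i} v z with hEdef
  have hE0 : ∀ z, 0 ≤ E z := fun z => add_nonneg (sq_nonneg _) (eG_nonneg _ _ _)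
  set P := 3 * (A + d * A) ^ 2 + 13 * (d * A ^ 2)
  have hP : 0 ≤ P := by positivity
  set J := ∫ z in {z : Spc d × ℝ | δ ≤ z.1 i}, rexp (-(‖z.1‖ ^ 2 / 10)) * E z
  have hJ0 : 0 ≤ J := integral_nonneg fun z => mul_nonneg (exp_pos _).le (hE0 z)
  refine ⟨P * J, max S₁ S₂, mul_nonneg hP hJ0, fun S hS hS1 τ hτ => ?_⟩
  have hSp : 0 < S := by linarith
  set Γ := rexp (2 * (S ^ 3 * rate κ (3 * δ))) with hΓ
  have hΓ1 : 1 ≤ Γ := Real.one_le_exp (by have := rate_nonneg (κ := κ) (y := 3 * δ) (by positivity)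
                                          positivity)
  have hpt : ∀ z : Spc d × ℝ, timeCut (1 - 2 * τ) τ z * rexp (wt κ C S i z) ^ 2 *
      (cutErr (cutoff κ δ (S ^ 8) i) z * E z) ≤ P * Γ *
        {z : Spc d × ℝ | δ ≤ z.1 i}.indicator (fun z => rexp (-(‖z.1‖ ^ 2 / 10)) * E z) z := by
    intro z
    have hr : 0 ≤ P * Γ * {z : Spc d × ℝ | δ ≤ z.1 i}.indicator
        (fun z => rexp (-(‖z.1‖ ^ 2 / 10)) * E z) z :=
      mul_nonneg (by positivity) (indicator_nonneg (fun z _ => mul_nonneg (exp_pos _).le (hE0 z)) z)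
    by_cases hz : cutErr (cutoff κ δ (S ^ 8) i) z = 0
    · rw [hz, zero_mul, mul_zero]; exact hr
    by_cases hc : z ∈ cyl {x : Spc d | 0 < x i}
    swap
    · have : E z = 0 := by simp [hEdef, uZ, hc, eG_eq_zero hc]
      rw [this, mul_zero, mul_zero]; exact hr
    have hδz := le_of_cutErr_cutoff_ne_zero hκ0 hδ hz
    have hz0 : 0 < z.1 i := hc.1
    have hs : z.2 ∈ Icc (0:ℝ) 1 := ⟨hc.2.1.le, hc.2.2.le⟩
    have hw : rexp (wt κ C S i z) ^ 2 ≤ Γ * rexp (-(‖z.1‖ ^ 2 / 10)) := by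
      rw [← Real.exp_nat_mul, hΓ, ← Real.exp_add]
      refine exp_le_exp.2 ?_
      push_cast
      have hr := rate_nonneg (κ := κ) (y := 3 * δ) (by positivity)
      have hr2 : 0 ≤ S ^ 3 * rate κ (3 * δ) := by positivity
      rcases le_or_gt z.2 (1 / κ) with h | h
      · linarith [he S z hSp hz0 hs.1 h]
      rcases le_or_gt (z.1 i) (2 * δ) with h' | h'
      · have := h₂ S ((le_max_right _ _).trans hS) hS1 i z hδz h' hs
        rw [rate]
        linarith
      rcases lt_or_ge (jap z) (S ^ 8) with h'' | h''
      · exact absurd (cutErr_cutoff_eq_zero hκ0 hδ h h' h'') hz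
      · linarith [h₁ S ((le_max_left _ _).trans hS) hS1 i z hz0 hs h'']
    rw [indicator_of_mem (show z ∈ {z : Spc d × ℝ | δ ≤ z.1 i} from hδz)]
    calc timeCut (1 - 2 * τ) τ z * rexp (wt κ C S i z) ^ 2 *
          (cutErr (cutoff κ δ (S ^ 8) i) z * E z)
        ≤ 1 * (Γ * rexp (-(‖z.1‖ ^ 2 / 10))) * (P * E z) := by
          have h3 := (hA i (S ^ 8)).cutErr_le z
          have h4 := timeCut_le_one (a := 1 - 2 * τ) (b := τ) z
          have h5 := timeCut_nonneg (a := 1 - 2 * τ) (b := τ) z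
          have h6 := cutErr_nonneg (χ := cutoff κ δ (S ^ 8) i) z
          have h7 := hE0 z
          gcongr
      _ = _ := by ring
  calc _ ≤ ∫ z, P * Γ * {z : Spc d × ℝ | δ ≤ z.1 i}.indicator
        (fun z => rexp (-(‖z.1‖ ^ 2 / 10)) * E z) z := by
        refine integral_mono_of_nonneg (ae_of_all _ fun z => ?_)
          ((hJ.integrable_indicator hmeas).const_mul _) (ae_of_all _ hpt)
        exact mul_nonneg (mul_nonneg (timeCut_nonneg z) (sq_nonneg _))
          (mul_nonneg (cutErr_nonneg z) (hE0 z))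
    _ = P * J * Γ := by
        rw [integral_const_mul, integral_indicator hmeas]
        ring

end CutTerm

section FinalTerm

variable {d : ℕ} {i : Fin d} {κ C S δ R ε M M0 τ A : ℝ} {O K : Set (Spc d)} {v : Spc d → ℝ → ℝ}
  {b : Spc d × ℝ → ℝ}

theorem setIntegral_prod_symm {f : Spc d × ℝ → ℝ} {I : Set ℝ} (hf : IntegrableOn f (K ×ˢ I)) :
    ∫ z in K ×ˢ I, f z = ∫ s in I, ∫ x in K, f (x, s) := by
  rw [Measure.volume_eq_prod, ← setIntegral_prod_swap, setIntegral_prod]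
  · rfl
  · exact hf.swap

theorem HeatSol.continuousOn_integral_sq (hv : HeatSol O M v) (hK : IsCompact K) (hKO : K ⊆ O)
    (hb : ContinuousOn b (K ×ˢ Icc (0:ℝ) 1)) :
    ContinuousOn (fun s => ∫ x in K, b (x, s) * v x s ^ 2) (Icc 0 1) := by
  obtain ⟨m, hm⟩ := hv.bdd K hKO hK
  obtain ⟨B, hB⟩ := (hK.prod isCompact_Icc).exists_bound_of_continuousOn hb
  refine continuousOn_of_dominated (bound := fun _ => B * m ^ 2) (fun s hs => ?_)
    (fun s hs => ?_) (integrableOn_const hK.measure_lt_top.ne) ?_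
  · refine ContinuousOn.aestronglyMeasurable ?_ hK.measurableSet
    exact (hb.comp (by fun_prop) fun x hx => ⟨hx, hs⟩).mul
      (((hv.contDiffOn s hs).continuousOn.mono hKO).pow 2)
  · filter_upwards [ae_restrict_mem hK.measurableSet] with x hx
    have h1 := hB (x, s) ⟨hx, hs⟩
    have h2 := hm x hx s hs
    rw [norm_mul, norm_pow, Real.norm_eq_abs (v x s)]
    gcongr
    exact (norm_nonneg _).trans h1
  · filter_upwards [ae_restrict_mem hK.measurableSet] with x hx
    exact (hb.comp (by fun_prop) fun s hs => ⟨hx, hs⟩).mul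
      ((hv.differentiableOn x (hKO hx)).continuousOn.pow 2)

/-- The contribution of the time cutoff is controlled by the final time slice. -/
theorem HeatSol.exists_timeCut_le (hv : HeatSol O M v) (hK : IsCompact K) (hKO : K ⊆ O)
    (hb : ContinuousOn b (K ×ˢ Icc (0:ℝ) 1)) (hb0 : ∀ z, 0 ≤ b z) (hbK : ∀ z, z.1 ∉ K → b z = 0)
    {L : ℝ} (hL : ∀ t, |deriv smoothTransition t| ≤ L) :
    ∃ τ, 0 < τ ∧ τ ≤ 1 / 8 ∧ ∫ z, -pd tv (timeCut (1 - 2 * τ) τ) z * (b z * uZ O v z ^ 2) ≤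
      L * ((∫ x in K, b (x, 1) * v x 1 ^ 2) + 1) := by
  set m : ℝ → ℝ := fun s => ∫ x in K, b (x, s) * v x s ^ 2 with hm
  have hm0 : ∀ s, 0 ≤ m s := fun s => integral_nonneg fun x => mul_nonneg (hb0 _) (sq_nonneg _)
  have hmc : ContinuousWithinAt m (Icc 0 1) 1 :=
    hv.continuousOn_integral_sq hK hKO hb 1 ⟨zero_le_one, le_rfl⟩
  obtain ⟨η, hη, hη'⟩ := Metric.continuousWithinAt_iff.1 hmc 1 one_pos
  refine ⟨min (1 / 8) (η / 4), by positivity, min_le_left _ _, ?_⟩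
  set τ := min (1 / 8) (η / 4)
  have hτ : 0 < τ := by positivity
  have hτ8 : τ ≤ 1 / 8 := min_le_left _ _
  have hτη : τ ≤ η / 4 := min_le_right _ _
  set I := Icc (1 - 2 * τ) (1 - τ)
  have hI : I ⊆ Icc 0 1 := Icc_subset_Icc (by linarith) (by linarith)
  have hIo : I ⊆ Ioo 0 1 := fun s hs => ⟨by linarith [hs.1], by linarith [hs.2]⟩
  have hcyl : K ×ˢ I ⊆ cyl O := prod_mono hKO hIo
  have hKI : IsCompact (K ×ˢ I) := hK.prod isCompact_Icc
  set G : Spc d × ℝ → ℝ := fun z => -pd tv (timeCut (1 - 2 * τ) τ) z * (b z * uZ O v z ^ 2) with hG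
  have hG0 : ∀ z ∉ K ×ˢ I, G z = 0 := by
    intro z hz
    by_cases hzK : z.1 ∈ K
    · have : z.2 < 1 - 2 * τ ∨ 1 - 2 * τ + τ < z.2 := by
        by_contra! h
        exact hz ⟨hzK, h.1, by linarith [h.2]⟩
      simp only [hG]
      rw [pd_tv_timeCut_eq_zero hτ this]
      ring
    · simp only [hG]
      rw [hbK z hzK]
      ring
  have hGi : IntegrableOn G (K ×ˢ I) := by
    have h1 := hv.sq_integrableOn_uZ hKI hcyl
    have h2 : ContinuousOn (fun z => -pd tv (timeCut (1 - 2 * τ) τ) z * b z) (K ×ˢ I) :=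
      (contDiff_timeCut.pd_infty (e := tv)).continuous.neg.continuousOn.mul
        (hb.mono (prod_mono le_rfl hI))
    refine (h1.continuousOn_mul h2 hKI).congr_fun (fun z _ => ?_) hKI.measurableSet
    simp only [hG]
    ring
  have e1 : ∫ z, G z = ∫ s in I, ∫ x in K, G (x, s) := by
    rw [← setIntegral_eq_integral_of_forall_compl_eq_zero hG0, setIntegral_prod_symm hGi]
  rw [e1]
  have hL0 : 0 ≤ L := (abs_nonneg _).trans (hL 0)
  have hbd : ∀ s ∈ I, ‖∫ x in K, G (x, s)‖ ≤ L / τ * (m 1 + 1) := by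
    intro s hs
    have e2 : ∫ x in K, G (x, s) = -pd tv (timeCut (1 - 2 * τ) τ) ((0 : Spc d), s) * m s := by
      rw [hm, ← integral_const_mul]
      refine setIntegral_congr_fun hK.measurableSet fun x hx => ?_
      simp only [hG, uZ]
      rw [indicator_of_mem (show (x, s) ∈ cyl O from ⟨hKO hx, hIo hs⟩), (pd_timeCut _ _ (x, s)).2,
        (pd_timeCut _ _ ((0 : Spc d), s)).2]
    have h3 : m s ≤ m 1 + 1 := by
      have := hη' (hI hs) (by
        rw [Real.dist_eq, abs_lt]
        constructor <;> linarith [hs.1, hs.2])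
      rw [Real.dist_eq, abs_lt] at this
      linarith
    have h4 := pd_tv_timeCut_nonpos (a := 1 - 2 * τ) hτ ((0 : Spc d), s)
    rw [e2, Real.norm_of_nonneg (mul_nonneg (by linarith) (hm0 s))]
    exact mul_le_mul (neg_pd_tv_timeCut_le hL hτ _) h3 (hm0 s) (by positivity)
  have h5 := norm_setIntegral_le_of_norm_le_const (μ := volume) (s := I)
    isCompact_Icc.measure_lt_top hbd
  have h6 : volume.real I = τ := by
    rw [Real.volume_real_Icc_of_le (by linarith)]; ring
  rw [h6] at h5
  refine ((le_abs_self _).trans h5).trans (le_of_eq ?_)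
  rw [mul_right_comm, div_mul_cancel₀ _ hτ.ne']

/-- Super-Gaussian decay makes the final time slice contribution uniformly bounded. -/
theorem exists_final_slice_le {w : Spc d → ℝ} {H : Set (Spc d)}
    (hw : ∀ k : ℝ, 1 ≤ k → ∃ c : ℝ, 0 < c ∧ ∀ x ∈ H, |w x| ≤ c * rexp (-k * ‖x‖ ^ 2))
    (hA : 0 ≤ A) : ∃ Q : ℝ, 0 ≤ Q ∧ ∀ (K : Set (Spc d)) (f : Spc d → ℝ), MeasurableSet K → K ⊆ H →
      (∀ x ∈ K, 0 ≤ f x ∧ f x ≤ A * rexp (A * ‖x‖ ^ 2)) → ∫ x in K, f x * w x ^ 2 ≤ Q := by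
  obtain ⟨c, hc, h⟩ := hw (A + 1) (by linarith)
  have hi := (integrable_exp_neg_mul_norm_sq d one_pos).const_mul (A * c ^ 2)
  refine ⟨∫ x : Spc d, A * c ^ 2 * rexp (-1 * ‖x‖ ^ 2), integral_nonneg fun x => by positivity,
    fun K f hK hKH hf => ?_⟩
  refine (integral_mono_of_nonneg ?_ hi.integrableOn ?_).trans
    (setIntegral_le_integral hi (ae_of_all _ fun x => by positivity))
  · filter_upwards [ae_restrict_mem hK] with x hx
    exact mul_nonneg (hf x hx).1 (sq_nonneg _)
  · filter_upwards [ae_restrict_mem hK] with x hx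
    have h1 := pow_le_pow_left₀ (abs_nonneg _) (h x (hKH hx)) 2
    rw [sq_abs] at h1
    calc f x * w x ^ 2 ≤ A * rexp (A * ‖x‖ ^ 2) * (c * rexp (-(A + 1) * ‖x‖ ^ 2)) ^ 2 :=
          mul_le_mul (hf x hx).2 h1 (sq_nonneg _) (by positivity)
      _ = A * c ^ 2 * rexp (A * ‖x‖ ^ 2 + 2 * (-(A + 1) * ‖x‖ ^ 2)) := by
          rw [mul_pow, ← Real.exp_nat_mul, Real.exp_add]
          push_cast
          ring
      _ ≤ _ := by
          gcongr
          nlinarith [sq_nonneg ‖x‖, mul_nonneg hA (sq_nonneg ‖x‖)]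

end FinalTerm

section Middle

variable {d : ℕ} {i : Fin d} {κ C S δ R ε M M0 τ r μ : ℝ} {v : Spc d → ℝ → ℝ}

theorem isOpen_coord_pos (i : Fin d) : IsOpen {x : Spc d | 0 < x i} :=
  isOpen_lt continuous_const contDiff_coord.continuous

theorem HeatSol.integrableOn_eG (hv : HeatSol {x : Spc d | 0 < x i} M v) (hε : ε ≤ 1 / 100)
    (hg : ∀ x ∈ {x : Spc d | 0 < x i}, ∀ s ∈ Icc (0:ℝ) 1, |v x s| ≤ M0 * rexp (ε * ‖x‖ ^ 2)) :
    ∀ K ⊆ cyl {x : Spc d | 0 < x i}, IsCompact K →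
      IntegrableOn (eG {x : Spc d | 0 < x i} v) K := by
  intro K hK hKc
  rcases K.eq_empty_or_nonempty with rfl | hne
  · exact integrableOn_empty
  obtain ⟨z₀, hz₀, hmin⟩ := hKc.exists_isMinOn hne
    (contDiff_coord_fst (d := d) i).continuous.continuousOn
  have h1 := (hv.integrableOn_weighted hε hg (hK hz₀).1).mono_set (s := K) fun z hz => hmin hz
  have h2 := h1.continuousOn_mul (g := fun z : Spc d × ℝ => rexp (‖z.1‖ ^ 2 / 10))
    (by fun_prop) hKc
  refine Integrable.mono' h2 hv.measurable_eG.aestronglyMeasurable (ae_of_all _ fun z => ?_)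
  rw [Real.norm_of_nonneg (eG_nonneg _ _ _), ← mul_assoc, ← Real.exp_add, add_neg_cancel,
    Real.exp_zero, one_mul]
  linarith [sq_nonneg (uZ {x : Spc d | 0 < x i} v z)]

/-- A compact piece of the half-space at positive distance from its boundary. -/
def innerBall {d : ℕ} (i : Fin d) (δ r : ℝ) : Set (Spc d) := {x | δ ≤ x i} ∩ closedBall 0 r

theorem isCompact_innerBall : IsCompact (innerBall i δ r) :=
  (isCompact_closedBall _ _).inter_left (isClosed_le continuous_const contDiff_coord.continuous)

theorem innerBall_subset (hδ : 0 < δ) : innerBall i δ r ⊆ {x : Spc d | 0 < x i} :=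
  fun _ hx => hδ.trans_le hx.1

theorem jap_le_of_mem_innerBall {z : Spc d × ℝ} (hr : 0 ≤ r) (hz : z.1 ∈ innerBall i δ r) :
    jap z ≤ 1 + r := by
  have h1 : ‖z.1‖ ≤ r := mem_closedBall_zero_iff.1 hz.2
  rw [jap, Real.sqrt_le_left (by linarith)]
  nlinarith [norm_nonneg z.1]

theorem HeatSol.integrable_main (hv : HeatSol {x : Spc d | 0 < x i} M v)
    (hE : ∀ K ⊆ cyl {x : Spc d | 0 < x i}, IsCompact K →
      IntegrableOn (eG {x : Spc d | 0 < x i} v) K) (hδ : 0 < δ) (hκ : 0 < κ) (hτ : 0 < τ) :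
    Integrable fun z => timeCut (1 - 2 * τ) τ z * rexp (wt κ C S i z) ^ 2 *
      (cutoff κ δ R i z ^ 2 *
        (uZ {x : Spc d | 0 < x i} v z ^ 2 + eG {x : Spc d | 0 < x i} v z) / 64) := by
  have hKΩ : cutRegion i κ δ R (1 - 2 * τ + τ) ⊆ innerCyl i (δ / 2) := fun z hz =>
    ⟨lt_of_lt_of_le (half_lt_self hδ) hz.2.2.1, lt_of_lt_of_le (by positivity) hz.1,
      lt_of_le_of_lt hz.2.1 (by linarith)⟩
  have hK' := hKΩ.trans (innerCyl_subset (half_pos hδ).le)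
  have hEK : IntegrableOn (fun z => uZ {x : Spc d | 0 < x i} v z ^ 2 +
      eG {x : Spc d | 0 < x i} v z) (cutRegion i κ δ R (1 - 2 * τ + τ)) :=
    (hv.sq_integrableOn_uZ isCompact_cutRegion hK').add (hE _ hK' isCompact_cutRegion)
  have hb : ContinuousOn (fun z => rexp (wt κ C S i z) ^ 2) (innerCyl i (δ / 2)) :=
    (continuousOn_wt (half_pos hδ)).rexp.pow 2
  have := integrable_weight_cut (ρ := fun z => timeCut (1 - 2 * τ) τ z * cutoff κ δ R i z ^ 2 / 64)
    isCompact_cutRegion hKΩ hEK hb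
    ((contDiff_timeCut.continuous.mul ((contDiff_cutoff hδ).continuous.pow 2)).div_const 64)
    fun z hz => ?_
  · refine this.congr (ae_of_all _ fun z => ?_)
    simp only
    ring
  · have h1 : cutoff κ δ R i z * timeCut (1 - 2 * τ) τ z = 0 := by
      by_contra h
      exact hz (tsupport_cutoff_mul_timeCut hκ hδ hτ (subset_tsupport _ h))
    linear_combination cutoff κ δ R i z / 64 * h1

/-- Lower bound for the left side of the Carleman inequality. -/
theorem HeatSol.le_main (hv : HeatSol {x : Spc d | 0 < x i} M v)
    (hE : ∀ K ⊆ cyl {x : Spc d | 0 < x i}, IsCompact K →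
      IntegrableOn (eG {x : Spc d | 0 < x i} v) K) (hδ : 0 < δ) (hκ : 8 ≤ κ) (hτ : 0 < τ)
    (hτ8 : τ ≤ 1 / 8) (hr : 0 ≤ r) (hS : 2 ≤ S) (hSr : 1 + r ≤ S)
    (hw : ∀ z : Spc d × ℝ, 4 * δ ≤ z.1 i → |z.2 - 1 / 2| ≤ 1 / S ^ 4 → z.2 ≤ 1 →
      S ^ 3 * rate κ (7 / 2 * δ) - C - ‖z.1‖ ^ 2 / 8 ≤ wt κ C S i z)
    (hμ : ∀ s, |s - 1 / 2| ≤ 1 / S ^ 4 → μ ≤ ∫ x in innerBall i (4 * δ) r, v x s ^ 2) :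
    rexp (2 * (S ^ 3 * rate κ (7 / 2 * δ) - C - r ^ 2 / 8)) / 64 * (2 / S ^ 4 * μ) ≤
      ∫ z, timeCut (1 - 2 * τ) τ z * rexp (wt κ C S i z) ^ 2 * (cutoff κ δ (S ^ 8) i z ^ 2 *
        (uZ {x : Spc d | 0 < x i} v z ^ 2 + eG {x : Spc d | 0 < x i} v z) / 64) := by
  set K := innerBall i (4 * δ) r
  have hκ0 : 0 < κ := by linarith
  have hKO : K ⊆ {x : Spc d | 0 < x i} := innerBall_subset (by positivity)
  have hS4 : 1 / S ^ 4 ≤ 1 / 8 := by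
    have : (2:ℝ) ^ 4 ≤ S ^ 4 := by gcongr
    exact one_div_le_one_div_of_le (by norm_num) (by linarith)
  have hSp : 0 < 1 / S ^ 4 := by positivity
  set I := Icc (1 / 2 - 1 / S ^ 4) (1 / 2 + 1 / S ^ 4) with hI
  have hIabs : ∀ s ∈ I, |s - 1 / 2| ≤ 1 / S ^ 4 := fun s hs => by
    rw [abs_le]; constructor <;> linarith [hs.1, hs.2]
  have hIo : I ⊆ Ioo 0 1 := fun s hs => ⟨by linarith [hs.1], by linarith [hs.2]⟩
  have hKI : IsCompact (K ×ˢ I) := isCompact_innerBall.prod isCompact_Icc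
  have hcyl : K ×ˢ I ⊆ cyl {x : Spc d | 0 < x i} := prod_mono hKO hIo
  set c := rexp (2 * (S ^ 3 * rate κ (7 / 2 * δ) - C - r ^ 2 / 8)) / 64
  have hc : 0 ≤ c := by positivity
  have hu := hv.sq_integrableOn_uZ hKI hcyl
  have hm : ContinuousOn (fun s => ∫ x in K, v x s ^ 2) (Icc 0 1) := by
    have := hv.continuousOn_integral_sq (b := fun _ => 1) isCompact_innerBall hKO continuousOn_const
    simpa only [one_mul] using this
  have hIv : volume.real I = 2 / S ^ 4 := by
    rw [hI, Real.volume_real_Icc_of_le (by linarith)]; ring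
  calc c * (2 / S ^ 4 * μ) = c * ∫ _ in I, μ := by
        rw [setIntegral_const, hIv, smul_eq_mul]
    _ ≤ c * ∫ s in I, ∫ x in K, v x s ^ 2 := by
        refine mul_le_mul_of_nonneg_left (setIntegral_mono_on (integrableOn_const
          isCompact_Icc.measure_lt_top.ne) ((hm.mono (hIo.trans Ioo_subset_Icc_self)
          ).integrableOn_compact isCompact_Icc) measurableSet_Icc fun s hs => hμ s (hIabs s hs)) hc
    _ = c * ∫ z in K ×ˢ I, uZ {x : Spc d | 0 < x i} v z ^ 2 := by
        rw [setIntegral_prod_symm hu]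
        congr 1
        refine setIntegral_congr_fun measurableSet_Icc fun s hs => ?_
        refine setIntegral_congr_fun isCompact_innerBall.measurableSet fun x hx => ?_
        simp only [uZ]
        rw [indicator_of_mem (show (x, s) ∈ cyl {x : Spc d | 0 < x i} from ⟨hKO hx, hIo hs⟩)]
    _ = ∫ z in K ×ˢ I, c * uZ {x : Spc d | 0 < x i} v z ^ 2 := (integral_const_mul _ _).symm
    _ ≤ ∫ z in K ×ˢ I, timeCut (1 - 2 * τ) τ z * rexp (wt κ C S i z) ^ 2 *
        (cutoff κ δ (S ^ 8) i z ^ 2 *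
          (uZ {x : Spc d | 0 < x i} v z ^ 2 + eG {x : Spc d | 0 < x i} v z) / 64) := by
        refine setIntegral_mono_on (hu.const_mul c)
          (hv.integrable_main hE hδ hκ0 hτ).integrableOn hKI.measurableSet fun z hz => ?_
        have hs := hIabs z.2 hz.2
        have hs2 := abs_le.1 (hs.trans hS4)
        have hj : jap z ≤ S ^ 8 := (jap_le_of_mem_innerBall hr hz.1).trans
          (hSr.trans (le_self_pow₀ (by linarith) (by norm_num)))
        have hk : 1 / κ ≤ z.2 :=
          (one_div_le_one_div_of_le (by norm_num) hκ).trans (by linarith)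
        have hz4 : 4 * δ ≤ z.1 i := hz.1.1
        rw [timeCut_eq_one hτ (by linarith), cutoff_eq_one hκ0 hδ hk (by linarith) hj]
        have hw' := hw z hz.1.1 hs (by linarith)
        have hn : ‖z.1‖ ^ 2 ≤ r ^ 2 :=
          pow_le_pow_left₀ (norm_nonneg _) (mem_closedBall_zero_iff.1 hz.1.2) 2
        have h1 : rexp (2 * (S ^ 3 * rate κ (7 / 2 * δ) - C - r ^ 2 / 8)) ≤
            rexp (wt κ C S i z) ^ 2 := by
          rw [← Real.exp_nat_mul]
          refine exp_le_exp.2 ?_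
          push_cast
          linarith
        have h2 := eG_nonneg {x : Spc d | 0 < x i} v z
        calc c * uZ {x : Spc d | 0 < x i} v z ^ 2 ≤ rexp (wt κ C S i z) ^ 2 / 64 *
              (uZ {x : Spc d | 0 < x i} v z ^ 2 + eG {x : Spc d | 0 < x i} v z) := by
              exact mul_le_mul (div_le_div_of_nonneg_right h1 (by norm_num))
                (le_add_of_nonneg_right h2) (sq_nonneg _) (by positivity)
          _ = _ := by ring
    _ ≤ _ := setIntegral_le_integral (hv.integrable_main hE hδ hκ0 hτ) (ae_of_all _ fun z =>
        mul_nonneg (mul_nonneg (timeCut_nonneg z) (sq_nonneg _)) (div_nonneg (mul_nonneg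
          (sq_nonneg _) (add_nonneg (sq_nonneg _) (eG_nonneg _ _ _))) (by norm_num)))

end Middle

section Core

variable {d : ℕ} {i : Fin d} {κ C S δ R ε M0 r A : ℝ} {v : Spc d → ℝ → ℝ}

theorem HeatSol.exists_final_term_le (hv : HeatSol {x : Spc d | 0 < x i} ε v) (hδ : 0 < δ)
    (hκ : 0 < κ) (hA : ∀ x : Spc d, 0 < x i → max (potential (wt κ C S i) (x, 1)) 0 *
      rexp (wt κ C S i (x, 1)) ^ 2 ≤ A * rexp (A * ‖x‖ ^ 2)) {Q L : ℝ}
    (hQ : ∀ (K : Set (Spc d)) (f : Spc d → ℝ), MeasurableSet K → K ⊆ {x : Spc d | 0 < x i} →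
      (∀ x ∈ K, 0 ≤ f x ∧ f x ≤ A * rexp (A * ‖x‖ ^ 2)) → ∫ x in K, f x * v x 1 ^ 2 ≤ Q)
    (hL : ∀ t, |deriv smoothTransition t| ≤ L) :
    ∃ τ, 0 < τ ∧ τ ≤ 1 / 8 ∧ ∫ z, -pd tv (timeCut (1 - 2 * τ) τ) z *
      max (potential (wt κ C S i) z) 0 * rexp (wt κ C S i z) ^ 2 *
        (uZ {x : Spc d | 0 < x i} v z * cutoff κ δ R i z) ^ 2 ≤ L * (Q + 1) := by
  have hKO : innerBall i δ (R + 1) ⊆ {x : Spc d | 0 < x i} := innerBall_subset hδ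
  have hL0 : 0 ≤ L := (abs_nonneg _).trans (hL 0)
  set b : Spc d × ℝ → ℝ := fun z => max (potential (wt κ C S i) z) 0 * rexp (wt κ C S i z) ^ 2 *
    cutoff κ δ R i z ^ 2 with hb
  have hbc : ContinuousOn b (innerBall i δ (R + 1) ×ˢ Icc (0:ℝ) 1) := fun z hz => by
    have hz0 : 0 < z.1 i := hKO hz.1
    have h1 : ContinuousAt (fun z => max (potential (wt κ C S i) z) 0) z :=
      (contDiffAt_potential_wt hz0).continuousAt.max continuousAt_const
    have h2 : ContinuousAt (fun z => rexp (wt κ C S i z) ^ 2) z :=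
      (contDiffAt_wt hz0).continuousAt.rexp.pow 2
    have h3 : ContinuousAt b z := (h1.mul h2).mul
      ((contDiff_cutoff hδ).continuous.continuousAt.pow 2)
    exact h3.continuousWithinAt
  have hb0 : ∀ z, 0 ≤ b z := fun z =>
    mul_nonneg (mul_nonneg (le_max_right _ _) (sq_nonneg _)) (sq_nonneg _)
  have hbK : ∀ z : Spc d × ℝ, z.1 ∉ innerBall i δ (R + 1) → b z = 0 := fun z hz => by
    have : cutoff κ δ R i z = 0 := by
      by_contra h
      obtain ⟨-, h1, h2⟩ := of_cutoff_ne_zero hκ hδ h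
      exact hz ⟨h1.le, mem_closedBall_zero_iff.2 ((norm_le_jap z).trans h2.le)⟩
    simp only [hb, this]
    ring
  obtain ⟨τ, hτ, hτ8, h⟩ := hv.exists_timeCut_le isCompact_innerBall hKO hbc hb0 hbK hL
  refine ⟨τ, hτ, hτ8, (le_of_eq_of_le ?_ h).trans ?_⟩
  · refine integral_congr_ae (ae_of_all _ fun z => ?_)
    simp only [hb]
    ring
  · refine mul_le_mul_of_nonneg_left (add_le_add_left (hQ _ (fun x => b (x, 1))
      isCompact_innerBall.measurableSet hKO fun x hx => ⟨hb0 _, ?_⟩) 1) hL0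
    refine le_trans ?_ (hA x (hKO hx))
    have h1 := (exists_tame_cutoff d κ hδ).choose_spec i R |>.abs_le_one (x, 1)
    have h2 : cutoff κ δ R i (x, 1) ^ 2 ≤ 1 := (sq_le_one_iff_abs_le_one _).2 h1
    exact mul_le_of_le_one_right (mul_nonneg (le_max_right _ _) (sq_nonneg _)) h2

theorem eventually_lt_exp_sq {a b c : ℝ} (ha : 0 < a) (hb : 0 < b) :
    ∀ᶠ S : ℝ in atTop, c * S ^ 4 < b * rexp (2 * (S ^ 3 * a)) := by
  filter_upwards [eventually_ge_atTop 1, eventually_gt_atTop (|c| / (2 * b * a ^ 2))] with S hS hSc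
  have h0 : 0 ≤ S ^ 3 * a := by positivity
  have h1 : (2 * (S ^ 3 * a)) ^ 2 / 2 ≤ rexp (2 * (S ^ 3 * a)) := by
    have := Real.quadratic_le_exp_of_nonneg (x := 2 * (S ^ 3 * a)) (by positivity)
    linarith
  have h2 : |c| < 2 * b * a ^ 2 * S := by
    rw [div_lt_iff₀ (by positivity)] at hSc; linarith
  calc c * S ^ 4 ≤ |c| * S ^ 4 := by gcongr; exact le_abs_self c
    _ < 2 * b * a ^ 2 * S * S ^ 4 := by gcongr
    _ ≤ 2 * b * a ^ 2 * S ^ 6 := by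
        have : S ^ 5 ≤ S ^ 6 := pow_le_pow_right₀ hS (by norm_num)
        calc _ = 2 * b * a ^ 2 * S ^ 5 := by ring
          _ ≤ _ := by gcongr
    _ = b * ((2 * (S ^ 3 * a)) ^ 2 / 2) := by ring
    _ ≤ _ := by gcongr

/-- Super-Gaussian decay at the final time forces the solution to vanish on compact sets at the
middle time. -/
theorem HeatSol.integral_sq_eq_zero (hv : HeatSol {x : Spc d | 0 < x i} ε v) (hε : ε ≤ 1 / 100)
    (hε2 : ε ^ 2 ≤ 1 / 384)
    (hg : ∀ x ∈ {x : Spc d | 0 < x i}, ∀ s ∈ Icc (0:ℝ) 1, |v x s| ≤ M0 * rexp (ε * ‖x‖ ^ 2))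
    (hd : ∀ k : ℝ, 1 ≤ k → ∃ c : ℝ, 0 < c ∧ ∀ x ∈ {x : Spc d | 0 < x i},
      |v x 1| ≤ c * rexp (-k * ‖x‖ ^ 2)) (hδ : 0 < δ) (hr : 0 ≤ r) :
    ∫ x in innerBall i (4 * δ) r, v x (1 / 2) ^ 2 = 0 := by
  have hE := hv.integrableOn_eG hε hg
  obtain ⟨C, hC, he⟩ := exists_wt_le_of_early
  set κ := max 8 (10 * C * (3 * C) ^ 5) with hκdef
  have hκ : 8 ≤ κ := le_max_left _ _
  have hκ0 : 0 < κ := by linarith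
  have hκC : 10 * C * (3 * C) ^ 5 ≤ κ ^ 2 :=
    (le_max_right _ _).trans (le_self_pow₀ (by linarith) (by norm_num))
  obtain ⟨P, S₁, hP, h₁⟩ := hv.exists_cut_term_le hε hg hδ hC hκ
    fun S z hS hz hs0 hs => he d i κ S z hκ hS hz hs0 hs
  obtain ⟨S₂, h₂⟩ := exists_le_wt (d := d) (C := C) (by linarith) hκ0 hδ
  obtain ⟨A, hA, h₃⟩ := exists_potential_mul_le (d := d) hC hκ0.le
  obtain ⟨Q, hQ, h₄⟩ := exists_final_slice_le hd hA
  obtain ⟨L, hL1, hL, -⟩ := exists_bound_deriv_smoothTransition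
  set K := innerBall i (4 * δ) r
  have hKO : K ⊆ {x : Spc d | 0 < x i} := innerBall_subset (by positivity)
  set m : ℝ → ℝ := fun s => ∫ x in K, v x s ^ 2 with hm
  have hmc : ContinuousOn m (Icc 0 1) := by
    have := hv.continuousOn_integral_sq (b := fun _ => 1) isCompact_innerBall hKO continuousOn_const
    simpa only [one_mul] using this
  by_contra hne
  have hμ : 0 < m (1 / 2) := (integral_nonneg fun x => sq_nonneg _).lt_of_ne' hne
  have hmt : ContinuousAt m (1 / 2) :=
    hmc.continuousAt (Icc_mem_nhds (by norm_num) (by norm_num))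
  obtain ⟨η, hη, hη'⟩ := Metric.eventually_nhds_iff.1
    (hmt.eventually (lt_mem_nhds (half_lt_self hμ)))
  have hrate : 0 < rate κ (7 / 2 * δ) - rate κ (3 * δ) := by
    rw [rate, rate, ← mul_sub]
    refine mul_pos (exp_pos _) (sub_pos.2 (Real.rpow_lt_rpow (by positivity) (by linarith)
      (by norm_num)))
  have hx := (eventually_lt_exp_sq (c := 64 * (P + L * (Q + 1))) (b := rexp (2 * (-C - r ^ 2 / 8)) *
    m (1 / 2)) hrate (mul_pos (exp_pos _) hμ)).and ((eventually_ge_atTop (max 2 (max (1 + r) (max S₁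
    (max S₂ (1 / ((δ / 2) ^ (1 / 4 : ℝ)) ^ 13)))))).and (eventually_gt_atTop (1 / η)))
  obtain ⟨S, hS, hSmax, hSη⟩ := hx.exists
  simp only [max_le_iff] at hSmax
  obtain ⟨hS2, hSr, hS1, hS2', hSδ⟩ := hSmax
  have hS1' : 1 ≤ S := by linarith
  have hSp : 0 < S := by linarith
  have hSδ' : 1 ≤ S ^ 3 * ((δ / 2) ^ (1 / 4 : ℝ)) ^ 13 := by
    rw [div_le_iff₀ (by positivity)] at hSδ
    refine hSδ.trans ?_
    gcongr
    exact le_self_pow₀ hS1' (by norm_num)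
  obtain ⟨τ, hτ, hτ8, h5⟩ := hv.exists_final_term_le (R := S ^ 8) hδ hκ0 (h₃ S hS1' i) h₄ hL
  have h6 := hv.carleman_cutoff (R := S ^ 8) hE hε2 hδ hC hκ hκC hS1' hSδ' hτ
  have h7 := h₁ S hS1 hS1' τ hτ
  have h8 := hv.le_main (μ := m (1 / 2) / 2) hE hδ hκ hτ hτ8 hr hS2 hSr
    (fun z hz hs hs1 => h₂ S hS2' hS1' i z hz hs hs1) fun s hs => by
      refine (hη' ?_).le
      rw [Real.dist_eq]
      refine hs.trans_lt ?_
      have : S ≤ S ^ 4 := le_self_pow₀ hS1' (by norm_num)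
      rw [div_lt_iff₀ hη] at hSη
      rw [div_lt_iff₀ (by positivity)]
      nlinarith
  have h9 := h8.trans (h6.trans (add_le_add h7 h5))
  set g := S ^ 3 * rate κ (3 * δ) with hgd
  have hg1 : 1 ≤ rexp (2 * g) := Real.one_le_exp (by
    have := rate_nonneg (κ := κ) (y := 3 * δ) (by positivity)
    positivity)
  have h10 : P * rexp (2 * g) + L * (Q + 1) ≤ (P + L * (Q + 1)) * rexp (2 * g) := by
    have : 0 ≤ L * (Q + 1) := by positivity
    nlinarith
  have e1 : rexp (2 * (S ^ 3 * rate κ (7 / 2 * δ) - C - r ^ 2 / 8)) =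
      rexp (2 * (-C - r ^ 2 / 8)) * rexp (2 * (S ^ 3 * (rate κ (7 / 2 * δ) - rate κ (3 * δ)))) *
        rexp (2 * g) := by
    rw [← Real.exp_add, ← Real.exp_add, hgd]
    congr 1
    ring
  rw [e1] at h9
  have h11 := mul_lt_mul_of_pos_right hS (exp_pos (2 * g))
  have h12 := mul_le_mul_of_nonneg_left (h9.trans h10) (by positivity : 0 ≤ 64 * S ^ 4)
  refine absurd h11 (not_lt.2 ?_)
  calc _ = 64 * S ^ 4 * (rexp (2 * (-C - r ^ 2 / 8)) *
        rexp (2 * (S ^ 3 * (rate κ (7 / 2 * δ) - rate κ (3 * δ)))) * rexp (2 * g) / 64 *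
        (2 / S ^ 4 * (m (1 / 2) / 2))) := by field_simp
    _ ≤ _ := h12
    _ = _ := by ring

theorem HeatSol.eq_zero_half (hv : HeatSol {x : Spc d | 0 < x i} ε v) (hε : ε ≤ 1 / 100)
    (hε2 : ε ^ 2 ≤ 1 / 384)
    (hg : ∀ x ∈ {x : Spc d | 0 < x i}, ∀ s ∈ Icc (0:ℝ) 1, |v x s| ≤ M0 * rexp (ε * ‖x‖ ^ 2))
    (hd : ∀ k : ℝ, 1 ≤ k → ∃ c : ℝ, 0 < c ∧ ∀ x ∈ {x : Spc d | 0 < x i},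
      |v x 1| ≤ c * rexp (-k * ‖x‖ ^ 2)) {x : Spc d} (hx : 0 < x i) : v x (1 / 2) = 0 := by
  have h0 := hv.integral_sq_eq_zero hε hε2 hg hd (δ := x i / 8) (r := ‖x‖ + 1) (by positivity)
    (by positivity)
  set K := innerBall i (4 * (x i / 8)) (‖x‖ + 1)
  have hKO : K ⊆ {x : Spc d | 0 < x i} := innerBall_subset (by positivity)
  set U : Set (Spc d) := {y | x i / 2 < y i} ∩ ball 0 (‖x‖ + 1) with hU
  have hUo : IsOpen U := (isOpen_lt continuous_const contDiff_coord.continuous).inter isOpen_ball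
  have hUK : U ⊆ K := fun y hy => ⟨by
    have : x i / 2 < y i := hy.1
    show 4 * (x i / 8) ≤ y i
    linarith, ball_subset_closedBall hy.2⟩
  have hc : ContinuousOn (fun y => v y (1 / 2) ^ 2) {x : Spc d | 0 < x i} :=
    (hv.contDiffOn (1 / 2) (by norm_num)).continuousOn.pow 2
  have hi : IntegrableOn (fun y => v y (1 / 2) ^ 2) K :=
    (hc.mono hKO).integrableOn_compact isCompact_innerBall
  have h1 := (setIntegral_eq_zero_iff_of_nonneg_ae (ae_of_all _ fun y => sq_nonneg _) hi).1 h0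
  have h2 : (fun y => v y (1 / 2) ^ 2) =ᵐ[volume.restrict U] fun _ => 0 :=
    ae_restrict_of_ae_restrict_of_subset hUK h1
  have h3 := Measure.eqOn_open_of_ae_eq h2 hUo (hc.mono (hUK.trans hKO)) continuousOn_const
  have h4 := h3 (show x ∈ U from ⟨by show x i / 2 < x i; linarith, by simp⟩)
  exact pow_eq_zero_iff (two_ne_zero) |>.1 h4

end Core

section Scaling

variable {d : ℕ} {i : Fin d} {T M : ℝ} {u : Spc d → ℝ → ℝ}

theorem pd_comp_smul (e : Spc d) (f : Spc d → ℝ) (c : ℝ) :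
    pd e (fun x => f (c • x)) = fun x => c * pd e f (c • x) := by
  funext x
  simp only [pd]
  rw [fderiv_comp_smul]
  simp

theorem slap_comp_smul (f : Spc d → ℝ) (c : ℝ) (x : Spc d) :
    slap (fun y => f (c • y)) x = c ^ 2 * slap f (c • x) := by
  simp only [slap_eq, pd_comp_smul, Finset.mul_sum]
  refine Finset.sum_congr rfl fun j _ => ?_
  have h := congr_fun (pd_comp_smul (bv j) (pd (bv j) f) c) x
  have h2 : pd (bv j) (fun y => c * pd (bv j) f (c • y)) x =
      c * pd (bv j) (fun y => pd (bv j) f (c • y)) x := by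
    exact congr_arg (fun L => L (bv j)) (congr_fun (fderiv_const_smul_field (𝕜 := ℝ) c
      (f := fun y => pd (bv j) f (c • y))) x)
  rw [h2, h]
  ring

theorem gsq_comp_smul (f : Spc d → ℝ) (c : ℝ) (x : Spc d) :
    gsq (fun y => f (c • y)) x = c ^ 2 * gsq f (c • x) := by
  simp only [gsq, pd_comp_smul, Finset.mul_sum, mul_pow]

/-- A solution of the backward inequality on a half-space up to the time `T`. -/
structure BackwardSol {d : ℕ} (i : Fin d) (T M : ℝ) (u : Spc d → ℝ → ℝ) : Prop where
  pos : 0 < M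
  contDiffOn : ∀ t ∈ Icc (0:ℝ) T, ContDiffOn ℝ 2 (fun x => u x t) {x : Spc d | 0 < x i}
  differentiableOn : ∀ x ∈ {x : Spc d | 0 < x i}, DifferentiableOn ℝ (u x) (Icc 0 T)
  pde : ∀ x ∈ {x : Spc d | 0 < x i}, ∀ t ∈ Icc (0:ℝ) T,
    |slap (fun y => u y t) x + derivWithin (u x) (Icc 0 T) t| ≤
      M * (|u x t| + √(gsq (fun y => u y t) x))
  growth : ∀ x ∈ {x : Spc d | 0 < x i}, ∀ t ∈ Icc (0:ℝ) T, |u x t| ≤ M * rexp (M * ‖x‖ ^ 2)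

variable {l a : ℝ}

theorem BackwardSol.heatSol (hu : BackwardSol i T M u) (hl : 0 < l) (hl1 : l ≤ 1)
    (hlM : l * M ≤ 1 / 100) (ha : 0 ≤ a) (haT : a + l ^ 2 ≤ T) :
    HeatSol {x : Spc d | 0 < x i} (1 / 100) (fun x s => u (l • x) (a + l ^ 2 * (1 - s))) ∧
    ∀ x ∈ {x : Spc d | 0 < x i}, ∀ s ∈ Icc (0:ℝ) 1,
      |u (l • x) (a + l ^ 2 * (1 - s))| ≤ M * rexp (1 / 100 * ‖x‖ ^ 2) := by
  have hM := hu.pos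
  have hmem : ∀ x ∈ {x : Spc d | 0 < x i}, l • x ∈ {x : Spc d | 0 < x i} := fun x hx => by
    show 0 < (l • x) i
    simpa using mul_pos hl hx
  have htime : MapsTo (fun s : ℝ => a + l ^ 2 * (1 - s)) (Icc 0 1) (Icc 0 T) := fun s hs => by
    have h0 : 0 ≤ l ^ 2 * (1 - s) := mul_nonneg (sq_nonneg _) (by linarith [hs.2])
    have h1 : l ^ 2 * (1 - s) ≤ l ^ 2 := mul_le_of_le_one_right (sq_nonneg _) (by linarith [hs.1])
    exact ⟨by linarith, by linarith⟩
  have hll : l ^ 2 * M ≤ 1 / 100 := by nlinarith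
  have hgr : ∀ x ∈ {x : Spc d | 0 < x i}, ∀ s ∈ Icc (0:ℝ) 1,
      |u (l • x) (a + l ^ 2 * (1 - s))| ≤ M * rexp (1 / 100 * ‖x‖ ^ 2) := fun x hx s hs => by
    refine (hu.growth _ (hmem x hx) _ (htime hs)).trans ?_
    rw [norm_smul, mul_pow, norm_eq_abs, sq_abs]
    refine mul_le_mul_of_nonneg_left (Real.exp_le_exp.2 ?_) hM.le
    nlinarith [mul_le_mul_of_nonneg_right hll (sq_nonneg ‖x‖)]
  have hder : ∀ x ∈ {x : Spc d | 0 < x i}, ∀ s ∈ Icc (0:ℝ) 1,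
      HasDerivWithinAt (fun s => u (l • x) (a + l ^ 2 * (1 - s)))
        (derivWithin (u (l • x)) (Icc 0 T) (a + l ^ 2 * (1 - s)) * (-l ^ 2)) (Icc 0 1) s := by
    intro x hx s hs
    have h1 := (hu.differentiableOn _ (hmem x hx) _ (htime hs)).hasDerivWithinAt
    have h2 : HasDerivWithinAt (fun s : ℝ => a + l ^ 2 * (1 - s)) (-l ^ 2) (Icc 0 1) s := by
      have := (((hasDerivAt_id s).const_sub 1).const_mul (l ^ 2)).const_add a
      exact (this.congr_deriv (by ring)).hasDerivWithinAt
    exact h1.comp s h2 htime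
  refine ⟨⟨isOpen_coord_pos i, by norm_num, fun s hs => ?_, fun x hx s hs =>
    (hder x hx s hs).differentiableWithinAt, fun x hx s hs => ?_, fun K hK hKc => ?_⟩, hgr⟩
  · exact (hu.contDiffOn _ (htime hs)).comp (by fun_prop) hmem
  · rw [(hder x hx s hs).derivWithin (uniqueDiffOn_Icc zero_lt_one s hs),
      slap_comp_smul (fun y => u y (a + l ^ 2 * (1 - s))),
      gsq_comp_smul (fun y => u y (a + l ^ 2 * (1 - s))), Real.sqrt_mul (sq_nonneg _),
      Real.sqrt_sq hl.le]
    have h1 := hu.pde _ (hmem x hx) _ (htime hs)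
    set D := derivWithin (u (l • x)) (Icc 0 T) (a + l ^ 2 * (1 - s))
    set Λ := slap (fun y => u y (a + l ^ 2 * (1 - s))) (l • x)
    set G := √(gsq (fun y => u y (a + l ^ 2 * (1 - s))) (l • x))
    have hG : 0 ≤ G := Real.sqrt_nonneg _
    rw [show D * -l ^ 2 - l ^ 2 * Λ = -(l ^ 2 * (Λ + D)) by ring, abs_neg, abs_mul,
      abs_of_nonneg (sq_nonneg l)]
    calc l ^ 2 * |Λ + D| ≤ l ^ 2 * (M * (|u (l • x) (a + l ^ 2 * (1 - s))| + G)) := by gcongr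
      _ = (l ^ 2 * M) * |u (l • x) (a + l ^ 2 * (1 - s))| + (l * M) * (l * G) := by ring
      _ ≤ 1 / 100 * |u (l • x) (a + l ^ 2 * (1 - s))| + 1 / 100 * (l * G) := by gcongr
      _ = _ := by ring
  · obtain ⟨r, hr⟩ := hKc.isBounded.exists_norm_le
    refine ⟨M * rexp (1 / 100 * r ^ 2), fun x hx s hs => (hgr x (hK hx) s hs).trans ?_⟩
    have := hr x hx
    gcongr

theorem BackwardSol.eq_zero_step (hu : BackwardSol i T M u) (hl : 0 < l) (hl1 : l ≤ 1)
    (hlM : l * M ≤ 1 / 100) (ha : 0 ≤ a) (haT : a + l ^ 2 ≤ T)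
    (hd : ∀ k : ℝ, 1 ≤ k → ∃ c : ℝ, 0 < c ∧ ∀ x ∈ {x : Spc d | 0 < x i},
      |u x a| ≤ c * rexp (-k * ‖x‖ ^ 2)) {x : Spc d} (hx : 0 < x i) :
    u x (a + l ^ 2 / 2) = 0 := by
  obtain ⟨h1, h2⟩ := hu.heatSol hl hl1 hlM ha haT
  have hx' : 0 < (l⁻¹ • x) i := by simpa using mul_pos (inv_pos.2 hl) hx
  have h3 := h1.eq_zero_half le_rfl (by norm_num) h2 (fun k hk => ?_) hx'
  · rw [smul_inv_smul₀ hl.ne'] at h3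
    rw [← h3]
    congr 1
    ring
  · have hl2 : l ^ 2 ≤ 1 := pow_le_one₀ hl.le hl1
    obtain ⟨c, hc, h⟩ := hd (k / l ^ 2) ((one_le_div (by positivity)).2 (hl2.trans hk))
    refine ⟨c, hc, fun y hy => ?_⟩
    have h4 := h (l • y) (by show 0 < (l • y) i; simpa using mul_pos hl hy)
    rw [sub_self, mul_zero, add_zero]
    refine h4.trans (le_of_eq ?_)
    rw [norm_smul, mul_pow, norm_eq_abs, sq_abs]
    congr 2
    field_simp

theorem BackwardSol.eq_zero (hu : BackwardSol i T M u)
    (hd : ∀ k : ℝ, 1 ≤ k → ∃ c : ℝ, 0 < c ∧ ∀ x ∈ {x : Spc d | 0 < x i},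
      |u x 0| ≤ c * rexp (-k * ‖x‖ ^ 2)) {t : ℝ} (ht : t ∈ Ioo 0 T) {x : Spc d} (hx : 0 < x i) :
    u x t = 0 := by
  have hM := hu.pos
  have ht0 := ht.1
  have htT := ht.2
  set l₀ := min 1 (1 / (100 * M))
  have hl₀ : 0 < l₀ := by positivity
  obtain ⟨N, hN⟩ := exists_nat_gt (t / min (l₀ ^ 2 / 2) (T - t))
  have hmin : 0 < min (l₀ ^ 2 / 2) (T - t) := lt_min (by positivity) (by linarith)
  have hN0 : (0:ℝ) < N := (div_pos ht0 hmin).trans hN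
  set σ := t / N with hσ
  have hσ0 : 0 < σ := by positivity
  have hσm : σ < min (l₀ ^ 2 / 2) (T - t) := by
    rw [div_lt_iff₀ hmin] at hN
    rw [hσ, div_lt_iff₀ hN0]
    linarith
  have hσ1 : 2 * σ ≤ l₀ ^ 2 := by linarith [hσm.trans_le (min_le_left _ _)]
  have hσ2 : t + σ ≤ T := by linarith [hσm.trans_le (min_le_right _ _)]
  have hNσ : N * σ = t := by rw [hσ]; field_simp
  have hl : √(2 * σ) ≤ l₀ := Real.sqrt_le_iff.2 ⟨hl₀.le, hσ1⟩
  have hsq : √(2 * σ) ^ 2 = 2 * σ := Real.sq_sqrt (by positivity)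
  have step : ∀ a, 0 ≤ a → a + 2 * σ ≤ T → (∀ k : ℝ, 1 ≤ k → ∃ c : ℝ, 0 < c ∧
      ∀ x ∈ {x : Spc d | 0 < x i}, |u x a| ≤ c * rexp (-k * ‖x‖ ^ 2)) →
      ∀ y : Spc d, 0 < y i → u y (a + σ) = 0 := fun a ha haT h y hy => by
    have h1 := hu.eq_zero_step (l := √(2 * σ)) (by positivity) (hl.trans (min_le_left _ _)) ?_ ha
      (by rw [hsq]; exact haT) h hy
    · rwa [hsq, mul_div_cancel_left₀ _ two_ne_zero] at h1
    · calc √(2 * σ) * M ≤ 1 / (100 * M) * M := by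
            gcongr; exact hl.trans (min_le_right _ _)
        _ = 1 / 100 := by field_simp
  have main : ∀ j : ℕ, j + 1 ≤ N → ∀ y : Spc d, 0 < y i → u y ((j + 1 : ℕ) * σ) = 0 := by
    intro j
    induction j with
    | zero =>
      intro h1 y hy
      have h2 : σ ≤ t := by
        rw [← hNσ]
        exact le_mul_of_one_le_left hσ0.le (by exact_mod_cast h1)
      have := step 0 le_rfl (by linarith) hd y hy
      simpa using this
    | succ j ih =>
      intro h1 y hy
      have h2 : ((j + 1 + 1 : ℕ) : ℝ) * σ ≤ t := by
        rw [← hNσ]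
        exact mul_le_mul_of_nonneg_right (by exact_mod_cast h1) hσ0.le
      have e : ((j + 1 + 1 : ℕ) : ℝ) * σ = (j + 1 : ℕ) * σ + σ := by push_cast; ring
      rw [e] at h2 ⊢
      refine step _ (by positivity) (by linarith) (fun k _ => ⟨1, one_pos, fun z hz => ?_⟩) y hy
      rw [ih (by omega) z hz, abs_zero]
      positivity
  have hN1 : 1 ≤ N := by exact_mod_cast hN0
  have := main (N - 1) (by omega) x hx
  rwa [Nat.sub_add_cancel hN1, hNσ] at this

end Scaling

/-- if `u` is `C^{2,1}` on `ℝⁿ₊ × [0,T]` (here the space has dimension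
`n+1 ≥ 1` and the half space is `{x : x_{last} > 0}`), satisfies
`|Δu + ∂ₜu| ≤ M(|u| + |∇u|)` and `|u| ≤ M e^{M|x|²}` there, and for every `k ≥ 1` there is
`C_k > 0` with `|u(x,0)| ≤ C_k e^{-k|x|²}` on `ℝⁿ₊`, then `u ≡ 0` on `ℝⁿ₊ × [0,T]`. -/
theorem stmt_3 (n : ℕ) (T M : ℝ) (hT : 0 < T) (hM : 0 < M)
    (H : Set (EuclideanSpace ℝ (Fin (n + 1))))
    (hH : H = {x : EuclideanSpace ℝ (Fin (n + 1)) | 0 < x (Fin.last n)})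
    (u : EuclideanSpace ℝ (Fin (n + 1)) → ℝ → ℝ)
    (hux : ∀ t ∈ Icc (0 : ℝ) T, ContDiffOn ℝ 2 (fun x => u x t) H)
    (hut : ∀ x ∈ H, ContDiffOn ℝ 1 (u x) (Icc (0 : ℝ) T))
    (hpde : ∀ x ∈ H, ∀ t ∈ Icc (0 : ℝ) T,
      |slap (fun y => u y t) x + derivWithin (u x) (Icc (0 : ℝ) T) t| ≤
        M * (|u x t| + ‖gradient (fun y => u y t) x‖))
    (hgrow : ∀ x ∈ H, ∀ t ∈ Icc (0 : ℝ) T, |u x t| ≤ M * Real.exp (M * ‖x‖ ^ 2))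
    (hdecay : ∀ k : ℝ, 1 ≤ k → ∃ C > 0, ∀ x ∈ H,
      |u x 0| ≤ C * Real.exp (-k * ‖x‖ ^ 2)) :
    ∀ x ∈ H, ∀ t ∈ Icc (0 : ℝ) T, u x t = 0 := by
  subst hH
  have hu : BackwardSol (Fin.last n) T M u :=
    ⟨hM, hux, fun x hx => (hut x hx).differentiableOn (by norm_num), fun x hx t ht => by
      have h := hpde x hx t ht
      rwa [show ‖gradient (fun y => u y t) x‖ = √(gsq (fun y => u y t) x) by
        rw [← norm_fderiv_eq_sqrt]; simp [gradient]] at h, hgrow⟩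
  intro x hx
  refine EqOn.of_subset_closure (s := Ioo 0 T) (g := fun _ => 0)
    (fun t ht => hu.eq_zero hdecay ht hx) (hut x hx).continuousOn continuousOn_const
    Ioo_subset_Icc_self ?_
  rw [closure_Ioo hT.ne]
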